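/- Let M be an n-vertex combinatorial d-manifold whose geometric carrier is a Z₂-homology sphere. If n ≤ d + 8 then M is a combinatorial d-sphere. -/

import Mathlib

/- Formalization of definitions from:
   B. Bagchi, B. Datta, "Combinatorial triangulations of homology spheres". -/

open Finset

noncomputable section

attribute [local instance] Classical.propDecidable

namespace HomologySpheres

variable {V : Type*} [DecidableEq V] {W : Type*} [DecidableEq W]

/-- The vertex set of a finite family of finite sets. -/
def verts (K : Finset (Finset V)) : Finset V := K.sup id

/-- An (abstract, finite) simplicial complex: a nonempty collection of nonempty
finite sets closed under taking nonempty subsets. -/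
def IsComplex (K : Finset (Finset V)) : Prop :=
  K.Nonempty ∧ ∅ ∉ K ∧ ∀ s ∈ K, ∀ t : Finset V, t ⊆ s → t.Nonempty → t ∈ K

/-- The facets (maximal faces) of `K`. -/
def facets (K : Finset (Finset V)) : Finset (Finset V) :=
  K.filter fun s => ∀ t ∈ K, s ⊆ t → t = s

/-- `K` is pure of dimension `d`: every maximal face has `d + 1` vertices. -/
def IsPure (d : ℕ) (K : Finset (Finset V)) : Prop :=
  ∀ s ∈ facets K, s.card = d + 1

/-- The link of a face `σ` in `K`. -/
def link (K : Finset (Finset V)) (σ : Finset V) : Finset (Finset V) :=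
  K.filter fun τ => Disjoint τ σ ∧ τ ∪ σ ∈ K

/-- `L` is an induced (full) subcomplex of `K`. -/
def IsInduced (K L : Finset (Finset V)) : Prop :=
  L ⊆ K ∧ ∀ s ∈ K, s ⊆ verts L → s ∈ L

/-- The simplicial complement `C(L, K)`: the induced subcomplex of `K` on
`V(K) \ V(L)`. -/
def simpComplement (L K : Finset (Finset V)) : Finset (Finset V) :=
  K.filter fun s => s ⊆ verts K \ verts L

/-- The simplicial neighbourhood `N(L, K)`: the subcomplex of `K` whose maximal
faces are the maximal faces of `K` meeting `V(L)`. -/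
def simpNbhd (L K : Finset (Finset V)) : Finset (Finset V) :=
  K.filter fun s => ∃ t ∈ facets K, s ⊆ t ∧ (t ∩ verts L).Nonempty

/-- `fvec K i` is the number of `i`-dimensional faces of `K`. -/
def fvec (K : Finset (Finset V)) (i : ℕ) : ℕ :=
  (K.filter fun s => s.card = i + 1).card

/-- The number of facets of cardinality `d + 1` containing a given `(d-1)`-face
(the degree of the face in a (weak) pseudomanifold of dimension `d`). -/
def degOf (K : Finset (Finset V)) (d : ℕ) (s : Finset V) : ℕ :=
  (K.filter fun t => s ⊆ t ∧ t.card = d + 1).card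

/-- Simplicial isomorphism (via a vertex bijection carrying faces to faces). -/
def Iso (K : Finset (Finset V)) (L : Finset (Finset W)) : Prop :=
  ∃ f : V → W, Set.InjOn f ↑(verts K) ∧ L = K.image (Finset.image f)

/-- The join of two simplicial complexes (on disjoint vertex sets). -/
def sjoin (K L : Finset (Finset V)) : Finset (Finset V) :=
  K ∪ L ∪ (K ×ˢ L).image fun p => p.1 ∪ p.2

/-- The standard ball on vertex set `A`: all nonempty subsets of `A`. -/
def stdBall (A : Finset V) : Finset (Finset V) := A.powerset.erase ∅

/-- The standard sphere on vertex set `A`: all nonempty proper subsets of `A`. -/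
def stdSphere (A : Finset V) : Finset (Finset V) := (A.powerset.erase ∅).erase A

/-- `τ` is a free face of `K`, with `σ` the unique face properly containing it. -/
def IsFreeFace (K : Finset (Finset V)) (τ σ : Finset V) : Prop :=
  τ ∈ K ∧ σ ∈ K ∧ τ ⊂ σ ∧ ∀ ρ ∈ K, τ ⊂ ρ → ρ = σ

/-- An elementary collapse removes a free face together with the unique face
properly containing it. -/
def ElemCollapse (K K' : Finset (Finset V)) : Prop :=
  ∃ τ σ : Finset V, IsFreeFace K τ σ ∧ K' = (K.erase τ).erase σ

/-- `K` collapses to `L` by a sequence of elementary collapses. -/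
def CollapsesTo (K L : Finset (Finset V)) : Prop :=
  Relation.ReflTransGen ElemCollapse K L

/-- `K` is collapsible: it collapses to a single vertex. -/
def Collapsible (K : Finset (Finset V)) : Prop :=
  ∃ v : V, CollapsesTo K {{v}}

/-! ### Simplicial homology with `ℤ/2` coefficients (augmented chain complex).
A chain of level `n` is a `ZMod 2`-valued function supported on the faces of
cardinality `n` (the empty set, of cardinality `0`, serves as the `(-1)`-simplex
of the augmented complex).  Reduced homology in dimension `q` lives at level
`q + 1`. -/

/-- `c` is a chain of level `n` of `K` (over `ℤ/2`). -/
def z2chainOK (K : Finset (Finset V)) (n : ℕ) (c : Finset V → ZMod 2) : Prop :=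
  ∀ s : Finset V, c s ≠ 0 → s.card = n ∧ (s ∈ K ∨ s = ∅)

/-- The mod-2 boundary operator. -/
def z2bdry (K : Finset (Finset V)) (c : Finset V → ZMod 2) : Finset V → ZMod 2 :=
  fun t => ∑ v ∈ verts K \ t, c (insert v t)

/-- `K` is `ℤ/2`-acyclic: all reduced homology with `ℤ/2` coefficients vanishes,
i.e. in the augmented mod-2 chain complex every cycle is a boundary. -/
def Z2Acyclic (K : Finset (Finset V)) : Prop :=
  ∀ (n : ℕ) (c : Finset V → ZMod 2), z2chainOK K n c → z2bdry K c = 0 →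
    ∃ c', z2chainOK K (n + 1) c' ∧ z2bdry K c' = c

/-- `K` has the reduced `ℤ/2`-homology of the `d`-sphere: reduced homology
vanishes in all dimensions except `d` (level `d + 1`), where it is `ℤ/2`
(there is a cycle `z` which is not a boundary, and modulo boundaries every
cycle is `0` or `z`). -/
def Z2HomologySphere (d : ℕ) (K : Finset (Finset V)) : Prop :=
  (∀ (n : ℕ) (c : Finset V → ZMod 2), n ≠ d + 1 → z2chainOK K n c →
    z2bdry K c = 0 → ∃ c', z2chainOK K (n + 1) c' ∧ z2bdry K c' = c) ∧
  (∃ z : Finset V → ZMod 2, z2chainOK K (d + 1) z ∧ z2bdry K z = 0 ∧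
    (∀ c', z2chainOK K (d + 2) c' → z2bdry K c' ≠ z) ∧
    (∀ z', z2chainOK K (d + 1) z' → z2bdry K z' = 0 →
      (∃ c', z2chainOK K (d + 2) c' ∧ z2bdry K c' = z') ∨
      (∃ c', z2chainOK K (d + 2) c' ∧ z2bdry K c' = z + z')))

/-! ### Integral simplicial homology via ordered chains (Munkres §13: ordered
simplicial homology, allowing repeated vertices, agrees with simplicial
homology). An ordered `m`-tuple chain corresponds to dimension `m - 1`; the
unique `0`-tuple is the `(-1)`-simplex of the augmented complex. -/

/-- `c` is an ordered chain of `K` over `ℤ`: supported on tuples whose image is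
a face (the empty tuple being allowed in level `0`). -/
def zchainOK (K : Finset (Finset V)) {m : ℕ} (c : (Fin m → V) → ℤ) : Prop :=
  ∀ x : Fin m → V, c x ≠ 0 → (Finset.univ.image x ∈ K ∨ m = 0)

/-- The integral boundary operator on ordered chains. -/
def zbdry (K : Finset (Finset V)) {m : ℕ} (c : (Fin (m + 1) → V) → ℤ) :
    (Fin m → V) → ℤ :=
  fun y => ∑ i : Fin (m + 1), (-1 : ℤ) ^ (i : ℕ) * ∑ v ∈ verts K, c (i.insertNth v y)

/-- `K` has the reduced integral homology of the `d`-sphere: reduced homology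
vanishes in all dimensions except `d`, where it is infinite cyclic (there is a
cycle `z` such that every cycle is, modulo boundaries, a unique multiple of `z`). -/
def ZHomologySphere (d : ℕ) (K : Finset (Finset V)) : Prop :=
  (∀ c : (Fin 0 → V) → ℤ, ∃ c' : (Fin 1 → V) → ℤ, zchainOK K c' ∧ zbdry K c' = c) ∧
  (∀ (m : ℕ) (c : (Fin (m + 1) → V) → ℤ), m ≠ d → zchainOK K c → zbdry K c = 0 →
    ∃ c' : (Fin (m + 2) → V) → ℤ, zchainOK K c' ∧ zbdry K c' = c) ∧
  (∃ z : (Fin (d + 1) → V) → ℤ, zchainOK K z ∧ zbdry K z = 0 ∧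
    ∀ z' : (Fin (d + 1) → V) → ℤ, zchainOK K z' → zbdry K z' = 0 →
      ∃! k : ℤ, ∃ c'' : (Fin (d + 2) → V) → ℤ,
        zchainOK K c'' ∧ zbdry K c'' = z' - k • z)

/-- A weak pseudomanifold of dimension `d`: pure, and every `(d-1)`-face is in
exactly two facets. -/
def IsWeakPseudomanifold (d : ℕ) (K : Finset (Finset V)) : Prop :=
  IsComplex K ∧ IsPure d K ∧ ∀ s ∈ K, s.card = d → degOf K d s = 2

/-- Adjacency of facets along a common `(d-1)`-face. -/
def FacetAdj (d : ℕ) (K : Finset (Finset V)) (s t : Finset V) : Prop :=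
  s ∈ K ∧ t ∈ K ∧ s.card = d + 1 ∧ t.card = d + 1 ∧ (s ∩ t).card = d

/-- A pseudomanifold: a weak pseudomanifold in which any two facets are joined
by a chain of facets, consecutive ones sharing a `(d-1)`-face. -/
def IsPseudomanifold (d : ℕ) (K : Finset (Finset V)) : Prop :=
  IsWeakPseudomanifold d K ∧ ∀ s ∈ K, ∀ t ∈ K, s.card = d + 1 → t.card = d + 1 →
    Relation.ReflTransGen (FacetAdj d K) s t

/-- A weak pseudomanifold with boundary. -/
def IsWeakPseudomanifoldWithBdry (d : ℕ) (K : Finset (Finset V)) : Prop :=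
  IsComplex K ∧ IsPure d K ∧
  (∀ s ∈ K, s.card = d → degOf K d s = 1 ∨ degOf K d s = 2) ∧
  (∃ s ∈ K, s.card = d ∧ degOf K d s = 1)

/-- The boundary complex: all faces of degree-one `(d-1)`-faces. -/
def bdryComplex (d : ℕ) (K : Finset (Finset V)) : Finset (Finset V) :=
  K.filter fun t => ∃ s ∈ K, t ⊆ s ∧ s.card = d ∧ degOf K d s = 1

/-- `K` is connected (any two vertices joined by a path of edges). -/
def SConnected (K : Finset (Finset V)) : Prop :=
  ∀ u ∈ verts K, ∀ v ∈ verts K,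
    Relation.ReflTransGen (fun a b : V => ({a, b} : Finset V) ∈ K) u v

/-! ### Geometric realizations, subdivisions and combinatorial equivalence. -/

/-- A geometric simplicial complex in `ℝ^ℕ`: finitely many geometric simplices
(affinely independent vertex sets), closed under faces, any two of which meet
in a common face. -/
structure GComplex where
  faces : Finset (Finset (ℕ → ℝ))
  nonempty : faces.Nonempty
  empty_not_mem : ∅ ∉ faces
  down_closed : ∀ s ∈ faces, ∀ t : Finset (ℕ → ℝ), t ⊆ s → t.Nonempty → t ∈ faces
  indep : ∀ s ∈ faces,
    AffineIndependent ℝ (fun x : {y : ℕ → ℝ // y ∈ s} => (x : ℕ → ℝ))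
  glue : ∀ s ∈ faces, ∀ t ∈ faces,
    convexHull ℝ (s : Set (ℕ → ℝ)) ∩ convexHull ℝ (t : Set (ℕ → ℝ)) =
      convexHull ℝ ((s ∩ t : Finset (ℕ → ℝ)) : Set (ℕ → ℝ))

/-- The geometric carrier (underlying polyhedron) of a geometric complex. -/
def GComplex.carrier (G : GComplex) : Set (ℕ → ℝ) :=
  ⋃ s ∈ G.faces, convexHull ℝ (s : Set (ℕ → ℝ))

/-- `G` realizes the abstract complex `K` via the vertex map `f`. -/
def RealizesMap (G : GComplex) (K : Finset (Finset V)) (f : V → ℕ → ℝ) : Prop :=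
  Set.InjOn f ↑(verts K) ∧ G.faces = K.image (Finset.image f)

/-- `G` is a geometric realization of the abstract complex `K`. -/
def Realizes (G : GComplex) (K : Finset (Finset V)) : Prop :=
  ∃ f : V → ℕ → ℝ, RealizesMap G K f

/-- `G'` is a subdivision of `G`: same carrier, and every simplex of `G'` is
contained in a simplex of `G`. -/
def Subdivides (G' G : GComplex) : Prop :=
  G'.carrier = G.carrier ∧
  ∀ s ∈ G'.faces, ∃ t ∈ G.faces,
    convexHull ℝ (s : Set (ℕ → ℝ)) ⊆ convexHull ℝ (t : Set (ℕ → ℝ))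

/-- Combinatorial equivalence: `K` and `L` admit isomorphic subdivisions. -/
def CombEquiv (K : Finset (Finset V)) (L : Finset (Finset W)) : Prop :=
  ∃ G1 G1' G2 G2' : GComplex, Realizes G1 K ∧ Realizes G2 L ∧
    Subdivides G1' G1 ∧ Subdivides G2' G2 ∧ Iso G1'.faces G2'.faces

/-- A combinatorial `d`-ball: combinatorially equivalent to the standard ball. -/
def IsCombBall (d : ℕ) (K : Finset (Finset V)) : Prop :=
  ∃ A : Finset ℕ, A.card = d + 1 ∧ CombEquiv K (stdBall A)

/-- A combinatorial `d`-sphere: combinatorially equivalent to the standard sphere. -/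
def IsCombSphere (d : ℕ) (K : Finset (Finset V)) : Prop :=
  ∃ A : Finset ℕ, A.card = d + 2 ∧ CombEquiv K (stdSphere A)

/-- A combinatorial `d`-manifold: every vertex link is a combinatorial
`(d-1)`-sphere. -/
def IsCombManifold (d : ℕ) (K : Finset (Finset V)) : Prop :=
  IsComplex K ∧ ∀ v ∈ verts K, IsCombSphere (d - 1) (link K {v})

/-- A combinatorial `d`-manifold with boundary. -/
def IsCombManifoldWithBdry (d : ℕ) (K : Finset (Finset V)) : Prop :=
  IsComplex K ∧
  (∀ v ∈ verts K, IsCombSphere (d - 1) (link K {v}) ∨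
    IsCombBall (d - 1) (link K {v})) ∧
  (∃ v ∈ verts K, IsCombBall (d - 1) (link K {v}))

/-- A pl `k`-ball: a polyhedron carried by some geometric complex whose face
structure is a combinatorial `k`-ball. -/
def IsPLBall (k : ℕ) (P : Set (ℕ → ℝ)) : Prop :=
  ∃ G : GComplex, G.carrier = P ∧ IsCombBall k G.faces

/-- Elementary polyhedral collapse: `P = P' ∪ B` with `B` a pl `k`-ball and
`P' ∩ B` a pl `(k-1)`-ball. -/
def PolyElemCollapse (P P' : Set (ℕ → ℝ)) : Prop :=
  ∃ k : ℕ, 1 ≤ k ∧ ∃ B : Set (ℕ → ℝ),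
    IsPLBall k B ∧ P = P' ∪ B ∧ IsPLBall (k - 1) (P' ∩ B)

/-- Polyhedral collapse. -/
def PolyCollapsesTo (P Q : Set (ℕ → ℝ)) : Prop :=
  Relation.ReflTransGen PolyElemCollapse P Q

/-- Carrier of a subcomplex under a vertex realization map `f`. -/
def subCarrier (f : V → ℕ → ℝ) (L : Finset (Finset V)) : Set (ℕ → ℝ) :=
  ⋃ s ∈ L, convexHull ℝ ((s.image f : Finset (ℕ → ℝ)) : Set (ℕ → ℝ))

/-! ### Bistellar moves. -/

/-- The core `β = {x ∈ A : A \ {x} ∈ X}` of a `(d+2)`-set `A`. -/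
def bcore (X : Finset (Finset V)) (A : Finset V) : Finset V :=
  A.filter fun x => A.erase x ∈ X

/-- `κ_A` is a bistellar `i`-move on the `d`-dimensional complex `X`:
`A` has `d + 2` elements and contains at least one and at most `d + 1` facets
of `X`; with `β` the core of `A` and `α = A \ β` an `i`-face of `X`, one has
`β ∉ X`, and either `α` is a facet of `X` or `Lk_X(α)` has vertex set `β`. -/
def BistellarIMove (d i : ℕ) (X : Finset (Finset V)) (A : Finset V) : Prop :=
  A.card = d + 2 ∧
  0 < ((facets X).filter fun σ => σ ⊆ A).card ∧
  ((facets X).filter fun σ => σ ⊆ A).card ≤ d + 1 ∧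
  bcore X A ∉ X ∧
  A \ bcore X A ∈ X ∧ (A \ bcore X A).card = i + 1 ∧
  (A \ bcore X A ∈ facets X ∨ verts (link X (A \ bcore X A)) = bcore X A)

/-! ### The explicit small complexes of the paper. -/

/-- The complex generated by a list of facets: all nonempty subsets thereof. -/
def genBy (F : Finset (Finset ℕ)) : Finset (Finset ℕ) :=
  F.sup fun s => s.powerset.erase ∅

/-- The standard 2-sphere `S²₄`. -/
def S24 : Finset (Finset ℕ) := stdSphere {1, 2, 3, 4}

/-- The join `S¹₃ * S⁰₂`. -/
def S13S02 : Finset (Finset ℕ) := sjoin (stdSphere {1, 2, 3}) (stdSphere {4, 5})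

/-- The octahedron `S⁰₂ * S⁰₂ * S⁰₂`. -/
def Octa : Finset (Finset ℕ) :=
  sjoin (stdSphere {1, 2}) (sjoin (stdSphere {3, 4}) (stdSphere {5, 6}))

/-- The 6-vertex real projective plane `ℝP²₆`. -/
def RP26 : Finset (Finset ℕ) :=
  genBy {{1, 2, 3}, {1, 2, 4}, {1, 3, 5}, {1, 4, 6}, {1, 5, 6},
         {2, 3, 6}, {2, 4, 5}, {2, 5, 6}, {3, 4, 5}, {3, 4, 6}}

/-- `Σ₁`: the 6-vertex 2-sphere with a vertex of degree 3 and one of degree 5. -/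
def Sigma1 : Finset (Finset ℕ) :=
  genBy {{1, 2, 5}, {1, 2, 6}, {1, 5, 6}, {2, 3, 5},
         {2, 3, 6}, {3, 4, 5}, {3, 4, 6}, {4, 5, 6}}

/-- The double pyramid `S¹₅ * S⁰₂`. -/
def S15S02 : Finset (Finset ℕ) :=
  sjoin (genBy {{1, 2}, {2, 3}, {3, 4}, {4, 5}, {1, 5}}) (stdSphere {6, 7})

/-- `Σ₂` (7-vertex 2-sphere with 10 triangles). -/
def Sigma2 : Finset (Finset ℕ) :=
  genBy {{1, 2, 6}, {1, 2, 7}, {1, 6, 7}, {2, 3, 6}, {2, 3, 7},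
         {3, 4, 6}, {3, 4, 7}, {4, 5, 6}, {4, 5, 7}, {5, 6, 7}}

/-- `Σ₃` (7-vertex 2-sphere with 10 triangles). -/
def Sigma3 : Finset (Finset ℕ) :=
  genBy {{1, 2, 6}, {1, 2, 7}, {1, 6, 7}, {2, 3, 4}, {2, 3, 7},
         {2, 4, 6}, {3, 4, 7}, {4, 5, 6}, {4, 5, 7}, {5, 6, 7}}

/-- `Σ₄` (7-vertex 2-sphere with 10 triangles). -/
def Sigma4 : Finset (Finset ℕ) :=
  genBy {{1, 2, 4}, {1, 2, 7}, {1, 4, 5}, {1, 5, 6}, {1, 6, 7},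
         {2, 3, 4}, {2, 3, 7}, {3, 4, 7}, {4, 5, 7}, {5, 6, 7}}

/-- `Σ₅` (7-vertex 2-sphere with 10 triangles). -/
def Sigma5 : Finset (Finset ℕ) :=
  genBy {{1, 2, 3}, {1, 2, 6}, {1, 3, 5}, {1, 5, 6}, {2, 3, 4},
         {2, 4, 6}, {3, 4, 5}, {4, 5, 7}, {4, 6, 7}, {5, 6, 7}}

/-- `Υ₁ = S²₄ ∪ S²₄`: two tetrahedral spheres sharing exactly one vertex. -/
def Upsilon1 : Finset (Finset ℕ) :=
  stdSphere {1, 2, 3, 7} ∪ stdSphere {4, 5, 6, 7}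

/-- `Υ₂ = S²₄ ∪ (S⁰₂ * S¹₃)`: a tetrahedral sphere and a join, where the two
common vertices span an edge of the `S²₄`. -/
def Upsilon2 : Finset (Finset ℕ) :=
  stdSphere {4, 5, 6, 7} ∪ sjoin (stdSphere {6, 7}) (stdSphere {1, 2, 3})

/-- The complex `R` obtained from `ℝP²₆` by the generalized bistellar 1-move
`κ_A`, `A = {1, 2, 5, 6}` (all such choices of `A` yield isomorphic complexes). -/
def Rcomplex : Finset (Finset ℕ) :=
  genBy {{1, 2, 3}, {1, 2, 4}, {1, 2, 5}, {1, 2, 6}, {1, 3, 5},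
         {1, 4, 6}, {2, 3, 6}, {2, 4, 5}, {3, 4, 5}, {3, 4, 6}}

end HomologySpheres

end

namespace HS
open Finset
open scoped Classical
set_option linter.all false

section

variable {V W U : Type*}

/-- Complexes contain the empty face and are closed downwards. -/
def Cx (K : Finset (Finset V)) : Prop := ∅ ∈ K ∧ ∀ s ∈ K, ∀ t, t ⊆ s → t ∈ K

/-- The cone (fan) over a complex. -/
def C (K : Finset (Finset V)) : Set (V →₀ ℝ) := {x | (∀ v, 0 ≤ x v) ∧ x.support ∈ K}

/-- `T` subdivides `K` via the linear map `φ`. -/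
def Sub (T : Finset (Finset W)) (K : Finset (Finset V)) (φ : (W →₀ ℝ) →ₗ[ℝ] (V →₀ ℝ)) : Prop :=
  Set.BijOn φ (C T) (C K)

/-- indicator vector -/
noncomputable def e (v : V) : V →₀ ℝ := Finsupp.single v 1

lemma e_nonneg (v u : V) : 0 ≤ e v u := by
  unfold e; rw [Finsupp.single_apply]; split_ifs <;> norm_num

lemma supp_e (v : V) : (e v).support = {v} := by
  unfold e; exact Finsupp.support_single_ne_zero v one_ne_zero

lemma e_mem {K : Finset (Finset V)} {v : V} (h : {v} ∈ K) : e v ∈ C K :=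
  ⟨e_nonneg v, by rw [supp_e]; exact h⟩

lemma zero_mem {K : Finset (Finset V)} (h : Cx K) : (0 : V →₀ ℝ) ∈ C K :=
  ⟨fun v => le_rfl, by simpa using h.1⟩

lemma mem_of_supp {K : Finset (Finset V)} (h : Cx K) {x : V →₀ ℝ} {s : Finset V} (hs : s ∈ K)
    (hx : ∀ v, 0 ≤ x v) (hxs : x.support ⊆ s) : x ∈ C K :=
  ⟨hx, h.2 s hs _ hxs⟩

lemma map_eq_sum (φ : (W →₀ ℝ) →ₗ[ℝ] U →₀ ℝ) (x : W →₀ ℝ) :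
    φ x = ∑ w ∈ x.support, x w • φ (e w) := by
  conv_lhs => rw [← Finsupp.sum_single x]
  rw [Finsupp.sum, map_sum]
  refine Finset.sum_congr rfl fun w _ => ?_
  rw [← map_smul]; unfold e; simp

lemma map_eq_sum' {E : Type*} [AddCommGroup E] [Module ℝ E] (φ : (W →₀ ℝ) →ₗ[ℝ] E) (x : W →₀ ℝ) :
    φ x = ∑ w ∈ x.support, x w • φ (e w) := by
  conv_lhs => rw [← Finsupp.sum_single x]
  rw [Finsupp.sum, map_sum]
  refine Finset.sum_congr rfl fun w _ => ?_
  rw [← map_smul]; unfold e; simp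

lemma supp_sum_subset {ι : Type*} (t : Finset ι) (a : ι → ℝ) (p : ι → V →₀ ℝ) (s : Finset V)
    (h : ∀ i ∈ t, (p i).support ⊆ s) : (∑ i ∈ t, a i • p i).support ⊆ s := by
  intro v hv
  by_contra hvs
  rw [Finsupp.mem_support_iff] at hv
  apply hv
  rw [Finsupp.finsetSum_apply]
  refine Finset.sum_eq_zero fun i hi => ?_
  have : p i v = 0 := by
    by_contra h0
    exact hvs (h i hi (Finsupp.mem_support_iff.2 h0))
  simp [this]

lemma nonneg_sum {ι : Type*} (t : Finset ι) (a : ι → ℝ) (p : ι → V →₀ ℝ)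
    (ha : ∀ i ∈ t, 0 ≤ a i) (h : ∀ i ∈ t, ∀ v, 0 ≤ p i v) (v : V) :
    0 ≤ (∑ i ∈ t, a i • p i) v := by
  rw [Finsupp.finsetSum_apply]
  refine Finset.sum_nonneg fun i hi => ?_
  simpa using mul_nonneg (ha i hi) (h i hi v)

/-- the factorisation lemma -/
lemma factor {E : Type*} [AddCommGroup E] [Module ℝ E] {T : Finset (Finset W)}
    {K : Finset (Finset V)} (hK : Cx K)
    (ev1 : (W →₀ ℝ) →ₗ[ℝ] E) (ev2 : (V →₀ ℝ) →ₗ[ℝ] E)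
    (inj1 : Set.InjOn ev1 (C T)) (inj2 : Set.InjOn ev2 (C K))
    (surj : ∀ y ∈ C K, ∃ x ∈ C T, ev1 x = ev2 y)
    (carr : ∀ t ∈ T, ∃ s ∈ K, ∀ w ∈ t, ∃ y : V →₀ ℝ, (∀ v, 0 ≤ y v) ∧ y.support ⊆ s ∧
      ev2 y = ev1 (e w)) :
    ∃ ψ : (W →₀ ℝ) →ₗ[ℝ] (V →₀ ℝ), Sub T K ψ ∧ ∀ x ∈ C T, ev2 (ψ x) = ev1 x := by
  let p : W → V →₀ ℝ := fun w => if h : ∃ y ∈ C K, ev2 y = ev1 (e w) then h.choose else 0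
  let ψ : (W →₀ ℝ) →ₗ[ℝ] (V →₀ ℝ) := Finsupp.linearCombination ℝ p
  have hψe : ∀ w, ψ (e w) = p w := by
    intro w; simp [ψ, e, Finsupp.linearCombination_single]
  have key : ∀ x ∈ C T, ψ x ∈ C K ∧ ev2 (ψ x) = ev1 x := by
    intro x hx
    obtain ⟨s, hs, hc⟩ := carr _ hx.2
    have hp : ∀ w ∈ x.support, (∀ v, 0 ≤ p w v) ∧ (p w).support ⊆ s ∧ ev2 (p w) = ev1 (e w) := by
      intro w hw
      obtain ⟨y, hy0, hys, hy⟩ := hc w hw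
      have hyC : y ∈ C K := mem_of_supp hK hs hy0 hys
      have hex : ∃ y ∈ C K, ev2 y = ev1 (e w) := ⟨y, hyC, hy⟩
      have : p w = y := by
        have h1 : p w = hex.choose := dif_pos hex
        rw [h1]
        exact inj2 hex.choose_spec.1 hyC (hex.choose_spec.2.trans hy.symm)
      rw [this]; exact ⟨hy0, hys, hy⟩
    rw [map_eq_sum' ψ, map_eq_sum' ev1]
    simp only [hψe]
    refine ⟨mem_of_supp hK hs ?_ ?_, ?_⟩
    · exact nonneg_sum _ _ _ (fun i _ => hx.1 i) (fun i hi => (hp i hi).1)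
    · exact supp_sum_subset _ _ _ _ (fun i hi => (hp i hi).2.1)
    · rw [map_sum]
      refine Finset.sum_congr rfl fun w hw => ?_
      rw [map_smul, (hp w hw).2.2]
  refine ⟨ψ, ⟨fun x hx => (key x hx).1, ?_, ?_⟩, fun x hx => (key x hx).2⟩
  · intro x hx y hy hxy
    apply inj1 hx hy
    rw [← (key x hx).2, ← (key y hy).2, hxy]
  · intro y hy
    obtain ⟨x, hx, hxy⟩ := surj y hy
    exact ⟨x, hx, inj2 (key x hx).1 hy ((key x hx).2.trans hxy)⟩

lemma Sub.comp {T : Finset (Finset W)} {K : Finset (Finset V)} {R : Finset (Finset U)}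
    {ψ : (U →₀ ℝ) →ₗ[ℝ] (W →₀ ℝ)} {φ : (W →₀ ℝ) →ₗ[ℝ] (V →₀ ℝ)} (h1 : Sub T K φ) (h2 : Sub R T ψ) :
    Sub R K (φ ∘ₗ ψ) := by
  have := Set.BijOn.comp h1 h2
  simpa [Sub] using this

lemma Sub.id (K : Finset (Finset V)) : Sub K K LinearMap.id := by
  simpa [Sub] using Set.bijOn_id _

/-- indicator of a finset -/
noncomputable def one (s : Finset V) : V →₀ ℝ := ∑ v ∈ s, e v

lemma one_apply (s : Finset V) (v : V) : one s v = if v ∈ s then 1 else 0 := by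
  unfold one e
  rw [Finsupp.finsetSum_apply]
  simp [Finsupp.single_apply]

lemma supp_one (s : Finset V) : (one s).support = s := by
  ext v; simp [one_apply]

lemma one_mem {K : Finset (Finset V)} {s : Finset V} (h : s ∈ K) : one s ∈ C K :=
  ⟨fun v => by rw [one_apply]; split_ifs <;> norm_num, by rw [supp_one]; exact h⟩

/-- monotonicity of the support under a subdivision map -/
lemma Sub.supp_mono {T : Finset (Finset W)} {K : Finset (Finset V)} {φ : (W →₀ ℝ) →ₗ[ℝ] (V →₀ ℝ)}
    (hT : Cx T) (h : Sub T K φ) {x y : W →₀ ℝ} (hx : x ∈ C T) (hy : ∀ w, 0 ≤ y w)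
    (hyx : y.support ⊆ x.support) : (φ y).support ⊆ (φ x).support := by
  have hw : ∀ w ∈ x.support, (φ (e w)).support ⊆ (φ x).support := by
    intro w hw v hv
    rw [map_eq_sum φ x]
    rw [Finsupp.mem_support_iff, Finsupp.finsetSum_apply]
    have hnn : ∀ u ∈ x.support, 0 ≤ φ (e u) v := fun u hu =>
      (h.1 (e_mem (hT.2 _ hx.2 _ (by simpa using hu)))).1 v
    apply ne_of_gt
    apply Finset.sum_pos' (fun u hu => by simpa using mul_nonneg (hx.1 u) (hnn u hu))
    refine ⟨w, hw, ?_⟩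
    have h1 : φ (e w) v ≠ 0 := Finsupp.mem_support_iff.1 hv
    have h2 : x w ≠ 0 := Finsupp.mem_support_iff.1 hw
    have := lt_of_le_of_ne (hnn w hw) h1.symm
    have := lt_of_le_of_ne (hx.1 w) h2.symm
    simp only [Finsupp.smul_apply, smul_eq_mul]
    positivity
  rw [map_eq_sum φ y]
  exact supp_sum_subset _ _ _ _ fun w hwy => hw w (hyx hwy)

lemma Cx.vert {K : Finset (Finset V)} (h : Cx K) {s : Finset V} (hs : s ∈ K) {v : V} (hv : v ∈ s) :
    {v} ∈ K := h.2 s hs _ (by simpa using hv)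

end

end HS

namespace HS
open Finset
open scoped Classical
set_option linter.all false

section

variable {V W U : Type*} [DecidableEq V] [DecidableEq W] [DecidableEq U]

/-- stellar subdivision at the face `σ` with new vertex `p` -/
def star (K : Finset (Finset V)) (σ : Finset V) (p : V) : Finset (Finset V) :=
  K.filter (fun t => ¬ σ ⊆ t) ∪ (K.filter (fun t => ¬ σ ⊆ t ∧ t ∪ σ ∈ K)).image (insert p)

lemma mem_star {K : Finset (Finset V)} {σ : Finset V} {p : V} {t : Finset V} :
    t ∈ star K σ p ↔ (t ∈ K ∧ ¬ σ ⊆ t) ∨ ∃ u ∈ K, ¬ σ ⊆ u ∧ u ∪ σ ∈ K ∧ insert p u = t := by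
  unfold star
  simp only [mem_union, mem_filter, mem_image]
  constructor
  · rintro (h | ⟨u, ⟨h1, h2, h3⟩, h4⟩)
    · exact Or.inl h
    · exact Or.inr ⟨u, h1, h2, h3, h4⟩
  · rintro (h | ⟨u, h1, h2, h3, h4⟩)
    · exact Or.inl h
    · exact Or.inr ⟨u, ⟨h1, h2, h3⟩, h4⟩

/-- `p` is not a vertex of `K` -/
def Fresh (K : Finset (Finset V)) (p : V) : Prop := ∀ t ∈ K, p ∉ t

lemma star_cx {K : Finset (Finset V)} {σ : Finset V} {p : V} (hK : Cx K) (hσ : σ.Nonempty) :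
    Cx (star K σ p) := by
  constructor
  · rw [mem_star]
    exact Or.inl ⟨hK.1, fun h => by
      rw [Finset.subset_empty] at h; exact hσ.ne_empty h⟩
  · intro s hs t hts
    rw [mem_star] at hs ⊢
    rcases hs with ⟨h1, h2⟩ | ⟨u, h1, h2, h3, rfl⟩
    · exact Or.inl ⟨hK.2 _ h1 _ hts, fun h => h2 (h.trans hts)⟩
    · by_cases hp : p ∈ t
      · right
        have hsub : t.erase p ⊆ u := by
          intro x hx
          have := hts (mem_of_mem_erase hx)
          rw [mem_insert] at this
          exact this.resolve_left (ne_of_mem_erase hx)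
        exact ⟨t.erase p, hK.2 _ h1 _ hsub, fun h => h2 (h.trans hsub),
          hK.2 _ h3 _ (union_subset_union_left hsub), insert_erase hp⟩
      · left
        have hsub : t ⊆ u := by
          intro x hx
          have := hts hx
          rw [mem_insert] at this
          exact this.resolve_left (fun h => hp (h ▸ hx))
        exact ⟨hK.2 _ h1 _ hsub, fun h => h2 (h.trans hsub)⟩

/-- the map of a stellar subdivision, sending the new vertex to `y` -/
noncomputable def starMap (p : V) (y : V →₀ ℝ) : (V →₀ ℝ) →ₗ[ℝ] (V →₀ ℝ) :=
  Finsupp.linearCombination ℝ (fun v => if v = p then y else e v)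

lemma starMap_e_ne {p v : V} (y : V →₀ ℝ) (h : v ≠ p) : starMap p y (e v) = e v := by
  simp [starMap, e, Finsupp.linearCombination_single, h]

lemma starMap_e_self {p : V} (y : V →₀ ℝ) : starMap p y (e p) = y := by
  simp [starMap, e, Finsupp.linearCombination_single]

lemma starMap_eq (p : V) (y x : V →₀ ℝ) :
    starMap p y x = x.erase p + x p • y := by
  have h : ∀ x : V →₀ ℝ, x p = 0 → starMap p y x = x := by
    intro x hx
    rw [map_eq_sum]
    conv_rhs => rw [← Finsupp.sum_single x]
    rw [Finsupp.sum]
    refine Finset.sum_congr rfl fun w hw => ?_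
    rw [starMap_e_ne]
    · simp [e]
    · rintro rfl; exact (Finsupp.mem_support_iff.1 hw) hx
  have h2 : x = x.erase p + x p • e p := by
    conv_lhs => rw [← Finsupp.erase_add_single p x]
    simp [e]
  conv_lhs => rw [h2]
  rw [map_add, map_smul, starMap_e_self, h _ (by simp)]

lemma starMap_apply {p v : V} (y x : V →₀ ℝ) (hv : v ≠ p) :
    starMap p y x v = x v + x p * y v := by
  rw [starMap_eq]; simp [Finsupp.erase_ne hv]

lemma Fresh.apply {K : Finset (Finset V)} {p : V} (h : Fresh K p) {x : V →₀ ℝ} (hx : x ∈ C K) :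
    x p = 0 := by
  by_contra h0
  exact h _ hx.2 (Finsupp.mem_support_iff.2 h0)

lemma star_zero {K : Finset (Finset V)} {σ : Finset V} {p : V} (hp : Fresh K p) (hσ : σ ∈ K)
    {x : V →₀ ℝ} (hx : x ∈ C (star K σ p)) :
    ∃ v ∈ σ, x v = 0 := by
  have : ¬ σ ⊆ x.support := by
    intro hsub
    have h := hx.2
    rw [mem_star] at h
    rcases h with ⟨h1, h2⟩ | ⟨u, h1, h2, h3, h4⟩
    · exact h2 hsub
    · rw [← h4] at hsub
      apply h2
      intro v hv
      have := hsub hv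
      rw [mem_insert] at this
      exact this.resolve_left (by rintro rfl; exact hp _ hσ hv)
  rw [Finset.not_subset] at this
  obtain ⟨v, hv, hv'⟩ := this
  exact ⟨v, hv, by simpa using hv'⟩

lemma star_sub {K : Finset (Finset V)} {p : V} {y : V →₀ ℝ} (hK : Cx K) (hp : Fresh K p)
    (hy : y ∈ C K) (hy0 : y ≠ 0) : Sub (star K y.support p) K (starMap p y) := by
  have hyp : y p = 0 := hp.apply hy
  have hypos : ∀ v ∈ y.support, 0 < y v := fun v hv =>
    lt_of_le_of_ne (hy.1 v) (Finsupp.mem_support_iff.1 hv).symm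
  have hne : ∀ v ∈ y.support, v ≠ p := by
    rintro v hv rfl; exact (Finsupp.mem_support_iff.1 hv) hyp
  have hlt : ∀ x ∈ C (star K y.support p), ∀ x' ∈ C (star K y.support p),
      starMap p y x = starMap p y x' → x p ≤ x' p := by
    intro x hx x' hx' heq
    obtain ⟨v, hv, hv0⟩ := star_zero hp hy.2 hx'
    have h := DFunLike.congr_fun heq v
    rw [starMap_apply _ _ (hne v hv), starMap_apply _ _ (hne v hv), hv0] at h
    have h1 := hx.1 v
    have h2 := hypos v hv
    by_contra hcon
    push Not at hcon
    nlinarith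
  refine ⟨?_, ?_, ?_⟩
  · intro x hx
    have hs := hx.2
    rw [mem_star] at hs
    rw [starMap_eq]
    have hnn : ∀ v, 0 ≤ (x.erase p + x p • y) v := by
      intro v
      have h1 : 0 ≤ x.erase p v := by
        rw [Finsupp.erase_apply]; split_ifs
        · exact le_rfl
        · exact hx.1 v
      have h2 : 0 ≤ x p * y v := mul_nonneg (hx.1 p) (hy.1 v)
      simpa using add_nonneg h1 h2
    rcases hs with ⟨h1, h2⟩ | ⟨u, h1, h2, h3, h4⟩
    · refine mem_of_supp hK h1 hnn ?_
      have : x p = 0 := by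
        by_contra h0
        exact hp _ h1 (Finsupp.mem_support_iff.2 h0)
      rw [this, zero_smul, add_zero, Finsupp.support_erase]
      exact erase_subset _ _
    · refine mem_of_supp hK h3 hnn ?_
      refine Finsupp.support_add.trans (union_subset_union ?_ Finsupp.support_smul)
      rw [Finsupp.support_erase, ← h4]
      intro v hv
      have h5 := mem_of_mem_erase hv
      rw [mem_insert] at h5
      exact h5.resolve_left (ne_of_mem_erase hv)
  · intro x hx x' hx' heq
    have hpp : x p = x' p := le_antisymm (hlt x hx x' hx' heq) (hlt x' hx' x hx heq.symm)
    ext v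
    by_cases hv : v = p
    · rw [hv, hpp]
    · have h := DFunLike.congr_fun heq v
      rw [starMap_apply _ _ hv, starMap_apply _ _ hv, hpp] at h
      linarith
  · intro z hz
    have hzp : z p = 0 := hp.apply hz
    have hnonempty : y.support.Nonempty := Finsupp.support_nonempty_iff.2 hy0
    obtain ⟨v0, hv0, hmin⟩ := Finset.exists_min_image y.support (fun v => z v / y v) hnonempty
    set m := z v0 / y v0 with hm
    have hm0 : 0 ≤ m := div_nonneg (hz.1 _) (hy.1 _)
    have hle : ∀ v, m * y v ≤ z v := by
      intro v
      by_cases hv : v ∈ y.support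
      · have := hmin v hv
        rw [le_div_iff₀ (hypos v hv)] at this
        exact this
      · have : y v = 0 := by simpa using hv
        rw [this, mul_zero]; exact hz.1 v
    let x : V →₀ ℝ := z - m • y + m • e p
    have hep : e p p = 1 := by simp [e]
    have hev : ∀ v, v ≠ p → e p v = 0 := fun v hv => by simp [e, Finsupp.single_apply, Ne.symm hv]
    have hxp : x p = m := by simp [x, hzp, hyp, hep]
    have hxv : ∀ v, v ≠ p → x v = z v - m * y v := fun v hv => by simp [x, hev v hv]
    refine ⟨x, ⟨?_, ?_⟩, ?_⟩
    · intro v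
      by_cases hv : v = p
      · rw [hv, hxp]; exact hm0
      · rw [hxv v hv]; linarith [hle v]
    · have hv0z : z v0 - m * y v0 = 0 := by
        rw [hm, div_mul_cancel₀ _ (hypos v0 hv0).ne']; ring
      by_cases hm00 : m = 0
      · have hxz : x = z := by simp [x, hm00]
        rw [hxz, mem_star]
        refine Or.inl ⟨hz.2, fun h => ?_⟩
        have := Finsupp.mem_support_iff.1 (h hv0)
        rw [hm00] at hv0z
        apply this; linarith
      · have hmpos : 0 < m := lt_of_le_of_ne hm0 (Ne.symm hm00)
        have hyz : y.support ⊆ z.support := by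
          intro v hv
          rw [Finsupp.mem_support_iff]
          have := hle v
          have := mul_pos hmpos (hypos v hv)
          linarith
        have hxz : (x.support.erase p) ⊆ z.support := by
          intro v hv
          have hvp := ne_of_mem_erase hv
          have hvx := Finsupp.mem_support_iff.1 (mem_of_mem_erase hv)
          rw [hxv v hvp] at hvx
          rw [Finsupp.mem_support_iff]
          intro h0
          have : v ∉ y.support := fun h => (Finsupp.mem_support_iff.1 (hyz h)) h0
          have : y v = 0 := by simpa using this
          rw [h0, this] at hvx; simp at hvx
        rw [mem_star]
        refine Or.inr ⟨x.support.erase p, hK.2 _ hz.2 _ hxz, fun h => ?_,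
          hK.2 _ hz.2 _ (union_subset hxz hyz), insert_erase ?_⟩
        · have := Finsupp.mem_support_iff.1 (mem_of_mem_erase (h hv0))
          rw [hxv v0 (hne v0 hv0)] at this
          exact this hv0z
        · rw [Finsupp.mem_support_iff, hxp]; exact hm00
    · rw [starMap_eq, hxp]
      ext v
      by_cases hv : v = p
      · rw [hv]; simp [hzp, hyp]
      · simp [Finsupp.erase_ne hv, hxv v hv]

end

end HS

namespace HS
open Finset
open scoped Classical
set_option linter.all false

section

variable {V W U : Type*} [DecidableEq V] [DecidableEq W] [DecidableEq U]

/-- weighted point on an edge -/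
noncomputable def edgePt (a b : V) (α β : ℝ) : V →₀ ℝ := α • e a + β • e b

lemma edgePt_supp {a b : V} {α β : ℝ} (hα : 0 < α) (hβ : 0 < β) :
    (edgePt a b α β).support = {a, b} := by
  ext v
  have h1 := e_nonneg a v
  have h2 := e_nonneg b v
  rw [Finsupp.mem_support_iff]
  simp only [edgePt, Finsupp.add_apply, Finsupp.smul_apply, smul_eq_mul, mem_insert, mem_singleton]
  constructor
  · intro h
    by_contra hcon
    push Not at hcon
    apply h
    simp [e, Finsupp.single_apply, Ne.symm hcon.1, Ne.symm hcon.2]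
  · rintro (rfl | rfl)
    · have : e v v = 1 := by simp [e]
      rw [this]; nlinarith [mul_nonneg hβ.le h2]
    · have : e v v = 1 := by simp [e]
      rw [this]; nlinarith [mul_nonneg hα.le h1]

lemma edgePt_mem {K : Finset (Finset V)} {a b : V} {α β : ℝ} (hα : 0 < α) (hβ : 0 < β)
    (h : {a, b} ∈ K) : edgePt a b α β ∈ C K := by
  refine ⟨fun v => ?_, by rw [edgePt_supp hα hβ]; exact h⟩
  have h1 := e_nonneg a v
  have h2 := e_nonneg b v
  simp only [edgePt, Finsupp.add_apply, Finsupp.smul_apply, smul_eq_mul]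
  positivity

lemma edgePt_ne {a b : V} {α β : ℝ} (hα : 0 < α) (hβ : 0 < β) : edgePt a b α β ≠ 0 := by
  rw [← Finsupp.support_nonempty_iff, edgePt_supp hα hβ]
  simp

/-- iterated edge-stellar subdivisions -/
inductive ES (K : Finset (Finset V)) :
    Finset (Finset V) → ((V →₀ ℝ) →ₗ[ℝ] (V →₀ ℝ)) → Prop
  | refl : ES K K LinearMap.id
  | step {T φ} (a b p : V) (α β : ℝ) (h : ES K T φ) (hab : a ≠ b) (hT : {a, b} ∈ T)
      (hα : 0 < α) (hβ : 0 < β) (hp : Fresh T p) :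
      ES K (star T {a, b} p) (φ ∘ₗ starMap p (edgePt a b α β))

lemma ES.trans {K T R : Finset (Finset V)} {φ ψ} (h1 : ES K T φ) (h2 : ES T R ψ) :
    ES K R (φ ∘ₗ ψ) := by
  induction h2 with
  | refl => simpa using h1
  | step a b p α β h hab hT hα hβ hp ih =>
    rw [← LinearMap.comp_assoc]
    exact ES.step a b p α β ih hab hT hα hβ hp

lemma ES.sub {K T : Finset (Finset V)} {φ} (hK : Cx K) (h : ES K T φ) : Cx T ∧ Sub T K φ := by
  induction h with
  | refl => exact ⟨hK, Sub.id K⟩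
  | step a b p α β h hab hT hα hβ hp ih =>
    refine ⟨star_cx ih.1 (by simp), ih.2.comp ?_⟩
    have := star_sub ih.1 hp (edgePt_mem hα hβ hT) (edgePt_ne hα hβ)
    rwa [edgePt_supp hα hβ] at this

def OneSided (T : Finset (Finset W)) (g : (W →₀ ℝ) →ₗ[ℝ] ℝ) : Prop :=
  ∀ t ∈ T, (∀ w ∈ t, 0 ≤ g (e w)) ∨ (∀ w ∈ t, g (e w) ≤ 0)

lemma OneSided.comp {T : Finset (Finset W)} {T' : Finset (Finset U)} {g : (W →₀ ℝ) →ₗ[ℝ] ℝ}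
    {θ : (U →₀ ℝ) →ₗ[ℝ] (W →₀ ℝ)} (hT' : Cx T') (h : OneSided T g) (hθ : Sub T' T θ) :
    OneSided T' (g ∘ₗ θ) := by
  intro t ht
  have h1 : θ (one t) ∈ C T := hθ.1 (one_mem ht)
  have hs : ∀ w ∈ t, (∀ v, 0 ≤ θ (e w) v) ∧ (θ (e w)).support ⊆ (θ (one t)).support := by
    intro w hw
    exact ⟨(hθ.1 (e_mem (hT'.vert ht hw))).1, hθ.supp_mono hT' (one_mem ht) (e_nonneg w)
      (by rw [supp_e, supp_one]; simpa using hw)⟩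
  rcases h _ h1.2 with h2 | h2
  · left
    intro w hw
    rw [LinearMap.comp_apply, map_eq_sum' g]
    exact Finset.sum_nonneg fun v hv => mul_nonneg ((hs w hw).1 v) (h2 v ((hs w hw).2 hv))
  · right
    intro w hw
    rw [LinearMap.comp_apply, map_eq_sum' g]
    exact Finset.sum_nonpos fun v hv =>
      mul_nonpos_of_nonneg_of_nonpos ((hs w hw).1 v) (h2 v ((hs w hw).2 hv))

lemma exists_fresh [Infinite V] (K : Finset (Finset V)) : ∃ p, Fresh K p := by
  obtain ⟨p, hp⟩ := Infinite.exists_notMem_finset (K.biUnion id)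
  refine ⟨p, fun t ht h => hp ?_⟩
  rw [mem_biUnion]; exact ⟨t, ht, h⟩

/-- crossing edges -/
noncomputable def cr (T : Finset (Finset V)) (g : (V →₀ ℝ) →ₗ[ℝ] ℝ) : Finset (Finset V) :=
  T.filter (fun t => ∃ a b, t = {a, b} ∧ g (e a) < 0 ∧ 0 < g (e b))

lemma split_aux [Infinite V] (n : ℕ) : ∀ (T : Finset (Finset V)) (g : (V →₀ ℝ) →ₗ[ℝ] ℝ), Cx T →
    (cr T g).card = n → ∃ T' θ, ES T T' θ ∧ OneSided T' (g ∘ₗ θ) := by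
  induction n using Nat.strong_induction_on with
  | _ n ih =>
  intro T g hT hn
  by_cases hne : (cr T g).Nonempty
  · obtain ⟨t, ht⟩ := hne
    have ht' := ht
    simp only [cr, mem_filter] at ht
    obtain ⟨htT, a, b, rfl, ha, hb⟩ := ht
    obtain ⟨p, hp⟩ := exists_fresh T
    have hab : a ≠ b := by rintro rfl; linarith
    have hes : ES T (star T {a, b} p) (LinearMap.id ∘ₗ starMap p (edgePt a b (g (e b)) (-g (e a)))) :=
      ES.step a b p _ _ ES.refl hab htT hb (by linarith) hp
    rw [LinearMap.id_comp] at hes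
    set y := edgePt a b (g (e b)) (-g (e a)) with hy
    have hgp : (g ∘ₗ starMap p y) (e p) = 0 := by
      rw [LinearMap.comp_apply, starMap_e_self, hy]
      simp only [edgePt, map_add, map_smul, smul_eq_mul]; ring
    have hgv : ∀ v, v ≠ p → (g ∘ₗ starMap p y) (e v) = g (e v) := fun v hv => by
      rw [LinearMap.comp_apply, starMap_e_ne _ hv]
    have hlt : (cr (star T {a, b} p) (g ∘ₗ starMap p y)).card < n := by
      rw [← hn]
      apply Finset.card_lt_card
      refine ⟨?_, fun h => ?_⟩
      · intro t ht
        simp only [cr, mem_filter] at ht ⊢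
        obtain ⟨h1, c, d, rfl, hc, hd⟩ := ht
        have hcp : c ≠ p := by rintro rfl; rw [hgp] at hc; exact lt_irrefl _ hc
        have hdp : d ≠ p := by rintro rfl; rw [hgp] at hd; exact lt_irrefl _ hd
        rw [hgv _ hcp] at hc
        rw [hgv _ hdp] at hd
        refine ⟨?_, c, d, rfl, hc, hd⟩
        rw [mem_star] at h1
        rcases h1 with h1 | ⟨u, -, -, -, h4⟩
        · exact h1.1
        · have : p ∈ ({c, d} : Finset V) := by rw [← h4]; exact mem_insert_self _ _
          simp only [mem_insert, mem_singleton] at this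
          rcases this with h | h
          · exact absurd h.symm hcp
          · exact absurd h.symm hdp
      · have h1 := h ht'
        simp only [cr, mem_filter] at h1
        have h2 := h1.1
        rw [mem_star] at h2
        rcases h2 with h2 | ⟨u, -, -, -, h4⟩
        · exact h2.2 (Finset.Subset.refl _)
        · exact hp _ htT (by rw [← h4]; exact mem_insert_self _ _)
    obtain ⟨T', θ, h1, h2⟩ := ih _ hlt (star T {a, b} p) (g ∘ₗ starMap p y) (hes.sub hT).1 rfl
    exact ⟨T', _, hes.trans h1, by rwa [LinearMap.comp_assoc] at h2⟩
  · refine ⟨T, _, ES.refl, ?_⟩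
    rw [LinearMap.comp_id]
    intro t ht
    by_contra hcon
    push Not at hcon
    obtain ⟨⟨a, ha, ha'⟩, b, hb, hb'⟩ := hcon
    apply hne
    refine ⟨{a, b}, ?_⟩
    simp only [cr, mem_filter]
    refine ⟨hT.2 _ ht _ ?_, a, b, rfl, ha', hb'⟩
    intro x hx
    simp only [mem_insert, mem_singleton] at hx
    rcases hx with rfl | rfl <;> assumption

lemma split_list [Infinite V] {T : Finset (Finset V)} (hT : Cx T) (l : List ((V →₀ ℝ) →ₗ[ℝ] ℝ)) :
    ∃ T' θ, ES T T' θ ∧ ∀ g ∈ l, OneSided T' (g ∘ₗ θ) := by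
  induction l with
  | nil => exact ⟨T, _, ES.refl, by simp⟩
  | cons g l ih =>
    obtain ⟨T1, θ1, h1, h2⟩ := ih
    obtain ⟨T2, θ2, h3, h4⟩ := split_aux _ T1 (g ∘ₗ θ1) (h1.sub hT).1 rfl
    refine ⟨T2, _, h1.trans h3, ?_⟩
    intro g' hg'
    rcases List.mem_cons.1 hg' with rfl | h
    · rwa [LinearMap.comp_assoc] at h4
    · rw [← LinearMap.comp_assoc]
      have hc := h1.sub hT
      exact OneSided.comp (h3.sub hc.1).1 (h2 g' h) (h3.sub hc.1).2

lemma split_set [Infinite V] {T : Finset (Finset V)} (hT : Cx T) (l : Set ((V →₀ ℝ) →ₗ[ℝ] ℝ))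
    (hl : l.Finite) : ∃ T' θ, ES T T' θ ∧ ∀ g ∈ l, OneSided T' (g ∘ₗ θ) := by
  obtain ⟨T', θ, h1, h2⟩ := split_list hT hl.toFinset.toList
  exact ⟨T', θ, h1, fun g hg => h2 g (by simpa using hg)⟩

/-- a subdivision map is linearly injective on each simplex span -/
lemma Sub.inj_span {T : Finset (Finset W)} {K : Finset (Finset V)} {φ : (W →₀ ℝ) →ₗ[ℝ] (V →₀ ℝ)}
    (hT : Cx T) (h : Sub T K φ) {s : Finset W} (hs : s ∈ T) {x : W →₀ ℝ} (hx : x.support ⊆ s)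
    (h0 : φ x = 0) : x = 0 := by
  let a : W →₀ ℝ := x.mapRange (fun r => max r 0) (by simp)
  let b : W →₀ ℝ := x.mapRange (fun r => max (-r) 0) (by simp)
  have hab : x = a - b := by
    ext w
    simp only [a, b, Finsupp.sub_apply, Finsupp.mapRange_apply]
    rcases le_total (x w) 0 with h | h
    · rw [max_eq_right h, max_eq_left (by linarith)]; ring
    · rw [max_eq_left h, max_eq_right (by linarith)]; ring
  have ha : a ∈ C T := mem_of_supp hT hs (fun v => by simp [a])
    (Finsupp.support_mapRange.trans hx)
  have hb : b ∈ C T := mem_of_supp hT hs (fun v => by simp [b])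
    (Finsupp.support_mapRange.trans hx)
  have : a = b := h.2.1 ha hb (by
    rw [hab, map_sub, sub_eq_zero] at h0; exact h0)
  rw [hab, this, sub_self]

/-- coordinate functionals on a simplex -/
lemma exists_coord {T : Finset (Finset W)} {K : Finset (Finset V)} {φ : (W →₀ ℝ) →ₗ[ℝ] (V →₀ ℝ)}
    (hT : Cx T) (h : Sub T K φ) {s : Finset W} (hs : s ∈ T) :
    ∃ ρ : (V →₀ ℝ) →ₗ[ℝ] (W →₀ ℝ), (∀ y, (ρ y).support ⊆ s) ∧
      ∀ x : W →₀ ℝ, x.support ⊆ s → ρ (φ x) = x := by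
  let S : Submodule ℝ (W →₀ ℝ) := Finsupp.supported ℝ ℝ (s : Set W)
  have hker : LinearMap.ker (φ ∘ₗ S.subtype) = ⊥ := by
    rw [LinearMap.ker_eq_bot']
    intro x hx
    have h1 := x.2
    rw [Finsupp.mem_supported] at h1
    have := h.inj_span hT hs (by exact_mod_cast h1) hx
    exact Subtype.ext this
  let f : S →ₗ[ℝ] (V →₀ ℝ) := φ ∘ₗ S.subtype
  obtain ⟨g, hg⟩ := LinearMap.exists_leftInverse_of_injective (K := ℝ) (V := S) (V' := V →₀ ℝ) f hker
  refine ⟨S.subtype ∘ₗ g, fun y => ?_, fun x hx => ?_⟩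
  · have := (g y).2
    rw [Finsupp.mem_supported] at this
    exact_mod_cast this
  · have hxS : x ∈ S := by rw [Finsupp.mem_supported]; exact_mod_cast hx
    have := LinearMap.congr_fun hg ⟨x, hxS⟩
    simp only [LinearMap.comp_apply, Submodule.subtype_apply, LinearMap.id_apply] at this ⊢
    exact congrArg Subtype.val this

/-- common refinement -/
lemma common [Infinite V] {X : Type*} [DecidableEq X] {T1 : Finset (Finset V)}
    {T2 : Finset (Finset W)} {K : Finset (Finset X)}
    (h1 : Cx T1) (h2 : Cx T2) {φ1 : (V →₀ ℝ) →ₗ[ℝ] (X →₀ ℝ)}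
    {φ2 : (W →₀ ℝ) →ₗ[ℝ] (X →₀ ℝ)} (s1 : Sub T1 K φ1) (s2 : Sub T2 K φ2) :
    ∃ T ψ1, ES T1 T ψ1 ∧ ∃ ψ2 : (V →₀ ℝ) →ₗ[ℝ] (W →₀ ℝ), Sub T T2 ψ2 ∧
      ∀ x ∈ C T, φ2 (ψ2 x) = φ1 (ψ1 x) := by
  have hρ : ∀ s : Finset W, ∃ ρ : (X →₀ ℝ) →ₗ[ℝ] (W →₀ ℝ), s ∈ T2 → (∀ y, (ρ y).support ⊆ s) ∧
      ∀ x : W →₀ ℝ, x.support ⊆ s → ρ (φ2 x) = x := by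
    intro s
    by_cases hs : s ∈ T2
    · obtain ⟨ρ, h⟩ := exists_coord h2 s2 hs
      exact ⟨ρ, fun _ => h⟩
    · exact ⟨0, fun h => absurd h hs⟩
  choose ρ hρ using hρ
  let VK : Finset X := K.biUnion _root_.id
  let F1 : Set ((V →₀ ℝ) →ₗ[ℝ] ℝ) :=
    (fun q : Finset W × W => Finsupp.lapply q.2 ∘ₗ ρ q.1 ∘ₗ φ1) ''
      ((T2 ×ˢ T2.biUnion _root_.id : Finset (Finset W × W)) : Set (Finset W × W))
  let F2 : Set ((V →₀ ℝ) →ₗ[ℝ] ℝ) :=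
    (fun q : Finset W × X => Finsupp.lapply q.2 ∘ₗ (LinearMap.id - φ2 ∘ₗ ρ q.1) ∘ₗ φ1) ''
      ((T2 ×ˢ VK : Finset (Finset W × X)) : Set (Finset W × X))
  have hfin : (F1 ∪ F2).Finite :=
    ((Finset.finite_toSet _).image _).union ((Finset.finite_toSet _).image _)
  obtain ⟨T, ψ1, hES, hone⟩ := split_set h1 _ hfin
  obtain ⟨hT, hsub⟩ := hES.sub h1
  have hs1 : Sub T K (φ1 ∘ₗ ψ1) := s1.comp hsub
  refine ⟨T, ψ1, hES, ?_⟩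
  have hsuppK : ∀ y ∈ C K, ∀ u, u ∉ VK → y u = 0 := by
    intro y hy u hu
    by_contra h0
    apply hu
    rw [mem_biUnion]
    exact ⟨_, hy.2, Finsupp.mem_support_iff.2 h0⟩
  -- a one-sided functional vanishing at the barycentre vanishes
  have hvan : ∀ (g : (V →₀ ℝ) →ₗ[ℝ] ℝ), OneSided T g → ∀ t ∈ T, g (one t) = 0 →
      ∀ w ∈ t, g (e w) = 0 := by
    intro g hg t ht h0 w hw
    rw [one, map_sum] at h0
    rcases hg t ht with h | h
    · exact (Finset.sum_eq_zero_iff_of_nonneg h).1 h0 w hw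
    · exact (Finset.sum_eq_zero_iff_of_nonpos h).1 h0 w hw
  have hpos : ∀ (g : (V →₀ ℝ) →ₗ[ℝ] ℝ), OneSided T g → ∀ t ∈ T, 0 ≤ g (one t) →
      ∀ w ∈ t, 0 ≤ g (e w) := by
    intro g hg t ht h0 w hw
    rcases hg t ht with h | h
    · exact h w hw
    · have : g (one t) = 0 := by
        apply le_antisymm _ h0
        rw [one, map_sum]
        exact Finset.sum_nonpos h
      rw [hvan g hg t ht this w hw]
  obtain ⟨ψ2, h3, h4⟩ := factor (T := T) (K := T2) h2 (φ1 ∘ₗ ψ1) φ2 hs1.2.1 s2.2.1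
    (fun y hy => hs1.2.2 (s2.1 hy)) (by
      intro t ht
      obtain ⟨x, hx, hxy⟩ := s2.2.2 (hs1.1 (one_mem ht))
      refine ⟨x.support, hx.2, ?_⟩
      intro w hw
      obtain ⟨hr1, hr2⟩ := hρ _ hx.2
      have hx' : ρ x.support ((φ1 ∘ₗ ψ1) (one t)) = x := by
        rw [← hxy, hr2 x (Finset.Subset.refl _)]
      refine ⟨ρ x.support ((φ1 ∘ₗ ψ1) (e w)), ?_, hr1 _, ?_⟩
      · intro u
        by_cases hu : u ∈ x.support
        · have hmem : (Finsupp.lapply u ∘ₗ ρ x.support ∘ₗ φ1 : (V →₀ ℝ) →ₗ[ℝ] ℝ) ∈ F1 ∪ F2 := by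
            left
            refine ⟨(x.support, u), ?_, rfl⟩
            simp only [coe_product, Set.mem_prod, mem_coe, mem_biUnion]
            exact ⟨hx.2, _, hx.2, hu⟩
          have := hpos _ (hone _ hmem) t ht (by
            simp only [LinearMap.comp_apply, Finsupp.lapply_apply] at hx' ⊢
            rw [hx']; exact hx.1 u) w hw
          simpa using this
        · have : (ρ x.support ((φ1 ∘ₗ ψ1) (e w))) u = 0 := by
            by_contra h0
            exact hu (hr1 _ (Finsupp.mem_support_iff.2 h0))
          rw [this]
      · ext u
        have hyK : (φ1 ∘ₗ ψ1) (e w) ∈ C K := hs1.1 (e_mem (hT.vert ht hw))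
        by_cases hu : u ∈ VK
        · have hmem : (Finsupp.lapply u ∘ₗ (LinearMap.id - φ2 ∘ₗ ρ x.support) ∘ₗ φ1 :
              (V →₀ ℝ) →ₗ[ℝ] ℝ) ∈ F1 ∪ F2 := by
            right
            refine ⟨(x.support, u), ?_, rfl⟩
            simp only [coe_product, Set.mem_prod, mem_coe]
            exact ⟨hx.2, hu⟩
          have := hvan _ (hone _ hmem) t ht (by
            simp only [LinearMap.comp_apply, Finsupp.lapply_apply, LinearMap.sub_apply,
              LinearMap.id_apply] at hx' ⊢
            rw [hx', hxy]
            simp) w hw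
          simp only [LinearMap.comp_apply, Finsupp.lapply_apply, LinearMap.sub_apply,
              LinearMap.id_apply, Finsupp.sub_apply, sub_eq_zero] at this ⊢
          exact this.symm
        · rw [hsuppK _ hyK u hu]
          have hsupp : ∀ v ∈ x.support, (φ2 (e v)) u = 0 := by
            intro v hv
            exact hsuppK _ (s2.1 (e_mem (h2.vert hx.2 hv))) u hu
          rw [map_eq_sum, Finsupp.finsetSum_apply]
          refine Finset.sum_eq_zero fun v hv => ?_
          rw [Finsupp.smul_apply, hsupp v (hr1 _ hv), smul_zero])
  exact ⟨ψ2, h3, h4⟩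

end

end HS

namespace HS
open Finset
open scoped Classical
set_option linter.all false

section

variable {V W U : Type*} [DecidableEq V] [DecidableEq W] [DecidableEq U]

/-- vertices -/
def vs (K : Finset (Finset V)) : Finset V := K.biUnion id

lemma mem_vs {K : Finset (Finset V)} {v : V} : v ∈ vs K ↔ ∃ t ∈ K, v ∈ t := by
  simp [vs]

lemma Cx.mem_vs {K : Finset (Finset V)} (h : Cx K) {v : V} : v ∈ vs K ↔ {v} ∈ K := by
  rw [HS.mem_vs]
  exact ⟨fun ⟨t, ht, hv⟩ => h.vert ht hv, fun hv => ⟨_, hv, mem_singleton_self v⟩⟩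

/-- relabelling -/
def im (f : V → W) (K : Finset (Finset V)) : Finset (Finset W) := K.image (fun t => t.image f)

lemma mem_im {f : V → W} {K : Finset (Finset V)} {s : Finset W} :
    s ∈ im f K ↔ ∃ t ∈ K, t.image f = s := by simp [im]

lemma im_cx {f : V → W} {K : Finset (Finset V)} (h : Cx K) : Cx (im f K) := by
  constructor
  · rw [mem_im]; exact ⟨∅, h.1, by simp⟩
  · intro s hs t hts
    rw [mem_im] at hs ⊢
    obtain ⟨u, hu, rfl⟩ := hs
    refine ⟨u.filter (fun x => f x ∈ t), h.2 _ hu _ (filter_subset _ _), ?_⟩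
    ext y
    simp only [mem_image, mem_filter]
    constructor
    · rintro ⟨x, ⟨-, h2⟩, rfl⟩; exact h2
    · intro hy
      obtain ⟨x, hx, rfl⟩ := mem_image.1 (hts hy)
      exact ⟨x, ⟨hx, hy⟩, rfl⟩

lemma im_im {g : W → U} {f : V → W} (K : Finset (Finset V)) : im g (im f K) = im (g ∘ f) K := by
  simp [im, Finset.image_image, Function.comp_def]

lemma im_id {f : V → V} {K : Finset (Finset V)} (h : ∀ v ∈ vs K, f v = v) : im f K = K := by
  have : ∀ t ∈ K, t.image f = t := by
    intro t ht
    have : t.image f = t.image id := Finset.image_congr (fun v hv =>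
      h v (mem_vs.2 ⟨t, ht, hv⟩))
    rw [this, image_id]
  ext s
  rw [mem_im]
  constructor
  · rintro ⟨t, ht, rfl⟩; rw [this t ht]; exact ht
  · intro hs; exact ⟨s, hs, this s hs⟩

lemma im_sub {f : V → W} {K : Finset (Finset V)} (hf : Set.InjOn f (vs K)) :
    Sub K (im f K) (Finsupp.lmapDomain ℝ ℝ f) := by
  have hsup : ∀ x ∈ C K, ∀ v ∈ x.support, v ∈ (vs K : Set V) := fun x hx v hv =>
    mem_coe.2 (mem_vs.2 ⟨_, hx.2, hv⟩)
  refine ⟨?_, ?_, ?_⟩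
  · intro x hx
    simp only [Finsupp.lmapDomain_apply]
    constructor
    · intro w
      unfold Finsupp.mapDomain
      rw [Finsupp.sum_apply]
      refine Finset.sum_nonneg fun v _ => ?_
      dsimp only
      rw [Finsupp.single_apply]; split_ifs
      · exact hx.1 v
      · exact le_rfl
    · rw [mem_im]
      refine ⟨_, hx.2, ?_⟩
      rw [Finsupp.mapDomain_support_of_injOn]
      intro a ha b hb hab
      exact hf (hsup x hx a ha) (hsup x hx b hb) hab
  · intro x hx y hy hxy
    simp only [Finsupp.lmapDomain_apply] at hxy
    exact Finsupp.mapDomain_injOn _ hf (fun v hv => hsup x hx v hv) (fun v hv => hsup y hy v hv) hxy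
  · intro y hy
    obtain ⟨t, ht, hty⟩ := mem_im.1 hy.2
    have hft : Set.InjOn f t := hf.mono fun v hv => mem_coe.2 (mem_vs.2 ⟨t, ht, hv⟩)
    let x : V →₀ ℝ := ∑ v ∈ t, y (f v) • e v
    have hxv : ∀ v, x v = if v ∈ t then y (f v) else 0 := by
      intro v
      simp only [x, Finsupp.finsetSum_apply, Finsupp.smul_apply, e, Finsupp.single_apply]
      simp
    have hxs : x.support = t := by
      ext v
      rw [Finsupp.mem_support_iff, hxv]
      constructor
      · intro h; by_contra h2; rw [if_neg h2] at h; exact h rfl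
      · intro h; rw [if_pos h]
        have : f v ∈ y.support := by rw [← hty]; exact mem_image_of_mem f h
        exact Finsupp.mem_support_iff.1 this
    refine ⟨x, ⟨fun v => ?_, by rw [hxs]; exact ht⟩, ?_⟩
    · rw [hxv]; split_ifs
      · exact hy.1 _
      · exact le_rfl
    · simp only [x, map_sum, map_smul, Finsupp.lmapDomain_apply, e, Finsupp.mapDomain_single]
      rw [← Finset.sum_image (g := f) (f := fun w => y w • Finsupp.single w (1 : ℝ)) hft, hty]
      conv_rhs => rw [← Finsupp.sum_single y]
      rw [Finsupp.sum]
      refine Finset.sum_congr rfl fun w _ => by simp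

lemma exists_nat_inj (s : Finset V) : ∃ f : V → ℕ, Set.InjOn f s := by
  refine ⟨fun v => if h : v ∈ s then (s.equivFin ⟨v, h⟩ : ℕ) else 0, ?_⟩
  intro a ha b hb hab
  have ha' : a ∈ s := ha
  have hb' : b ∈ s := hb
  simp only [ha', hb', dif_pos] at hab
  have := s.equivFin.injective (Fin.ext hab)
  simpa using this

lemma vs_im {f : V → W} {K : Finset (Finset V)} : vs (im f K) = (vs K).image f := by
  ext w
  simp only [mem_vs, mem_im, mem_image]
  constructor
  · rintro ⟨_, ⟨t, ht, rfl⟩, hw⟩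
    obtain ⟨v, hv, rfl⟩ := mem_image.1 hw
    exact ⟨v, ⟨t, ht, hv⟩, rfl⟩
  · rintro ⟨v, ⟨t, ht, hv⟩, rfl⟩
    exact ⟨_, ⟨t, ht, rfl⟩, mem_image_of_mem f hv⟩

/-- reverse relabelling -/
lemma im_sub_inv {f : V → W} {K : Finset (Finset V)} (hf : Set.InjOn f (vs K)) :
    ∃ φ, Sub (im f K) K φ := by
  rcases isEmpty_or_nonempty V with hV | hV
  · have hz : ∀ x : V →₀ ℝ, x = 0 := fun x => Subsingleton.elim _ _
    have hs := im_sub hf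
    have hz' : ∀ y ∈ C (im f K), y = 0 := by
      intro y hy
      obtain ⟨x, hx, rfl⟩ := hs.2.2 hy
      rw [hz x, map_zero]
    refine ⟨0, ?_, ?_, ?_⟩
    · intro y hy
      obtain ⟨x, hx, -⟩ := hs.2.2 hy
      have : (0 : (W →₀ ℝ) →ₗ[ℝ] (V →₀ ℝ)) y = x := Subsingleton.elim _ _
      rw [this]; exact hx
    · intro y hy y' hy' _
      rw [hz' y hy, hz' y' hy']
    · intro x hx
      exact ⟨_, hs.1 hx, Subsingleton.elim _ _⟩
  · let g : W → V := Function.invFunOn f (vs K)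
    have hg : ∀ v ∈ vs K, g (f v) = v := fun v hv =>
      hf (Function.invFunOn_mem ⟨v, hv, rfl⟩) hv (Function.invFunOn_eq ⟨v, hv, rfl⟩)
    refine ⟨Finsupp.lmapDomain ℝ ℝ g, ?_⟩
    have h1 : im g (im f K) = K := by
      rw [im_im]; exact im_id hg
    have h2 : Set.InjOn g (vs (im f K)) := by
      rw [vs_im]
      intro a ha b hb hab
      simp only [coe_image, Set.mem_image, mem_coe] at ha hb
      obtain ⟨x, hx, rfl⟩ := ha
      obtain ⟨y, hy, rfl⟩ := hb
      rw [hg x hx, hg y hy] at hab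
      rw [hab]
    have := im_sub h2
    rwa [h1] at this

/-- combinatorial equivalence -/
def CombEq (K : Finset (Finset V)) (L : Finset (Finset W)) : Prop :=
  ∃ (T : Finset (Finset ℕ)) (φ : (ℕ →₀ ℝ) →ₗ[ℝ] (V →₀ ℝ)) (ψ : (ℕ →₀ ℝ) →ₗ[ℝ] (W →₀ ℝ)),
    Cx T ∧ Sub T K φ ∧ Sub T L ψ

lemma CombEq.of_subs {T : Finset (Finset U)} {K : Finset (Finset V)} {L : Finset (Finset W)}
    (hT : Cx T) {φ ψ} (h1 : Sub T K φ) (h2 : Sub T L ψ) : CombEq K L := by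
  obtain ⟨f, hf⟩ := exists_nat_inj (vs T)
  obtain ⟨θ, hθ⟩ := im_sub_inv hf
  exact ⟨im f T, _, _, im_cx hT, h1.comp hθ, h2.comp hθ⟩

lemma CombEq.of_sub {T : Finset (Finset U)} {K : Finset (Finset V)} (hT : Cx T) {φ}
    (h1 : Sub T K φ) : CombEq T K := CombEq.of_subs hT (Sub.id T) h1

lemma CombEq.refl {T : Finset (Finset U)} (hT : Cx T) : CombEq T T :=
  CombEq.of_sub hT (Sub.id T)

lemma CombEq.symm {K : Finset (Finset V)} {L : Finset (Finset W)} (h : CombEq K L) :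
    CombEq L K := by
  obtain ⟨T, φ, ψ, h1, h2, h3⟩ := h
  exact ⟨T, ψ, φ, h1, h3, h2⟩

lemma CombEq.trans {K : Finset (Finset V)} {L : Finset (Finset W)} {N : Finset (Finset U)}
    (h : CombEq K L) (h' : CombEq L N) : CombEq K N := by
  obtain ⟨T, φ, ψ, h1, h2, h3⟩ := h
  obtain ⟨T', φ', ψ', h1', h2', h3'⟩ := h'
  obtain ⟨R, θ, hR, θ', hR', -⟩ := common h1 h1' h3 h2'
  exact ⟨R, _, _, (hR.sub h1).1, h2.comp (hR.sub h1).2, h3'.comp hR'⟩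

lemma CombEq.im {f : V → W} {K : Finset (Finset V)} (hK : Cx K) (hf : Set.InjOn f (vs K)) :
    CombEq K (im f K) := CombEq.of_sub hK (im_sub hf)

/-- link of a vertex -/
def lk (K : Finset (Finset V)) (v : V) : Finset (Finset V) :=
  K.filter (fun t => v ∉ t ∧ insert v t ∈ K)

lemma mem_lk {K : Finset (Finset V)} {v : V} {t : Finset V} :
    t ∈ lk K v ↔ t ∈ K ∧ v ∉ t ∧ insert v t ∈ K := by simp [lk]

lemma Cx.mem_lk {K : Finset (Finset V)} (h : Cx K) {v : V} {t : Finset V} :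
    t ∈ lk K v ↔ v ∉ t ∧ insert v t ∈ K := by
  rw [HS.mem_lk]
  exact ⟨fun h => h.2, fun h' => ⟨h.2 _ h'.2 _ (subset_insert _ _), h'⟩⟩

lemma lk_cx {K : Finset (Finset V)} (h : Cx K) {v : V} (hv : {v} ∈ K) : Cx (lk K v) := by
  constructor
  · rw [mem_lk]; exact ⟨h.1, by simp, by simpa using hv⟩
  · intro s hs t hts
    rw [mem_lk] at hs ⊢
    exact ⟨h.2 _ hs.1 _ hts, fun hv => hs.2.1 (hts hv), h.2 _ hs.2.2 _ (insert_subset_insert _ hts)⟩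

/-- erasing a coordinate -/
noncomputable def drop (v : V) : (V →₀ ℝ) →ₗ[ℝ] (V →₀ ℝ) where
  toFun x := x - x v • e v
  map_add' x y := by
    simp only [Finsupp.add_apply, add_smul]; abel
  map_smul' c x := by
    simp only [Finsupp.smul_apply, smul_eq_mul, RingHom.id_apply, smul_sub, mul_smul]

lemma drop_self (v : V) (x : V →₀ ℝ) : drop v x v = 0 := by simp [drop, e]

lemma drop_ne {v u : V} (x : V →₀ ℝ) (h : u ≠ v) : drop v x u = x u := by
  simp [drop, e, Finsupp.single_apply, Ne.symm h]

lemma drop_def (v : V) (x : V →₀ ℝ) : drop v x = x - x v • e v := rfl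

lemma drop_supp (v : V) (x : V →₀ ℝ) : (drop v x).support = x.support.erase v := by
  ext u
  rw [mem_erase, Finsupp.mem_support_iff, Finsupp.mem_support_iff]
  by_cases h : u = v
  · subst h; simp [drop_self]
  · rw [drop_ne x h]; simp [h]

lemma link_sub {T : Finset (Finset W)} {K : Finset (Finset V)} {φ : (W →₀ ℝ) →ₗ[ℝ] (V →₀ ℝ)}
    (hT : Cx T) (hK : Cx K) (h : Sub T K φ) {w : W} {v : V} {c : ℝ} (hc : 0 < c) (hw : {w} ∈ T)
    (hwv : φ (e w) = c • e v) : Sub (lk T w) (lk K v) (drop v ∘ₗ φ) := by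
  have hCT : ∀ x ∈ C (lk T w), x ∈ C T ∧ x w = 0 ∧ insert w x.support ∈ T := by
    intro x hx
    have := mem_lk.1 hx.2
    exact ⟨⟨hx.1, this.1⟩, by simpa using this.2.1, this.2.2⟩
  -- adding multiples of e w
  have hadd : ∀ x ∈ C (lk T w), ∀ l : ℝ, 0 ≤ l → x + l • e w ∈ C T := by
    intro x hx l hl
    refine mem_of_supp hT (hCT x hx).2.2 (fun u => ?_) ?_
    · have := hx.1 u
      have := e_nonneg w u
      simp only [Finsupp.add_apply, Finsupp.smul_apply, smul_eq_mul]
      positivity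
    · refine Finsupp.support_add.trans ?_
      rw [insert_eq, union_comm]
      refine union_subset_union ?_ (Finset.Subset.refl _)
      · exact Finsupp.support_smul.trans (by rw [supp_e]) 
  have hinj : ∀ x ∈ C (lk T w), ∀ x' ∈ C (lk T w), ∀ l : ℝ, 0 ≤ l → φ x = φ x' + l • e v → x = x' := by
    intro x hx x' hx' l hl heq
    have h1 : φ x = φ (x' + (l / c) • e w) := by
      rw [heq, map_add, map_smul, hwv, smul_smul, div_mul_cancel₀ _ hc.ne']
    have h2 := h.2.1 (hCT x hx).1 (hadd x' hx' _ (div_nonneg hl hc.le)) h1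
    have h3 := DFunLike.congr_fun h2 w
    rw [(hCT x hx).2.1, Finsupp.add_apply, (hCT x' hx').2.1] at h3
    have : l / c = 0 := by
      have h4 : (e w : W →₀ ℝ) w = 1 := by simp [e]
      rw [Finsupp.smul_apply, h4, smul_eq_mul, mul_one, zero_add] at h3
      exact h3.symm
    rw [this, zero_smul, add_zero] at h2
    exact h2
  refine ⟨?_, ?_, ?_⟩
  · intro x hx
    have h1 := h.1 (hadd x hx 1 zero_le_one)
    have h2 := h.1 (hCT x hx).1
    rw [map_add, one_smul, hwv] at h1
    rw [LinearMap.comp_apply]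
    have hv : v ∈ (φ x + c • e v).support := by
      rw [Finsupp.mem_support_iff]
      have := h2.1 v
      have h3 : (φ x + c • e v) v = φ x v + c := by simp [e]
      rw [h3]; linarith
    have hsub : (φ x).support ⊆ (φ x + c • e v).support := by
      intro u hu
      have h3 := h2.1 u
      have h4 := Finsupp.mem_support_iff.1 hu
      have h5 := e_nonneg v u
      have h6 := lt_of_le_of_ne h3 (Ne.symm h4)
      have h7 := mul_nonneg hc.le h5
      rw [Finsupp.mem_support_iff]
      simp only [Finsupp.add_apply, Finsupp.smul_apply, smul_eq_mul]
      linarith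
    constructor
    · intro u
      by_cases hu : u = v
      · rw [hu, drop_self]
      · rw [drop_ne _ hu]; exact h2.1 u
    · rw [hK.mem_lk, drop_supp]
      refine ⟨by simp, hK.2 _ h1.2 _ ?_⟩
      intro u hu
      rw [mem_insert] at hu
      rcases hu with rfl | hu
      · exact hv
      · exact hsub (mem_of_mem_erase hu)
  · intro x hx x' hx' heq
    simp only [LinearMap.comp_apply, drop_def] at heq
    rcases le_total (φ x' v) (φ x v) with hle | hle
    · refine hinj x hx x' hx' (φ x v - φ x' v) (by linarith) ?_
      rw [sub_smul]
      have : φ x = φ x' - (φ x' v) • e v + (φ x v) • e v := by rw [← heq]; abel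
      conv_lhs => rw [this]
      abel
    · refine (hinj x' hx' x hx (φ x' v - φ x v) (by linarith) ?_).symm
      rw [sub_smul]
      have : φ x' = φ x - (φ x v) • e v + (φ x' v) • e v := by rw [heq]; abel
      conv_lhs => rw [this]
      abel
  · intro y hy
    have hyv : y v = 0 := by
      have := (mem_lk.1 hy.2).2.1
      simpa using this
    have hyn : ∀ n : ℕ, y + (n : ℝ) • e v ∈ C K := by
      intro n
      refine mem_of_supp hK (mem_lk.1 hy.2).2.2 (fun u => ?_) ?_
      · have := hy.1 u
        have := e_nonneg v u
        simp only [Finsupp.add_apply, Finsupp.smul_apply, smul_eq_mul]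
        positivity
      · refine Finsupp.support_add.trans ?_
        rw [insert_eq, union_comm]
        refine union_subset_union ?_ (Finset.Subset.refl _)
        exact Finsupp.support_smul.trans (by rw [supp_e])
    choose x hxT hx using fun n => h.2.2 (hyn n)
    -- pigeonhole
    obtain ⟨s, hs⟩ := Finite.exists_infinite_fiber (fun n : ℕ => (⟨(x n).support, (hxT n).2⟩ : {s // s ∈ T}))
    have hinf : Set.Infinite {n : ℕ | (x n).support = s.1} := by
      rw [Set.infinite_coe_iff] at hs
      refine hs.mono ?_
      intro n hn
      simpa using congrArg Subtype.val hn
    obtain ⟨n1, hn1⟩ := hinf.nonempty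
    obtain ⟨n2, hn2, hlt⟩ := hinf.exists_gt n1
    have hn1' : (x n1).support = s.1 := hn1
    have hn2' : (x n2).support = s.1 := hn2
    have hpos : (0 : ℝ) < (n2 : ℝ) - n1 := by
      have : (n1 : ℝ) < n2 := by exact_mod_cast hlt
      linarith
    let z : W →₀ ℝ := ((n2 : ℝ) - n1)⁻¹ • (x n2 - x n1)
    have hzs : z.support ⊆ s.1 := by
      refine Finsupp.support_smul.trans (Finsupp.support_sub.trans ?_)
      rw [hn1', hn2', union_self]
    have hφz : φ z = e v := by
      simp only [z, map_smul, map_sub, hx]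
      rw [add_sub_add_left_eq_sub, ← sub_smul, smul_smul, inv_mul_cancel₀ hpos.ne', one_smul]
    have hxn : ∀ n, (x n).support = s.1 → x n = x n1 + ((n : ℝ) - n1) • z := by
      intro n hn
      have h0 : φ (x n - (x n1 + ((n : ℝ) - n1) • z)) = 0 := by
        rw [map_sub, map_add, map_smul, hφz, hx, hx, sub_smul]
        abel
      have := h.inj_span hT s.2 (x := x n - (x n1 + ((n : ℝ) - n1) • z)) ?_ h0
      · exact sub_eq_zero.1 this
      · refine Finsupp.support_sub.trans (union_subset hn.le ?_)
        refine Finsupp.support_add.trans (union_subset hn1'.le ?_)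
        exact Finsupp.support_smul.trans hzs
    have hz0 : ∀ u, 0 ≤ z u := by
      intro u
      by_contra hneg
      push Not at hneg
      obtain ⟨N, hN⟩ := exists_nat_gt ((x n1 u) / (- z u) + n1)
      obtain ⟨n, hn, hNn⟩ := hinf.exists_gt N
      have h1 := (hxT n).1 u
      rw [hxn n hn] at h1
      simp only [Finsupp.add_apply, Finsupp.smul_apply, smul_eq_mul] at h1
      have h2 : (N : ℝ) < n := by exact_mod_cast hNn
      have h3 : (x n1 u) / (- z u) < (n : ℝ) - n1 := by linarith
      rw [div_lt_iff₀ (by linarith)] at h3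
      nlinarith
    have hzC : z ∈ C T := mem_of_supp hT s.2 hz0 hzs
    have hzw : c • z = e w := by
      apply h.2.1 _ (e_mem hw)
      · rw [map_smul, hφz, hwv]
      · refine mem_of_supp hT s.2 (fun u => ?_) (Finsupp.support_smul.trans hzs)
        have := hz0 u
        simp only [Finsupp.smul_apply, smul_eq_mul]; positivity
    have hws : w ∈ s.1 := by
      have : w ∈ (e w).support := by rw [supp_e]; simp
      rw [← hzw] at this
      exact hzs (Finsupp.support_smul this)
    refine ⟨drop w (x n1), ⟨fun u => ?_, ?_⟩, ?_⟩
    · by_cases hu : u = w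
      · rw [hu, drop_self]
      · rw [drop_ne _ hu]; exact (hxT n1).1 u
    · rw [hT.mem_lk, drop_supp, hn1', insert_erase hws]
      exact ⟨by simp, s.2⟩
    · rw [LinearMap.comp_apply, drop_def w, map_sub, map_smul, hwv, hx]
      ext u
      by_cases hu : u = v
      · rw [hu, drop_self, hyv]
      · rw [drop_ne _ hu]
        simp [e, Finsupp.single_apply, Ne.symm hu]

lemma exists_vertex {T : Finset (Finset W)} {K : Finset (Finset V)} {φ : (W →₀ ℝ) →ₗ[ℝ] (V →₀ ℝ)}
    (hT : Cx T) (h : Sub T K φ) {v : V} (hv : {v} ∈ K) :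
    ∃ (w : W) (c : ℝ), 0 < c ∧ {w} ∈ T ∧ φ (e w) = c • e v := by
  obtain ⟨x, hx, hxv⟩ := h.2.2 (e_mem hv)
  have hx0 : x ≠ 0 := by
    rintro rfl
    rw [map_zero] at hxv
    have := DFunLike.congr_fun hxv v
    simp [e] at this
  obtain ⟨w, hw⟩ := Finsupp.support_nonempty_iff.2 hx0
  have hwT : {w} ∈ T := hT.vert hx.2 hw
  have hsupp : (φ (e w)).support ⊆ {v} := by
    have := h.supp_mono hT hx (e_nonneg w) (by rw [supp_e]; simpa using hw)
    rwa [hxv, supp_e] at this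
  have heq : φ (e w) = (φ (e w) v) • e v := by
    ext u
    by_cases hu : u = v
    · rw [hu]; simp [e]
    · have : φ (e w) u = 0 := by
        by_contra h0
        exact hu (by simpa using hsupp (Finsupp.mem_support_iff.2 h0))
      rw [this]; simp [e, Finsupp.single_apply, Ne.symm hu]
  refine ⟨w, φ (e w) v, lt_of_le_of_ne ((h.1 (e_mem hwT)).1 v) ?_, hwT, heq⟩
  intro h0
  rw [← h0, zero_smul] at heq
  have := h.2.1 (e_mem hwT) (zero_mem hT) (by rw [heq, map_zero])
  have := DFunLike.congr_fun this w
  simp [e] at this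

end

end HS

namespace HS
open Finset
open scoped Classical
set_option linter.all false

section

variable {V W U : Type*} [DecidableEq V] [DecidableEq W] [DecidableEq U]

lemma ssub_cx {A : Finset V} (h : A.Nonempty) : Cx A.ssubsets := by
  constructor
  · rw [mem_ssubsets]; exact h.empty_ssubset
  · intro s hs t ht
    rw [mem_ssubsets] at *
    exact lt_of_le_of_lt ht hs

/-- PL sphere of dimension `k-1` -/
def PL (k : ℕ) (K : Finset (Finset V)) : Prop :=
  Cx K ∧ ∃ A : Finset ℕ, A.card = k + 1 ∧ CombEq K A.ssubsets

lemma PL.of_combEq {k : ℕ} {K : Finset (Finset V)} {L : Finset (Finset W)} (h : PL k L) (hK : Cx K)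
    (h' : CombEq K L) : PL k K := by
  obtain ⟨_, A, hA, hL⟩ := h
  exact ⟨hK, A, hA, h'.trans hL⟩

lemma ssub_im {A : Finset V} {f : V → W} (hf : Set.InjOn f A) : im f A.ssubsets = (A.image f).ssubsets := by
  ext s
  rw [mem_im, mem_ssubsets]
  constructor
  · rintro ⟨t, ht, rfl⟩
    rw [mem_ssubsets] at ht
    refine Finset.ssubset_iff_subset_ne.2 ⟨image_subset_image ht.1, fun h => ?_⟩
    obtain ⟨a, haA, hat⟩ := exists_of_ssubset ht
    have : f a ∈ t.image f := by rw [h]; exact mem_image_of_mem f haA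
    obtain ⟨b, hb, hab⟩ := mem_image.1 this
    exact hat (hf (ht.1 hb) haA hab ▸ hb)
  · intro hs
    refine ⟨A.filter (fun x => f x ∈ s), ?_, ?_⟩
    · rw [mem_ssubsets]
      refine Finset.ssubset_iff_subset_ne.2 ⟨filter_subset _ _, fun h => ?_⟩
      refine hs.2 ?_
      intro y hy
      obtain ⟨x, hx, rfl⟩ := mem_image.1 hy
      rw [← h] at hx
      exact (mem_filter.1 hx).2
    · ext y
      simp only [mem_image, mem_filter]
      constructor
      · rintro ⟨x, ⟨-, h⟩, rfl⟩; exact h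
      · intro hy
        obtain ⟨x, hx, rfl⟩ := mem_image.1 (hs.1 hy)
        exact ⟨x, ⟨hx, hy⟩, rfl⟩

lemma vs_ssub_subset (A : Finset V) : vs A.ssubsets ⊆ A := by
  intro v hv
  obtain ⟨t, ht, hvt⟩ := mem_vs.1 hv
  exact (mem_ssubsets.1 ht).1 hvt

lemma PL.ssub {A : Finset V} {k : ℕ} (h : A.card = k + 1) : PL k A.ssubsets := by
  have hne : A.Nonempty := by rw [← card_pos]; omega
  refine ⟨ssub_cx hne, ?_⟩
  obtain ⟨f, hf⟩ := exists_nat_inj A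
  refine ⟨A.image f, by rw [card_image_of_injOn hf, h], ?_⟩
  rw [← ssub_im hf]
  exact CombEq.im (ssub_cx hne) (hf.mono (by exact_mod_cast vs_ssub_subset A))

lemma exists_fresh' [Infinite V] (K : Finset (Finset V)) (A : Finset V) : ∃ p, Fresh K p ∧ p ∉ A := by
  obtain ⟨p, hp⟩ := exists_fresh (insert A K)
  exact ⟨p, fun t ht => hp t (mem_insert_of_mem ht), hp A (mem_insert_self _ _)⟩

lemma lk_star_ssub {A α : Finset V} {b p : V} (hb : b ∈ A) (hbα : b ∉ α) (hα : α ⊆ A) (hp : p ∉ A) :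
    lk (star A.ssubsets α p) p = star (A.erase b).ssubsets α b := by
  ext u
  have hpα : p ∉ α := fun h => hp (hα h)
  rw [mem_lk, mem_star, mem_star, mem_star]
  simp only [mem_ssubsets]
  have key : ∀ v : Finset V, v ⊂ A → p ∉ v := fun v hv h => hp (hv.1 h)
  have h1 : ((u ⊂ A ∧ ¬α ⊆ u ∨ ∃ u_1 ⊂ A, ¬α ⊆ u_1 ∧ u_1 ∪ α ⊂ A ∧ insert p u_1 = u) ∧
      p ∉ u ∧ (insert p u ⊂ A ∧ ¬α ⊆ insert p u ∨
          ∃ u_1 ⊂ A, ¬α ⊆ u_1 ∧ u_1 ∪ α ⊂ A ∧ insert p u_1 = insert p u)) ↔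
      (u ⊂ A ∧ ¬ α ⊆ u ∧ u ∪ α ⊂ A) := by
    constructor
    · rintro ⟨h, hpu, h'⟩
      rcases h with h | ⟨u1, -, -, -, rfl⟩
      · rcases h' with h' | ⟨u1, h1, h2, h3, h4⟩
        · exact absurd (h'.1.1 (mem_insert_self p u)) hp
        · have : u1 = u := by
            rw [← erase_insert (key u1 h1), h4, erase_insert hpu]
          subst this
          exact ⟨h1, h2, h3⟩
      · exact absurd (mem_insert_self p u1) hpu
    · rintro ⟨h1, h2, h3⟩
      exact ⟨Or.inl ⟨h1, h2⟩, key u h1, Or.inr ⟨u, h1, h2, h3, rfl⟩⟩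
  rw [h1]; clear h1
  have hss : ∀ v : Finset V, v ⊂ A ↔ v ⊆ A ∧ ∃ x ∈ A, x ∉ v := by
    intro v
    constructor
    · intro h; exact ⟨h.1, exists_of_ssubset h⟩
    · rintro ⟨h, x, hx, hxv⟩; exact ⟨h, fun h' => hxv (h' hx)⟩
  have hss' : ∀ v : Finset V, v ⊂ A.erase b ↔ v ⊆ A.erase b ∧ ∃ x ∈ A.erase b, x ∉ v := by
    intro v
    constructor
    · intro h; exact ⟨h.1, exists_of_ssubset h⟩
    · rintro ⟨h, x, hx, hxv⟩; exact ⟨h, fun h' => hxv (h' hx)⟩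
  simp only [hss, hss', subset_erase, not_subset]
  by_cases hbu : b ∈ u
  · constructor
    · rintro ⟨⟨h1, -⟩, ⟨a, ha, hau⟩, ⟨h3, x, hx, hxu⟩⟩
      right
      have hab : a ≠ b := fun h => hbα (h ▸ ha)
      simp only [mem_union, not_or] at hxu
      have hxb : x ≠ b := fun h => hxu.1 (h ▸ hbu)
      refine ⟨u.erase b, ⟨⟨(erase_subset _ _).trans h1, notMem_erase _ _⟩, x, mem_erase.2 ⟨hxb, hx⟩, ?_⟩,
        ⟨a, ha, ?_⟩, ⟨⟨union_subset ((erase_subset _ _).trans h1) hα, ?_⟩, x, mem_erase.2 ⟨hxb, hx⟩, ?_⟩,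
        insert_erase hbu⟩
      · exact fun h => hxu.1 (mem_of_mem_erase h)
      · exact fun h => hau (mem_of_mem_erase h)
      · simp [hbα]
      · simp [hxu.1, hxu.2]
    · rintro (⟨⟨⟨_, h⟩, _⟩, _⟩ | ⟨u1, ⟨⟨h1, h2⟩, _⟩, ⟨a, ha, hau⟩, ⟨⟨h3, h4⟩, x, hx, hxu⟩, rfl⟩)
      · exact absurd hbu h
      · have hab : a ≠ b := fun h => hbα (h ▸ ha)
        rw [mem_erase] at hx
        simp only [mem_union, not_or] at hxu
        refine ⟨⟨insert_subset hb h1, x, hx.2, ?_⟩, ⟨a, ha, ?_⟩, union_subset (insert_subset hb h1) hα, x, hx.2, ?_⟩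
        · simp [hx.1, hxu.1]
        · simp [hab, hau]
        · simp [hx.1, hxu.1, hxu.2]
  · constructor
    · rintro ⟨⟨h1, -⟩, ⟨a, ha, hau⟩, ⟨h3, x, hx, hxu⟩⟩
      left
      refine ⟨⟨⟨h1, hbu⟩, a, mem_erase.2 ⟨fun h => hbα (h ▸ ha), hα ha⟩, hau⟩, a, ha, hau⟩
    · rintro (⟨⟨⟨h1, _⟩, _⟩, a, ha, hau⟩ | ⟨u1, _, _, _, rfl⟩)
      · exact ⟨⟨h1, b, hb, hbu⟩, ⟨a, ha, hau⟩, union_subset h1 hα, b, hb, by simp [hbu, hbα]⟩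
      · exact absurd (mem_insert_self _ _) hbu

lemma star_ssub_self {A : Finset V} {b : V} : star A.ssubsets A b = A.ssubsets := by
  ext u
  rw [mem_star]
  simp only [mem_ssubsets]
  constructor
  · rintro (h | ⟨u1, _, _, h, _⟩)
    · exact h.1
    · exact absurd subset_union_right h.2
  · intro h; exact Or.inl ⟨h, h.2⟩

lemma PL.lk {k : ℕ} {K : Finset (Finset V)} (h : PL (k + 1) K) {v : V} (hv : {v} ∈ K) :
    PL k (lk K v) := by
  obtain ⟨hK, A, hA, T, φ1, φ2, hT, h1, h2⟩ := h
  have hAne : A.Nonempty := by rw [← card_pos]; omega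
  refine ⟨lk_cx hK hv, ?_⟩
  obtain ⟨w, c, hc, hw, hwv⟩ := exists_vertex hT h1 hv
  set y := φ2 (e w) with hy
  have hyC : y ∈ C A.ssubsets := h2.1 (e_mem hw)
  have hy0 : y ≠ 0 := by
    intro h0
    have := h2.2.1 (e_mem hw) (zero_mem hT) (by rw [← hy, h0, map_zero])
    have := DFunLike.congr_fun this w
    simp [e] at this
  obtain ⟨p, hp, hpA⟩ := exists_fresh' A.ssubsets A
  have hS := star_sub (ssub_cx hAne) hp hyC hy0
  have hScx : Cx (star A.ssubsets y.support p) :=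
    star_cx (ssub_cx hAne) (Finsupp.support_nonempty_iff.2 hy0)
  obtain ⟨T', ψ1, hES, ψ2, hψ2, hcomm⟩ := common hT hScx h2 hS
  obtain ⟨hT', hψ1⟩ := hES.sub hT
  obtain ⟨w', c', hc', hw', hw'v⟩ := exists_vertex hT' hψ1 hw
  have hpS : ({p} : Finset ℕ) ∈ star A.ssubsets y.support p := by
    rw [mem_star]; right
    refine ⟨∅, (ssub_cx hAne).1, ?_, ?_, by simp⟩
    · rw [subset_empty]; simpa using hy0
    · rw [empty_union]; exact hyC.2
  have hψw : ψ2 (e w') = c' • e p := by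
    apply hS.2.1 (hψ2.1 (e_mem hw'))
    · refine mem_of_supp hScx hpS (fun u => ?_) ?_
      · have := e_nonneg p u
        simp only [Finsupp.smul_apply, smul_eq_mul]; positivity
      · refine Finsupp.support_smul.trans (by rw [supp_e])
    · rw [hcomm _ (e_mem hw'), hw'v, map_smul, map_smul, starMap_e_self]
  have l1 := link_sub hT' hK (h1.comp hψ1) (w := w') (v := v) (c := c' * c) (by positivity) hw'
    (by rw [LinearMap.comp_apply, hw'v, map_smul, hwv, smul_smul])
  have l2 := link_sub hT' hScx hψ2 hc' hw' hψw
  have hce : CombEq (HS.lk K v) (HS.lk (star A.ssubsets y.support p) p) :=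
    CombEq.of_subs (lk_cx hT' hw') l1 l2
  obtain ⟨b, hb, hbα⟩ := exists_of_ssubset (mem_ssubsets.1 hyC.2)
  rw [lk_star_ssub hb hbα (mem_ssubsets.1 hyC.2).1 hpA] at hce
  refine ⟨A.erase b, by rw [card_erase_of_mem hb]; omega, ?_⟩
  have hsub : y.support ⊆ A.erase b := by
    rw [subset_erase]; exact ⟨(mem_ssubsets.1 hyC.2).1, hbα⟩
  by_cases heq : y.support = A.erase b
  · rwa [heq, star_ssub_self] at hce
  · have hne : (A.erase b).Nonempty := by rw [← card_pos, card_erase_of_mem hb]; omega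
    have hss : y.support ∈ (A.erase b).ssubsets := by
      rw [mem_ssubsets]; exact Finset.ssubset_iff_subset_ne.2 ⟨hsub, heq⟩
    have hfr : Fresh (A.erase b).ssubsets b := by
      intro t ht hbt
      exact notMem_erase b A ((mem_ssubsets.1 ht).1 hbt)
    have := star_sub (ssub_cx hne) hfr (y := y) ⟨hyC.1, hss⟩ hy0
    exact hce.trans (CombEq.of_sub (star_cx (ssub_cx hne) (Finsupp.support_nonempty_iff.2 hy0)) this)

lemma PL.zero {K : Finset (Finset V)} (h : PL 0 K) : K = {∅} := by
  obtain ⟨hK, A, hA, T, φ1, φ2, hT, h1, h2⟩ := h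
  obtain ⟨a, rfl⟩ := card_eq_one.1 hA
  have hC : ∀ y ∈ C ({a} : Finset ℕ).ssubsets, y = 0 := by
    intro y hy
    have := hy.2
    rw [mem_ssubsets, ssubset_singleton_iff] at this
    simpa using this
  have hC2 : ∀ x ∈ C T, x = 0 := by
    intro x hx
    exact h2.2.1 hx (zero_mem hT) (by rw [map_zero]; exact hC _ (h2.1 hx))
  have hC3 : ∀ x ∈ C K, x = 0 := by
    intro x hx
    obtain ⟨y, hy, rfl⟩ := h1.2.2 hx
    rw [hC2 y hy, map_zero]
  ext t
  rw [mem_singleton]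
  constructor
  · intro ht
    have := hC3 _ (one_mem ht)
    rw [← supp_one t, this]; rfl
  · rintro rfl; exact hK.1

/-- the flip lemma -/
lemma flip_combEq [Infinite V] {K1 K2 : Finset (Finset V)} (h1 : Cx K1) (h2 : Cx K2) {a β : Finset V}
    (ha : a.Nonempty) (hβ : β.Nonempty) (hd : Disjoint a β) (haK : a ∈ K1) (hβK : β ∉ K1)
    (hlk : ∀ t, Disjoint t a → (t ∪ a ∈ K1 ↔ t ⊂ β))
    (hK2 : ∀ t, t ∈ K2 ↔ (t ∈ K1 ∧ ¬ a ⊆ t) ∨ (t ⊆ a ∪ β ∧ ¬ a ⊆ t)) : CombEq K1 K2 := by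
  obtain ⟨p, hp⟩ := exists_fresh (K1 ∪ K2)
  have hp1 : Fresh K1 p := fun t ht => hp t (mem_union_left _ ht)
  have hp2 : Fresh K2 p := fun t ht => hp t (mem_union_right _ ht)
  have hβK2 : β ∈ K2 := by
    rw [hK2]; right
    refine ⟨subset_union_right, fun h => ?_⟩
    obtain ⟨x, hx⟩ := ha
    exact disjoint_left.1 hd hx (h hx)
  have hcup : ∀ u, ¬ a ⊆ u → (u ∪ a ∈ K1 ↔ (u ⊆ a ∪ β ∧ ¬ β ⊆ u)) := by
    intro u hu
    have : u ∪ a = (u \ a) ∪ a := by simp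
    rw [this, hlk _ sdiff_disjoint]
    constructor
    · intro h
      refine ⟨?_, fun h' => h.2 ?_⟩
      · intro x hx
        by_cases hxa : x ∈ a
        · exact mem_union_left _ hxa
        · exact mem_union_right _ (h.1 (mem_sdiff.2 ⟨hx, hxa⟩))
      · intro x hx
        exact mem_sdiff.2 ⟨h' hx, fun hxa => disjoint_left.1 hd hxa hx⟩
    · rintro ⟨h, h'⟩
      refine ⟨fun x hx => ?_, fun h'' => h' fun x hx => (mem_sdiff.1 (h'' hx)).1⟩
      obtain ⟨hxu, hxa⟩ := mem_sdiff.1 hx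
      exact (mem_union.1 (h hxu)).resolve_left hxa
  have hnβ : ∀ t ∈ K1, ¬ β ⊆ t := fun t ht h => hβK (h1.2 _ ht _ h)
  have hstar : star K1 a p = star K2 β p := by
    have e1 : ∀ t, (t ∈ K1 ∧ ¬ a ⊆ t) ↔ (t ∈ K2 ∧ ¬ β ⊆ t) := by
      intro t
      rw [hK2]
      constructor
      · intro h; exact ⟨Or.inl h, hnβ t h.1⟩
      · rintro ⟨h | h, h'⟩
        · exact h
        · exact ⟨h1.2 _ ((hcup t h.2).2 ⟨h.1, h'⟩) _ subset_union_left, h.2⟩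
    have e2 : ∀ u, (u ∈ K1 ∧ ¬ a ⊆ u ∧ u ∪ a ∈ K1) ↔ (u ∈ K2 ∧ ¬ β ⊆ u ∧ u ∪ β ∈ K2) := by
      intro u
      constructor
      · rintro ⟨h, h', h''⟩
        obtain ⟨h3, h4⟩ := (e1 u).1 ⟨h, h'⟩
        refine ⟨h3, h4, ?_⟩
        rw [hK2]; right
        refine ⟨union_subset ((hcup u h').1 h'').1 subset_union_right, fun h5 => h' fun x hx => ?_⟩
        exact (mem_union.1 (h5 hx)).resolve_right (disjoint_left.1 hd hx)
      · rintro ⟨h, h', h''⟩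
        obtain ⟨h3, h4⟩ := (e1 u).2 ⟨h, h'⟩
        refine ⟨h3, h4, ?_⟩
        rw [hcup u h4]
        refine ⟨?_, h'⟩
        rw [hK2] at h''
        rcases h'' with h'' | h''
        · exact absurd subset_union_right (hnβ _ h''.1)
        · exact subset_union_left.trans h''.1
    ext t
    rw [mem_star, mem_star, e1]
    refine or_congr Iff.rfl ?_
    constructor
    · rintro ⟨u, hu, hu', hu'', rfl⟩
      obtain ⟨h3, h4, h5⟩ := (e2 u).1 ⟨hu, hu', hu''⟩
      exact ⟨u, h3, h4, h5, rfl⟩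
    · rintro ⟨u, hu, hu', hu'', rfl⟩
      obtain ⟨h3, h4, h5⟩ := (e2 u).2 ⟨hu, hu', hu''⟩
      exact ⟨u, h3, h4, h5, rfl⟩
  have ne : ∀ s : Finset V, s.Nonempty → one s ≠ 0 := by
    intro s hs h
    have := supp_one s
    rw [h] at this
    rw [← this] at hs
    simp at hs
  have s1 := star_sub h1 hp1 (one_mem haK) (ne _ ha)
  have s2 := star_sub h2 hp2 (one_mem hβK2) (ne _ hβ)
  rw [supp_one] at s1 s2
  rw [← hstar] at s2
  exact CombEq.of_subs (star_cx h1 ha) s1 s2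

end

end HS

namespace HS
open Finset
open scoped Classical
set_option linter.all false

section

variable {V W U : Type*} [DecidableEq V] [DecidableEq W] [DecidableEq U]

/-- barycentric subdivision -/
def sd (K : Finset (Finset V)) : Finset (Finset (Finset V)) :=
  (K.erase ∅).powerset.filter (fun c => ∀ s ∈ c, ∀ t ∈ c, s ⊆ t ∨ t ⊆ s)

lemma mem_sd {K : Finset (Finset V)} {c : Finset (Finset V)} :
    c ∈ sd K ↔ (∀ s ∈ c, s ∈ K ∧ s.Nonempty) ∧ ∀ s ∈ c, ∀ t ∈ c, s ⊆ t ∨ t ⊆ s := by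
  simp only [sd, mem_filter, mem_powerset]
  refine and_congr ?_ Iff.rfl
  constructor
  · intro h s hs
    have := h hs
    rw [mem_erase] at this
    exact ⟨this.2, nonempty_iff_ne_empty.2 this.1⟩
  · intro h s hs
    exact mem_erase.2 ⟨(h s hs).2.ne_empty, (h s hs).1⟩

lemma sd_cx (K : Finset (Finset V)) : Cx (sd K) := by
  constructor
  · rw [mem_sd]; simp
  · intro s hs t ht
    rw [mem_sd] at *
    exact ⟨fun x hx => hs.1 x (ht hx), fun x hx y hy => hs.2 x (ht hx) y (ht hy)⟩

noncomputable def sdMap : (Finset V →₀ ℝ) →ₗ[ℝ] (V →₀ ℝ) := Finsupp.linearCombination ℝ one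

lemma sdMap_e (t : Finset V) : sdMap (e t) = one t := by simp [sdMap, e]

lemma sdMap_apply (z : Finset V →₀ ℝ) (v : V) :
    sdMap z v = ∑ t ∈ z.support, if v ∈ t then z t else 0 := by
  rw [map_eq_sum, Finsupp.finsetSum_apply]
  refine Finset.sum_congr rfl fun t _ => ?_
  rw [Finsupp.smul_apply, sdMap_e, one_apply, smul_eq_mul]
  split_ifs <;> simp

lemma sdMap_nonneg {z : Finset V →₀ ℝ} (hz : ∀ t, 0 ≤ z t) (v : V) : 0 ≤ sdMap z v := by
  rw [sdMap_apply]
  refine Finset.sum_nonneg fun t _ => ?_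
  split_ifs
  · exact hz t
  · exact le_rfl

lemma sdMap_supp {z : Finset V →₀ ℝ} (hz : ∀ t, 0 ≤ z t) (v : V) :
    v ∈ (sdMap z).support ↔ ∃ t ∈ z.support, v ∈ t := by
  rw [Finsupp.mem_support_iff, sdMap_apply, Ne, Finset.sum_eq_zero_iff_of_nonneg]
  · push Not
    refine exists_congr fun t => and_congr_right fun ht => ?_
    constructor
    · intro h; by_contra h'; simp [h'] at h
    · intro h hx
      rw [if_pos h] at hx
      exact Finsupp.mem_support_iff.1 ht hx
  · intro t _
    split_ifs
    · exact hz t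
    · exact le_rfl

/-- nonempty chain has a maximum -/
lemma chain_max {c : Finset (Finset V)} (hc : ∀ s ∈ c, ∀ t ∈ c, s ⊆ t ∨ t ⊆ s) (hne : c.Nonempty) :
    ∃ m ∈ c, ∀ t ∈ c, t ⊆ m := by
  obtain ⟨m, hm, hmax⟩ := exists_max_image c card hne
  refine ⟨m, hm, fun t ht => ?_⟩
  rcases hc t ht m hm with h | h
  · exact h
  · rw [eq_of_subset_of_card_le h (hmax t ht)]

lemma sdMap_max {K : Finset (Finset V)} {z : Finset V →₀ ℝ} (hz : z ∈ C (sd K)) (h0 : z ≠ 0) :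
    (sdMap z).support ∈ z.support := by
  obtain ⟨m, hm, hmax⟩ := chain_max (mem_sd.1 hz.2).2 (Finsupp.support_nonempty_iff.2 h0)
  have : (sdMap z).support = m := by
    ext v
    rw [sdMap_supp hz.1]
    exact ⟨fun ⟨t, ht, hv⟩ => hmax t ht hv, fun hv => ⟨m, hm, hv⟩⟩
  rw [this]; exact hm

lemma sdMap_ne {K : Finset (Finset V)} {z : Finset V →₀ ℝ} (hz : z ∈ C (sd K)) (h0 : z ≠ 0) :
    sdMap z ≠ 0 := by
  intro h
  have := sdMap_max hz h0
  rw [h] at this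
  exact absurd rfl ((mem_sd.1 hz.2).1 _ this).2.ne_empty

lemma sd_inj {K : Finset (Finset V)} (n : ℕ) : ∀ z ∈ C (sd K), ∀ z' ∈ C (sd K),
    z.support.card + z'.support.card = n → sdMap z = sdMap z' → z = z' := by
  induction n using Nat.strong_induction_on with
  | _ n ih =>
  have main : ∀ z ∈ C (sd K), ∀ z' ∈ C (sd K), z.support.card + z'.support.card = n → 
      sdMap z = sdMap z' → z ≠ 0 → z' ≠ 0 → z (sdMap z).support ≤ z' (sdMap z).support → z = z' := by
    intro z hz z' hz' hn heq h0 h0' hle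
    have hm := sdMap_max hz h0
    have hm' := sdMap_max hz' h0'
    rw [← heq] at hm'
    set m := (sdMap z).support with hmdef
    have hs1 : (z - z m • e m).support = z.support.erase m := by
      rw [← drop_def, drop_supp]
    have hs2 : (z' - z m • e m).support ⊆ z'.support := by
      refine Finsupp.support_sub.trans (union_subset (Finset.Subset.refl _) ?_)
      refine Finsupp.support_smul.trans ?_
      rw [supp_e]; simpa using hm'
    have e1 : z - z m • e m ∈ C (sd K) := by
      refine mem_of_supp (sd_cx K) hz.2 (fun t => ?_) (by rw [hs1]; exact erase_subset _ _)
      rw [← drop_def]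
      by_cases ht : t = m
      · rw [ht, drop_self]
      · rw [drop_ne _ ht]; exact hz.1 t
    have e2 : z' - z m • e m ∈ C (sd K) := by
      refine mem_of_supp (sd_cx K) hz'.2 (fun t => ?_) hs2
      by_cases ht : t = m
      · subst ht
        simp [e, hle]
      · simp [e, Finsupp.single_apply, Ne.symm ht]; exact hz'.1 t
    have := ih _ ?_ _ e1 _ e2 rfl (by rw [map_sub, map_sub, heq])
    · exact sub_left_injective this
    · rw [hs1, ← hn]
      have := card_erase_lt_of_mem hm
      have := card_le_card hs2
      omega
  intro z hz z' hz' hn heq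
  by_cases h0 : z = 0
  · by_contra h0'
    rw [h0, map_zero] at heq
    rw [h0] at h0'
    exact sdMap_ne hz' (Ne.symm h0') heq.symm
  by_cases h0' : z' = 0
  · rw [h0', map_zero] at heq
    exact absurd heq (sdMap_ne hz h0)
  rcases le_total (z (sdMap z).support) (z' (sdMap z).support) with h | h
  · exact main z hz z' hz' hn heq h0 h0' h
  · rw [heq] at h
    exact (main z' hz' z hz (by omega) heq.symm h0' h0 h).symm

lemma sd_surj {K : Finset (Finset V)} (hK : Cx K) (n : ℕ) : ∀ x ∈ C K, x.support.card = n →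
    ∃ z ∈ C (sd K), sdMap z = x := by
  induction n using Nat.strong_induction_on with
  | _ n ih =>
  intro x hx hn
  by_cases h0 : x = 0
  · exact ⟨0, zero_mem (sd_cx K), by rw [map_zero, h0]⟩
  obtain ⟨a, ha, hmin⟩ := exists_min_image x.support x (Finsupp.support_nonempty_iff.2 h0)
  set m := x.support with hm
  have happ : ∀ v, (x - x a • one m) v = if v ∈ m then x v - x a else 0 := by
    intro v
    simp only [Finsupp.sub_apply, Finsupp.smul_apply, one_apply, smul_eq_mul]
    split_ifs with h
    · ring
    · rw [hm, Finsupp.mem_support_iff, not_not] at h; rw [h]; ring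
  have hs : (x - x a • one m).support ⊆ m.erase a := by
    intro v hv
    rw [Finsupp.mem_support_iff, happ] at hv
    split_ifs at hv with h
    · rw [mem_erase]; refine ⟨?_, h⟩
      rintro rfl; exact hv (sub_self _)
    · exact absurd rfl hv
  have hC : x - x a • one m ∈ C K := by
    refine mem_of_supp hK hx.2 (fun v => ?_) (hs.trans (erase_subset _ _))
    rw [happ]; split_ifs with h
    · have := hmin v h; linarith
    · exact le_rfl
  obtain ⟨z, hz, hzx⟩ := ih _ (by
    rw [← hn]; exact lt_of_le_of_lt (card_le_card hs) (card_erase_lt_of_mem ha)) _ hC rfl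
  refine ⟨z + x a • e m, ⟨fun t => ?_, ?_⟩, ?_⟩
  · have h1 := hz.1 t
    have h2 := e_nonneg m t
    have h3 := hx.1 a
    simp only [Finsupp.add_apply, Finsupp.smul_apply, smul_eq_mul]
    positivity
  · have hsub : ∀ t ∈ z.support, t ⊆ m := by
      intro t ht v hv
      have : v ∈ (sdMap z).support := (sdMap_supp hz.1 v).2 ⟨t, ht, hv⟩
      rw [hzx] at this
      exact erase_subset _ _ (hs this)
    have hz2 := mem_sd.1 hz.2
    refine (sd_cx K).2 (insert m z.support) ?_ _ ?_
    · rw [mem_sd]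
      constructor
      · intro s hs
        rw [mem_insert] at hs
        rcases hs with rfl | hs
        · exact ⟨hx.2, ⟨a, ha⟩⟩
        · exact hz2.1 s hs
      · intro s hs t ht
        rw [mem_insert] at hs ht
        rcases hs with rfl | hs <;> rcases ht with rfl | ht
        · exact Or.inl (Finset.Subset.refl _)
        · exact Or.inr (hsub t ht)
        · exact Or.inl (hsub s hs)
        · exact hz2.2 s hs t ht
    · refine Finsupp.support_add.trans ?_
      rw [insert_eq, union_comm]
      refine union_subset_union ?_ (Finset.Subset.refl _)
      exact Finsupp.support_smul.trans (by rw [supp_e])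
  · rw [map_add, hzx, map_smul, sdMap_e]; abel

lemma sd_sub {K : Finset (Finset V)} (hK : Cx K) : Sub (sd K) K sdMap := by
  refine ⟨?_, ?_, ?_⟩
  · intro z hz
    refine ⟨sdMap_nonneg hz.1, ?_⟩
    by_cases h0 : z = 0
    · rw [h0, map_zero]; exact hK.1
    · exact ((mem_sd.1 hz.2).1 _ (sdMap_max hz h0)).1
  · intro z hz z' hz' h
    exact sd_inj _ z hz z' hz' rfl h
  · intro x hx
    obtain ⟨z, hz, h⟩ := sd_surj hK _ x hx rfl
    exact ⟨z, hz, h⟩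

end

end HS

namespace HS
open Finset
open scoped Classical
set_option linter.all false

section

variable {V W U : Type*} [DecidableEq V] [DecidableEq W] [DecidableEq U]

lemma inj_span' {E : Type*} [AddCommGroup E] [Module ℝ E] {T : Finset (Finset W)}
    {φ : (W →₀ ℝ) →ₗ[ℝ] E}
    (hT : Cx T) (h : Set.InjOn φ (C T)) {s : Finset W} (hs : s ∈ T) {x : W →₀ ℝ} (hx : x.support ⊆ s)
    (h0 : φ x = 0) : x = 0 := by
  let a : W →₀ ℝ := x.mapRange (fun r => max r 0) (by simp)
  let b : W →₀ ℝ := x.mapRange (fun r => max (-r) 0) (by simp)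
  have hab : x = a - b := by
    ext w
    simp only [a, b, Finsupp.sub_apply, Finsupp.mapRange_apply]
    rcases le_total (x w) 0 with h | h
    · rw [max_eq_right h, max_eq_left (by linarith)]; ring
    · rw [max_eq_left h, max_eq_right (by linarith)]; ring
  have ha : a ∈ C T := mem_of_supp hT hs (fun v => by simp [a])
    (Finsupp.support_mapRange.trans hx)
  have hb : b ∈ C T := mem_of_supp hT hs (fun v => by simp [b])
    (Finsupp.support_mapRange.trans hx)
  have : a = b := h ha hb (by
    rw [hab, map_sub, sub_eq_zero] at h0; exact h0)
  rw [hab, this, sub_self]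

/-- homogeneous evaluation -/
noncomputable def hev (g : W → ℕ → ℝ) : (W →₀ ℝ) →ₗ[ℝ] (ℕ → ℝ) × ℝ :=
  Finsupp.linearCombination ℝ (fun w => (g w, (1 : ℝ)))

lemma hev_e (g : W → ℕ → ℝ) (w : W) : hev g (e w) = (g w, 1) := by simp [hev, e]

lemma hev_eq (g : W → ℕ → ℝ) {x : W →₀ ℝ} {s : Finset W} (hs : x.support ⊆ s) :
    hev g x = (∑ w ∈ s, x w • g w, ∑ w ∈ s, x w) := by
  have : hev g x = ∑ w ∈ s, x w • hev g (e w) := by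
    rw [map_eq_sum']
    refine Finset.sum_subset hs fun w _ hw => ?_
    rw [Finsupp.notMem_support_iff.1 hw, zero_smul]
  rw [this]
  simp only [hev_e, Prod.smul_mk, smul_eq_mul, mul_one]
  exact Prod.ext (by simp [Prod.fst_sum]) (by simp [Prod.snd_sum])

lemma hull_iff {g : W → ℕ → ℝ} {s : Finset W} (hg : Set.InjOn g s) {q : ℕ → ℝ} :
    q ∈ convexHull ℝ ((s.image g : Finset (ℕ → ℝ)) : Set (ℕ → ℝ)) ↔
      ∃ x : W →₀ ℝ, (∀ w, 0 ≤ x w) ∧ x.support ⊆ s ∧ hev g x = (q, 1) := by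
  rw [Finset.mem_convexHull']
  constructor
  · rintro ⟨w, hw0, hw1, hwq⟩
    have happ : ∀ v, (∑ v ∈ s, w (g v) • e v : W →₀ ℝ) v = if v ∈ s then w (g v) else 0 := by
      intro v
      simp only [Finsupp.finsetSum_apply, Finsupp.smul_apply, e, Finsupp.single_apply]
      simp
    have hs : (∑ v ∈ s, w (g v) • e v : W →₀ ℝ).support ⊆ s :=
      supp_sum_subset _ _ _ _ fun v hv => by rw [supp_e]; simpa using hv
    refine ⟨∑ v ∈ s, w (g v) • e v, fun v => ?_, hs, ?_⟩
    · rw [happ]; split_ifs with h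
      · exact hw0 _ (mem_image_of_mem g h)
      · exact le_rfl
    · rw [hev_eq g hs]
      rw [Finset.sum_image hg] at hw1 hwq
      refine Prod.ext ?_ ?_
      · simp only
        rw [← hwq]
        exact Finset.sum_congr rfl fun v hv => by rw [happ, if_pos hv]
      · simp only
        rw [← hw1]
        exact Finset.sum_congr rfl fun v hv => by rw [happ, if_pos hv]
  · rintro ⟨x, hx0, hxs, hxq⟩
    rw [hev_eq g hxs, Prod.mk.injEq] at hxq
    rcases isEmpty_or_nonempty W with hW | hW
    · exfalso
      have : s = ∅ := by
        ext v; exact (hW.false v).elim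
      rw [this] at hxq; simp at hxq
    have hinv : ∀ v ∈ s, Function.invFunOn g s (g v) = v := fun v hv =>
      hg (Function.invFunOn_mem ⟨v, hv, rfl⟩) hv (Function.invFunOn_eq ⟨v, hv, rfl⟩)
    refine ⟨fun p => x (Function.invFunOn g s p), fun y _ => hx0 _, ?_, ?_⟩
    · rw [Finset.sum_image hg, ← hxq.2]
      exact Finset.sum_congr rfl fun v hv => by rw [hinv v hv]
    · rw [Finset.sum_image hg, ← hxq.1]
      exact Finset.sum_congr rfl fun v hv => by simp only [hinv v hv]

open HomologySpheres

/-- cone version of a geometric complex -/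
noncomputable def gc (G : GComplex) : Finset (Finset (ℕ → ℝ)) := insert ∅ G.faces

lemma gc_cx (G : GComplex) : Cx (gc G) := by
  constructor
  · exact mem_insert_self _ _
  · intro s hs t ht
    rw [gc, mem_insert] at *
    by_cases h : t = ∅
    · exact Or.inl h
    · rcases hs with rfl | hs
      · exact Or.inl (subset_empty.1 ht)
      · exact Or.inr (G.down_closed s hs t ht (nonempty_iff_ne_empty.2 h))

lemma gc_simplex (G : GComplex) {s : Finset (ℕ → ℝ)} (hs : s ∈ gc G) {x : (ℕ → ℝ) →₀ ℝ}
    (hx : x.support ⊆ s) (h0 : hev id x = 0) : x = 0 := by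
  rw [gc, mem_insert] at hs
  rcases hs with rfl | hs
  · simpa using hx
  · have hi := affineIndependent_iff.1 (G.indep s hs)
    rw [hev_eq id hx, Prod.mk_eq_zero] at h0
    have := hi Finset.univ (fun y => x y.1) (by
        rw [← h0.2]; exact Finset.sum_coe_sort s (fun y => x y)) (by
        rw [← h0.1]; exact Finset.sum_coe_sort s (fun y => x y • y))
    ext y
    by_cases hy : y ∈ s
    · exact this ⟨y, hy⟩ (mem_univ _)
    · exact Finsupp.notMem_support_iff.1 fun h => hy (hx h)

lemma gc_hull {s : Finset (ℕ → ℝ)} {q : ℕ → ℝ} :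
    q ∈ convexHull ℝ (s : Set (ℕ → ℝ)) ↔
      ∃ x : (ℕ → ℝ) →₀ ℝ, (∀ w, 0 ≤ x w) ∧ x.support ⊆ s ∧ hev id x = (q, 1) := by
  have := hull_iff (g := (id : (ℕ → ℝ) → ℕ → ℝ)) (s := s) (q := q) (Function.injective_id.injOn)
  rwa [image_id] at this

lemma hev_snd_pos {g : W → ℕ → ℝ} {x : W →₀ ℝ} (h : ∀ w, 0 ≤ x w) (h0 : x ≠ 0) : 0 < (hev g x).2 := by
  rw [hev_eq g (Finset.Subset.refl _)]
  refine Finset.sum_pos (fun w hw => ?_) (Finsupp.support_nonempty_iff.2 h0)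
  exact lt_of_le_of_ne (h w) (Finsupp.mem_support_iff.1 hw).symm

lemma gc_inj (G : GComplex) : Set.InjOn (hev (id : (ℕ → ℝ) → ℕ → ℝ)) (C (gc G)) := by
  intro x hx y hy hxy
  by_cases hx0 : x = 0
  · subst hx0
    rw [map_zero] at hxy
    exact (gc_simplex G hy.2 (Finset.Subset.refl _) hxy.symm).symm
  by_cases hy0 : y = 0
  · subst hy0
    rw [map_zero] at hxy
    exact (gc_simplex G hx.2 (Finset.Subset.refl _) hxy)
  have hxG : x.support ∈ G.faces := by
    have := hx.2
    rw [gc, mem_insert] at this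
    exact this.resolve_left (by simpa using hx0)
  have hyG : y.support ∈ G.faces := by
    have := hy.2
    rw [gc, mem_insert] at this
    exact this.resolve_left (by simpa using hy0)
  set c := (hev id x).2 with hc
  have hcpos : 0 < c := hev_snd_pos hx.1 hx0
  have hq : hev id x = c • ((c⁻¹ • (hev id x).1, 1) : (ℕ → ℝ) × ℝ) := by
    refine Prod.ext ?_ ?_
    · simp [smul_smul, hcpos.ne']
    · simp [hc]
  have hmem : ∀ z : (ℕ → ℝ) →₀ ℝ, (∀ w, 0 ≤ z w) → hev id z = hev id x →
      c⁻¹ • (hev id x).1 ∈ convexHull ℝ (z.support : Set (ℕ → ℝ)) := by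
    intro z hz hzx
    rw [gc_hull]
    refine ⟨c⁻¹ • z, fun w => ?_, Finsupp.support_smul, ?_⟩
    · have := hz w
      simp only [Finsupp.smul_apply, smul_eq_mul]; positivity
    · rw [map_smul, hzx, hq, smul_smul, inv_mul_cancel₀ hcpos.ne', one_smul, ← hq]
  have h3 : c⁻¹ • (hev id x).1 ∈ convexHull ℝ ((x.support ∩ y.support : Finset (ℕ → ℝ)) : Set (ℕ → ℝ)) := by
    rw [← G.glue _ hxG _ hyG]
    exact ⟨hmem x hx.1 rfl, hmem y hy.1 hxy.symm⟩
  obtain ⟨z, hz0, hzs, hzq⟩ := gc_hull.1 h3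
  have hcz : hev id (c • z) = hev id x := by rw [map_smul, hzq, ← hq]
  have hzs' : (c • z).support ⊆ x.support ∩ y.support := Finsupp.support_smul.trans hzs
  have a1 : c • z - x = 0 := gc_simplex G hx.2
    (Finsupp.support_sub.trans (union_subset (hzs'.trans inter_subset_left) (Finset.Subset.refl _)))
    (by rw [map_sub, hcz, sub_self])
  have a2 : c • z - y = 0 := gc_simplex G hy.2
    (Finsupp.support_sub.trans (union_subset (hzs'.trans inter_subset_right) (Finset.Subset.refl _)))
    (by rw [map_sub, hcz, hxy, sub_self])
  rw [← sub_eq_zero.1 a1, ← sub_eq_zero.1 a2]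

lemma subdivides_sub {G' G : GComplex} (h : Subdivides G' G) : ∃ φ, Sub (gc G') (gc G) φ := by
  refine (factor (gc_cx G) (hev id) (hev id) (gc_inj G') (gc_inj G) (T := gc G') ?_ ?_).imp fun φ h => h.1
  · intro y hy
    by_cases hy0 : y = 0
    · exact ⟨0, zero_mem (gc_cx G'), by rw [hy0]⟩
    have hyG : y.support ∈ G.faces := by
      have := hy.2
      rw [gc, mem_insert] at this
      exact this.resolve_left (by simpa using hy0)
    set c := (hev id y).2 with hc
    have hcpos : 0 < c := hev_snd_pos hy.1 hy0
    have hq : hev id y = c • ((c⁻¹ • (hev id y).1, 1) : (ℕ → ℝ) × ℝ) := by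
      refine Prod.ext ?_ ?_
      · simp [smul_smul, hcpos.ne']
      · simp [hc]
    have hmem : c⁻¹ • (hev id y).1 ∈ convexHull ℝ (y.support : Set (ℕ → ℝ)) := by
      rw [gc_hull]
      refine ⟨c⁻¹ • y, fun w => ?_, Finsupp.support_smul, ?_⟩
      · have := hy.1 w
        simp only [Finsupp.smul_apply, smul_eq_mul]; positivity
      · rw [map_smul, hq, smul_smul, inv_mul_cancel₀ hcpos.ne', one_smul, ← hq]
    have hcar : c⁻¹ • (hev id y).1 ∈ G'.carrier := by
      rw [h.1]
      simp only [GComplex.carrier, Set.mem_iUnion]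
      exact ⟨_, hyG, hmem⟩
    simp only [GComplex.carrier, Set.mem_iUnion] at hcar
    obtain ⟨t, ht, hqt⟩ := hcar
    obtain ⟨z, hz0, hzs, hzq⟩ := gc_hull.1 hqt
    refine ⟨c • z, mem_of_supp (gc_cx G') (mem_insert_of_mem ht) (fun w => ?_)
      (Finsupp.support_smul.trans hzs), by rw [map_smul, hzq, ← hq]⟩
    have := hz0 w
    simp only [Finsupp.smul_apply, smul_eq_mul]; positivity
  · intro t ht
    rw [gc, mem_insert] at ht
    rcases ht with rfl | ht
    · exact ⟨∅, (gc_cx G).1, by simp⟩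
    · obtain ⟨s, hs, hts⟩ := h.2 t ht
      refine ⟨s, mem_insert_of_mem hs, fun w hw => ?_⟩
      obtain ⟨z, hz0, hzs, hzq⟩ := gc_hull.1 (hts (subset_convexHull ℝ _ (mem_coe.2 hw)))
      exact ⟨z, hz0, hzs, by rw [hzq, hev_e]; rfl⟩

lemma verts_eq (K : Finset (Finset V)) : verts K = vs (insert ∅ K) := by
  ext v
  simp [verts, mem_vs, Finset.mem_sup]

lemma iso_sub {K : Finset (Finset V)} {L : Finset (Finset W)} (h : Iso K L) :
    ∃ φ, Sub (insert ∅ K) (insert ∅ L) φ := by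
  obtain ⟨f, hf, rfl⟩ := h
  refine ⟨Finsupp.lmapDomain ℝ ℝ f, ?_⟩
  have : insert ∅ (K.image (Finset.image f)) = im f (insert ∅ K) := by
    simp [im, image_insert]
  rw [this]
  exact im_sub (by rw [← verts_eq]; exact hf)

lemma combEq_of_iso {K : Finset (Finset V)} {L : Finset (Finset W)} (hK : Cx (insert ∅ K)) (h : Iso K L) :
    CombEq (insert ∅ K) (insert ∅ L) := by
  obtain ⟨φ, hφ⟩ := iso_sub h
  exact CombEq.of_sub hK hφ

lemma cx_insert {K : Finset (Finset V)} (h : IsComplex K) : Cx (insert ∅ K) := by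
  constructor
  · exact mem_insert_self _ _
  · intro s hs t ht
    rw [mem_insert] at *
    by_cases h' : t = ∅
    · exact Or.inl h'
    · rcases hs with rfl | hs
      · exact Or.inl (subset_empty.1 ht)
      · exact Or.inr (h.2.2 s hs t ht (nonempty_iff_ne_empty.2 h'))

lemma combEq_of_combEquiv {K : Finset (Finset V)} {L : Finset (Finset W)} (hK : Cx (insert ∅ K))
    (hL : Cx (insert ∅ L)) (h : CombEquiv K L) : CombEq (insert ∅ K) (insert ∅ L) := by
  obtain ⟨G1, G1', G2, G2', h1, h2, s1, s2, hI⟩ := h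
  have c1 : CombEq (insert ∅ K) (gc G1) := by
    obtain ⟨f, hf⟩ := h1
    exact combEq_of_iso hK ⟨f, hf⟩
  have c2 : CombEq (insert ∅ L) (gc G2) := by
    obtain ⟨f, hf⟩ := h2
    exact combEq_of_iso hL ⟨f, hf⟩
  have c3 : CombEq (gc G1') (gc G2') := combEq_of_iso (gc_cx G1') hI
  obtain ⟨_, hs1⟩ := subdivides_sub s1
  obtain ⟨_, hs2⟩ := subdivides_sub s2
  exact c1.trans ((CombEq.of_sub (gc_cx _) hs1).symm.trans (c3.trans ((CombEq.of_sub (gc_cx _) hs2).trans c2.symm)))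

end

end HS

namespace HS
open Finset
open scoped Classical
set_option linter.all false

section

variable {V W U : Type*} [DecidableEq V] [DecidableEq W] [DecidableEq U]
open HomologySpheres

lemma hev_injOn_vs {T : Finset (Finset W)} (hT : Cx T) {g : W → ℕ → ℝ} (hinj : Set.InjOn (hev g) (C T)) :
    Set.InjOn g (vs T) := by
  intro a ha b hb hab
  have ha' := hT.mem_vs.1 (mem_coe.1 ha)
  have hb' := hT.mem_vs.1 (mem_coe.1 hb)
  have := hinj (e_mem ha') (e_mem hb') (by rw [hev_e, hev_e, hab])
  have h2 := supp_e a
  rw [this, supp_e] at h2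
  simpa using h2.symm

lemma im_inter {g : W → ℕ → ℝ} {T : Finset (Finset W)} (hg : Set.InjOn g (vs T)) {s t : Finset W}
    (hs : s ∈ T) (ht : t ∈ T) : s.image g ∩ t.image g = (s ∩ t).image g := by
  ext y
  simp only [mem_inter, mem_image]
  constructor
  · rintro ⟨⟨a, ha, rfl⟩, b, hb, hab⟩
    have : b = a := hg (mem_coe.2 (mem_vs.2 ⟨t, ht, hb⟩)) (mem_coe.2 (mem_vs.2 ⟨s, hs, ha⟩)) hab
    subst this
    exact ⟨b, ⟨ha, hb⟩, rfl⟩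
  · rintro ⟨a, ⟨h1, h2⟩, rfl⟩
    exact ⟨⟨a, h1, rfl⟩, a, h2, rfl⟩

/-- geometric complex from an injective homogeneous evaluation -/
lemma exists_G {T : Finset (Finset W)} (hT : Cx T) (hne : ∃ t ∈ T, t ≠ ∅) {g : W → ℕ → ℝ}
    (hinj : Set.InjOn (hev g) (C T)) :
    ∃ G : GComplex, G.faces = (T.erase ∅).image (Finset.image g) := by
  have hg := hev_injOn_vs hT hinj
  have hgs : ∀ s ∈ T, Set.InjOn g s := fun s hs => hg.mono fun v hv =>
    mem_coe.2 (mem_vs.2 ⟨s, hs, hv⟩)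
  refine ⟨⟨(T.erase ∅).image (Finset.image g), ?_, ?_, ?_, ?_, ?_⟩, rfl⟩
  · obtain ⟨t, ht, h0⟩ := hne
    exact ⟨_, mem_image_of_mem _ (mem_erase.2 ⟨h0, ht⟩)⟩
  · simp only [mem_image, mem_erase, image_eq_empty]
    rintro ⟨t, ⟨h, -⟩, h'⟩
    exact h h'
  · intro s hs t hts htn
    obtain ⟨s', hs', rfl⟩ := mem_image.1 hs
    rw [mem_erase] at hs'
    have := (im_cx (f := g) hT).2 _ (mem_im.2 ⟨s', hs'.2, rfl⟩) t hts
    obtain ⟨t', ht', rfl⟩ := mem_im.1 this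
    refine mem_image_of_mem _ (mem_erase.2 ⟨?_, ht'⟩)
    rintro rfl; simp at htn
  · intro s hs
    obtain ⟨s', hs', rfl⟩ := mem_image.1 hs
    rw [mem_erase] at hs'
    rw [affineIndependent_iff]
    intro S w hw0 hw1
    -- pull back
    let wt : (ℕ → ℝ) → ℝ := fun y => if h : y ∈ s'.image g then (if ⟨y, h⟩ ∈ S then w ⟨y, h⟩ else 0) else 0
    let x : W →₀ ℝ := ∑ v ∈ s', wt (g v) • e v
    have hxv : ∀ v ∈ s', x v = wt (g v) := by
      intro v hv
      simp only [x, Finsupp.finsetSum_apply, Finsupp.smul_apply, e, Finsupp.single_apply]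
      simp [hv]
    have hxs : x.support ⊆ s' := supp_sum_subset _ _ _ _ fun v hv => by rw [supp_e]; simpa using hv
    have hsumg : ∀ {M : Type} [AddCommMonoid M] (F : (ℕ → ℝ) → ℝ → M) (hF : ∀ y, F y 0 = 0),
        ∑ v ∈ s', F (g v) (wt (g v)) = ∑ y ∈ S, F y.1 (w y) := by
      intro M _ F hF
      rw [← Finset.sum_image (g := g) (f := fun y => F y (wt y)) (hgs s' hs'.2),
        ← Finset.sum_coe_sort (s'.image g)]
      rw [← Finset.sum_subset (subset_univ S)]
      · refine Finset.sum_congr rfl fun y hy => ?_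
        simp only [wt]
        rw [dif_pos y.2, if_pos hy]
      · intro y _ hy
        simp only [wt]
        rw [dif_pos y.2, if_neg hy, hF]
    have h0 : hev g x = 0 := by
      rw [hev_eq g hxs, Prod.mk_eq_zero]
      constructor
      · rw [← hw1, ← hsumg (fun y r => r • y) (by simp)]
        exact Finset.sum_congr rfl fun v hv => by rw [hxv v hv]
      · rw [← hw0, ← hsumg (fun y r => r) (by simp)]
        exact Finset.sum_congr rfl fun v hv => by rw [hxv v hv]
    have hx0 := inj_span' hT hinj hs'.2 hxs h0
    intro y hy
    obtain ⟨v, hv, hvy⟩ := mem_image.1 y.2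
    have h1 := hxv v hv
    rw [hx0] at h1
    simp only [wt, hvy] at h1
    rw [dif_pos y.2, if_pos hy] at h1
    exact h1.symm
  · intro s hs t ht
    obtain ⟨s, hs', rfl⟩ := mem_image.1 hs
    obtain ⟨t, ht', rfl⟩ := mem_image.1 ht
    rw [mem_erase] at hs' ht'
    rw [im_inter hg hs'.2 ht'.2]
    ext q
    rw [Set.mem_inter_iff, hull_iff (hgs s hs'.2), hull_iff (hgs t ht'.2),
      hull_iff ((hgs s hs'.2).mono (by exact_mod_cast inter_subset_left))]
    constructor
    · rintro ⟨⟨x, hx, hxs, hxq⟩, y, hy, hyt, hyq⟩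
      have : x = y := hinj (mem_of_supp hT hs'.2 hx hxs) (mem_of_supp hT ht'.2 hy hyt) (by rw [hxq, hyq])
      subst this
      exact ⟨x, hx, subset_inter hxs hyt, hxq⟩
    · rintro ⟨x, hx, hxs, hxq⟩
      exact ⟨⟨x, hx, hxs.trans inter_subset_left, hxq⟩, x, hx, hxs.trans inter_subset_right, hxq⟩

lemma carrier_iff {T : Finset (Finset W)} (hT : Cx T) {g : W → ℕ → ℝ}
    (hinj : Set.InjOn (hev g) (C T)) {G : GComplex} (hG : G.faces = (T.erase ∅).image (Finset.image g))
    {q : ℕ → ℝ} : q ∈ G.carrier ↔ ∃ x ∈ C T, hev g x = (q, 1) := by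
  have hg := hev_injOn_vs hT hinj
  have hgs : ∀ s ∈ T, Set.InjOn g s := fun s hs => hg.mono fun v hv =>
    mem_coe.2 (mem_vs.2 ⟨s, hs, hv⟩)
  simp only [GComplex.carrier, Set.mem_iUnion, exists_prop, hG]
  constructor
  · rintro ⟨s, hs, hq⟩
    obtain ⟨s, hs', rfl⟩ := mem_image.1 hs
    rw [mem_erase] at hs'
    obtain ⟨x, hx, hxs, hxq⟩ := (hull_iff (hgs s hs'.2)).1 hq
    exact ⟨x, mem_of_supp hT hs'.2 hx hxs, hxq⟩
  · rintro ⟨x, hx, hxq⟩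
    refine ⟨x.support.image g, mem_image_of_mem _ (mem_erase.2 ⟨?_, hx.2⟩),
      (hull_iff (hgs _ hx.2)).2 ⟨x, hx.1, Finset.Subset.refl _, hxq⟩⟩
    intro h
    rw [Finsupp.support_eq_empty] at h
    rw [h, map_zero] at hxq
    have := congrArg Prod.snd hxq
    simp at this

/-- positive diagonal scaling -/
lemma scale_sub {T : Finset (Finset W)} (d : W → ℝ) (hd : ∀ w, 0 < d w) :
    Sub T T (Finsupp.linearCombination ℝ (fun w => d w • e w)) := by
  have happ : ∀ (d : W → ℝ) (x : W →₀ ℝ) w, (Finsupp.linearCombination ℝ (fun w => d w • e w)) x w = x w * d w := by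
    intro d x w
    rw [Finsupp.linearCombination_apply, Finsupp.sum, Finsupp.finsetSum_apply]
    simp only [Finsupp.smul_apply, e, Finsupp.single_apply, smul_eq_mul]
    simp
    intro h; rw [h]; simp
  have hsup : ∀ (d : W → ℝ) (hd : ∀ w, 0 < d w) (x : W →₀ ℝ),
      ((Finsupp.linearCombination ℝ (fun w => d w • e w)) x).support = x.support := by
    intro d hd x
    ext w
    rw [Finsupp.mem_support_iff, Finsupp.mem_support_iff, happ]
    simp [(hd w).ne']
  have hmem : ∀ (d : W → ℝ) (hd : ∀ w, 0 < d w), ∀ x ∈ C T,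
      (Finsupp.linearCombination ℝ (fun w => d w • e w)) x ∈ C T := by
    intro d hd x hx
    refine ⟨fun w => ?_, by rw [hsup d hd]; exact hx.2⟩
    rw [happ]; exact mul_nonneg (hx.1 w) (hd w).le
  refine ⟨hmem d hd, ?_, ?_⟩
  · intro x hx y hy hxy
    ext w
    have := DFunLike.congr_fun hxy w
    rw [happ, happ] at this
    exact mul_right_cancel₀ (hd w).ne' this
  · intro y hy
    refine ⟨_, hmem (fun w => (d w)⁻¹) (fun w => inv_pos.2 (hd w)) y hy, ?_⟩
    ext w
    rw [happ, happ]
    have := (hd w).ne'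
    field_simp

/-- the standard realisation plus a subdivision -/
lemma exists_real {T : Finset (Finset W)} {K : Finset (Finset V)} (hT : Cx T) (hK : Cx K)
    (hne : ∃ t ∈ K, t ≠ ∅) {φ} (h : Sub T K φ) :
    ∃ (G G' : GComplex) (g : W → ℕ → ℝ), Realizes G (K.erase ∅) ∧ Subdivides G' G ∧
      Set.InjOn g (vs T) ∧ G'.faces = (T.erase ∅).image (Finset.image g) := by
  obtain ⟨ι, hι⟩ := exists_nat_inj (vs K)
  let f : V → ℕ → ℝ := fun v => Pi.single (ι v) 1
  have hfinj : Set.InjOn (hev f) (C K) := by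
    intro x hx y hy hxy
    have key : ∀ z ∈ C K, ∀ v ∈ vs K, (hev f z).1 (ι v) = z v := by
      intro z hz v hv
      have hzs : z.support ⊆ vs K := fun u hu => mem_vs.2 ⟨_, hz.2, hu⟩
      rw [hev_eq f hzs]
      simp only [Finset.sum_apply, Pi.smul_apply, smul_eq_mul, f]
      rw [Finset.sum_eq_single v]
      · simp
      · intro u hu huv
        rw [Pi.single_eq_of_ne, mul_zero]
        intro heq
        exact huv (hι (mem_coe.2 hu) (mem_coe.2 hv) heq.symm)
      · intro h; exact absurd hv h
    ext v
    by_cases hv : v ∈ vs K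
    · rw [← key x hx v hv, ← key y hy v hv, hxy]
    · have a1 : ∀ z ∈ C K, z v = 0 := fun z hz => by
        by_contra h0
        exact hv (mem_vs.2 ⟨_, hz.2, Finsupp.mem_support_iff.2 h0⟩)
      rw [a1 x hx, a1 y hy]
  -- normalise
  let n : W → ℝ := fun w => if 0 < (hev f (φ (e w))).2 then (hev f (φ (e w))).2 else 1
  have hn : ∀ w, 0 < n w := by
    intro w; simp only [n]; split_ifs with h
    · exact h
    · exact one_pos
  let D : (W →₀ ℝ) →ₗ[ℝ] (W →₀ ℝ) := Finsupp.linearCombination ℝ (fun w => (n w)⁻¹ • e w)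
  have hD : Sub T T D := scale_sub _ fun w => inv_pos.2 (hn w)
  have hDe : ∀ w, D (e w) = (n w)⁻¹ • e w := by intro w; simp [D, e]
  have h' := h.comp hD
  set φ' := φ ∘ₗ D with hφ'
  let g : W → ℕ → ℝ := fun w => (hev f (φ' (e w))).1
  have hge : ∀ w, {w} ∈ T → hev g (e w) = hev f (φ' (e w)) := by
    intro w hw
    rw [hev_e]
    refine Prod.ext rfl ?_
    have hpos : 0 < (hev f (φ (e w))).2 := by
      apply hev_snd_pos (h.1 (e_mem hw)).1
      intro h0
      have := h.2.1 (e_mem hw) (zero_mem hT) (by rw [h0, map_zero])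
      have := DFunLike.congr_fun this w
      simp [e] at this
    have hnw : n w = (hev f (φ (e w))).2 := if_pos hpos
    rw [hφ', LinearMap.comp_apply, hDe, map_smul, map_smul, Prod.smul_snd, hnw, smul_eq_mul,
      inv_mul_cancel₀ hpos.ne']
  have hgx : ∀ x ∈ C T, hev g x = hev f (φ' x) := by
    intro x hx
    rw [map_eq_sum' (hev g), map_eq_sum φ', map_sum]
    refine Finset.sum_congr rfl fun w hw => ?_
    rw [hge w (hT.vert hx.2 hw), map_smul]
  have hginj : Set.InjOn (hev g) (C T) := by
    intro x hx y hy hxy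
    rw [hgx x hx, hgx y hy] at hxy
    exact h'.2.1 hx hy (hfinj (h'.1 hx) (h'.1 hy) hxy)
  have hneT : ∃ t ∈ T, t ≠ ∅ := by
    obtain ⟨t, ht, h0⟩ := hne
    obtain ⟨x, hx, hxt⟩ := h.2.2 (one_mem ht)
    refine ⟨_, hx.2, fun h1 => h0 ?_⟩
    rw [Finsupp.support_eq_empty] at h1
    rw [h1, map_zero] at hxt
    rw [← supp_one t, ← hxt]; rfl
  obtain ⟨G, hG⟩ := exists_G hK hne hfinj
  obtain ⟨G', hG'⟩ := exists_G hT hneT hginj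
  refine ⟨G, G', g, ⟨f, ?_, hG⟩, ⟨?_, ?_⟩, hev_injOn_vs hT hginj, hG'⟩
  · rw [verts_eq, insert_erase hK.1]
    exact hev_injOn_vs hK hfinj
  · ext q
    rw [carrier_iff hT hginj hG', carrier_iff hK hfinj hG]
    constructor
    · rintro ⟨x, hx, hxq⟩
      exact ⟨_, h'.1 hx, by rw [← hgx x hx, hxq]⟩
    · rintro ⟨y, hy, hyq⟩
      obtain ⟨x, hx, rfl⟩ := h'.2.2 hy
      exact ⟨x, hx, by rw [hgx x hx, hyq]⟩
  · intro s hs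
    rw [hG'] at hs
    obtain ⟨s, hs', rfl⟩ := mem_image.1 hs
    rw [mem_erase] at hs'
    have h1 := h'.1 (one_mem hs'.2)
    have hgs : Set.InjOn g s := (hev_injOn_vs hT hginj).mono fun v hv =>
      mem_coe.2 (mem_vs.2 ⟨s, hs'.2, hv⟩)
    have hft : Set.InjOn f (φ' (one s)).support := (hev_injOn_vs hK hfinj).mono fun v hv =>
      mem_coe.2 (mem_vs.2 ⟨_, h1.2, hv⟩)
    refine ⟨(φ' (one s)).support.image f, ?_, ?_⟩
    · rw [hG]
      refine mem_image_of_mem _ (mem_erase.2 ⟨?_, h1.2⟩)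
      intro h0
      rw [Finsupp.support_eq_empty] at h0
      have := h'.2.1 (one_mem hs'.2) (zero_mem hT) (by rw [h0, map_zero])
      apply hs'.1
      rw [← supp_one s, this]; rfl
    · intro q hq
      obtain ⟨x, hx, hxs, hxq⟩ := (hull_iff hgs).1 hq
      have hxC := mem_of_supp hT hs'.2 hx hxs
      rw [hull_iff hft]
      refine ⟨φ' x, (h'.1 hxC).1, ?_, by rw [← hgx x hxC, hxq]⟩
      exact h'.supp_mono hT (one_mem hs'.2) hx (by rw [supp_one]; exact hxs)

lemma combEquiv_of_combEq {K : Finset (Finset V)} {L : Finset (Finset W)} (hK : Cx K) (hL : Cx L)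
    (hKne : ∃ t ∈ K, t ≠ ∅) (hLne : ∃ t ∈ L, t ≠ ∅)
    (h : CombEq K L) : CombEquiv (K.erase ∅) (L.erase ∅) := by
  obtain ⟨T, φ, ψ, hT, h1, h2⟩ := h
  obtain ⟨G1, G1', g1, r1, s1, i1, f1⟩ := exists_real hT hK hKne h1
  obtain ⟨G2, G2', g2, r2, s2, i2, f2⟩ := exists_real hT hL hLne h2
  refine ⟨G1, G1', G2, G2', r1, r2, s1, s2, g2 ∘ Function.invFunOn g1 (vs T), ?_, ?_⟩
  · have hinv : ∀ v ∈ vs T, Function.invFunOn g1 (vs T) (g1 v) = v := fun v hv =>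
      i1 (Function.invFunOn_mem ⟨v, hv, rfl⟩) hv (Function.invFunOn_eq ⟨v, hv, rfl⟩)
    intro a ha b hb hab
    have hmem : ∀ a ∈ verts G1'.faces, ∃ v ∈ vs T, g1 v = a := by
      intro a ha
      rw [verts_eq, mem_vs] at ha
      obtain ⟨t, ht, hat⟩ := ha
      rw [mem_insert] at ht
      rcases ht with rfl | ht
      · simp at hat
      rw [f1] at ht
      obtain ⟨s, hs, rfl⟩ := mem_image.1 ht
      obtain ⟨v, hv, rfl⟩ := mem_image.1 hat
      exact ⟨v, mem_vs.2 ⟨s, mem_of_mem_erase hs, hv⟩, rfl⟩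
    obtain ⟨v, hv, rfl⟩ := hmem a ha
    obtain ⟨u, hu, rfl⟩ := hmem b hb
    simp only [Function.comp_apply, hinv v hv, hinv u hu] at hab
    rw [i2 hv hu hab]
  · have hinv : ∀ v ∈ vs T, Function.invFunOn g1 (vs T) (g1 v) = v := fun v hv =>
      i1 (Function.invFunOn_mem ⟨v, hv, rfl⟩) hv (Function.invFunOn_eq ⟨v, hv, rfl⟩)
    rw [f1, f2, Finset.image_image]
    refine Finset.image_congr fun s hs => ?_
    rw [Function.comp_apply, Finset.image_image]
    refine Finset.image_congr fun v hv => ?_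
    simp only [Function.comp_apply]
    rw [hinv v (mem_vs.2 ⟨s, mem_of_mem_erase hs, hv⟩)]

lemma ssub_erase (A : Finset V) (hA : A.Nonempty) : insert ∅ (stdSphere A) = A.ssubsets := by
  ext t
  simp only [stdSphere, mem_insert, mem_erase, mem_powerset, mem_ssubsets, Finset.ssubset_iff_subset_ne]
  by_cases h : t = ∅
  · subst h; simp [hA.ne_empty.symm]
  · simp [h]; tauto

lemma ssub_erase' (A : Finset V) (hA : A.Nonempty) : A.ssubsets.erase ∅ = stdSphere A := by
  rw [← ssub_erase A hA, erase_insert]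
  simp [stdSphere]

lemma PL.of_combSphere {d : ℕ} {K : Finset (Finset V)} (hK : Cx (insert ∅ K)) (h : IsCombSphere d K) :
    PL (d + 1) (insert ∅ K) := by
  obtain ⟨A, hA, h⟩ := h
  have hne : A.Nonempty := by rw [← card_pos]; omega
  refine ⟨hK, A, by omega, ?_⟩
  have := combEq_of_combEquiv hK (by rw [ssub_erase A hne]; exact ssub_cx hne) h
  rwa [ssub_erase A hne] at this

lemma PL.toCombSphere {d : ℕ} {K : Finset (Finset V)} (hK : IsComplex K) (h : PL (d + 1) (insert ∅ K)) :
    IsCombSphere d K := by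
  obtain ⟨hc, A, hA, h⟩ := h
  have hne : A.Nonempty := by rw [← card_pos]; omega
  refine ⟨A, by omega, ?_⟩
  have := combEquiv_of_combEq hc (ssub_cx hne) ?_ ?_ h
  · rwa [ssub_erase' A hne, erase_insert hK.2.1] at this
  · obtain ⟨t, ht⟩ := hK.1
    exact ⟨t, mem_insert_of_mem ht, fun h => hK.2.1 (h ▸ ht)⟩
  · obtain ⟨a, ha⟩ := hne
    refine ⟨{a}, ?_, by simp⟩
    rw [mem_ssubsets, Finset.ssubset_iff_subset_ne]
    refine ⟨by simpa using ha, ?_⟩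
    rintro rfl
    simp at hA

end

end HS

namespace HS
open Finset
open scoped Classical
set_option linter.all false

section

variable {V W U : Type*} [DecidableEq V] [DecidableEq W] [DecidableEq U]

abbrev Chn (V : Type*) := Finset V →₀ ZMod 2

/-- basis chain -/
noncomputable def bs (t : Finset V) : Chn V := Finsupp.single t 1

/-- boundary -/
noncomputable def bd : Chn V →ₗ[ZMod 2] Chn V :=
  Finsupp.linearCombination (ZMod 2) (fun t => ∑ v ∈ t, bs (t.erase v))

/-- cone -/
noncomputable def cone (a : V) : Chn V →ₗ[ZMod 2] Chn V :=
  Finsupp.linearCombination (ZMod 2) (fun t => if a ∈ t then 0 else bs (insert a t))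

/-- chains on a set of simplices -/
noncomputable abbrev Ch (K : Set (Finset V)) : Submodule (ZMod 2) (Chn V) := Finsupp.supported (ZMod 2) (ZMod 2) K

lemma bd_bs (t : Finset V) : bd (bs t) = ∑ v ∈ t, bs (t.erase v) := by simp [bd, bs]

lemma cone_bs (a : V) (t : Finset V) : cone a (bs t) = if a ∈ t then 0 else bs (insert a t) := by
  simp [cone, bs]

lemma add_self2 {M : Type*} [AddCommGroup M] [Module (ZMod 2) M] (x : M) : x + x = 0 := by
  have : (1 + 1 : ZMod 2) • x = 0 := by
    have h : (1 + 1 : ZMod 2) = 0 := by decide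
    rw [h, zero_smul]
  rwa [add_smul, one_smul] at this

lemma eq_of_add2 {M : Type*} [AddCommGroup M] [Module (ZMod 2) M] {x y : M} (h : x + y = 0) : x = y := by
  have := add_self2 y
  rw [← this] at h
  exact add_right_cancel h

lemma chn_ext {M : Type*} [AddCommGroup M] [Module (ZMod 2) M] {f g : Chn V →ₗ[ZMod 2] M}
    (h : ∀ t, f (bs t) = g (bs t)) : f = g := by
  refine Finsupp.lhom_ext' fun t => LinearMap.ext_ring ?_
  exact h t

lemma chn_ext_on {M : Type*} [AddCommGroup M] [Module (ZMod 2) M] {f g : Chn V →ₗ[ZMod 2] M}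
    {K : Set (Finset V)} (h : ∀ t ∈ K, f (bs t) = g (bs t)) {x : Chn V} (hx : x ∈ Ch K) : f x = g x := by
  rw [Ch, Finsupp.supported_eq_span_single] at hx
  induction hx using Submodule.span_induction with
  | mem x hx => obtain ⟨t, ht, rfl⟩ := hx; exact h t ht
  | zero => simp
  | add x y _ _ h1 h2 => rw [map_add, map_add, h1, h2]
  | smul c x _ h1 => rw [map_smul, map_smul, h1]

lemma bs_mem {K : Set (Finset V)} {t : Finset V} : bs t ∈ Ch K ↔ t ∈ K := by
  rw [Ch, bs, Finsupp.mem_supported, Finsupp.support_single_ne_zero t one_ne_zero]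
  simp

lemma map_mem {f : Chn V →ₗ[ZMod 2] Chn W} {K : Set (Finset V)} {L : Set (Finset W)}
    (h : ∀ t ∈ K, f (bs t) ∈ Ch L) {x : Chn V} (hx : x ∈ Ch K) : f x ∈ Ch L := by
  rw [Ch, Finsupp.supported_eq_span_single] at hx
  induction hx using Submodule.span_induction with
  | mem x hx => obtain ⟨t, ht, rfl⟩ := hx; exact h t ht
  | zero => simp
  | add x y _ _ h1 h2 => rw [map_add]; exact Submodule.add_mem _ h1 h2
  | smul c x _ h1 => rw [map_smul]; exact Submodule.smul_mem _ _ h1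

lemma Ch_mono {K L : Set (Finset V)} (h : K ⊆ L) {x : Chn V} (hx : x ∈ Ch K) : x ∈ Ch L :=
  Finsupp.supported_mono h hx

lemma mem_Ch {K : Set (Finset V)} {x : Chn V} : x ∈ Ch K ↔ ∀ t, x t ≠ 0 → t ∈ K := by
  rw [Ch, Finsupp.mem_supported]
  constructor
  · intro h t ht; exact h (mem_coe.2 (Finsupp.mem_support_iff.2 ht))
  · intro h t ht; exact h t (Finsupp.mem_support_iff.1 (mem_coe.1 ht))

lemma bd_bd (x : Chn V) : bd (bd x) = 0 := by
  have : (bd ∘ₗ bd : Chn V →ₗ[ZMod 2] Chn V) = 0 := by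
    refine chn_ext fun t => ?_
    rw [LinearMap.comp_apply, bd_bs, map_sum]
    simp only [bd_bs, LinearMap.zero_apply]
    rw [Finset.sum_sigma']
    refine Finset.sum_involution (fun x _ => ⟨x.2, x.1⟩) ?_ ?_ ?_ ?_
    · rintro ⟨a, b⟩ h
      simp only
      rw [erase_right_comm]
      exact add_self2 _
    · rintro ⟨a, b⟩ h _ heq
      simp only [mem_sigma, mem_erase] at h
      simp only [Sigma.mk.injEq] at heq
      exact h.2.1 heq.1
    · rintro ⟨a, b⟩ h
      simp only [mem_sigma, mem_erase] at h ⊢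
      exact ⟨h.2.2, Ne.symm h.2.1, h.1⟩
    · rintro ⟨a, b⟩ h; rfl
  exact LinearMap.congr_fun this x

lemma cone_bd (a : V) (x : Chn V) : bd (cone a x) + cone a (bd x) = x := by
  have : (bd ∘ₗ cone a + cone a ∘ₗ bd : Chn V →ₗ[ZMod 2] Chn V) = LinearMap.id := by
    refine chn_ext fun t => ?_
    rw [LinearMap.add_apply, LinearMap.comp_apply, LinearMap.comp_apply, bd_bs, cone_bs, map_sum,
      LinearMap.id_apply]
    simp only [cone_bs]
    by_cases ha : a ∈ t
    · rw [if_pos ha, map_zero, zero_add, Finset.sum_eq_single a]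
      · rw [if_neg (notMem_erase a t), insert_erase ha]
      · intro v hv hva
        rw [if_pos (mem_erase.2 ⟨Ne.symm hva, ha⟩)]
      · intro h; exact absurd ha h
    · rw [if_neg ha, bd_bs, sum_insert ha, erase_insert ha, add_assoc, ← sum_add_distrib]
      rw [Finset.sum_eq_zero, add_zero]
      intro v hv
      have hva : v ≠ a := fun h => ha (h ▸ hv)
      rw [if_neg (fun h => ha (mem_of_mem_erase h)), erase_insert_of_ne (Ne.symm hva)]
      exact add_self2 _
  exact LinearMap.congr_fun this x

lemma bd_mem {K : Set (Finset V)} (hK : ∀ s ∈ K, ∀ t ⊆ s, t ∈ K) {x : Chn V} (hx : x ∈ Ch K) :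
    bd x ∈ Ch K := by
  refine map_mem (fun t ht => ?_) hx
  rw [bd_bs]
  exact Submodule.sum_mem _ fun v _ => bs_mem.2 (hK t ht _ (erase_subset _ _))

/-- homogeneous chains -/
abbrev Dg (k : ℕ) : Set (Finset V) := {t | t.card = k}

lemma bd_deg {k : ℕ} {x : Chn V} (hx : x ∈ Ch (Dg (k + 1))) : bd x ∈ Ch (Dg k : Set (Finset V)) := by
  refine map_mem (fun t ht => ?_) hx
  rw [bd_bs]
  refine Submodule.sum_mem _ fun v hv => bs_mem.2 ?_
  have : t.card = k + 1 := ht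
  simp [card_erase_of_mem hv, this]

lemma cone_deg {k : ℕ} {a : V} {x : Chn V} (hx : x ∈ Ch (Dg k)) : cone a x ∈ Ch (Dg (k + 1) : Set (Finset V)) := by
  refine map_mem (fun t ht => ?_) hx
  have ht' : t.card = k := ht
  rw [cone_bs]; split_ifs with h
  · exact Submodule.zero_mem _
  · exact bs_mem.2 (by simp [card_insert_of_notMem h, ht'])

lemma cone_mem {K : Set (Finset V)} {a : V} (hK : ∀ s ∈ K, insert a s ∈ K) {x : Chn V} (hx : x ∈ Ch K) :
    cone a x ∈ Ch K := by
  refine map_mem (fun t ht => ?_) hx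
  rw [cone_bs]; split_ifs with h
  · exact Submodule.zero_mem _
  · exact bs_mem.2 (hK t ht)

/-- the coefficient formula -/
lemma bd_apply {X : Finset V} {x : Chn V} (hx : ∀ s, x s ≠ 0 → s ⊆ X) (t : Finset V) :
    bd x t = ∑ v ∈ X \ t, x (insert v t) := by
  let R : Chn V →ₗ[ZMod 2] ZMod 2 := ∑ v ∈ X \ t, Finsupp.lapply (insert v t)
  have : (Finsupp.lapply t ∘ₗ bd) x = R x := by
    refine chn_ext_on (K := {s | s ⊆ X}) (fun s hs => ?_) (mem_Ch.2 hx)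
    have hs' : s ⊆ X := hs
    rw [LinearMap.comp_apply, bd_bs]
    simp only [R, LinearMap.sum_apply, Finsupp.lapply_apply, Finsupp.finsetSum_apply,
      bs, Finsupp.single_apply]
    rw [Finset.sum_boole, Finset.sum_boole]
    congr 2
    ext v
    simp only [mem_filter, mem_sdiff]
    constructor
    · rintro ⟨hv, rfl⟩
      exact ⟨⟨hs' hv, notMem_erase _ _⟩, (insert_erase hv).symm⟩
    · rintro ⟨⟨h1, h2⟩, rfl⟩
      exact ⟨mem_insert_self _ _, erase_insert h2⟩
  simpa [R] using this

/-! ### carriers -/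

/-- recursive chain map -/
noncomputable def car (F : Finset V → Chn W) (a : Finset V → W) (t : Finset V) : Chn W :=
  if t = ∅ then F t else cone (a t) (F t + ∑ v ∈ t.attach, car F a (t.erase v.1))
termination_by t.card
decreasing_by exact card_erase_lt_of_mem v.2

lemma car_empty (F : Finset V → Chn W) (a : Finset V → W) : car F a ∅ = F ∅ := by
  rw [car]; simp

lemma car_ne (F : Finset V → Chn W) (a : Finset V → W) {t : Finset V} (h : t ≠ ∅) :
    car F a t = cone (a t) (F t + ∑ v ∈ t, car F a (t.erase v)) := by
  rw [car, if_neg h, ← Finset.sum_attach t (fun v => car F a (t.erase v))]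

noncomputable def carL (F : Finset V → Chn W) (a : Finset V → W) : Chn V →ₗ[ZMod 2] Chn W :=
  Finsupp.linearCombination (ZMod 2) (car F a)

lemma carL_bs (F : Finset V → Chn W) (a : Finset V → W) (t : Finset V) : carL F a (bs t) = car F a t := by
  simp [carL, bs]

lemma carL_bd (F : Finset V → Chn W) (a : Finset V → W) (t : Finset V) :
    carL F a (bd (bs t)) = ∑ v ∈ t, car F a (t.erase v) := by
  rw [bd_bs, map_sum]; simp only [carL_bs]

lemma car_mem {K : Set (Finset V)} (hK : ∀ s ∈ K, ∀ t ⊆ s, t ∈ K) {F : Finset V → Chn W} {a : Finset V → W}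
    {S : Finset V → Set (Finset W)} (hS : ∀ t ∈ K, ∀ s ⊆ t, S s ⊆ S t)
    (hF : ∀ t ∈ K, F t ∈ Ch (S t)) (ha : ∀ t ∈ K, t ≠ ∅ → ∀ s ∈ S t, insert (a t) s ∈ S t) :
    ∀ t ∈ K, car F a t ∈ Ch (S t) := by
  have : ∀ n, ∀ t ∈ K, t.card = n → car F a t ∈ Ch (S t) := by
    intro n
    induction n using Nat.strong_induction_on with
    | _ n ih =>
    intro t ht hn
    by_cases h : t = ∅
    · subst h; rw [car_empty]; exact hF _ ht
    · rw [car_ne F a h]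
      refine cone_mem (ha t ht h) (Submodule.add_mem _ (hF t ht) (Submodule.sum_mem _ fun v hv => ?_))
      refine Ch_mono (hS t ht _ (erase_subset _ _)) (ih _ ?_ _ (hK t ht _ (erase_subset _ _)) rfl)
      rw [← hn]; exact card_erase_lt_of_mem hv
  exact fun t ht => this _ t ht rfl

/-- existence of a chain map with a coned carrier -/
lemma carrier_exists {K : Set (Finset V)} (hK : ∀ s ∈ K, ∀ t ⊆ s, t ∈ K) {a : Finset V → W}
    {S : Finset V → Set (Finset W)} (hS : ∀ t ∈ K, ∀ s ⊆ t, S s ⊆ S t) (h0 : ∀ t ∈ K, ∅ ∈ S t)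
    (ha : ∀ t ∈ K, t ≠ ∅ → ∀ s ∈ S t, insert (a t) s ∈ S t) :
    ∃ G : Chn V →ₗ[ZMod 2] Chn W, (∀ x, bd (G x) = G (bd x)) ∧ G (bs ∅) = bs ∅ ∧
      (∀ k, ∀ x ∈ Ch (Dg k), G x ∈ Ch (Dg k)) ∧ ∀ t ∈ K, G (bs t) ∈ Ch (S t) := by
  let F : Finset V → Chn W := fun t => if t = ∅ then bs ∅ else 0
  have hF0 : F ∅ = bs ∅ := if_pos rfl
  have hF1 : ∀ t, t ≠ ∅ → F t = 0 := fun t h => if_neg h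
  refine ⟨carL F a, ?_, by rw [carL_bs, car_empty, hF0], ?_, ?_⟩
  · have hmain : ∀ n, ∀ t : Finset V, t.card = n → bd (carL F a (bs t)) = carL F a (bd (bs t)) := by
      intro n
      induction n using Nat.strong_induction_on with
      | _ n ih =>
      intro t hn
      by_cases h : t = ∅
      · subst h
        rw [carL_bs, car_empty, hF0]
        simp [bd_bs]
      · have key : bd (carL F a (bd (bs t))) = 0 := by
          rw [bd_bs, map_sum, map_sum]
          have : ∀ v ∈ t, bd (carL F a (bs (t.erase v))) = carL F a (bd (bs (t.erase v))) := fun v hv =>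
            ih _ (by rw [← hn]; exact card_erase_lt_of_mem hv) _ rfl
          rw [Finset.sum_congr rfl this, ← map_sum, ← map_sum, ← bd_bs, bd_bd, map_zero]
        rw [carL_bs, car_ne F a h, hF1 t h, zero_add, ← carL_bd]
        have := cone_bd (a t) (carL F a (bd (bs t)))
        rwa [key, map_zero, add_zero] at this
    intro x
    have : bd ∘ₗ carL F a = carL F a ∘ₗ bd := chn_ext fun t => hmain _ t rfl
    exact LinearMap.congr_fun this x
  · have hmain : ∀ n, ∀ t : Finset V, t.card = n → car F a t ∈ Ch (Dg t.card) := by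
      intro n
      induction n using Nat.strong_induction_on with
      | _ n ih =>
      intro t hn
      by_cases h : t = ∅
      · subst h; rw [car_empty, hF0]; exact bs_mem.2 rfl
      · rw [car_ne F a h, hF1 t h, zero_add]
        have hpos : 0 < t.card := card_pos.2 (nonempty_iff_ne_empty.2 h)
        have : t.card = (t.card - 1) + 1 := by omega
        rw [this]
        refine cone_deg (Submodule.sum_mem _ fun v hv => ?_)
        have h2 := ih _ (by rw [← hn]; exact card_erase_lt_of_mem hv) (t.erase v) rfl
        rwa [card_erase_of_mem hv] at h2
    intro k x hx
    refine map_mem (fun t ht => ?_) hx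
    have ht' : t.card = k := ht
    rw [carL_bs, ← ht']; exact hmain _ t rfl
  · intro t ht
    rw [carL_bs]
    refine car_mem hK hS (fun t ht => ?_) ha t ht
    by_cases h : t = ∅
    · subst h; rw [hF0]; exact bs_mem.2 (h0 _ ht)
    · rw [hF1 t h]; exact Submodule.zero_mem _

/-- chain maps vanishing on `∅` with a coned carrier are nullhomotopic -/
lemma carrier_unique {K : Set (Finset V)} (hK : ∀ s ∈ K, ∀ t ⊆ s, t ∈ K) {a : Finset V → W}
    {S : Finset V → Set (Finset W)} (hS : ∀ t ∈ K, ∀ s ⊆ t, S s ⊆ S t)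
    (ha : ∀ t ∈ K, t ≠ ∅ → ∀ s ∈ S t, insert (a t) s ∈ S t) {F : Chn V →ₗ[ZMod 2] Chn W}
    (hF : ∀ x, bd (F x) = F (bd x)) (hF0 : F (bs ∅) = 0) (hFS : ∀ t ∈ K, F (bs t) ∈ Ch (S t)) :
    ∃ D : Chn V →ₗ[ZMod 2] Chn W, (∀ x, bd (D x) + D (bd x) = F x) ∧ ∀ t ∈ K, D (bs t) ∈ Ch (S t) := by
  let F' : Finset V → Chn W := fun t => F (bs t)
  refine ⟨carL F' a, ?_, ?_⟩
  · have hmain : ∀ n, ∀ t : Finset V, t.card = n → bd (carL F' a (bs t)) = F (bs t) + carL F' a (bd (bs t)) := by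
      intro n
      induction n using Nat.strong_induction_on with
      | _ n ih =>
      intro t hn
      by_cases h : t = ∅
      · subst h
        rw [carL_bs, car_empty]
        simp [F', hF0, bd_bs]
      · have key : bd (F (bs t) + carL F' a (bd (bs t))) = 0 := by
          rw [map_add, hF, bd_bs, map_sum, map_sum, map_sum]
          have : ∀ v ∈ t, bd (carL F' a (bs (t.erase v))) = F (bs (t.erase v)) + carL F' a (bd (bs (t.erase v))) :=
            fun v hv => ih _ (by rw [← hn]; exact card_erase_lt_of_mem hv) _ rfl
          rw [Finset.sum_congr rfl this, sum_add_distrib, ← add_assoc, add_self2, zero_add,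
            ← map_sum, ← map_sum, ← bd_bs, bd_bd, map_zero]
        have h2 := cone_bd (a t) (F (bs t) + carL F' a (bd (bs t)))
        rw [key, map_zero, add_zero] at h2
        rw [← h2, carL_bs, car_ne F' a h, ← carL_bd]
    intro x
    have : bd ∘ₗ carL F' a + carL F' a ∘ₗ bd = F := chn_ext fun t => by
      rw [LinearMap.add_apply, LinearMap.comp_apply, LinearMap.comp_apply, hmain _ t rfl, add_assoc,
        add_self2, add_zero]
    exact LinearMap.congr_fun this x
  · intro t ht
    rw [carL_bs]
    exact car_mem hK hS hFS ha t ht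

end

end HS

namespace HS
open Finset
open scoped Classical
set_option linter.all false

section

variable {V W U : Type*} [DecidableEq V] [DecidableEq W] [DecidableEq U]

/-- homology of `K` is a retract of that of `T` -/
def Dom (K : Finset (Finset V)) (T : Finset (Finset W)) : Prop :=
  ∃ (i : Chn V →ₗ[ZMod 2] Chn W) (r : Chn W →ₗ[ZMod 2] Chn V),
    (∀ x, bd (i x) = i (bd x)) ∧ (∀ x, bd (r x) = r (bd x)) ∧
    (∀ x ∈ Ch (K : Set (Finset V)), i x ∈ Ch (T : Set (Finset W))) ∧
    (∀ x ∈ Ch (T : Set (Finset W)), r x ∈ Ch (K : Set (Finset V))) ∧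
    (∀ n, ∀ x ∈ Ch (Dg n), r x ∈ Ch (Dg n)) ∧
    ∀ x ∈ Ch (K : Set (Finset V)), bd x = 0 → ∃ b ∈ Ch (K : Set (Finset V)), bd b = r (i x) + x

lemma Dom.refl (K : Finset (Finset V)) : Dom K K := by
  refine ⟨LinearMap.id, LinearMap.id, fun x => rfl, fun x => rfl, fun x h => h, fun x h => h,
    fun n x h => h, fun x hx hb => ⟨0, Submodule.zero_mem _, ?_⟩⟩
  simp only [LinearMap.id_apply, map_zero]
  exact (add_self2 x).symm

lemma Dom.trans {K : Finset (Finset V)} {T : Finset (Finset W)} {R : Finset (Finset U)}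
    (h1 : Dom K T) (h2 : Dom T R) : Dom K R := by
  obtain ⟨i, r, a1, a2, a3, a4, a5, a6⟩ := h1
  obtain ⟨i', r', b1, b2, b3, b4, b5, b6⟩ := h2
  refine ⟨i' ∘ₗ i, r ∘ₗ r', fun x => ?_, fun x => ?_, fun x hx => b3 _ (a3 _ hx), fun x hx => a4 _ (b4 _ hx),
    fun n x hx => a5 _ _ (b5 _ _ hx), fun x hx hb => ?_⟩
  · simp only [LinearMap.comp_apply]; rw [b1, a1]
  · simp only [LinearMap.comp_apply]; rw [a2, b2]
  · obtain ⟨b, hb1, hb2⟩ := a6 x hx hb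
    obtain ⟨c, hc1, hc2⟩ := b6 (i x) (a3 x hx) (by rw [a1, hb, map_zero])
    refine ⟨r c + b, Submodule.add_mem _ (a4 _ hc1) hb1, ?_⟩
    rw [map_add, a2, hc2, hb2, map_add, LinearMap.comp_apply, LinearMap.comp_apply,
      add_assoc, ← add_assoc (r (i x)), add_self2, zero_add]

/-- homology sphere -/
def HSph (k : ℕ) (K : Finset (Finset V)) : Prop :=
  ∃ Z ∈ Ch (K : Set (Finset V)), Z ∈ Ch (Dg k) ∧ bd Z = 0 ∧
    (∀ b ∈ Ch (K : Set (Finset V)), bd b ≠ Z) ∧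
    ∀ x ∈ Ch (K : Set (Finset V)), bd x = 0 → ∃ b ∈ Ch (K : Set (Finset V)), bd b = x ∨ bd b = Z + x

lemma HSph.of_dom {k : ℕ} {K : Finset (Finset V)} {T : Finset (Finset W)} (h : HSph k T)
    (h1 : Dom K T) (h2 : Dom T K) : HSph k K := by
  obtain ⟨i, r, a1, a2, a3, a4, a5, a6⟩ := h1
  obtain ⟨i', r', b1, b2, b3, b4, b5, b6⟩ := h2
  obtain ⟨Z, z1, z2, z3, z4, z5⟩ := h
  have main : ∀ x ∈ Ch (K : Set (Finset V)), bd x = 0 →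
      ∃ b ∈ Ch (K : Set (Finset V)), bd b = x ∨ bd b = r Z + x := by
    intro x hx hb
    obtain ⟨b, hb1, hb2⟩ := a6 x hx hb
    obtain ⟨c, hc1, hc2⟩ := z5 (i x) (a3 x hx) (by rw [a1, hb, map_zero])
    refine ⟨r c + b, Submodule.add_mem _ (a4 _ hc1) hb1, ?_⟩
    rcases hc2 with hc2 | hc2
    · left
      rw [map_add, a2, hc2, hb2, ← add_assoc, add_self2, zero_add]
    · right
      rw [map_add, a2, hc2, hb2, map_add, add_assoc, ← add_assoc (r (i x)), add_self2, zero_add]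
  refine ⟨r Z, a4 _ z1, a5 _ _ z2, by rw [a2, z3, map_zero], ?_, main⟩
  intro b hb hbZ
  have all : ∀ x ∈ Ch (K : Set (Finset V)), bd x = 0 → ∃ b ∈ Ch (K : Set (Finset V)), bd b = x := by
    intro x hx hx0
    obtain ⟨c, hc, h | h⟩ := main x hx hx0
    · exact ⟨c, hc, h⟩
    · refine ⟨b + c, Submodule.add_mem _ hb hc, ?_⟩
      rw [map_add, hbZ, h, ← add_assoc, add_self2, zero_add]
  obtain ⟨c, hc, hc2⟩ := all (i' Z) (b3 _ z1) (by rw [b1, z3, map_zero])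
  obtain ⟨f, hf, hf2⟩ := b6 Z z1 z3
  refine z4 (r' c + f) (Submodule.add_mem _ (b4 _ hc) hf) ?_
  rw [map_add, b2, hc2, hf2, ← add_assoc, add_self2, zero_add]

/-- chain maps with simplex carriers -/
lemma sc_exists [Nonempty W] {K : Finset (Finset V)} (hK : Cx K) (c : Finset V → Finset W)
    (hc : ∀ t ∈ K, ∀ s ⊆ t, c s ⊆ c t) (hne : ∀ t ∈ K, t ≠ ∅ → (c t).Nonempty) :
    ∃ G : Chn V →ₗ[ZMod 2] Chn W, (∀ x, bd (G x) = G (bd x)) ∧ G (bs ∅) = bs ∅ ∧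
      (∀ k, ∀ x ∈ Ch (Dg k), G x ∈ Ch (Dg k)) ∧ ∀ t ∈ K, G (bs t) ∈ Ch {s | s ⊆ c t} := by
  have : ∀ t : Finset V, ∃ a : W, t ∈ K → t ≠ ∅ → a ∈ c t := by
    intro t
    by_cases h : t ∈ K ∧ t ≠ ∅
    · obtain ⟨a, ha⟩ := hne t h.1 h.2
      exact ⟨a, fun _ _ => ha⟩
    · exact ⟨Classical.arbitrary W, fun h1 h2 => absurd ⟨h1, h2⟩ h⟩
  choose a ha using this
  refine carrier_exists (K := (K : Set (Finset V))) (a := a) (S := fun t => {s | s ⊆ c t})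
    (fun s hs t hts => hK.2 s hs t hts) ?_ ?_ ?_
  · intro t ht s hst u hu
    exact Finset.Subset.trans hu (hc t ht s hst)
  · intro t ht
    exact empty_subset _
  · intro t ht h s hs
    exact insert_subset (ha t ht h) hs

/-- carried self-maps are homotopic to the identity -/
lemma homotopic_id {K : Finset (Finset V)} (hK : Cx K) {a : Finset V → V}
    {S : Finset V → Set (Finset V)} (hS : ∀ t ∈ K, ∀ s ⊆ t, S s ⊆ S t) (hSK : ∀ t ∈ K, S t ⊆ K)
    (hSt : ∀ t ∈ K, t ∈ S t)
    (ha : ∀ t ∈ K, t ≠ ∅ → ∀ s ∈ S t, insert (a t) s ∈ S t) {F : Chn V →ₗ[ZMod 2] Chn V}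
    (hF : ∀ x, bd (F x) = F (bd x)) (hF0 : F (bs ∅) = bs ∅) (hFS : ∀ t ∈ K, F (bs t) ∈ Ch (S t)) :
    ∀ x ∈ Ch (K : Set (Finset V)), bd x = 0 → ∃ b ∈ Ch (K : Set (Finset V)), bd b = F x + x := by
  obtain ⟨D, hD1, hD2⟩ := carrier_unique (K := (K : Set (Finset V)))
    (fun s hs t hts => hK.2 s hs t hts) (a := a) (S := S) hS ha (F := F + LinearMap.id)
    (fun x => by simp [hF]) (by simp only [LinearMap.add_apply, LinearMap.id_apply, hF0]; exact add_self2 _)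
    (fun t ht => Submodule.add_mem _ (hFS t ht) (bs_mem.2 (hSt t ht)))
  intro x hx hx0
  refine ⟨D x, map_mem (fun t ht => Ch_mono (hSK t ht) (hD2 t ht)) hx, ?_⟩
  have := hD1 x
  rw [hx0, map_zero, add_zero] at this
  exact this

lemma homotopic_id' {K : Finset (Finset V)} (hK : Cx K) {F : Chn V →ₗ[ZMod 2] Chn V}
    (hF : ∀ x, bd (F x) = F (bd x)) (hF0 : F (bs ∅) = bs ∅) (hFS : ∀ t ∈ K, F (bs t) ∈ Ch {s | s ⊆ t}) :
    ∀ x ∈ Ch (K : Set (Finset V)), bd x = 0 → ∃ b ∈ Ch (K : Set (Finset V)), bd b = F x + x := by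
  rcases isEmpty_or_nonempty V with hV | hV
  · intro x hx _
    refine ⟨0, Submodule.zero_mem _, ?_⟩
    have : F x = x := chn_ext_on (K := (K : Set (Finset V))) (f := F) (g := LinearMap.id)
      (fun t ht => by rw [Finset.eq_empty_of_isEmpty t, hF0]; rfl) hx
    rw [this, map_zero]; exact (add_self2 x).symm
  have : ∀ t : Finset V, ∃ a : V, t ≠ ∅ → a ∈ t := by
    intro t
    by_cases h : t ≠ ∅
    · obtain ⟨a, ha⟩ := nonempty_iff_ne_empty.2 h
      exact ⟨a, fun _ => ha⟩
    · exact ⟨Classical.arbitrary V, fun h2 => absurd h2 h⟩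
  choose a ha using this
  refine homotopic_id hK (a := a) (S := fun t => {s | s ⊆ t}) ?_ ?_ ?_ ?_ hF hF0 hFS
  · intro t _ s hst u hu; exact Finset.Subset.trans hu hst
  · intro t ht s hs; exact hK.2 t ht s hs
  · intro t _; exact Finset.Subset.refl t
  · intro t _ h s hs; exact insert_subset (ha t h) hs

/-- composition of carried maps -/
lemma comp_carried {G : Chn V →ₗ[ZMod 2] Chn W} {H : Chn W →ₗ[ZMod 2] Chn U} {x : Chn V}
    {S : Set (Finset W)} {R : Set (Finset U)} (hG : G x ∈ Ch S) (hH : ∀ s ∈ S, H (bs s) ∈ Ch R) :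
    (H ∘ₗ G) x ∈ Ch R := map_mem hH hG

lemma dom_of_maps [Nonempty V] [Nonempty W] {K : Finset (Finset V)} {T : Finset (Finset W)} (hK : Cx K)
    (hT : Cx T) {f : V → W} {g : W → V} (hf : ∀ t ∈ K, t.image f ∈ T) (hg : ∀ t ∈ T, t.image g ∈ K)
    (hgf : ∀ t ∈ K, (t.image f).image g = t) : Dom K T := by
  obtain ⟨i, i1, i2, i3, i4⟩ := sc_exists hK (fun t => t.image f) (fun t _ s hs => image_subset_image hs)
    (fun t _ h => (nonempty_iff_ne_empty.2 h).image f)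
  obtain ⟨r, r1, r2, r3, r4⟩ := sc_exists hT (fun t => t.image g) (fun t _ s hs => image_subset_image hs)
    (fun t _ h => (nonempty_iff_ne_empty.2 h).image g)
  refine ⟨i, r, i1, r1, ?_, ?_, r3, ?_⟩
  · exact fun x hx => map_mem (fun t ht => Ch_mono (fun s hs => hT.2 _ (hf t ht) s hs) (i4 t ht)) hx
  · exact fun x hx => map_mem (fun t ht => Ch_mono (fun s hs => hK.2 _ (hg t ht) s hs) (r4 t ht)) hx
  · refine homotopic_id' hK (F := r ∘ₗ i) (fun x => ?_) ?_ ?_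
    · rw [LinearMap.comp_apply, LinearMap.comp_apply, r1, i1]
    · rw [LinearMap.comp_apply, i2, r2]
    · intro t ht
      refine comp_carried (i4 t ht) fun s hs => ?_
      refine Ch_mono (fun u hu => ?_) (r4 s (hT.2 _ (hf t ht) s hs))
      have : s.image g ⊆ (t.image f).image g := image_subset_image hs
      rw [hgf t ht] at this
      exact Finset.Subset.trans hu this

lemma dom_im [Nonempty V] [Nonempty W] {f : V → W} {K : Finset (Finset V)} (hK : Cx K) (hf : Set.InjOn f (vs K)) :
    Dom K (im f K) ∧ Dom (im f K) K := by
  have hg : ∀ v ∈ vs K, Function.invFunOn f (vs K) (f v) = v := fun v hv =>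
    hf (Function.invFunOn_mem ⟨v, hv, rfl⟩) hv (Function.invFunOn_eq (s := (vs K : Set V)) ⟨v, hv, rfl⟩)
  have hgf : ∀ t ∈ K, (t.image f).image (Function.invFunOn f (vs K)) = t := by
    intro t ht
    rw [image_image]
    conv_rhs => rw [← image_id (s := t)]
    exact image_congr fun v hv => hg v (mem_vs.2 ⟨t, ht, hv⟩)
  have h1 : ∀ t ∈ K, t.image f ∈ im f K := fun t ht => mem_im.2 ⟨t, ht, rfl⟩
  have h2 : ∀ t ∈ im f K, t.image (Function.invFunOn f (vs K)) ∈ K := by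
    intro t ht
    obtain ⟨u, hu, rfl⟩ := mem_im.1 ht
    rw [hgf u hu]; exact hu
  refine ⟨dom_of_maps hK (im_cx hK) h1 h2 hgf, dom_of_maps (im_cx hK) hK h2 h1 ?_⟩
  intro t ht
  obtain ⟨u, hu, rfl⟩ := mem_im.1 ht
  rw [hgf u hu]

/-- carrier of a simplex under a subdivision map -/
noncomputable def cr' (φ : (W →₀ ℝ) →ₗ[ℝ] (V →₀ ℝ)) (t : Finset W) : Finset V := (φ (one t)).support

lemma one_nonneg (s : Finset V) (v : V) : 0 ≤ one s v := by rw [one_apply]; split_ifs <;> norm_num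

lemma cr_mono {T : Finset (Finset W)} {K : Finset (Finset V)} {φ : (W →₀ ℝ) →ₗ[ℝ] (V →₀ ℝ)}
    (hT : Cx T) (h : Sub T K φ) {s t : Finset W} (ht : t ∈ T) (hst : s ⊆ t) : cr' φ s ⊆ cr' φ t :=
  h.supp_mono hT (one_mem ht) (one_nonneg s) (by rw [supp_one, supp_one]; exact hst)

lemma cr_mem {T : Finset (Finset W)} {K : Finset (Finset V)} {φ : (W →₀ ℝ) →ₗ[ℝ] (V →₀ ℝ)}
    (h : Sub T K φ) {t : Finset W} (ht : t ∈ T) : cr' φ t ∈ K := (h.1 (one_mem ht)).2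

lemma cr_ne {T : Finset (Finset W)} {K : Finset (Finset V)} {φ : (W →₀ ℝ) →ₗ[ℝ] (V →₀ ℝ)}
    (hT : Cx T) (h : Sub T K φ) {t : Finset W} (ht : t ∈ T) (h0 : t ≠ ∅) : (cr' φ t).Nonempty := by
  rw [cr', Finsupp.support_nonempty_iff]
  intro h1
  have := h.2.1 (one_mem ht) (zero_mem hT) (by rw [h1, map_zero])
  have h2 := supp_one t
  rw [this] at h2
  exact h0 (by rw [← h2]; simp)

lemma cr_comp {T : Finset (Finset W)} {K : Finset (Finset V)} {φ : (W →₀ ℝ) →ₗ[ℝ] (V →₀ ℝ)}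
    {R : Finset (Finset U)} {ψ : (U →₀ ℝ) →ₗ[ℝ] (W →₀ ℝ)} (hT : Cx T) (h : Sub T K φ) (h' : Sub R T ψ)
    {t : Finset U} (ht : t ∈ R) : cr' (φ ∘ₗ ψ) t = cr' φ (cr' ψ t) := by
  have h1 := h'.1 (one_mem ht)
  apply Finset.Subset.antisymm
  · exact h.supp_mono hT (one_mem (cr_mem h' ht)) h1.1 (by rw [supp_one]; rfl)
  · exact h.supp_mono hT h1 (one_nonneg _) (by rw [supp_one]; rfl)

lemma cr_id (t : Finset V) : cr' (LinearMap.id : (V →₀ ℝ) →ₗ[ℝ] (V →₀ ℝ)) t = t := supp_one t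

/-- the retraction chain map -/
lemma retr_exists [Nonempty V] {T : Finset (Finset W)} {K : Finset (Finset V)} {φ : (W →₀ ℝ) →ₗ[ℝ] (V →₀ ℝ)}
    (hT : Cx T) (h : Sub T K φ) :
    ∃ G : Chn W →ₗ[ZMod 2] Chn V, (∀ x, bd (G x) = G (bd x)) ∧ G (bs ∅) = bs ∅ ∧
      (∀ k, ∀ x ∈ Ch (Dg k), G x ∈ Ch (Dg k)) ∧ ∀ t ∈ T, G (bs t) ∈ Ch {s | s ⊆ cr' φ t} :=
  sc_exists hT (cr' φ) (fun t ht s hs => cr_mono hT h ht hs) (fun t ht h0 => cr_ne hT h ht h0)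

lemma cr_star {T : Finset (Finset V)} {a b p : V} {α β : ℝ} (hα : 0 < α) (hβ : 0 < β)
    (hpa : p ≠ a) (hpb : p ≠ b) (t : Finset V) :
    cr' (starMap p (edgePt a b α β)) t = if p ∈ t then t.erase p ∪ {a, b} else t := by
  have hs := edgePt_supp (a := a) (b := b) hα hβ
  ext v
  have hnn : 0 ≤ edgePt a b α β v := by
    have h1 := e_nonneg a v
    have h2 := e_nonneg b v
    simp only [edgePt, Finsupp.add_apply, Finsupp.smul_apply, smul_eq_mul]; positivity
  have hv : edgePt a b α β v ≠ 0 ↔ v ∈ ({a, b} : Finset V) := by rw [← hs, Finsupp.mem_support_iff]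
  rw [cr', Finsupp.mem_support_iff, starMap_eq, Finsupp.add_apply, Finsupp.smul_apply, smul_eq_mul,
    Finsupp.erase_apply, one_apply, one_apply]
  by_cases hp : p ∈ t
  · simp only [hp, if_true, one_mul, mem_union, mem_erase]
    rw [← hv]
    by_cases h1 : v = p
    · simp [h1]
    · by_cases h2 : v ∈ t
      · have : 1 + edgePt a b α β v ≠ 0 := by positivity
        simp [h1, h2, this]
      · simp [h1, h2]
  · simp only [hp, if_false, zero_mul, add_zero]
    by_cases h1 : v = p
    · simp [h1, hp]
    · simp [h1]

/-- apex property for the stellar carrier -/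
lemma star_apex {T : Finset (Finset V)} {a b p : V} (hT : Cx T) (hp : Fresh T p) (hab : {a, b} ∈ T) {t : Finset V}
    (ht : t ∈ T) {v : V} (hv : if {a, b} ⊆ t then v = p else v ∈ t) {u : Finset V}
    (hu : u ∈ star T {a, b} p) (hut : (if p ∈ u then u.erase p ∪ {a, b} else u) ⊆ t) :
    insert v u ∈ star T {a, b} p ∧
      (if p ∈ insert v u then (insert v u).erase p ∪ {a, b} else insert v u) ⊆ t := by
  have hu' : ¬ {a, b} ⊆ u.erase p := by
    rw [mem_star] at hu
    rcases hu with ⟨h1, h2⟩ | ⟨w, h1, h2, h3, rfl⟩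
    · exact fun h => h2 (h.trans (erase_subset _ _))
    · rwa [erase_insert (hp w h1)]
  by_cases h : {a, b} ⊆ t
  · rw [if_pos h] at hv; subst hv
    have hsub : u.erase v ∪ {a, b} ⊆ t := by
      split_ifs at hut with h1
      · exact hut
      · rw [erase_eq_of_notMem h1]; exact union_subset hut h
    have he : (insert v u).erase v = u.erase v := by
      ext x; simp only [mem_erase, mem_insert]; tauto
    refine ⟨?_, ?_⟩
    · rw [mem_star]; right
      refine ⟨u.erase v, hT.2 t ht _ (subset_union_left.trans hsub), hu', hT.2 t ht _ hsub, ?_⟩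
      ext x; simp only [mem_insert, mem_erase]; tauto
    · rw [if_pos (mem_insert_self _ _), he]; exact hsub
  · rw [if_neg h] at hv
    have hpt := hp t ht
    have hpu : p ∉ u := by
      intro h1
      rw [if_pos h1] at hut
      exact h (subset_union_right.trans hut)
    rw [if_neg hpu] at hut
    have hpv : p ∉ insert v u := by
      rw [mem_insert]; rintro (rfl | h1)
      · exact hpt hv
      · exact hpu h1
    have hsub : insert v u ⊆ t := insert_subset hv hut
    refine ⟨?_, by rw [if_neg hpv]; exact hsub⟩
    rw [mem_star]; left
    exact ⟨hT.2 t ht _ hsub, fun h1 => h (h1.trans hsub)⟩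

/-- one edge-stellar step -/
lemma star_step [Nonempty V] {T : Finset (Finset V)} {a b p : V} {α β : ℝ} (hT : Cx T) (hp : Fresh T p)
    (hab : {a, b} ∈ T) (hα : 0 < α) (hβ : 0 < β) :
    (∃ G : Chn V →ₗ[ZMod 2] Chn V, (∀ x, bd (G x) = G (bd x)) ∧ G (bs ∅) = bs ∅ ∧
      ∀ t ∈ T, G (bs t) ∈ Ch {s | s ∈ star T {a, b} p ∧ cr' (starMap p (edgePt a b α β)) s ⊆ t}) ∧
    Dom (star T {a, b} p) T := by
  have hpa : p ≠ a := fun h => hp _ hab (by rw [h]; simp)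
  have hpb : p ≠ b := fun h => hp _ hab (by rw [h]; simp)
  have hcr := cr_star (T := T) (α := α) (β := β) hα hβ hpa hpb
  have hS : Cx (star T {a, b} p) := star_cx hT (by simp)
  have hsub : Sub (star T {a, b} p) T (starMap p (edgePt a b α β)) := by
    have := star_sub hT hp (edgePt_mem hα hβ hab) (edgePt_ne hα hβ)
    rwa [edgePt_supp hα hβ] at this
  set ψ := starMap p (edgePt a b α β) with hψ
  have hapex : ∀ t : Finset V, ∃ v, t ≠ ∅ → if {a, b} ⊆ t then v = p else v ∈ t := by
    intro t
    by_cases h : {a, b} ⊆ t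
    · exact ⟨p, fun _ => by rw [if_pos h]⟩
    · by_cases h0 : t = ∅
      · exact ⟨p, fun h => absurd h0 h⟩
      · obtain ⟨v, hv⟩ := nonempty_iff_ne_empty.2 h0
        exact ⟨v, fun _ => by rw [if_neg h]; exact hv⟩
  choose ap hap using hapex
  obtain ⟨G, g1, g2, g3, g4⟩ := carrier_exists (K := (T : Set (Finset V))) (fun s hs t hts => hT.2 s hs t hts)
    (a := ap) (S := fun t => {s | s ∈ star T {a, b} p ∧ cr' ψ s ⊆ t})
    (fun t _ s hst u hu => ⟨hu.1, Finset.Subset.trans hu.2 hst⟩)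
    (fun t ht => ⟨hS.1, by rw [hcr]; simp⟩) (by
      intro t ht h0 s hs
      obtain ⟨hs1, hs2⟩ := hs
      rw [hcr] at hs2
      have := star_apex hT hp hab ht (hap t h0) hs1 hs2
      exact ⟨this.1, by rw [hcr]; exact this.2⟩)
  refine ⟨⟨G, g1, g2, g4⟩, ?_⟩
  obtain ⟨i, i1, i2, i3, i4⟩ := retr_exists hS hsub
  refine ⟨i, G, i1, g1, ?_, ?_, g3, ?_⟩
  · exact fun x hx => map_mem (fun t ht => Ch_mono (fun s hs => hT.2 _ (cr_mem hsub ht) s hs) (i4 t ht)) hx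
  · exact fun x hx => map_mem (fun t ht => Ch_mono (fun s hs => hs.1) (g4 t ht)) hx
  · refine homotopic_id hS (a := fun t => ap (cr' ψ t))
      (S := fun t => {s | s ∈ star T {a, b} p ∧ cr' ψ s ⊆ cr' ψ t}) ?_ ?_ ?_ ?_ (F := G ∘ₗ i) (fun x => ?_) ?_ ?_
    · intro t ht s hst u hu
      exact ⟨hu.1, Finset.Subset.trans hu.2 (cr_mono hS hsub ht hst)⟩
    · exact fun t ht s hs => hs.1
    · exact fun t ht => ⟨ht, Finset.Subset.refl _⟩
    · intro t ht h0 s hs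
      obtain ⟨hs1, hs2⟩ := hs
      rw [hcr s] at hs2
      have := star_apex hT hp hab (cr_mem hsub ht) (hap _ (nonempty_iff_ne_empty.1 (cr_ne hS hsub ht h0))) hs1 hs2
      exact ⟨this.1, by rw [hcr (insert _ s)]; exact this.2⟩
    · rw [LinearMap.comp_apply, LinearMap.comp_apply, g1, i1]
    · rw [LinearMap.comp_apply, i2, g2]
    · intro t ht
      refine comp_carried (i4 t ht) fun s hs => ?_
      refine Ch_mono (K := {u | u ∈ star T {a, b} p ∧ cr' ψ u ⊆ s}) (L := {u | u ∈ star T {a, b} p ∧ cr' ψ u ⊆ cr' ψ t}) (fun u hu => ⟨hu.1, Finset.Subset.trans hu.2 hs⟩) (g4 s (hT.2 _ (cr_mem hsub ht) s hs))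

lemma ES.chain [Nonempty V] {K T : Finset (Finset V)} {φ} (hK : Cx K) (h : ES K T φ) :
    (∃ G : Chn V →ₗ[ZMod 2] Chn V, (∀ x, bd (G x) = G (bd x)) ∧ G (bs ∅) = bs ∅ ∧
      ∀ t ∈ K, G (bs t) ∈ Ch {s | s ∈ T ∧ cr' φ s ⊆ t}) ∧ Dom T K := by
  induction h with
  | refl =>
    refine ⟨⟨LinearMap.id, fun x => rfl, rfl, fun t ht => bs_mem.2 ⟨ht, ?_⟩⟩, Dom.refl K⟩
    rw [cr_id]
  | @step T φ a b p α β h hab hT hα hβ hp ih =>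
    obtain ⟨⟨G, g1, g2, g3⟩, hd⟩ := ih
    obtain ⟨hTc, hTs⟩ := h.sub hK
    obtain ⟨⟨H, h1, h2, h3⟩, hd'⟩ := star_step (α := α) (β := β) hTc hp hT hα hβ
    refine ⟨⟨H ∘ₗ G, fun x => ?_, ?_, fun t ht => ?_⟩, hd'.trans hd⟩
    · rw [LinearMap.comp_apply, LinearMap.comp_apply, h1, g1]
    · rw [LinearMap.comp_apply, g2, h2]
    · refine comp_carried (g3 t ht) fun s hs => ?_
      refine Ch_mono (K := {u | u ∈ star T {a, b} p ∧ cr' (starMap p (edgePt a b α β)) u ⊆ s})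
        (L := {s | s ∈ star T {a, b} p ∧ cr' (φ ∘ₗ starMap p (edgePt a b α β)) s ⊆ t}) (fun u hu => ⟨hu.1, ?_⟩) (h3 s hs.1)
      have hsub := star_sub hTc hp (edgePt_mem hα hβ hT) (edgePt_ne hα hβ)
      rw [edgePt_supp hα hβ] at hsub
      rw [cr_comp hTc hTs hsub hu.1]
      exact (cr_mono hTc hTs hs.1 hu.2).trans hs.2

/-- `K` is dominated by its subdivisions -/
lemma Sub.dom [Infinite V] [Nonempty W] {T : Finset (Finset W)} {K : Finset (Finset V)} {φ : (W →₀ ℝ) →ₗ[ℝ] (V →₀ ℝ)}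
    (hK : Cx K) (hT : Cx T) (h : Sub T K φ) : Dom K T := by
  obtain ⟨R, ψ, hES, ψ2, h2, hc⟩ := common hK hT (Sub.id K) h
  obtain ⟨hR, hRs⟩ := hES.sub hK
  obtain ⟨⟨G, g1, g2, g3⟩, -⟩ := hES.chain hK
  obtain ⟨g, k1, k2, k3, k4⟩ := retr_exists hR h2
  obtain ⟨r, r1, r2, r3, r4⟩ := retr_exists hT h
  have hcr : ∀ s ∈ R, cr' φ (cr' ψ2 s) = cr' ψ s := by
    intro s hs
    rw [← cr_comp hT h h2 hs, cr', LinearMap.comp_apply, hc _ (one_mem hs)]; rfl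
  have hi : ∀ t ∈ K, (g ∘ₗ G) (bs t) ∈ Ch {s | s ∈ T ∧ cr' φ s ⊆ t} := by
    intro t ht
    refine comp_carried (g3 t ht) fun s hs => ?_
    refine Ch_mono (K := {u | u ⊆ cr' ψ2 s}) (L := {s | s ∈ T ∧ cr' φ s ⊆ t}) (fun u hu => ⟨hT.2 _ (cr_mem h2 hs.1) u hu, ?_⟩) (k4 s hs.1)
    have := cr_mono hT h (cr_mem h2 hs.1) hu
    rw [hcr s hs.1] at this
    exact this.trans hs.2
  refine ⟨g ∘ₗ G, r, fun x => ?_, r1, ?_, ?_, r3, ?_⟩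
  · rw [LinearMap.comp_apply, LinearMap.comp_apply, k1, g1]
  · exact fun x hx => map_mem (fun t ht => Ch_mono (fun s hs => hs.1) (hi t ht)) hx
  · exact fun x hx => map_mem (fun t ht => Ch_mono (fun s hs => hK.2 _ (cr_mem h ht) s hs) (r4 t ht)) hx
  · refine homotopic_id' hK (F := r ∘ₗ (g ∘ₗ G)) (fun x => ?_) ?_ ?_
    · simp only [LinearMap.comp_apply]; rw [r1, k1, g1]
    · simp only [LinearMap.comp_apply]; rw [g2, k2, r2]
    · intro t ht
      exact comp_carried (hi t ht) fun s hs => Ch_mono (fun u hu => Finset.Subset.trans hu hs.2) (r4 s hs.1)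

lemma Sub.dom' [Infinite V] [Infinite W] {T : Finset (Finset W)} {K : Finset (Finset V)} {φ : (W →₀ ℝ) →ₗ[ℝ] (V →₀ ℝ)}
    (hK : Cx K) (hT : Cx T) (h : Sub T K φ) : Dom T K := by
  obtain ⟨R, ψ, hES, ψ2, h2, hc⟩ := common hK hT (Sub.id K) h
  obtain ⟨hR, hRs⟩ := hES.sub hK
  exact (Sub.dom hT hR h2).trans (hES.chain hK).2

/-- the boundary of a simplex -/
lemma HSph.ssub {A : Finset V} {k : ℕ} (h : A.card = k + 1) : HSph k A.ssubsets := by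
  obtain ⟨a, ha⟩ : A.Nonempty := by rw [← card_pos]; omega
  have hbd : bd (bs A) ∈ Ch ((A.ssubsets : Finset (Finset V)) : Set (Finset V)) := by
    rw [bd_bs]
    exact Submodule.sum_mem _ fun v hv => bs_mem.2 (mem_coe.2 (mem_ssubsets.2 (erase_ssubset hv)))
  -- every cycle on `A.powerset` bounds; split off the coefficient of `A`
  have hsplit : ∀ y ∈ Ch {s : Finset V | s ⊆ A}, ∃ b ∈ Ch ((A.ssubsets : Finset (Finset V)) : Set (Finset V)),
      bd b = bd y ∨ bd b = bd (bs A) + bd y := by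
    intro y hy
    by_cases h0 : y A = 0
    · refine ⟨y, mem_Ch.2 fun t ht => ?_, Or.inl rfl⟩
      rw [mem_coe, mem_ssubsets, Finset.ssubset_iff_subset_ne]
      exact ⟨mem_Ch.1 hy t ht, fun he => ht (he ▸ h0)⟩
    · refine ⟨bs A + y, mem_Ch.2 fun t ht => ?_, Or.inr (map_add _ _ _)⟩
      have h1 : y A = 1 := by
        revert h0; generalize y A = z; revert z; decide
      rw [mem_coe, mem_ssubsets, Finset.ssubset_iff_subset_ne]
      have hne : t ≠ A := by
        rintro rfl
        apply ht
        rw [Finsupp.add_apply, h1, bs, Finsupp.single_eq_same]; decide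
      refine ⟨mem_Ch.1 hy t ?_, hne⟩
      intro h2
      apply ht
      rw [Finsupp.add_apply, h2, bs, Finsupp.single_eq_of_ne hne, add_zero]
  refine ⟨bd (bs A), hbd, bd_deg (bs_mem.2 h), bd_bd _, ?_, ?_⟩
  · intro b hb hbA
    have h1 : bd (b + bs A) = 0 := by rw [map_add, hbA]; exact add_self2 _
    have h2 := cone_bd a (b + bs A)
    rw [h1, map_zero, add_zero] at h2
    -- coefficient of A
    have h3 : (b + bs A) A = 1 := by
      have : b A = 0 := by
        by_contra h4
        have := mem_Ch.1 hb A h4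
        simp at this
      rw [Finsupp.add_apply, this, bs, Finsupp.single_eq_same, zero_add]
    have h5 : cone a (b + bs A) ∈ Ch {s : Finset V | s ⊆ A} := by
      refine cone_mem (K := {s : Finset V | s ⊆ A}) (fun s hs => insert_subset ha hs) (Submodule.add_mem _ ?_ (bs_mem.2 (Finset.Subset.refl A)))
      exact Ch_mono (fun s hs => (mem_ssubsets.1 (mem_coe.1 hs)).1) hb
    rw [← h2, bd_apply (X := A) (fun s hs => mem_Ch.1 h5 s hs), sdiff_self] at h3
    simp at h3
  · intro x hx hx0
    have hx' : x ∈ Ch {s : Finset V | s ⊆ A} := Ch_mono (fun s hs => (mem_ssubsets.1 (mem_coe.1 hs)).1) hx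
    obtain ⟨b, hb, h1⟩ := hsplit (cone a x) (cone_mem (K := {s : Finset V | s ⊆ A}) (fun s hs => insert_subset ha hs) hx')
    have h2 := cone_bd a x
    rw [hx0, map_zero, add_zero] at h2
    rw [h2] at h1
    exact ⟨b, hb, h1⟩

lemma PL.hsph {k : ℕ} {K : Finset (Finset V)} (h : PL (k + 1) K) : HSph (k + 1) K := by
  obtain ⟨hK, A, hA, T, φ, ψ, hT, h1, h2⟩ := h
  have hAne : A.Nonempty := by rw [← card_pos]; omega
  have hne : Nonempty V := by
    by_contra hV
    rw [not_nonempty_iff] at hV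
    obtain ⟨a, ha⟩ := hAne
    have haA : ({a} : Finset ℕ) ∈ A.ssubsets := by
      rw [mem_ssubsets, Finset.ssubset_iff_subset_ne]
      refine ⟨by simpa using ha, fun he => ?_⟩
      rw [← he] at hA; simp at hA
    obtain ⟨x, hx, hxa⟩ := h2.2.2 (e_mem haA)
    have : x = 0 := h1.2.1 hx (zero_mem hT) (Subsingleton.elim _ _)
    rw [this, map_zero] at hxa
    have h3 := supp_e a
    rw [← hxa] at h3
    simp at h3
  have hT1 : HSph (k + 1) T := (HSph.ssub hA).of_dom (Sub.dom' (ssub_cx hAne) hT h2) (Sub.dom (ssub_cx hAne) hT h2)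
  obtain ⟨f, hf⟩ := exists_nat_inj (vs K)
  have hf' := im_sub hf
  have h3 := hf'.comp h1
  have hT2 : HSph (k + 1) (im f K) := hT1.of_dom (Sub.dom (im_cx hK) hT h3) (Sub.dom' (im_cx hK) hT h3)
  exact hT2.of_dom (dom_im hK hf).1 (dom_im hK hf).2

/-- iterated homology spheres -/
def HS : ℕ → Finset (Finset V) → Prop
  | 0, K => K = {∅}
  | k + 1, K => Cx K ∧ HSph (k + 1) K ∧ ∀ v, {v} ∈ K → HS k (lk K v)

lemma PL.hs {k : ℕ} : ∀ {K : Finset (Finset V)}, PL k K → HS k K := by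
  induction k with
  | zero => exact fun h => h.zero
  | succ k ih => exact fun h => ⟨h.1, h.hsph, fun v hv => ih (h.lk hv)⟩

end
end HS

namespace HS
open Finset
open scoped Classical
set_option linter.all false

section

variable {V W U : Type*} [DecidableEq V] [DecidableEq W] [DecidableEq U]

lemma HS.cx {k : ℕ} {K : Finset (Finset V)} (h : HS k K) : Cx K := by
  cases k with
  | zero =>
    have h : K = {∅} := h
    subst h
    exact ⟨by simp, fun s hs t ht => by
      rw [mem_singleton] at *; subst hs; exact subset_empty.1 ht⟩
  | succ k => exact h.1

lemma HS.lk {k : ℕ} {K : Finset (Finset V)} (h : HS (k + 1) K) {v : V} (hv : {v} ∈ K) : HS k (lk K v) := h.2.2 v hv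

lemma lk_erase {K : Finset (Finset V)} (hK : Cx K) {t : Finset V} (ht : t ∈ K) {v : V} (hv : v ∈ t) :
    t.erase v ∈ lk K v := by
  rw [hK.mem_lk, insert_erase hv]
  exact ⟨notMem_erase _ _, ht⟩

lemma HS.card_le {k : ℕ} : ∀ {K : Finset (Finset V)}, HS k K → ∀ t ∈ K, t.card ≤ k := by
  induction k with
  | zero =>
    intro K h t ht
    have h : K = {∅} := h
    subst h
    rw [mem_singleton] at ht; simp [ht]
  | succ k ih =>
    intro K h t ht
    rcases t.eq_empty_or_nonempty with rfl | ⟨v, hv⟩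
    · simp
    · have := ih (h.lk (h.cx.vert ht hv)) _ (lk_erase h.cx ht hv)
      rw [card_erase_of_mem hv] at this; omega

lemma bs_apply (s t : Finset V) : bs s t = if s = t then 1 else 0 := by
  rw [bs, Finsupp.single_apply]

lemma HS.hsph {k : ℕ} {K : Finset (Finset V)} (h : HS k K) : HSph k K := by
  cases k with
  | succ k => exact h.2.1
  | zero =>
    have h : K = {∅} := h
    subst h
    have hb : ∀ b ∈ Ch ((({∅} : Finset (Finset V)) : Finset (Finset V)) : Set (Finset V)), bd b = 0 ∧ (b = 0 ∨ b = bs ∅) := by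
      intro b hb
      have h1 : b = b ∅ • bs ∅ := by
        ext t
        rw [Finsupp.smul_apply, bs_apply]
        split_ifs with ht
        · subst ht; simp
        · by_contra h2
          have := mem_Ch.1 hb t (by simpa using h2)
          simp at this
          exact ht this.symm
      refine ⟨by rw [h1, map_smul, bd_bs]; simp, ?_⟩
      have : ∀ z : ZMod 2, z = 0 ∨ z = 1 := by decide
      rcases this (b ∅) with h2 | h2
      · left; rw [h1, h2, zero_smul]
      · right; rw [h1, h2, one_smul]
    have hne : (bs ∅ : Chn V) ≠ 0 := fun h => by
      have := DFunLike.congr_fun h ∅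
      rw [bs_apply] at this; simp at this
    refine ⟨bs ∅, bs_mem.2 (by simp), bs_mem.2 rfl, by rw [bd_bs]; simp, ?_, ?_⟩
    · intro b h1 h2
      rw [(hb b h1).1] at h2; exact hne h2.symm
    · intro x hx hx0
      refine ⟨0, Submodule.zero_mem _, ?_⟩
      rw [map_zero]
      rcases (hb x hx).2 with h1 | h1
      · left; exact h1.symm
      · right; rw [h1]; exact (add_self2 _).symm

/-- top chains of `K` -/
def Top (k : ℕ) (K : Finset (Finset V)) (x : Chn V) : Prop :=
  x ∈ Ch (K : Set (Finset V)) ∧ x ∈ Ch (Dg k : Set (Finset V)) ∧ bd x = 0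

lemma sup_vs {K : Finset (Finset V)} {x : Chn V} (hx : x ∈ Ch (K : Set (Finset V))) : ∀ s, x s ≠ 0 → s ⊆ vs K :=
  fun s hs v hv => mem_vs.2 ⟨s, mem_Ch.1 hx s hs, hv⟩

/-- homology sphere data with a given fundamental cycle -/
lemma HS.fund {k : ℕ} {K : Finset (Finset V)} (h : HS k K) :
    (∃ Z, Top k K Z ∧ Z ≠ 0) ∧ ∀ Z, Top k K Z → Z ≠ 0 → (∀ b ∈ Ch (K : Set (Finset V)), bd b ≠ Z) ∧
      (∀ x ∈ Ch (K : Set (Finset V)), bd x = 0 → ∃ b ∈ Ch (K : Set (Finset V)), bd b = x ∨ bd b = Z + x) ∧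
      ∀ x, Top k K x → x = 0 ∨ x = Z := by
  obtain ⟨Z, z1, z2, z3, z4, z5⟩ := h.hsph
  have hZ0 : Z ≠ 0 := fun h0 => z4 0 (Submodule.zero_mem _) (by rw [h0, map_zero])
  have hb0 : ∀ b ∈ Ch (K : Set (Finset V)), bd b ∈ Ch (Dg k : Set (Finset V)) → bd b = 0 := by
    intro b hb hd
    ext t
    by_contra ht
    have hc : t.card = k := mem_Ch.1 hd t ht
    rw [bd_apply (sup_vs hb)] at ht
    obtain ⟨v, hv, hv2⟩ := exists_ne_zero_of_sum_ne_zero ht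
    have h1 := h.card_le _ (mem_Ch.1 hb _ hv2)
    rw [card_insert_of_notMem (mem_sdiff.1 hv).2] at h1
    omega
  have huniq : ∀ x, Top k K x → x = 0 ∨ x = Z := by
    rintro x ⟨x1, x2, x3⟩
    obtain ⟨b, hb, h1 | h1⟩ := z5 x x1 x3
    · left; rw [← h1]; exact hb0 b hb (by rw [h1]; exact x2)
    · right
      have := hb0 b hb (by rw [h1]; exact Submodule.add_mem _ z2 x2)
      rw [this] at h1
      exact (eq_of_add2 h1.symm).symm
  refine ⟨⟨Z, ⟨z1, z2, z3⟩, hZ0⟩, fun Z' hZ' hne => ?_⟩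
  obtain rfl := (huniq Z' hZ').resolve_left hne
  exact ⟨z4, z5, huniq⟩

/-! ### splitting off a vertex -/

noncomputable def lpart (v : V) : Chn V →ₗ[ZMod 2] Chn V :=
  Finsupp.linearCombination (ZMod 2) (fun t => if v ∈ t then bs (t.erase v) else 0)

noncomputable def npart (v : V) : Chn V →ₗ[ZMod 2] Chn V :=
  Finsupp.linearCombination (ZMod 2) (fun t => if v ∈ t then 0 else bs t)

lemma lpart_bs (v : V) (t : Finset V) : lpart v (bs t) = if v ∈ t then bs (t.erase v) else 0 := by simp [lpart, bs]
lemma npart_bs (v : V) (t : Finset V) : npart v (bs t) = if v ∈ t then 0 else bs t := by simp [npart, bs]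

lemma split_v (v : V) (x : Chn V) : npart v x + cone v (lpart v x) = x := by
  have : npart v + cone v ∘ₗ lpart v = LinearMap.id := chn_ext fun t => by
    rw [LinearMap.add_apply, LinearMap.comp_apply, npart_bs, lpart_bs]
    split_ifs with h
    · rw [cone_bs, if_neg (notMem_erase _ _), insert_erase h, zero_add]; rfl
    · rw [map_zero, add_zero]; rfl
  exact LinearMap.congr_fun this x

lemma lpart_bd (v : V) (x : Chn V) : lpart v (bd x) = bd (lpart v x) := by
  have : lpart v ∘ₗ bd = bd ∘ₗ lpart v := chn_ext fun t => by
    rw [LinearMap.comp_apply, LinearMap.comp_apply, bd_bs, lpart_bs, map_sum]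
    simp only [lpart_bs]
    by_cases h : v ∈ t
    · rw [if_pos h, bd_bs, ← add_sum_erase _ _ h, if_neg (notMem_erase _ _), zero_add]
      refine sum_congr rfl fun w hw => ?_
      rw [if_pos (mem_erase.2 ⟨(ne_of_mem_erase hw).symm, h⟩), erase_right_comm]
    · rw [if_neg h, map_zero]
      exact sum_eq_zero fun w hw => if_neg fun h1 => h (mem_of_mem_erase h1)
  exact LinearMap.congr_fun this x

lemma npart_bd (v : V) (x : Chn V) : npart v (bd x) = bd (npart v x) + lpart v x := by
  have : npart v ∘ₗ bd = bd ∘ₗ npart v + lpart v := chn_ext fun t => by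
    rw [LinearMap.add_apply, LinearMap.comp_apply, LinearMap.comp_apply, bd_bs, lpart_bs, npart_bs, map_sum]
    simp only [npart_bs]
    by_cases h : v ∈ t
    · rw [if_pos h, if_pos h, map_zero, zero_add, ← add_sum_erase _ _ h, if_neg (notMem_erase _ _)]
      rw [sum_eq_zero, add_zero]
      intro w hw
      exact if_pos (mem_erase.2 ⟨(ne_of_mem_erase hw).symm, h⟩)
    · rw [if_neg h, if_neg h, add_zero, bd_bs]
      exact sum_congr rfl fun w hw => if_neg fun h1 => h (mem_of_mem_erase h1)
  exact LinearMap.congr_fun this x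

/-- deletion of a set of vertices -/
def del (K : Finset (Finset V)) (σ : Finset V) : Finset (Finset V) := K.filter (fun t => Disjoint t σ)

lemma mem_del {K : Finset (Finset V)} {σ t : Finset V} : t ∈ del K σ ↔ t ∈ K ∧ Disjoint t σ := by simp [del]

lemma lpart_mem {K : Finset (Finset V)} (hK : Cx K) {v : V} {x : Chn V} (hx : x ∈ Ch (K : Set (Finset V))) :
    lpart v x ∈ Ch (lk K v : Set (Finset V)) := by
  refine map_mem (fun t ht => ?_) hx
  rw [lpart_bs]; split_ifs with h
  · exact bs_mem.2 (mem_coe.2 (lk_erase hK (mem_coe.1 ht) h))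
  · exact Submodule.zero_mem _

lemma npart_mem {K : Finset (Finset V)} {v : V} {x : Chn V} (hx : x ∈ Ch (K : Set (Finset V))) :
    npart v x ∈ Ch (del K {v} : Set (Finset V)) := by
  refine map_mem (fun t ht => ?_) hx
  rw [npart_bs]; split_ifs with h
  · exact Submodule.zero_mem _
  · exact bs_mem.2 (mem_coe.2 (mem_del.2 ⟨ht, by simpa using h⟩))

lemma npart_id {K : Finset (Finset V)} {v : V} {x : Chn V} (hx : x ∈ Ch (del K {v} : Set (Finset V))) :
    npart v x = x ∧ lpart v x = 0 := by
  constructor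
  · refine chn_ext_on (f := npart v) (g := LinearMap.id) (fun t ht => ?_) hx
    have : v ∉ t := by simpa using (mem_del.1 (mem_coe.1 ht)).2
    rw [npart_bs, if_neg this]; rfl
  · refine chn_ext_on (f := lpart v) (g := 0) (fun t ht => ?_) hx
    have : v ∉ t := by simpa using (mem_del.1 (mem_coe.1 ht)).2
    rw [lpart_bs, if_neg this]; rfl

lemma lpart_apply (v : V) (x : Chn V) (t : Finset V) (hv : v ∉ t) : lpart v x t = x (insert v t) := by
  have : Finsupp.lapply t ∘ₗ lpart v = (Finsupp.lapply (insert v t) : Chn V →ₗ[ZMod 2] ZMod 2) := chn_ext fun s => by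
    rw [LinearMap.comp_apply, lpart_bs, Finsupp.lapply_apply, Finsupp.lapply_apply, bs_apply]
    split_ifs with h1 h2 h2
    · rw [bs_apply, if_pos]; rw [h2, erase_insert hv]
    · rw [bs_apply, if_neg]; intro h3; exact h2 (by rw [← h3, insert_erase h1])
    · exact absurd (h2 ▸ mem_insert_self v t) h1
    · rfl
  exact LinearMap.congr_fun this x

lemma Top.lpart {k : ℕ} {K : Finset (Finset V)} (hK : Cx K) {Z : Chn V} (h : Top (k + 1) K Z) (v : V) :
    Top k (lk K v) (lpart v Z) := by
  refine ⟨lpart_mem hK h.1, map_mem (fun t ht => ?_) h.2.1, by rw [← lpart_bd, h.2.2, map_zero]⟩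
  rw [lpart_bs]; split_ifs with hv
  · refine bs_mem.2 ?_
    have : t.card = k + 1 := ht
    simp [card_erase_of_mem hv, this]
  · exact Submodule.zero_mem _

/-- full support -/
lemma HS.full {k : ℕ} : ∀ {K : Finset (Finset V)}, HS k K → ∀ Z, Top k K Z → Z ≠ 0 → ∀ t ∈ K, ∃ f, Z f ≠ 0 ∧ t ⊆ f := by
  induction k with
  | zero =>
    intro K h Z hZ hne t ht
    have h : K = {∅} := h
    subst h
    rw [mem_singleton] at ht; subst ht
    obtain ⟨f, hf⟩ := DFunLike.ne_iff.1 hne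
    exact ⟨f, hf, empty_subset _⟩
  | succ k ih =>
    intro K h Z hZ hne t ht
    have hK := h.cx
    -- supported vertices
    let S : Finset V := (vs K).filter (fun v => lpart v Z ≠ 0)
    have hS1 : ∀ v ∈ S, ∀ t ∈ K, v ∈ t → ∃ f, Z f ≠ 0 ∧ t ⊆ f := by
      intro v hv t ht hvt
      have h1 := (mem_filter.1 hv).2
      obtain ⟨f, hf, hf2⟩ := ih (h.lk (hK.vert ht hvt)) _ (hZ.lpart hK v) h1 _ (lk_erase hK ht hvt)
      have h2 := mem_Ch.1 (hZ.lpart hK v).1 f hf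
      have hvf : v ∉ f := (hK.mem_lk.1 (mem_coe.1 h2)).1
      rw [lpart_apply v Z f hvf] at hf
      refine ⟨_, hf, ?_⟩
      intro x hx
      by_cases hxv : x = v
      · rw [hxv]; exact mem_insert_self _ _
      · exact mem_insert_of_mem (hf2 (mem_erase.2 ⟨hxv, hx⟩))
    have hS2 : ∀ v, ∀ f, Z f ≠ 0 → v ∈ f → v ∈ S := by
      intro v f hf hvf
      refine mem_filter.2 ⟨sup_vs hZ.1 f hf hvf, fun h0 => hf ?_⟩
      have := lpart_apply v Z (f.erase v) (notMem_erase _ _)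
      rw [insert_erase hvf, h0] at this
      exact this.symm
    have hSadj : ∀ v ∈ S, ∀ t ∈ K, v ∈ t → t ⊆ S := by
      intro v hv t ht hvt w hw
      obtain ⟨f, hf, hf2⟩ := hS1 v hv t ht hvt
      exact hS2 w f hf (hf2 hw)
    have hSne : S.Nonempty := by
      obtain ⟨f, hf⟩ := DFunLike.ne_iff.1 hne
      have hc : f.card = k + 1 := mem_Ch.1 hZ.2.1 f hf
      obtain ⟨v, hv⟩ : f.Nonempty := by rw [← card_pos]; omega
      exact ⟨v, hS2 v f hf hv⟩
    have hall : ∀ w, {w} ∈ K → w ∈ S := by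
      intro w hw
      by_contra hwS
      obtain ⟨u, hu⟩ := hSne
      have huK : {u} ∈ K := hK.mem_vs.1 (mem_filter.1 hu).1
      have huw : u ≠ w := fun h => hwS (h ▸ hu)
      let x : Chn V := bs {u} + bs {w}
      have hx1 : x ∈ Ch (K : Set (Finset V)) := Submodule.add_mem _ (bs_mem.2 (mem_coe.2 huK)) (bs_mem.2 (mem_coe.2 hw))
      have hx0 : bd x = 0 := by
        simp only [x, map_add, bd_bs, sum_singleton]
        simp only [erase_singleton]; exact add_self2 _
      let lam : Chn V →ₗ[ZMod 2] ZMod 2 := ∑ v ∈ S, Finsupp.lapply {v}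
      have hlam : ∀ y : Chn V, lam y = ∑ v ∈ S, y {v} := fun y => by simp [lam]
      have hlx : lam x = 1 := by
        rw [hlam, sum_eq_single u]
        · simp only [x, Finsupp.add_apply, bs_apply]
          simp [huw.symm]
        · intro v hv hvu
          have hvw : v ≠ w := fun h => hwS (h ▸ hv)
          simp only [x, Finsupp.add_apply, bs_apply]
          simp [hvu.symm, hvw.symm]
        · exact fun h => absurd hu h
      have hlb : ∀ b ∈ Ch (K : Set (Finset V)), lam (bd b) = 0 := by
        intro b hb
        refine chn_ext_on (f := lam ∘ₗ bd) (g := 0) (fun t ht => ?_) hb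
        rw [LinearMap.comp_apply, LinearMap.zero_apply, hlam, bd_bs]
        simp only [Finsupp.finsetSum_apply, bs_apply]
        by_cases hc : t.card = 2
        · obtain ⟨p, q, hpq, rfl⟩ := card_eq_two.1 hc
          have e1 : ({p, q} : Finset V).erase p = {q} := by
            ext x; simp only [mem_erase, mem_insert, mem_singleton]; constructor
            · tauto
            · rintro rfl; exact ⟨hpq.symm, Or.inr rfl⟩
          have e2 : ({p, q} : Finset V).erase q = {p} := by
            ext x; simp only [mem_erase, mem_insert, mem_singleton]; constructor
            · tauto
            · rintro rfl; exact ⟨hpq, Or.inl rfl⟩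
          simp only [sum_pair hpq, e1, e2, Finset.singleton_inj]
          rw [sum_add_distrib, Finset.sum_ite_eq, Finset.sum_ite_eq]
          have : q ∈ S ↔ p ∈ S := by
            constructor
            · intro h1; exact hSadj q h1 _ ht (by simp) (by simp)
            · intro h1; exact hSadj p h1 _ ht (by simp) (by simp)
          by_cases h1 : p ∈ S
          · rw [if_pos h1, if_pos (this.2 h1)]; decide
          · rw [if_neg h1, if_neg fun h2 => h1 (this.1 h2)]; decide
        · refine sum_eq_zero fun v hv => sum_eq_zero fun w hw => if_neg fun he => hc ?_
          have := congrArg Finset.card he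
          rw [card_erase_of_mem hw, card_singleton] at this; omega
      obtain ⟨b, hb, h1⟩ := (h.fund.2 Z hZ hne).2.1 x hx1 hx0
      rcases h1 with h1 | h1
      · have := hlb b hb
        rw [h1, hlx] at this; exact one_ne_zero this
      · have h2 := hlb b hb
        rw [h1, map_add, hlx] at h2
        rcases Nat.eq_zero_or_pos k with rfl | hk
        · -- top dimension one
          have hxT : Top 1 K x := ⟨hx1, Submodule.add_mem _ (bs_mem.2 (by simp)) (bs_mem.2 (by simp)), hx0⟩
          have hxw : x {w} = 1 := by simp only [x, Finsupp.add_apply, bs_apply]; simp [huw]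
          rcases (h.fund.2 Z hZ hne).2.2 x hxT with h3 | h3
          · rw [h3] at hxw; simp at hxw
          · rw [h3] at hxw
            exact hwS (hS2 w {w} (by rw [hxw]; exact one_ne_zero) (by simp))
        · have : lam Z = 0 := by
            rw [hlam]
            refine sum_eq_zero fun v hv => ?_
            by_contra h4
            have : ({v} : Finset V).card = k + 1 := mem_Ch.1 hZ.2.1 _ h4
            simp at this; omega
          rw [this, zero_add] at h2; exact one_ne_zero h2
    rcases t.eq_empty_or_nonempty with rfl | ⟨v, hv⟩
    · obtain ⟨f, hf⟩ := DFunLike.ne_iff.1 hne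
      exact ⟨f, hf, empty_subset _⟩
    · exact hS1 v (hall v (hK.vert ht hv)) t ht hv

lemma HS.pure {k : ℕ} {K : Finset (Finset V)} (h : HS k K) {t : Finset V} (ht : t ∈ K) :
    ∃ f ∈ K, f.card = k ∧ t ⊆ f := by
  obtain ⟨⟨Z, hZ, hne⟩, -⟩ := h.fund
  obtain ⟨f, hf, hf2⟩ := h.full Z hZ hne t ht
  exact ⟨f, mem_Ch.1 hZ.1 f hf, mem_Ch.1 hZ.2.1 f hf, hf2⟩

/-- a facet avoiding a given vertex -/
lemma HS.avoid {k : ℕ} {K : Finset (Finset V)} (h : HS k K) (v : V) : ∃ f ∈ K, f.card = k ∧ v ∉ f := by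
  obtain ⟨⟨Z, hZ, hne⟩, -⟩ := h.fund
  by_contra hcon
  push Not at hcon
  have h1 : npart v Z = 0 := by
    refine chn_ext_on (K := {f | f ∈ K ∧ f.card = k}) (f := npart v) (g := 0) (fun t ht => ?_)
      (mem_Ch.2 fun t ht => ⟨mem_Ch.1 hZ.1 t ht, mem_Ch.1 hZ.2.1 t ht⟩)
    rw [npart_bs, if_pos (hcon t ht.1 ht.2)]; rfl
  have h2 := npart_bd v Z
  rw [hZ.2.2, map_zero, h1, map_zero, zero_add] at h2
  apply hne
  rw [← split_v v Z, h1, ← h2, map_zero, add_zero]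

/-- acyclicity -/
def Acyc (K : Finset (Finset V)) : Prop :=
  ∀ x ∈ Ch (K : Set (Finset V)), bd x = 0 → ∃ b ∈ Ch (K : Set (Finset V)), bd b = x

lemma del_subset {K : Finset (Finset V)} {σ : Finset V} : (del K σ : Set (Finset V)) ⊆ K := by
  intro t ht; exact (mem_del.1 (mem_coe.1 ht)).1

lemma lk_sub_del {K : Finset (Finset V)} {v : V} : (lk K v : Set (Finset V)) ⊆ del K {v} := by
  intro t ht
  obtain ⟨h1, h2, h3⟩ := mem_lk.1 (mem_coe.1 ht)
  exact mem_coe.2 (mem_del.2 ⟨h1, by simpa using h2⟩)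

lemma HS.acyc_del {k : ℕ} {K : Finset (Finset V)} (h : HS (k + 1) K) {v : V} (hv : {v} ∈ K) : Acyc (del K {v}) := by
  obtain ⟨⟨Z, hZ, hne⟩, hfund⟩ := h.fund
  obtain ⟨z1, z2, z3⟩ := hfund Z hZ hne
  have hK := h.cx
  have hζ0 : lpart v Z ≠ 0 := by
    obtain ⟨f, hf, hvf⟩ := h.full Z hZ hne _ hv
    intro h0
    have hvf' : v ∈ f := by simpa using hvf
    have := lpart_apply v Z (f.erase v) (notMem_erase _ _)
    rw [insert_erase hvf', h0] at this
    exact hf this.symm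
  obtain ⟨l1, l2, l3⟩ := (h.lk hv).fund.2 _ (hZ.lpart hK v) hζ0
  intro x hx hx0
  obtain ⟨b, hb, hbx⟩ := z2 x (Ch_mono del_subset hx) hx0
  obtain ⟨hx1, hx2⟩ := npart_id hx
  rcases hbx with hbx | hbx
  · have h1 := lpart_bd v b
    rw [hbx, hx2] at h1
    have h2 := npart_bd v b
    rw [hbx, hx1] at h2
    obtain ⟨e, he, h3⟩ := l2 (lpart v b) (lpart_mem hK hb) h1.symm
    rcases h3 with h3 | h3
    · refine ⟨npart v b + e, Submodule.add_mem _ (npart_mem hb) (Ch_mono lk_sub_del he), ?_⟩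
      rw [map_add, h3, h2]
    · refine ⟨npart v b + e + npart v Z, Submodule.add_mem _ (Submodule.add_mem _ (npart_mem hb)
        (Ch_mono lk_sub_del he)) (npart_mem hZ.1), ?_⟩
      have h4 := npart_bd v Z
      rw [hZ.2.2, map_zero] at h4
      have h5 := eq_of_add2 h4.symm
      rw [map_add, map_add, h3, h5, h2, add_comm (lpart v Z), ← add_assoc, add_assoc, add_self2, add_zero]
  · exfalso
    have h1 := lpart_bd v b
    rw [hbx, map_add, hx2, add_zero] at h1
    exact l1 _ (lpart_mem hK hb) h1.symm

lemma Acyc.del {N : Finset (Finset V)} (hN : Cx N) {w : V} (h1 : Acyc N) (h2 : Acyc (lk N w)) : Acyc (del N {w}) := by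
  intro x hx hx0
  obtain ⟨b, hb, hbx⟩ := h1 x (Ch_mono del_subset hx) hx0
  obtain ⟨hx1, hx2⟩ := npart_id hx
  have h3 := lpart_bd w b
  rw [hbx, hx2] at h3
  have h4 := npart_bd w b
  rw [hbx, hx1] at h4
  obtain ⟨e, he, h5⟩ := h2 (lpart w b) (lpart_mem hN hb) h3.symm
  refine ⟨npart w b + e, Submodule.add_mem _ (npart_mem hb) (Ch_mono lk_sub_del he), ?_⟩
  rw [map_add, h5, h4]

lemma del_cx {K : Finset (Finset V)} (hK : Cx K) (σ : Finset V) : Cx (del K σ) := by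
  refine ⟨mem_del.2 ⟨hK.1, disjoint_empty_left _⟩, fun s hs t hts => ?_⟩
  rw [mem_del] at *
  exact ⟨hK.2 _ hs.1 _ hts, disjoint_of_subset_left hts hs.2⟩

lemma HS.acyc {σ : Finset V} : ∀ {k : ℕ} {K : Finset (Finset V)}, HS k K → σ ∈ K → σ.Nonempty → Acyc (del K σ) := by
  induction σ using Finset.induction_on with
  | empty => intro k K _ _ h; simp at h
  | @insert w σ hw ih =>
    intro k K h hσ _
    have hK := h.cx
    have hwK : {w} ∈ K := hK.vert hσ (mem_insert_self _ _)
    obtain ⟨k, rfl⟩ : ∃ j, k = j + 1 := by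
      cases k with
      | zero => have := h.card_le _ hwK; simp at this
      | succ k => exact ⟨k, rfl⟩
    rcases σ.eq_empty_or_nonempty with rfl | hne
    · exact h.acyc_del hwK
    · have h1 : Acyc (_root_.HS.del K σ) := ih h (hK.2 _ hσ _ (subset_insert _ _)) hne
      have h2 : Acyc (_root_.HS.del (_root_.HS.lk K w) σ) := ih (h.lk hwK) (hK.mem_lk.2 ⟨hw, hσ⟩) hne
      have e1 : _root_.HS.lk (_root_.HS.del K σ) w = _root_.HS.del (_root_.HS.lk K w) σ := by
        ext t
        simp only [mem_lk, mem_del, disjoint_insert_left]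
        tauto
      have e2 : _root_.HS.del (_root_.HS.del K σ) {w} = _root_.HS.del K (insert w σ) := by
        ext t
        simp only [mem_del, disjoint_insert_right, disjoint_singleton_right]
        tauto
      rw [← e2]
      exact Acyc.del (del_cx hK σ) h1 (e1 ▸ h2)

/-- neighbours of a face -/
def nb (K : Finset (Finset V)) (r : Finset V) : Finset V := (vs K).filter (fun x => x ∉ r ∧ insert x r ∈ K)

lemma mem_nb {K : Finset (Finset V)} {r : Finset V} {x : V} : x ∈ nb K r ↔ x ∉ r ∧ insert x r ∈ K := by
  simp only [nb, mem_filter]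
  exact ⟨fun h => h.2, fun h => ⟨mem_vs.2 ⟨_, h.2, mem_insert_self _ _⟩, h⟩⟩

/-- every ridge in exactly two facets -/
lemma HS.closed {k : ℕ} : ∀ {K : Finset (Finset V)}, HS (k + 1) K → ∀ r ∈ K, r.card = k → (nb K r).card = 2 := by
  induction k with
  | zero =>
    intro K h r hr hc
    rw [card_eq_zero] at hc; subst hc
    have hK := h.cx
    obtain ⟨⟨Z, hZ, hne⟩, hfund⟩ := h.fund
    obtain ⟨-, -, z3⟩ := hfund Z hZ hne
    have key : ∀ u w, {u} ∈ K → {w} ∈ K → u ≠ w → bs {u} + bs {w} = Z := by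
      intro u w hu hw huw
      have hT : Top 1 K (bs {u} + bs {w}) := by
        refine ⟨Submodule.add_mem _ (bs_mem.2 (mem_coe.2 hu)) (bs_mem.2 (mem_coe.2 hw)),
          Submodule.add_mem _ (bs_mem.2 (by simp)) (bs_mem.2 (by simp)), ?_⟩
        simp only [map_add, bd_bs, sum_singleton]
        simp only [erase_singleton]; exact add_self2 _
      refine (z3 _ hT).resolve_left fun h0 => ?_
      have := DFunLike.congr_fun h0 {u}
      simp only [Finsupp.add_apply, bs_apply] at this
      simp [huw.symm] at this
    obtain ⟨f, hf, hfc, -⟩ := h.pure hK.1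
    obtain ⟨u, rfl⟩ := card_eq_one.1 hfc
    obtain ⟨g, hg, hgc, hug⟩ := h.avoid u
    obtain ⟨w, rfl⟩ := card_eq_one.1 hgc
    have huw : u ≠ w := by simpa using hug
    rw [card_eq_two]
    refine ⟨u, w, huw, ?_⟩
    ext x
    rw [mem_nb]
    simp only [notMem_empty, not_false_eq_true, true_and, mem_insert, mem_singleton, insert_empty_eq]
    constructor
    · intro hx
      by_contra hcon
      push Not at hcon
      have h1 := key u w hf hg huw
      have h2 := key u x hf hx hcon.1.symm
      rw [← h2] at h1
      have := DFunLike.congr_fun h1 {w}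
      simp only [Finsupp.add_apply, bs_apply] at this
      simp [huw, hcon.2] at this
    · rintro (rfl | rfl)
      · exact hf
      · exact hg
  | succ k ih =>
    intro K h r hr hc
    have hK := h.cx
    obtain ⟨v, hv⟩ : r.Nonempty := by rw [← card_pos]; omega
    rw [← ih (h.lk (hK.vert hr hv)) _ (lk_erase hK hr hv) (by rw [card_erase_of_mem hv, hc]; rfl)]
    congr 1
    ext x
    rw [mem_nb, mem_nb, hK.mem_lk]
    by_cases hxv : x = v
    · subst hxv; simp [hv]
    · have e1 : insert v (insert x (r.erase v)) = insert x r := by rw [insert_comm, insert_erase hv]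
      rw [e1]
      simp only [mem_erase, mem_insert]
      constructor
      · rintro ⟨h1, h2⟩; exact ⟨fun h => h1 h.2, by simp [Ne.symm hxv], h2⟩
      · rintro ⟨h1, h2, h3⟩; exact ⟨fun h => h1 ⟨hxv, h⟩, h3⟩

end
end HS

namespace HS
open Finset
set_option linter.all false
section

/-- evaluation-forcing combinator -/
def frc {α : Type} (n : ℕ) (k : ℕ → α) : α := Nat.rec (motive := fun _ => α) (k 0) (fun m _ => k (Nat.succ m)) n

def ite2 {α : Type} (b : Bool) (x y : α) : α := Bool.rec (motive := fun _ => α) y x b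

/-- `j`-th slot of width `s` -/
def slot (s A j : ℕ) : ℕ := Nat.mod (Nat.shiftRight A (Nat.mul s j)) (Nat.pow 2 s)

/-- `n` faces, `m` ridges; `A0` packed face-to-ridge matrix, `C` packed ridge-to-face matrix, `E = ∑ 2^(m*j)` -/
def brl (m A0 : ℕ) (rec : ℕ → ℕ → ℕ → ℕ → ℕ → Bool) (E F O T A : ℕ) (l : ℕ) : ℕ → ℕ → Bool :=
  Nat.rec (motive := fun _ => ℕ → ℕ → Bool) (fun _ _ => false)
    (fun _ ih c X => ite2 (Nat.beq c 0) true
      (frc (Nat.log2 c) fun f => frc (Nat.pow 2 f) fun q => frc (slot m A f) fun v =>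
        ite2 (ite2 (Nat.beq v 0) true
          (frc (slot m A0 f) fun b => frc (Nat.lor F q) fun F' => frc (Nat.lor O b) fun O' =>
            frc (Nat.lor T (Nat.land O b)) fun T' =>
            frc (Nat.xor A (Nat.mul (Nat.land (Nat.shiftRight A (Nat.log2 v)) E) v)) fun A' => rec F' X O' T' A'))
          (frc (Nat.xor c q) fun c' => frc (Nat.lor X q) fun X' => ih c' X') false)) l

def srch (n m A0 C E : ℕ) (l : ℕ) : ℕ → ℕ → ℕ → ℕ → ℕ → Bool :=
  Nat.rec (motive := fun _ => ℕ → ℕ → ℕ → ℕ → ℕ → Bool) (fun _ _ _ _ _ => false)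
   (fun _ ih F X O T A =>
     frc (slot n C (Nat.log2 (Nat.xor O T))) fun w => frc (Nat.land w F) fun x =>
      ite2 (Nat.beq x 0) false (ite2 (Nat.beq (Nat.pow 2 (Nat.log2 x)) x)
        (frc (Nat.xor w (Nat.land w (Nat.lor F X))) fun c => brl m A0 ih E F O T A 8 c X) false)) l

def start (n m A0 C E X : ℕ) (l : List ℕ) : Bool :=
  List.rec (motive := fun _ => ℕ → ℕ → ℕ → ℕ → Bool) (fun F O T A => srch n m A0 C E 36 F X O T A)
   (fun f _ ih F O T A =>
      frc (Nat.pow 2 f) fun q => frc (slot m A f) fun v =>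
        ite2 (Nat.beq v 0) true
          (frc (slot m A0 f) fun b => frc (Nat.lor F q) fun F' => frc (Nat.lor O b) fun O' =>
            frc (Nat.lor T (Nat.land O b)) fun T' =>
            frc (Nat.xor A (Nat.mul (Nat.land (Nat.shiftRight A (Nat.log2 v)) E) v)) fun A' => ih F' O' T' A')) l 0 0 0 A0

/-- packing of an incidence matrix -/
def pack (s : ℕ) (p : ℕ → ℕ → Bool) (rows cols : List ℕ) : ℕ :=
  rows.foldr (fun a N => N * 2 ^ s + cols.foldr (fun b M => 2 * M + (p a b).toNat) 0) 0

def inc (f r : ℕ) : Bool := Nat.beq (Nat.land f r) r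

def codes (k : ℕ) : List ℕ :=
  ((List.range 128).filter (fun c => (List.range 7).countP (fun i => c.testBit i) == k)).reverse

def run (k : ℕ) (l e : List ℕ) (X : ℕ) : Bool :=
  frc (pack (e.length) inc (codes k) e) fun A0 => frc (pack (codes k).length (fun a b => inc b a) e (codes k)) fun C =>
   frc (pack (e.length) (fun _ _ => true) (codes k) [0]) fun E =>
   frc (codes k).length fun n => frc e.length fun m => start n m A0 C E X l

lemma frc_eq {α : Type} (n : ℕ) (k : ℕ → α) : frc n k = k n := by cases n <;> rfl
lemma ite2_eq {α : Type} (b : Bool) (x y : α) : ite2 b x y = if b = true then x else y := by cases b <;> rfl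

lemma slot_def (s A j : ℕ) : slot s A j = (A >>> (s * j)) % 2 ^ s := rfl

lemma slot_testBit (s A j i : ℕ) : (slot s A j).testBit i = (decide (i < s) && A.testBit (s * j + i)) := by
  rw [slot_def, Nat.testBit_mod_two_pow, Nat.testBit_shiftRight]

lemma slot_xor (s A B j : ℕ) : slot s (A ^^^ B) j = slot s A j ^^^ slot s B j := by
  apply Nat.eq_of_testBit_eq
  intro i
  simp only [slot_testBit, Nat.testBit_xor]
  by_cases h : i < s <;> simp [h]

lemma slot_lt (s A j : ℕ) : slot s A j < 2 ^ s := Nat.mod_lt _ (Nat.two_pow_pos s)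

lemma slot_zero' {s a : ℕ} (b : ℕ) (ha : a < 2 ^ s) : slot s (b * 2 ^ s + a) 0 = a := by
  rw [slot_def, Nat.mul_zero, Nat.shiftRight_zero, Nat.mul_comm, Nat.mul_add_mod, Nat.mod_eq_of_lt ha]

lemma slot_succ' {s a : ℕ} (b : ℕ) (ha : a < 2 ^ s) (j : ℕ) : slot s (b * 2 ^ s + a) (j + 1) = slot s b j := by
  rw [slot_def, slot_def, show s * (j + 1) = s + s * j by ring, Nat.shiftRight_add]
  congr 2
  rw [Nat.shiftRight_eq_div_pow, Nat.mul_comm, Nat.mul_add_div (by positivity), Nat.div_eq_of_lt ha, Nat.add_zero]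

lemma slot_mul {s v : ℕ} (hs : 0 < s) (hv : v < 2 ^ s) (j : ℕ) : ∀ (M : ℕ), (∀ i, M.testBit i = true → s ∣ i) →
    slot s (M * v) j = if M.testBit (s * j) then v else 0 := by
  have key : ∀ M : ℕ, (∀ i, M.testBit i = true → s ∣ i) → M = (M >>> s) * 2 ^ s + (M.testBit 0).toNat := by
    intro M hM
    have h1 : M % 2 ^ s = (M.testBit 0).toNat := by
      apply Nat.eq_of_testBit_eq
      intro i
      rw [Nat.testBit_mod_two_pow]
      rcases Nat.eq_zero_or_pos i with rfl | hi
      · rcases Nat.mod_two_eq_zero_or_one M with h | h <;> simp [hs, h]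
      · have h2 : (M.testBit 0).toNat.testBit i = false := by
          apply Nat.testBit_lt_two_pow
          calc (M.testBit 0).toNat < 2 := Bool.toNat_lt _
            _ = 2 ^ 1 := rfl
            _ ≤ 2 ^ i := Nat.pow_le_pow_right (by norm_num) hi
        rw [h2]
        by_contra h
        simp at h
        exact absurd (Nat.le_of_dvd hi (hM i h.2)) (by omega)
    rw [Nat.shiftRight_eq_div_pow, ← h1, Nat.mul_comm]
    exact (Nat.div_add_mod M (2 ^ s)).symm
  have hlt : ∀ b : Bool, b.toNat * v < 2 ^ s := by
    intro b; cases b <;> simp [hv]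
  induction j with
  | zero =>
    intro M hM
    have h := key M hM
    conv_lhs => rw [h]
    rw [show ((M >>> s) * 2 ^ s + (M.testBit 0).toNat) * v = ((M >>> s) * v) * 2 ^ s + (M.testBit 0).toNat * v by ring,
      slot_zero' _ (hlt _), Nat.mul_zero]
    cases M.testBit 0 <;> simp
  | succ j ih =>
    intro M hM
    have h := key M hM
    conv_lhs => rw [h]
    rw [show ((M >>> s) * 2 ^ s + (M.testBit 0).toNat) * v = ((M >>> s) * v) * 2 ^ s + (M.testBit 0).toNat * v by ring,
      slot_succ' _ (hlt _), ih]
    · rw [Nat.testBit_shiftRight, Nat.mul_add, Nat.mul_one, Nat.add_comm]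
    · intro i hi
      rw [Nat.testBit_shiftRight] at hi
      have := hM _ hi
      simpa using this

lemma row_testBit (q : ℕ → Bool) (l : List ℕ) : ∀ i, (l.foldr (fun b M => 2 * M + (q b).toNat) 0).testBit i =
    (l[i]?.elim false q) := by
  induction l with
  | nil => intro i; simp
  | cons b l ih =>
    intro i
    rw [List.foldr_cons]
    set N := l.foldr (fun b M => 2 * M + (q b).toNat) 0
    have e : 2 * N + (q b).toNat = Nat.bit (q b) N := by rw [Nat.bit_val]
    rw [e]
    cases i with
    | zero => simp [Nat.testBit_bit_zero]
    | succ i => rw [Nat.testBit_bit_succ, ih]; simp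

lemma row_lt (q : ℕ → Bool) (l : List ℕ) : l.foldr (fun b M => 2 * M + (q b).toNat) 0 < 2 ^ l.length := by
  induction l with
  | nil => simp
  | cons b l ih =>
    rw [List.foldr_cons, List.length_cons, pow_succ]
    have := Bool.toNat_lt (q b)
    omega

lemma pack_testBit {s : ℕ} (p : ℕ → ℕ → Bool) {cols : List ℕ} (hc : cols.length ≤ s) (rows : List ℕ) : ∀ j i,
    (slot s (pack s p rows cols) j).testBit i = rows[j]?.elim false (fun a => cols[i]?.elim false (p a)) := by
  have hlt : ∀ a, cols.foldr (fun b M => 2 * M + (p a b).toNat) 0 < 2 ^ s :=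
    fun a => lt_of_lt_of_le (row_lt _ _) (Nat.pow_le_pow_right (by norm_num) hc)
  induction rows with
  | nil => intro j i; simp [pack, slot_testBit]
  | cons a rows ih =>
    intro j i
    have e : pack s p (a :: rows) cols = pack s p rows cols * 2 ^ s + cols.foldr (fun b M => 2 * M + (p a b).toNat) 0 := rfl
    rw [e]
    cases j with
    | zero => rw [slot_zero' _ (hlt a), row_testBit]; simp
    | succ j => rw [slot_succ' _ (hlt a), ih]; simp

def bv (N r : ℕ) : ZMod 2 := if N.testBit r = true then 1 else 0

lemma bv_xor (a b r : ℕ) : bv (a ^^^ b) r = bv a r + bv b r := by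
  unfold bv
  rw [Nat.testBit_xor]
  cases a.testBit r <;> cases b.testBit r <;> simp
  decide

lemma bv_zero (r : ℕ) : bv 0 r = 0 := by simp [bv]

def Inv (n m A0 : ℕ) (D : ℕ → Prop) (F X A : ℕ) : Prop :=
  (∀ f, F.testBit f = true → D f) ∧ (∀ f, X.testBit f = true → ¬ D f) ∧
  ∀ j, ∃ x : ℕ → ZMod 2, (∀ f, x f ≠ 0 → F.testBit f = true) ∧
    ∀ r, bv (slot m A j) r = bv (slot m A0 j) r + ∑ f ∈ range n, x f * bv (slot m A0 f) r

structure Sys (n m A0 C E : ℕ) (D : ℕ → Prop) : Prop where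
  hm : 0 < m
  hE : ∀ i, E.testBit i = true → m ∣ i
  hD : ∀ f, D f → f < n
  hC : ∀ r f, (slot n C r).testBit f = true ↔ f < n ∧ (slot m A0 f).testBit r = true
  hfree : ∀ r, ¬ ∃! f, D f ∧ (slot m A0 f).testBit r = true
  hcyc : ∀ x : ℕ → ZMod 2, (∀ f, x f ≠ 0 → D f) → (∀ r, ∑ f ∈ range n, x f * bv (slot m A0 f) r = 0) → ∀ f, x f = 0

section
variable {n m A0 C E : ℕ} {D : ℕ → Prop}

lemma Inv.step (S : Sys n m A0 C E D) {F X A f : ℕ} (h : Inv n m A0 D F X A) (hf : D f) (hF : F.testBit f = false) :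
    slot m A f ≠ 0 ∧ Inv n m A0 D (F ||| 2 ^ f) X
      (A ^^^ (((A >>> Nat.log2 (slot m A f)) &&& E) * slot m A f)) := by
  obtain ⟨h1, h2, h3⟩ := h
  obtain ⟨x, hx1, hx2⟩ := h3 f
  let y : ℕ → ZMod 2 := fun g => x g + if g = f then 1 else 0
  have hy : ∀ r, bv (slot m A f) r = ∑ g ∈ range n, y g * bv (slot m A0 g) r := by
    intro r
    rw [hx2 r]
    simp only [y, add_mul, Finset.sum_add_distrib]
    rw [add_comm]
    congr 1
    simp [S.hD f hf]
  have hyF : ∀ g, y g ≠ 0 → (F ||| 2 ^ f).testBit g = true := by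
    intro g hg
    rw [Nat.testBit_or, Nat.testBit_two_pow]
    by_cases e : f = g
    · simp [e]
    · have : y g = x g := by simp [y, Ne.symm e]
      rw [this] at hg
      simp [hx1 g hg]
  have hF' : ∀ g, (F ||| 2 ^ f).testBit g = true → D g := by
    intro g hg
    rw [Nat.testBit_or, Nat.testBit_two_pow] at hg
    rcases Bool.or_eq_true_iff.1 hg with hg | hg
    · exact h1 g hg
    · rw [← of_decide_eq_true hg]; exact hf
  refine ⟨?_, hF', h2, ?_⟩
  · intro h0
    have := S.hcyc y (fun g hg => hF' g (hyF g hg)) (fun r => by rw [← hy r, h0, bv_zero]) f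
    have hxf : x f = 0 := by
      by_contra hne
      have := hx1 f hne
      rw [hF] at this
      simp at this
    simp [y, hxf] at this
  · intro j
    obtain ⟨z, hz1, hz2⟩ := h3 j
    set M := (A >>> Nat.log2 (slot m A f)) &&& E with hMdef
    have hM : ∀ i, M.testBit i = true → m ∣ i := by
      intro i hi
      rw [hMdef, Nat.testBit_and, Bool.and_eq_true] at hi
      exact S.hE i hi.2
    have hs := slot_mul S.hm (slot_lt m A f) j M hM
    rw [slot_xor, hs]
    by_cases hb : M.testBit (m * j) = true
    · refine ⟨fun g => z g + y g, ?_, ?_⟩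
      · intro g hg
        by_cases hyg : y g = 0
        · simp only [hyg, add_zero] at hg
          rw [Nat.testBit_or, hz1 g hg]; rfl
        · exact hyF g hyg
      · intro r
        rw [if_pos hb, bv_xor, hz2 r, hy r]
        simp only [add_mul, Finset.sum_add_distrib, add_assoc]
    · refine ⟨z, ?_, ?_⟩
      · intro g hg
        rw [Nat.testBit_or, hz1 g hg]; rfl
      · intro r
        rw [if_neg hb, bv_xor, hz2 r, bv_zero, add_zero]

lemma brl_zero (rec : ℕ → ℕ → ℕ → ℕ → ℕ → Bool) (F O T A c X : ℕ) : brl m A0 rec E F O T A 0 c X = false := rfl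

lemma brl_succ (rec : ℕ → ℕ → ℕ → ℕ → ℕ → Bool) (F O T A l c X : ℕ) : brl m A0 rec E F O T A (l+1) c X =
   ite2 (Nat.beq c 0) true
      (frc (Nat.log2 c) fun f => frc (Nat.pow 2 f) fun q => frc (slot m A f) fun v =>
        ite2 (ite2 (Nat.beq v 0) true
          (frc (slot m A0 f) fun b => frc (Nat.lor F q) fun F' => frc (Nat.lor O b) fun O' =>
            frc (Nat.lor T (Nat.land O b)) fun T' =>
            frc (Nat.xor A (Nat.mul (Nat.land (Nat.shiftRight A (Nat.log2 v)) E) v)) fun A' => rec F' X O' T' A'))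
          (frc (Nat.xor c q) fun c' => frc (Nat.lor X q) fun X' => brl m A0 rec E F O T A l c' X') false) := rfl

lemma srch_succ (l F X O T A : ℕ) : srch n m A0 C E (l+1) F X O T A =
     frc (slot n C (Nat.log2 (Nat.xor O T))) fun w => frc (Nat.land w F) fun x =>
      ite2 (Nat.beq x 0) false (ite2 (Nat.beq (Nat.pow 2 (Nat.log2 x)) x)
        (frc (Nat.xor w (Nat.land w (Nat.lor F X))) fun c => brl m A0 (srch n m A0 C E l) E F O T A 8 c X) false) := rfl

lemma brl_sound (S : Sys n m A0 C E D) (rec : ℕ → ℕ → ℕ → ℕ → ℕ → Bool)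
    (hrec : ∀ F X O T A, Inv n m A0 D F X A → rec F X O T A = true → False) (F O T A : ℕ) (l : ℕ) :
    ∀ c X, Inv n m A0 D F X A → (∀ f, c.testBit f = true → F.testBit f = false) →
      brl m A0 rec E F O T A l c X = true → ∀ f, c.testBit f = true → ¬ D f := by
  induction l with
  | zero => intro c X _ _ h; rw [brl_zero] at h; simp at h
  | succ l ih =>
    intro c X hI hc h f hf hDf
    rw [brl_succ] at h
    simp only [frc_eq, ite2_eq] at h
    by_cases c0 : c = 0
    · simp [c0] at hf
    have e1 : ¬ Nat.beq c 0 = true := by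
      intro hh; exact c0 (Nat.eq_of_beq_eq_true hh)
    rw [if_neg e1] at h
    set g := Nat.log2 c with hg
    have hgc : c.testBit g = true := Nat.testBit_log2 c0
    split_ifs at h with h1 h2 h2
    all_goals try (simp at h; done)
    all_goals
      have hDg : ¬ D g := by
        intro hDg
        obtain ⟨a1, a2⟩ := hI.step S hDg (hc g hgc)
        first
          | exact a1 (Nat.eq_of_beq_eq_true h1)
          | exact hrec _ _ _ _ _ a2 h1
          | exact hrec _ _ _ _ _ a2 h2
      have hfg : f ≠ g := by rintro rfl; exact hDg hDf
      have hbit : ∀ i, (Nat.xor c (Nat.pow 2 g)).testBit i = (c.testBit i ^^ decide (g = i)) := by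
        intro i
        show (c ^^^ 2 ^ g).testBit i = _
        rw [Nat.testBit_xor, Nat.testBit_two_pow]
      refine ih _ _ ?_ ?_ h f ?_ hDf
      · refine ⟨hI.1, ?_, hI.2.2⟩
        intro i hi
        have hi : (X ||| 2 ^ g).testBit i = true := hi
        rw [Nat.testBit_or, Nat.testBit_two_pow] at hi
        rcases Bool.or_eq_true_iff.1 hi with hi | hi
        · exact hI.2.1 i hi
        · rw [← of_decide_eq_true hi]; exact hDg
      · intro i hi
        rw [hbit] at hi
        by_cases e : g = i
        · rw [← e]; exact hc g hgc
        · apply hc; simpa [e] using hi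
      · rw [hbit, hf]; simp [Ne.symm hfg]

lemma srch_sound (S : Sys n m A0 C E D) (l : ℕ) :
    ∀ F X O T A, Inv n m A0 D F X A → srch n m A0 C E l F X O T A = true → False := by
  induction l with
  | zero => intro F X O T A _ h; exact Bool.false_ne_true h
  | succ l ih =>
    intro F X O T A hI h
    rw [srch_succ] at h
    simp only [frc_eq, ite2_eq] at h
    set r := Nat.log2 (Nat.xor O T)
    set w := slot n C r with hw
    split_ifs at h with h1 h2
    set f0 := Nat.log2 (Nat.land w F)
    have e : w &&& F = 2 ^ f0 := (Nat.eq_of_beq_eq_true h2).symm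
    have hb : ∀ i, (w.testBit i && F.testBit i) = decide (f0 = i) := by
      intro i
      rw [← Nat.testBit_and, e, Nat.testBit_two_pow]
    have h0 := hb f0
    simp only [decide_true, Bool.and_eq_true] at h0
    apply S.hfree r
    refine ⟨f0, ⟨hI.1 _ h0.2, ((S.hC r f0).1 h0.1).2⟩, ?_⟩
    rintro f ⟨hf1, hf2⟩
    have hwf : w.testBit f = true := (S.hC r f).2 ⟨S.hD f hf1, hf2⟩
    by_contra hne
    have hFf : F.testBit f = false := by
      have := hb f
      rw [hwf] at this
      simpa [Ne.symm hne] using this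
    have hXf : X.testBit f = false := by
      by_contra hX
      exact hI.2.1 f (by simpa using hX) hf1
    have hcb : ∀ i, (Nat.xor w (Nat.land w (Nat.lor F X))).testBit i = (w.testBit i ^^ (w.testBit i && (F.testBit i || X.testBit i))) := by
      intro i
      show (w ^^^ (w &&& (F ||| X))).testBit i = _
      rw [Nat.testBit_xor, Nat.testBit_and, Nat.testBit_or]
    refine brl_sound S _ ih F O T A 8 _ X hI ?_ h f ?_ hf1
    · intro i hi
      rw [hcb] at hi
      revert hi
      cases w.testBit i <;> cases F.testBit i <;> simp
    · rw [hcb, hwf, hFf, hXf]; rfl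

lemma start_sound (S : Sys n m A0 C E D) {X : ℕ} (hX : ∀ f, X.testBit f = true → ¬ D f) {l : List ℕ} (hl : l.Nodup)
    (hlD : ∀ f ∈ l, D f) (h : start n m A0 C E X l = true) : False := by
  have key : ∀ l : List ℕ, l.Nodup → (∀ f ∈ l, D f) → ∀ F O T A, Inv n m A0 D F X A → (∀ f ∈ l, F.testBit f = false) →
     List.rec (motive := fun _ => ℕ → ℕ → ℕ → ℕ → Bool) (fun F O T A => srch n m A0 C E 36 F X O T A)
   (fun f _ ih F O T A =>
      frc (Nat.pow 2 f) fun q => frc (slot m A f) fun v =>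
        ite2 (Nat.beq v 0) true
          (frc (slot m A0 f) fun b => frc (Nat.lor F q) fun F' => frc (Nat.lor O b) fun O' =>
            frc (Nat.lor T (Nat.land O b)) fun T' =>
            frc (Nat.xor A (Nat.mul (Nat.land (Nat.shiftRight A (Nat.log2 v)) E) v)) fun A' => ih F' O' T' A')) l F O T A = true → False := by
    intro l
    induction l with
    | nil => intro _ _ F O T A hI _ h; exact srch_sound S 36 F X O T A hI h
    | cons f l ih =>
      intro hl hlD F O T A hI hF h
      simp only [frc_eq, ite2_eq] at h ih
      rw [List.nodup_cons] at hl
      obtain ⟨a1, a2⟩ := hI.step S (hlD f (by simp)) (hF f (by simp))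
      rw [if_neg (fun hh => a1 (Nat.eq_of_beq_eq_true hh))] at h
      refine ih hl.2 (fun g hg => hlD g (by simp [hg])) _ _ _ _ a2 ?_ h
      intro g hg
      rw [Nat.testBit_or, Nat.testBit_two_pow, hF g (by simp [hg])]
      have : f ≠ g := by rintro rfl; exact hl.1 hg
      simp [this]
  refine key l hl hlD 0 0 0 A0 ⟨by simp, hX, fun j => ⟨0, by simp, by simp⟩⟩ (by simp) h
end

end
end HS

namespace HS
open Finset
open scoped Classical
set_option linter.all false
section

def dec (c : ℕ) : Finset ℕ := (range 7).filter (fun i => c.testBit i = true)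
def cod (s : Finset ℕ) : ℕ := ∑ i ∈ s, 2 ^ i

lemma dec_facts : ∀ c ∈ range 128, cod (dec c) = c ∧ (dec c).card = (List.range 7).countP (fun i => c.testBit i) := by
  decide +kernel

lemma cod_facts : ∀ s ∈ (range 7).powerset, cod s < 128 ∧ dec (cod s) = s := by
  decide +kernel

lemma dec_mem (c i : ℕ) : i ∈ dec c ↔ i < 7 ∧ c.testBit i = true := by simp [dec]

lemma inc_iff {a b : ℕ} (hb : b < 128) : inc a b = true ↔ dec b ⊆ dec a := by
  have h1 : inc a b = true ↔ a &&& b = b := ⟨Nat.eq_of_beq_eq_true, fun h => by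
    unfold inc
    show Nat.beq (a &&& b) b = true
    rw [h]; exact Nat.beq_refl b⟩
  rw [h1]
  constructor
  · intro h i hi
    rw [dec_mem] at hi ⊢
    rw [← h, Nat.testBit_and, Bool.and_eq_true] at hi
    exact ⟨hi.1, hi.2.1⟩
  · intro h
    apply Nat.eq_of_testBit_eq
    intro i
    rw [Nat.testBit_and]
    by_cases hi : b.testBit i = true
    · have h7 : i < 7 := by
        by_contra h7
        have : b.testBit i = false := Nat.testBit_lt_two_pow (lt_of_lt_of_le hb (by
          calc 128 = 2 ^ 7 := by norm_num
            _ ≤ 2 ^ i := Nat.pow_le_pow_right (by norm_num) (by omega)))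
        rw [this] at hi; simp at hi
      have := ((dec_mem a i).1 (h ((dec_mem b i).2 ⟨h7, hi⟩))).2
      rw [hi, this]; rfl
    · simp at hi
      simp [hi]

lemma codes_nodup (k : ℕ) : (codes k).Nodup := by
  unfold codes
  rw [List.nodup_reverse]
  exact List.Nodup.filter _ List.nodup_range

lemma mem_codes {k c : ℕ} : c ∈ codes k ↔ c < 128 ∧ (dec c).card = k := by
  unfold codes
  rw [List.mem_reverse, List.mem_filter, List.mem_range]
  constructor
  · rintro ⟨h, h2⟩
    exact ⟨h, by rw [(dec_facts c (by simpa using h)).2]; simpa using h2⟩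
  · rintro ⟨h, h2⟩
    rw [(dec_facts c (by simpa using h)).2] at h2
    exact ⟨h, by simpa using h2⟩

lemma cod_mem {k : ℕ} {s : Finset ℕ} (h : s ⊆ range 7) (hc : s.card = k) : cod s ∈ codes k := by
  have := cod_facts s (by simpa using h)
  rw [mem_codes, this.2]
  exact ⟨this.1, hc⟩

lemma run_sound {k X : ℕ} {l e : List ℕ} {G : Finset (Finset ℕ)} (hrun : run k l e X = true)
    (he : ∀ r ∈ e, r < 128) (hle : 0 < e.length) (hl : l.Nodup)
    (hl' : ∀ j ∈ l, ∃ c, (codes k)[j]? = some c ∧ dec c ∈ G)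
    (hX : ∀ j, X.testBit j = true → ∀ c, (codes k)[j]? = some c → dec c ∉ G)
    (hG : ∀ s ∈ G, s ⊆ range 7 ∧ s.card = k)
    (hfree : ∀ r ∈ e, ¬ ∃! s, s ∈ G ∧ dec r ⊆ s)
    (hcyc : ∀ z : Finset ℕ → ZMod 2, (∀ s, z s ≠ 0 → s ∈ G) → (∀ r ∈ e, ∑ s ∈ G.filter (fun s => dec r ⊆ s), z s = 0) → ∀ s, z s = 0) :
    False := by
  unfold run at hrun
  simp only [frc_eq] at hrun
  set n := (codes k).length with hn
  set m := e.length with hm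
  set A0 := pack m inc (codes k) e with hA0
  have hA : ∀ f r, (slot m A0 f).testBit r = true ↔ ∃ c, (codes k)[f]? = some c ∧ ∃ ρ, e[r]? = some ρ ∧ dec ρ ⊆ dec c := by
    intro f r
    rw [hA0, pack_testBit inc (le_refl _)]
    rcases h1 : (codes k)[f]? with _ | c <;> rcases h2 : e[r]? with _ | ρ <;> simp
    exact inc_iff (he ρ (List.mem_of_getElem? h2))
  have hidx : ∀ s ∈ G, (codes k)[(codes k).idxOf (cod s)]? = some (cod s) ∧ (codes k).idxOf (cod s) < n := by
    intro s hs
    have := cod_mem (hG s hs).1 (hG s hs).2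
    have h2 := List.idxOf_lt_length_iff.2 this
    refine ⟨?_, h2⟩
    rw [List.getElem?_eq_getElem h2, List.getElem_idxOf]
  have hdc : ∀ s ∈ G, dec (cod s) = s := fun s hs => (cod_facts s (by simpa using (hG s hs).1)).2
  have hinj : ∀ {i j c : ℕ}, (codes k)[i]? = some c → (codes k)[j]? = some c → i = j := by
    intro i j c h1 h2
    have hi : i < n := (List.getElem?_eq_some_iff.1 h1).1
    exact (List.getElem?_inj hi (codes_nodup k)).1 (h1.trans h2.symm)
  have hlt : ∀ {f c : ℕ}, (codes k)[f]? = some c → f < n := fun h => (List.getElem?_eq_some_iff.1 h).1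
  have hcd : ∀ {f c : ℕ}, (codes k)[f]? = some c → cod (dec c) = c := fun h =>
    (dec_facts _ (by simpa using (mem_codes.1 (List.mem_of_getElem? h)).1)).1
  let D : ℕ → Prop := fun f => ∃ c, (codes k)[f]? = some c ∧ dec c ∈ G
  refine start_sound (D := D) ?_ ?_ hl hl' hrun
  · refine ⟨hle, ?_, ?_, ?_, ?_, ?_⟩
    · intro i hi
      have e1 : m * (i / m) + i % m = i := Nat.div_add_mod i m
      have h1 := slot_testBit m (pack m (fun _ _ => true) (codes k) [0]) (i / m) (i % m)
      rw [e1, hi, pack_testBit _ (by simpa using Nat.succ_le_of_lt hle)] at h1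
      have h2 : i % m < m := Nat.mod_lt _ hle
      simp only [h2, decide_true, Bool.and_true] at h1
      rcases Nat.eq_zero_or_pos (i % m) with h0 | h0
      · exact Nat.dvd_of_mod_eq_zero h0
      · exfalso
        have : ([0] : List ℕ)[i % m]? = none := by
          rw [List.getElem?_eq_none_iff]; simpa using Nat.succ_le_of_lt h0
        rw [this] at h1
        rcases h3 : (codes k)[i / m]? with _ | c <;> rw [h3] at h1 <;> simp at h1
    · rintro f ⟨c, hc, _⟩
      exact hlt hc
    · intro r f
      rw [pack_testBit _ (le_refl _), hA0, pack_testBit inc (le_refl _)]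
      rcases h1 : (codes k)[f]? with _ | c <;> rcases h2 : e[r]? with _ | ρ <;> simp
      intro _
      exact hlt h1
    · rintro r ⟨f, ⟨⟨c, hc, hcG⟩, hb⟩, hu⟩
      obtain ⟨c', hc', ρ, hρ, hs⟩ := (hA f r).1 hb
      have e1 : c' = c := by rw [hc] at hc'; exact (Option.some_inj.1 hc').symm
      subst e1
      refine hfree ρ (List.mem_of_getElem? hρ) ⟨dec c', ⟨hcG, hs⟩, ?_⟩
      rintro s ⟨hsG, hss⟩
      obtain ⟨a1, a2⟩ := hidx s hsG
      have := hu _ ⟨⟨_, a1, by rw [hdc s hsG]; exact hsG⟩, (hA _ r).2 ⟨_, a1, ρ, hρ, by rw [hdc s hsG]; exact hss⟩⟩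
      rw [this, hc] at a1
      rw [Option.some_inj.1 a1, hdc s hsG]
    · intro x hx hsum f
      have hz := hcyc (fun s => if s ∈ G then x ((codes k).idxOf (cod s)) else 0) (fun s hs => by
        by_contra h; simp [h] at hs) (by
        intro ρ hρ
        obtain ⟨r, hr⟩ := List.mem_iff_getElem?.1 hρ
        rw [← hsum r]
        have e1 : ∑ f ∈ range n, x f * bv (slot m A0 f) r = ∑ f ∈ (range n).filter (fun f => D f ∧ (slot m A0 f).testBit r = true), x f := by
          rw [Finset.sum_filter]
          apply Finset.sum_congr rfl
          intro f _
          by_cases hD : D f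
          · by_cases hb : (slot m A0 f).testBit r = true <;> simp [hD, hb, bv]
          · have : x f = 0 := by by_contra h; exact hD (hx f h)
            simp [this]
        rw [e1]
        refine Finset.sum_bij' (fun s _ => (codes k).idxOf (cod s)) (fun f _ => dec ((codes k).getD f 0)) ?_ ?_ ?_ ?_ ?_
        · intro s hs
          rw [mem_filter] at hs
          obtain ⟨a1, a2⟩ := hidx s hs.1
          rw [mem_filter, mem_range]
          exact ⟨a2, ⟨_, a1, by rw [hdc s hs.1]; exact hs.1⟩, (hA _ r).2 ⟨_, a1, ρ, hr, by rw [hdc s hs.1]; exact hs.2⟩⟩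
        · intro f hf
          rw [mem_filter] at hf
          obtain ⟨_, ⟨c, hc, hcG⟩, hb⟩ := hf
          obtain ⟨c', hc', ρ', hρ', hs⟩ := (hA f r).1 hb
          rw [hr] at hρ'
          rw [hc] at hc'
          rw [List.getD_eq_getElem?_getD, hc, mem_filter]
          rw [← Option.some_inj.1 hρ', ← Option.some_inj.1 hc'] at hs
          exact ⟨hcG, hs⟩
        · intro s hs
          rw [mem_filter] at hs
          obtain ⟨a1, a2⟩ := hidx s hs.1
          simp only [List.getD_eq_getElem?_getD, a1, Option.getD_some]
          exact hdc s hs.1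
        · intro f hf
          rw [mem_filter] at hf
          obtain ⟨_, ⟨c, hc, hcG⟩, hb⟩ := hf
          simp only [List.getD_eq_getElem?_getD, hc, Option.getD_some]
          exact hinj (by have := (hidx _ hcG).1; rwa [hcd hc] at this ⊢) hc
        · intro s hs
          rw [mem_filter] at hs
          simp [hs.1])
      by_contra hne
      obtain ⟨c, hc, hcG⟩ := hx f hne
      have := hz (dec c)
      simp only [hcG, if_true] at this
      have e2 : (codes k).idxOf (cod (dec c)) = f := hinj (by have := (hidx _ hcG).1; rwa [hcd hc] at this ⊢) hc
      rw [e2] at this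
      exact hne this
  · rintro f hf ⟨c, hc, hcG⟩
    exact hX f hf c hc hcG

end
end HS

namespace HS
open Finset
set_option linter.all false
section
lemma run5 : run 5 [(codes 5).idxOf 31] (codes 4) 0 = true := by decide +kernel
lemma run2a : run 2 [(codes 2).idxOf 3] [64,32,16,8,4,2] 0 = true := by decide +kernel
lemma run2b : run 2 [(codes 2).idxOf 6] [64,32,16,8,4,2] 0 = true := by decide +kernel
lemma run4 : run 4 [(codes 4).idxOf 15,(codes 4).idxOf 23,(codes 4).idxOf 39] (codes 3) 524288 = true := by decide +kernel
lemma run3 : run 3 [(codes 3).idxOf 7,(codes 3).idxOf 11,(codes 3).idxOf 19] (codes 2) 0 = true := by decide +kernel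
end
end HS

namespace HS
open Finset
open scoped Classical
set_option linter.all false
section
variable {V W U : Type*} [DecidableEq V] [DecidableEq W] [DecidableEq U]

lemma run_V {k X : ℕ} {l e : List ℕ} {F : Finset (Finset V)} {ψ : ℕ → V} (hrun : run k l e X = true)
    (he : ∀ r ∈ e, r < 128) (hle : 0 < e.length) (hl : l.Nodup) (hψ : Set.InjOn ψ (range 7 : Finset ℕ))
    (hl' : ∀ j ∈ l, ∃ c, (codes k)[j]? = some c ∧ (dec c).image ψ ∈ F)
    (hX : ∀ j, X.testBit j = true → ∀ c, (codes k)[j]? = some c → (dec c).image ψ ∉ F)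
    (hF : ∀ s ∈ F, s ⊆ (range 7).image ψ ∧ s.card = k)
    (hfree : ∀ r ∈ e, ¬ ∃! s, s ∈ F ∧ (dec r).image ψ ⊆ s)
    (hcyc : ∀ z : Finset V → ZMod 2, (∀ s, z s ≠ 0 → s ∈ F) →
      (∀ r ∈ e, ∑ s ∈ F.filter (fun s => (dec r).image ψ ⊆ s), z s = 0) → ∀ s, z s = 0) : False := by
  have hinj : ∀ {s t : Finset ℕ}, s ⊆ range 7 → t ⊆ range 7 → (s.image ψ ⊆ t.image ψ ↔ s ⊆ t) := by
    intro s t hs ht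
    constructor
    · intro h i hi
      obtain ⟨j, hj, e⟩ := mem_image.1 (h (mem_image_of_mem ψ hi))
      have := hψ (by exact_mod_cast ht hj) (by exact_mod_cast hs hi) e
      rwa [← this]
    · exact fun h => image_subset_image h
  have hinj' : ∀ {s t : Finset ℕ}, s ⊆ range 7 → t ⊆ range 7 → s.image ψ = t.image ψ → s = t := by
    intro s t hs ht h
    exact Subset.antisymm ((hinj hs ht).1 h.le) ((hinj ht hs).1 h.ge)
  have hd : ∀ c, dec c ⊆ range 7 := fun c => filter_subset _ _
  have hpre : ∀ s ∈ F, ∃ t, t ⊆ range 7 ∧ t.image ψ = s := by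
    intro s hs
    obtain ⟨t, ht, e⟩ := subset_image_iff.1 (hF s hs).1
    exact ⟨t, by exact_mod_cast ht, e⟩
  let G : Finset (Finset ℕ) := ((range 7).powerset).filter (fun s => s.image ψ ∈ F)
  have hG : ∀ s, s ∈ G ↔ s ⊆ range 7 ∧ s.image ψ ∈ F := by intro s; simp [G]
  refine run_sound (G := G) hrun he hle hl ?_ ?_ ?_ ?_ ?_
  · intro j hj
    obtain ⟨c, h1, h2⟩ := hl' j hj
    exact ⟨c, h1, (hG _).2 ⟨hd c, h2⟩⟩
  · intro j hj c hc h
    exact hX j hj c hc ((hG _).1 h).2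
  · intro s hs
    rw [hG] at hs
    refine ⟨hs.1, ?_⟩
    rw [← (hF _ hs.2).2, card_image_of_injOn]
    exact hψ.mono (by exact_mod_cast hs.1)
  · rintro r hr ⟨s, ⟨h1, h2⟩, h3⟩
    rw [hG] at h1
    refine hfree r hr ⟨s.image ψ, ⟨h1.2, image_subset_image h2⟩, ?_⟩
    rintro t ⟨a1, a2⟩
    obtain ⟨t, ht, rfl⟩ := hpre t a1
    rw [h3 t ⟨(hG _).2 ⟨ht, a1⟩, (hinj (hd r) ht).1 a2⟩]
  · intro z hz1 hz2 s
    let y : Finset V → ZMod 2 := fun t => ∑ s ∈ G.filter (fun s => s.image ψ = t), z s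
    have hy : ∀ s ∈ G, y (s.image ψ) = z s := by
      intro s hs
      have : G.filter (fun u => u.image ψ = s.image ψ) = {s} := by
        ext u
        simp only [mem_filter, mem_singleton]
        constructor
        · rintro ⟨a, b⟩
          exact hinj' ((hG _).1 a).1 ((hG _).1 hs).1 b
        · rintro rfl; exact ⟨hs, rfl⟩
      simp only [y, this, sum_singleton]
    have h0 := hcyc y (by
      intro t ht
      obtain ⟨u, hu, _⟩ := Finset.exists_ne_zero_of_sum_ne_zero ht
      rw [mem_filter, hG] at hu
      rw [← hu.2]; exact hu.1.2) (by
      intro r hr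
      rw [← hz2 r hr]
      symm
      refine Finset.sum_bij (fun s _ => s.image ψ) ?_ ?_ ?_ ?_
      · intro a ha
        rw [mem_filter, hG] at ha
        exact mem_filter.2 ⟨ha.1.2, image_subset_image ha.2⟩
      · intro a ha b hb e
        rw [mem_filter, hG] at ha hb
        exact hinj' ha.1.1 hb.1.1 e
      · intro b hb
        rw [mem_filter] at hb
        obtain ⟨t, ht, rfl⟩ := hpre b hb.1
        exact ⟨t, mem_filter.2 ⟨(hG _).2 ⟨ht, hb.1⟩, (hinj (hd r) ht).1 hb.2⟩, rfl⟩
      · intro a ha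
        exact (hy a (mem_filter.1 ha).1).symm)
    by_contra hne
    have := hz1 s hne
    rw [← hy s this] at hne
    exact hne (h0 _)

lemma label {U : Finset V} (hU : U.card = 7) (P : List V) (hP : P.Nodup) (hPU : ∀ x ∈ P, x ∈ U) :
    ∃ ψ : ℕ → V, Set.InjOn ψ (range 7 : Finset ℕ) ∧ (range 7).image ψ = U ∧ ∀ i (h : i < P.length), ψ i = P[i] := by
  let L := P ++ (U \ P.toFinset).toList
  have hL : L.Nodup := by
    rw [List.nodup_append']
    refine ⟨hP, Finset.nodup_toList _, ?_⟩
    intro x hx hx'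
    simp at hx'
    exact hx'.2 hx
  have hLU : L.toFinset = U := by
    ext x
    simp only [L, List.toFinset_append, mem_union, List.mem_toFinset, Finset.mem_toList, mem_sdiff]
    constructor
    · rintro (h | h)
      · exact hPU x h
      · exact h.1
    · intro h; by_cases h' : x ∈ P <;> simp [h, h']
  have hlen : L.length = 7 := by
    rw [← List.toFinset_card_of_nodup hL, hLU, hU]
  obtain ⟨d, hd⟩ : U.Nonempty := by rw [← Finset.card_pos, hU]; norm_num
  have hg : ∀ i (h : i < 7), L.getD i d = L[i]'(by omega) := by
    intro i h; rw [List.getD_eq_getElem]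
  refine ⟨fun i => L.getD i d, ?_, ?_, ?_⟩
  · intro i hi j hj e
    simp at hi hj
    simp only [hg i hi, hg j hj] at e
    exact (List.Nodup.getElem_inj_iff hL).1 e
  · ext x
    rw [mem_image, ← hLU, List.mem_toFinset, List.mem_iff_getElem]
    constructor
    · rintro ⟨i, hi, rfl⟩
      rw [mem_range] at hi
      exact ⟨i, by omega, (hg i hi).symm⟩
    · rintro ⟨i, hi, rfl⟩
      exact ⟨i, by rw [mem_range]; omega, hg i (by omega)⟩
  · intro i hi
    have h7 : i < 7 := by rw [← hlen]; simp [L]; omega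
    simp only [hg i h7]
    simp only [L]
    rw [List.getElem_append_left hi]

lemma bd_sum {F : Finset (Finset V)} {k : ℕ} {U : Finset V} (hF : ∀ s ∈ F, s.card = k ∧ s ⊆ U) {Z : Chn V}
    (hZ : Z ∈ Ch (F : Set (Finset V))) {τ : Finset V} (hτ : τ.card + 1 = k) :
    bd Z τ = ∑ s ∈ F.filter (fun s => τ ⊆ s), Z s := by
  rw [mem_Ch] at hZ
  rw [bd_apply (X := U) (fun s hs => (hF s (hZ s hs)).2)]
  have : ∑ v ∈ U \ τ, Z (insert v τ) = ∑ s ∈ (U \ τ).image (fun v => insert v τ), Z s := by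
    rw [sum_image]
    intro a ha b hb e
    simp at ha hb
    have : a ∈ insert b τ := by rw [← show insert a τ = insert b τ from e]; simp
    rcases mem_insert.1 this with h | h
    · exact h
    · exact absurd h ha.2
  rw [this]
  symm
  apply sum_subset
  · intro s hs
    rw [mem_filter] at hs
    have h1 := hF s hs.1
    obtain ⟨v, hv⟩ : ∃ v, s \ τ = {v} := by
      rw [← card_eq_one, card_sdiff_of_subset hs.2]; omega
    have hvs : v ∈ s \ τ := by rw [hv]; simp
    rw [mem_sdiff] at hvs
    rw [mem_image]
    refine ⟨v, mem_sdiff.2 ⟨h1.2 hvs.1, hvs.2⟩, ?_⟩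
    show insert v τ = s
    rw [insert_eq, ← hv, sdiff_union_of_subset hs.2]
  · intro s hs hs'
    by_contra h
    rw [mem_image] at hs
    obtain ⟨v, _, rfl⟩ := hs
    exact hs' (mem_filter.2 ⟨hZ _ h, subset_insert _ _⟩)

set_option maxHeartbeats 1000000 in
lemma free_ridge [Infinite V] {F : Finset (Finset V)} {k : ℕ} {U : Finset V} {v : V} (hF : ∀ s ∈ F, s.card = k ∧ s ⊆ U)
    (hU : U.card ≤ 7) (hv : v ∈ U) (hne : F.Nonempty) (hk : 2 ≤ k)
    (hz : ∀ z ∈ Ch (F : Set (Finset V)), bd z = 0 → z = 0) :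
    ∃ τ : Finset V, τ.card + 1 = k ∧ (k = 2 → τ ≠ {v}) ∧ ∃! s, s ∈ F ∧ τ ⊆ s := by
  by_contra hcon
  have hfree : ∀ τ : Finset V, τ.card + 1 = k → (k = 2 → τ ≠ {v}) → ¬ ∃! s, s ∈ F ∧ τ ⊆ s :=
    fun τ h1 h2 h3 => hcon ⟨τ, h1, h2, h3⟩
  clear hcon
  obtain ⟨U', hUU, hU7⟩ := Infinite.exists_superset_card_eq U 7 hU
  replace hF : ∀ s ∈ F, s.card = k ∧ s ⊆ U' := fun s hs => ⟨(hF s hs).1, (hF s hs).2.trans hUU⟩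
  replace hv : v ∈ U' := hUU hv
  clear hUU hU
  have hcyc : ∀ z : Finset V → ZMod 2, (∀ s, z s ≠ 0 → s ∈ F) →
      (∀ τ : Finset V, τ.card + 1 = k → (k = 2 → τ ≠ {v}) → ∑ s ∈ F.filter (fun s => τ ⊆ s), z s = 0) → ∀ s, z s = 0 := by
    intro z h1 h2 s
    let Z : Chn V := Finsupp.onFinset F z (fun s hs => h1 s hs)
    have hZF : Z ∈ Ch (F : Set (Finset V)) := by
      rw [mem_Ch]; intro t ht; exact_mod_cast h1 t ht
    obtain ⟨j, rfl⟩ : ∃ j, k = j + 1 := ⟨k - 1, by omega⟩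
    have hdeg : bd Z ∈ Ch (Dg j : Set (Finset V)) :=
      bd_deg (Ch_mono (K := (F : Set (Finset V))) (fun s hs => (hF s (by exact_mod_cast hs)).1) hZF)
    have hg : ∀ τ : Finset V, (j + 1 = 2 → τ ≠ {v}) → bd Z τ = 0 := by
      intro τ hτ
      by_cases hc : τ.card = j
      · rw [bd_sum hF hZF (by omega)]
        exact h2 τ (by omega) hτ
      · by_contra h
        exact hc ((mem_Ch.1 hdeg) τ h)
    have h0 : bd Z = 0 := by
      ext τ
      by_cases hc : j + 1 = 2 → τ ≠ {v}
      · exact hg τ hc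
      · push Not at hc
        obtain ⟨_, rfl⟩ := hc
        have hb : bd (bd Z) ∅ = 0 := by rw [bd_bd]; rfl
        rw [bd_apply (X := U') ?_] at hb
        · rw [Finset.sum_eq_single v] at hb
          · simpa using hb
          · intro b _ hbv
            apply hg
            intro _ h
            rw [insert_empty_eq] at h
            exact hbv (by simpa using h)
          · intro h; simp [hv] at h
        · intro s hs
          have := hF
          have hm : bd Z ∈ Ch {t : Finset V | t ⊆ U'} := bd_mem (fun s hs t ht => ht.trans hs)
            (Ch_mono (K := (F : Set (Finset V))) (fun s hs => (hF s (by exact_mod_cast hs)).2) hZF)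
          exact (mem_Ch.1 hm) s hs
    have := DFunLike.congr_fun (hz Z hZF h0) s
    exact this
  have he : ∀ j, ∀ r ∈ codes j, r < 128 := fun j r hr => (mem_codes.1 hr).1
  have fin : ∀ {ψ : ℕ → V} {l e : List ℕ} {X : ℕ}, run k l e X = true → (∀ r ∈ e, r < 128) → 0 < e.length → l.Nodup →
      Set.InjOn ψ (range 7 : Finset ℕ) → (range 7).image ψ = U' →
      (∀ j ∈ l, ∃ c, (codes k)[j]? = some c ∧ (dec c).image ψ ∈ F) →
      (∀ j, X.testBit j = true → ∀ c, (codes k)[j]? = some c → (dec c).image ψ ∉ F) →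
      (∀ r ∈ e, (dec r).card + 1 = k ∧ (k = 2 → (dec r).image ψ ≠ {v})) →
      (∀ τ : Finset V, τ ⊆ U' → τ.card + 1 = k → (k = 2 → τ ≠ {v}) → ∃ r ∈ e, (dec r).image ψ = τ) → False := by
    intro ψ l e X hrun he hle hl hψ hi hl' hX hr1 hr2
    have hcr : ∀ r, ((dec r).image ψ).card = (dec r).card := fun r =>
      card_image_of_injOn (hψ.mono (by exact_mod_cast filter_subset _ _))
    refine run_V hrun he hle hl hψ hl' hX (fun s hs => ⟨by rw [hi]; exact (hF s hs).2, (hF s hs).1⟩) ?_ ?_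
    · intro r hr
      exact hfree _ (by rw [hcr]; exact (hr1 r hr).1) (hr1 r hr).2
    · intro z hz1 hz2
      apply hcyc z hz1
      intro τ h1 h2
      by_cases hτ : τ ⊆ U'
      · obtain ⟨r, hr, rfl⟩ := hr2 τ hτ h1 h2
        exact hz2 r hr
      · apply sum_eq_zero
        intro s hs
        rw [mem_filter] at hs
        exact absurd (hs.2.trans (hF s hs.1).2) hτ
  -- ridges all codes
  have rid : ∀ {ψ : ℕ → V}, Set.InjOn ψ (range 7 : Finset ℕ) → (range 7).image ψ = U' → ∀ j,
      ∀ τ : Finset V, τ ⊆ U' → τ.card = j → ∃ r ∈ codes j, (dec r).image ψ = τ := by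
    intro ψ hψ hi j τ hτ hc
    rw [← hi] at hτ
    obtain ⟨t, ht, rfl⟩ := subset_image_iff.1 hτ
    have ht' : t ⊆ range 7 := by exact_mod_cast ht
    have hc' : t.card = j := by rw [← hc, card_image_of_injOn (hψ.mono ht)]
    exact ⟨cod t, cod_mem ht' hc', by rw [(cod_facts t (by simpa using ht')).2]⟩
  by_cases hk2 : k = 2
  · subst hk2
    have hr1 : ∀ {ψ : ℕ → V}, Set.InjOn ψ (range 7 : Finset ℕ) → ψ 0 = v → ∀ r ∈ [64,32,16,8,4,2],
        (dec r).card + 1 = 2 ∧ (2 = 2 → (dec r).image ψ ≠ {v}) := by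
      intro ψ hψ h0 r hr
      have : ∃ i, i < 7 ∧ i ≠ 0 ∧ dec r = {i} := by
        simp only [List.mem_cons, List.not_mem_nil, or_false] at hr
        rcases hr with rfl | rfl | rfl | rfl | rfl | rfl
        · exact ⟨6, by decide⟩
        · exact ⟨5, by decide⟩
        · exact ⟨4, by decide⟩
        · exact ⟨3, by decide⟩
        · exact ⟨2, by decide⟩
        · exact ⟨1, by decide⟩
      obtain ⟨i, h7, hi0, hi⟩ := this
      rw [hi]
      refine ⟨by simp, fun _ h => hi0 ?_⟩
      rw [image_singleton, singleton_inj, ← h0] at h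
      exact hψ (by simpa using h7) (by simp) h
    have hr2 : ∀ {ψ : ℕ → V}, Set.InjOn ψ (range 7 : Finset ℕ) → (range 7).image ψ = U' → ψ 0 = v →
        (∀ τ : Finset V, τ ⊆ U' → τ.card + 1 = 2 → (2 = 2 → τ ≠ {v}) → ∃ r ∈ [64,32,16,8,4,2], (dec r).image ψ = τ) := by
      intro ψ hψ hi h0 τ hτ hc hne
      obtain ⟨r, hr, rfl⟩ := rid hψ hi 1 τ hτ (by omega)
      have e1 : codes 1 = [64,32,16,8,4,2,1] := by decide +kernel
      rw [e1] at hr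
      refine ⟨r, ?_, rfl⟩
      simp only [List.mem_cons, List.not_mem_nil, or_false] at hr ⊢
      rcases hr with h | h | h | h | h | h | h
      · exact Or.inl h
      · exact Or.inr (Or.inl h)
      · exact Or.inr (Or.inr (Or.inl h))
      · exact Or.inr (Or.inr (Or.inr (Or.inl h)))
      · exact Or.inr (Or.inr (Or.inr (Or.inr (Or.inl h))))
      · exact Or.inr (Or.inr (Or.inr (Or.inr (Or.inr h))))
      exfalso
      subst h
      apply hne rfl
      rw [show dec 1 = {0} by decide, image_singleton, h0]
    obtain ⟨s, hs⟩ := hne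
    obtain ⟨x, y, hxy, rfl⟩ := card_eq_two.1 (hF s hs).1
    have hsU := (hF _ hs).2
    have hx : x ∈ U' := hsU (by simp)
    have hy : y ∈ U' := hsU (by simp)
    have main : ∀ x y, x ≠ y → x ∈ U' → y ∈ U' → ({x, y} : Finset V) ∈ F → v = x → False := by
      rintro x y hxy hx hy hs rfl
      obtain ⟨ψ, p1, p2, p3⟩ := label hU7 [v, y] (by simp [hxy]) (by simp [hx, hy])
      have h0 : ψ 0 = v := p3 0 (by simp)
      have h1 : ψ 1 = y := p3 1 (by simp)
      refine fin run2a (by decide) (by decide) (by simp) p1 p2 ?_ (by simp) (hr1 p1 h0) (hr2 p1 p2 h0)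
      intro j hj
      refine ⟨3, ?_, ?_⟩
      · rw [List.mem_singleton.1 hj]; decide +kernel
      · rw [show dec 3 = {0, 1} by decide, image_insert, image_singleton, h0, h1]; exact hs
    by_cases h1 : v = x
    · exact main x y hxy hx hy hs h1
    by_cases h2 : v = y
    · exact main y x hxy.symm hy hx (by rw [pair_comm]; exact hs) h2
    obtain ⟨ψ, p1, p2, p3⟩ := label hU7 [v, x, y] (by simp [hxy, h1, h2]) (by simp [hx, hy, hv])
    have h0 : ψ 0 = v := p3 0 (by simp)
    have h1 : ψ 1 = x := p3 1 (by simp)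
    have h2 : ψ 2 = y := p3 2 (by simp)
    refine fin run2b (by decide) (by decide) (by simp) p1 p2 ?_ (by simp) (hr1 p1 h0) (hr2 p1 p2 h0)
    intro j hj
    refine ⟨6, ?_, ?_⟩
    · rw [List.mem_singleton.1 hj]; decide +kernel
    · rw [show dec 6 = {1, 2} by decide, image_insert, image_singleton, h1, h2]; exact hs
  have rid' : ∀ {ψ : ℕ → V}, Set.InjOn ψ (range 7 : Finset ℕ) → (range 7).image ψ = U' → ∀ j, j + 1 = k →
      (∀ r ∈ codes j, (dec r).card + 1 = k ∧ (k = 2 → (dec r).image ψ ≠ {v})) ∧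
      (∀ τ : Finset V, τ ⊆ U' → τ.card + 1 = k → (k = 2 → τ ≠ {v}) → ∃ r ∈ codes j, (dec r).image ψ = τ) := by
    intro ψ h1 h2 j hj
    refine ⟨fun r hr => ⟨by rw [(mem_codes.1 hr).2, hj], fun h => absurd h hk2⟩, fun τ h3 h4 _ => rid h1 h2 j τ h3 (by omega)⟩
  by_cases hk5 : k = 5
  · subst hk5
    obtain ⟨s, hs⟩ := hne
    have hl := Finset.length_toList s
    rw [(hF s hs).1] at hl
    obtain ⟨ψ, p1, p2, p3⟩ := label hU7 s.toList (Finset.nodup_toList s) (fun x hx => (hF s hs).2 (by simpa using hx))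
    refine fin run5 (he 4) (by decide +kernel) (by simp) p1 p2 ?_ (by simp) (rid' p1 p2 4 rfl).1 (rid' p1 p2 4 rfl).2
    intro j hj
    refine ⟨31, ?_, ?_⟩
    · rw [List.mem_singleton.1 hj]; decide +kernel
    · have : (dec 31).image ψ = s := by
        apply eq_of_subset_of_card_le
        · rw [show dec 31 = range 5 by decide]
          intro x hx
          obtain ⟨i, hi, rfl⟩ := mem_image.1 hx
          rw [mem_range] at hi
          rw [p3 i (by omega), ← Finset.mem_toList]
          exact List.getElem_mem _
        · rw [card_image_of_injOn (p1.mono (by exact_mod_cast filter_subset _ _)), (hF s hs).1]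
          decide
      rw [this]; exact hs
  -- an odd ridge
  obtain ⟨τ, hτ, hodd⟩ : ∃ τ : Finset V, τ.card + 1 = k ∧ Odd (F.filter (fun s => τ ⊆ s)).card := by
    by_contra hno
    push Not at hno
    obtain ⟨s, hs⟩ := hne
    have := hcyc (fun s => if s ∈ F then 1 else 0) (fun s hs => by by_contra h; simp [h] at hs) (by
      intro τ h1 _
      have h2 := hno τ h1
      rw [Nat.not_odd_iff_even] at h2
      rw [sum_congr rfl (g := fun _ => (1 : ZMod 2)) (fun s hs => by simp [(mem_filter.1 hs).1])]
      rw [sum_const, nsmul_eq_mul, mul_one]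
      exact (ZMod.natCast_eq_zero_iff_even).2 h2) s
    simp [hs] at this
  set S := F.filter (fun s => τ ⊆ s) with hS
  have hS1 : S.card ≠ 1 := by
    intro h1
    obtain ⟨s, hs⟩ := card_eq_one.1 h1
    refine hfree τ hτ (fun h => absurd h hk2) ⟨s, ?_, ?_⟩
    · have : s ∈ S := by rw [hs]; simp
      exact mem_filter.1 this
    · intro t ht
      have : t ∈ S := mem_filter.2 ht
      rw [hs] at this
      exact mem_singleton.1 this
  have hins : ∀ s ∈ S, ∃ x, x ∉ τ ∧ x ∈ U' ∧ s = insert x τ := by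
    intro s hs
    rw [hS, mem_filter] at hs
    have h1 := hF s hs.1
    obtain ⟨v, hv⟩ : ∃ v, s \ τ = {v} := by
      rw [← card_eq_one, card_sdiff_of_subset hs.2]; omega
    have hvs : v ∈ s \ τ := by rw [hv]; simp
    rw [mem_sdiff] at hvs
    refine ⟨v, hvs.2, h1.2 hvs.1, ?_⟩
    rw [insert_eq, ← hv, sdiff_union_of_subset hs.2]
  have hS3 : 2 < S.card := by obtain ⟨q, hq⟩ := hodd; omega
  obtain ⟨s1, m1, s2, m2, s3, m3, n12, n13, n23⟩ := two_lt_card.1 hS3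
  obtain ⟨x, hxτ, hxU, rfl⟩ := hins s1 m1
  obtain ⟨y, hyτ, hyU, rfl⟩ := hins s2 m2
  obtain ⟨w, hwτ, hwU, rfl⟩ := hins s3 m3
  have nxy : x ≠ y := by rintro rfl; exact n12 rfl
  have nxw : x ≠ w := by rintro rfl; exact n13 rfl
  have nyw : y ≠ w := by rintro rfl; exact n23 rfl
  have f1 := (mem_filter.1 m1).1
  have f2 := (mem_filter.1 m2).1
  have f3 := (mem_filter.1 m3).1
  have hτU : τ ⊆ U' := (subset_insert _ _).trans (hF _ f1).2
  have hSle : S.card ≤ 7 - τ.card := by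
    rw [← hU7, ← card_sdiff_of_subset hτU]
    refine (card_le_card (t := (U' \ τ).image (fun v => insert v τ)) ?_).trans card_image_le
    intro s hs
    obtain ⟨x, h1, h2, rfl⟩ := hins s hs
    exact mem_image.2 ⟨x, mem_sdiff.2 ⟨h2, h1⟩, rfl⟩
  by_cases hk3 : k = 3
  · subst hk3
    obtain ⟨a, b, hab, rfl⟩ := card_eq_two.1 (show τ.card = 2 by omega)
    simp only [mem_insert, mem_singleton, not_or] at hxτ hyτ hwτ
    obtain ⟨ψ, p1, p2, p3⟩ := label hU7 [a, b, x, y, w] (by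
      simp [hab, nxy, nxw, nyw, Ne.symm hxτ.1, Ne.symm hxτ.2, Ne.symm hyτ.1, Ne.symm hyτ.2, Ne.symm hwτ.1, Ne.symm hwτ.2])
      (by simp [hxU, hyU, hwU, hτU (mem_insert_self a {b}), hτU (show b ∈ ({a, b} : Finset V) by simp)])
    have h0 : ψ 0 = a := p3 0 (by simp)
    have h1 : ψ 1 = b := p3 1 (by simp)
    have h2 : ψ 2 = x := p3 2 (by simp)
    have h3 : ψ 3 = y := p3 3 (by simp)
    have h4 : ψ 4 = w := p3 4 (by simp)
    refine fin run3 (he 2) (by decide +kernel) (by decide +kernel) p1 p2 ?_ (by simp) (rid' p1 p2 2 rfl).1 (rid' p1 p2 2 rfl).2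
    intro j hj
    simp only [List.mem_cons, List.not_mem_nil, or_false] at hj
    rcases hj with h | h | h
    · refine ⟨7, ?_, ?_⟩
      · rw [h]; decide +kernel
      · rw [show dec 7 = {2, 0, 1} by decide]; simpa [image_insert, h0, h1, h2] using f1
    · refine ⟨11, ?_, ?_⟩
      · rw [h]; decide +kernel
      · rw [show dec 11 = {3, 0, 1} by decide]; simpa [image_insert, h0, h1, h3] using f2
    · refine ⟨19, ?_, ?_⟩
      · rw [h]; decide +kernel
      · rw [show dec 19 = {4, 0, 1} by decide]; simpa [image_insert, h0, h1, h4] using f3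
  by_cases hk4 : k = 4
  · subst hk4
    have hSc : S.card = 3 := by obtain ⟨q, hq⟩ := hodd; omega
    have hSeq : S = {insert x τ, insert y τ, insert w τ} := by
      symm
      apply eq_of_subset_of_card_le
      · intro s hs
        simp only [mem_insert, mem_singleton] at hs
        rcases hs with rfl | rfl | rfl <;> assumption
      · rw [hSc, card_eq_three.2 ⟨_, _, _, n12, n13, n23, rfl⟩]
    obtain ⟨a, b, c, hab, hac, hbc, rfl⟩ := card_eq_three.1 (show τ.card = 3 by omega)
    simp only [mem_insert, mem_singleton, not_or] at hxτ hyτ hwτ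
    obtain ⟨ψ, p1, p2, p3⟩ := label hU7 [a, b, c, x, y, w] (by
      simp [hab, hac, hbc, nxy, nxw, nyw, Ne.symm hxτ.1, Ne.symm hxτ.2.1, Ne.symm hxτ.2.2, Ne.symm hyτ.1,
        Ne.symm hyτ.2.1, Ne.symm hyτ.2.2, Ne.symm hwτ.1, Ne.symm hwτ.2.1, Ne.symm hwτ.2.2])
      (by simp [hxU, hyU, hwU, hτU (mem_insert_self a {b, c}), hτU (show b ∈ ({a, b, c} : Finset V) by simp),
        hτU (show c ∈ ({a, b, c} : Finset V) by simp)])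
    have h0 : ψ 0 = a := p3 0 (by simp)
    have h1 : ψ 1 = b := p3 1 (by simp)
    have h2 : ψ 2 = c := p3 2 (by simp)
    have h3 : ψ 3 = x := p3 3 (by simp)
    have h4 : ψ 4 = y := p3 4 (by simp)
    have h5 : ψ 5 = w := p3 5 (by simp)
    refine fin run4 (he 3) (by decide +kernel) (by decide +kernel) p1 p2 ?_ ?_ (rid' p1 p2 3 rfl).1 (rid' p1 p2 3 rfl).2
    · intro j hj
      simp only [List.mem_cons, List.not_mem_nil, or_false] at hj
      rcases hj with h | h | h
      · refine ⟨15, ?_, ?_⟩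
        · rw [h]; decide +kernel
        · rw [show dec 15 = {3, 0, 1, 2} by decide]; simpa [image_insert, h0, h1, h2, h3] using f1
      · refine ⟨23, ?_, ?_⟩
        · rw [h]; decide +kernel
        · rw [show dec 23 = {4, 0, 1, 2} by decide]; simpa [image_insert, h0, h1, h2, h4] using f2
      · refine ⟨39, ?_, ?_⟩
        · rw [h]; decide +kernel
        · rw [show dec 39 = {5, 0, 1, 2} by decide]; simpa [image_insert, h0, h1, h2, h5] using f3
    · intro j hj c' hc' hmem
      rw [show (524288 : ℕ) = 2 ^ 19 by norm_num, Nat.testBit_two_pow] at hj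
      have hj' : 19 = j := of_decide_eq_true hj
      subst hj'
      have : (codes 4)[19]? = some 71 := by decide +kernel
      rw [this] at hc'
      rw [← Option.some_inj.1 hc', show dec 71 = {6, 0, 1, 2} by decide] at hmem
      simp only [image_insert, image_singleton, h0, h1, h2] at hmem
      have hm : insert (ψ 6) {a, b, c} ∈ S := mem_filter.2 ⟨hmem, subset_insert _ _⟩
      have ne6 : ∀ i, i < 6 → ψ 6 ≠ ψ i := by
        intro i hi h
        have := p1 (by simp) (by simp; omega) h
        omega
      have : ψ 6 ∈ ({a, b, c, x, y, w} : Finset V) := by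
        rw [hSeq] at hm
        have h6 := mem_insert_self (ψ 6) {a, b, c}
        simp only [mem_insert, mem_singleton] at hm
        rcases hm with h | h | h <;> rw [h] at h6 <;> simp only [mem_insert, mem_singleton] at h6 ⊢ <;> rcases h6 with h6 | h6 | h6 | h6 <;> simp only [h6, true_or, or_true]
      simp only [mem_insert, mem_singleton] at this
      rcases this with h | h | h | h | h | h
      · exact ne6 0 (by norm_num) (h.trans h0.symm)
      · exact ne6 1 (by norm_num) (h.trans h1.symm)
      · exact ne6 2 (by norm_num) (h.trans h2.symm)
      · exact ne6 3 (by norm_num) (h.trans h3.symm)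
      · exact ne6 4 (by norm_num) (h.trans h4.symm)
      · exact ne6 5 (by norm_num) (h.trans h5.symm)
  omega
end
end HS

namespace HS
open Finset
open scoped Classical
set_option linter.all false
section
variable {V W U : Type*} [DecidableEq V] [DecidableEq W] [DecidableEq U]

/-- complexes obtained from a vertex by elementary expansions -/
inductive Expd (v : V) : Finset (Finset V) → Prop
  | base : Expd v {∅, {v}}
  | step {L : Finset (Finset V)} {σ τ : Finset V} : Expd v L → τ ⊆ σ → τ.card + 1 = σ.card → τ ≠ ∅ → σ ∉ L → τ ∉ L →
      (∀ t, t ⊂ σ → t ≠ τ → t ∈ L) → Expd v (insert σ (insert τ L))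

lemma Expd.of_free {v : V} {L : Finset (Finset V)} {σ τ : Finset V} (hL : Cx L) (hσ : σ ∈ L) (h1 : τ ⊆ σ)
    (h2 : τ.card + 1 = σ.card) (h3 : τ ≠ ∅) (h : Expd v ((L.erase σ).erase τ)) : Expd v L := by
  have hne : τ ≠ σ := by rintro rfl; omega
  have hτ : τ ∈ L := hL.2 _ hσ _ h1
  have e : L = insert σ (insert τ ((L.erase σ).erase τ)) := by
    rw [insert_erase (mem_erase.2 ⟨hne, hτ⟩), insert_erase hσ]
  rw [e]
  refine Expd.step h h1 h2 h3 (by simp) (by simp) ?_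
  intro t ht hne'
  simp only [mem_erase]
  exact ⟨hne', ht.ne, hL.2 _ hσ _ ht.1⟩

lemma Expd.cx {v : V} {L : Finset (Finset V)} (h : Expd v L) : Cx L ∧ {v} ∈ L := by
  induction h with
  | base =>
    refine ⟨⟨by simp, ?_⟩, by simp⟩
    intro s hs t hts
    simp only [mem_insert, mem_singleton] at hs ⊢
    rcases hs with rfl | rfl
    · left; exact subset_empty.1 hts
    · exact subset_singleton_iff.1 hts
  | @step L σ τ hL h1 h2 h3 h4 h5 h6 ih =>
    refine ⟨⟨by simp [ih.1.1], ?_⟩, by simp [ih.2]⟩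
    intro s hs t hts
    have hσ : ∀ t, t ⊆ σ → t ∈ insert σ (insert τ L) := by
      intro t ht
      by_cases e : t = σ
      · simp [e]
      by_cases e' : t = τ
      · simp [e']
      simp [h6 t (Finset.ssubset_iff_subset_ne.2 ⟨ht, e⟩) e']
    rcases mem_insert.1 hs with rfl | hs
    · exact hσ t hts
    rcases mem_insert.1 hs with rfl | hs
    · exact hσ t (hts.trans h1)
    · simp [ih.1.2 s hs t hts]

lemma Expd.of_cone {w : V} : ∀ (n : ℕ) {L : Finset (Finset V)}, L.card = n → Cx L → (∀ s ∈ L, insert w s ∈ L) → Expd w L := by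
  intro n
  induction n using Nat.strong_induction_on with
  | _ n ih =>
  intro L hn hL hw
  by_cases hS : ∃ s ∈ L, w ∉ s ∧ s ≠ ∅
  · obtain ⟨s, hs, hmax⟩ := Finset.exists_max_image (L.filter (fun s => w ∉ s ∧ s ≠ ∅)) card
      (by obtain ⟨s, h⟩ := hS; exact ⟨s, mem_filter.2 h⟩)
    rw [mem_filter] at hs
    obtain ⟨hsL, hws, hs0⟩ := hs
    have hmax' : ∀ t ∈ L, s ⊆ t → t = s ∨ t = insert w s := by
      intro t ht hst
      have h1 : t.erase w ∈ L := hL.2 _ ht _ (erase_subset _ _)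
      have h2 : s ⊆ t.erase w := fun x hx => mem_erase.2 ⟨by rintro rfl; exact hws hx, hst hx⟩
      have h3 : t.erase w ≠ ∅ := by
        intro h0; rw [h0] at h2; exact hs0 (subset_empty.1 h2)
      have h4 := hmax (t.erase w) (mem_filter.2 ⟨h1, notMem_erase _ _, h3⟩)
      have h5 := eq_of_subset_of_card_le h2 h4
      by_cases hwt : w ∈ t
      · right; rw [h5, insert_erase hwt]
      · left; rw [h5, erase_eq_of_notMem hwt]
    refine Expd.of_free hL (hw s hsL) (subset_insert _ _) (by rw [card_insert_of_notMem hws]) hs0 ?_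
    have hne : insert w s ≠ s := fun h => hws (by rw [← h]; simp)
    refine ih _ ?_ rfl ?_ ?_
    · rw [← hn]
      exact card_lt_card ((erase_subset _ _).trans_ssubset (erase_ssubset (hw s hsL)))
    · refine ⟨?_, ?_⟩
      · simp only [mem_erase]
        exact ⟨Ne.symm hs0, (insert_ne_empty _ _).symm, hL.1⟩
      · intro a ha b hb
        simp only [mem_erase] at ha ⊢
        refine ⟨?_, ?_, hL.2 _ ha.2.2 _ hb⟩
        · rintro rfl
          rcases hmax' a ha.2.2 hb with h | h
          · exact ha.1 h
          · exact ha.2.1 h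
        · rintro rfl
          rcases hmax' a ha.2.2 ((subset_insert _ _).trans hb) with h | h
          · exact ha.1 h
          · exact ha.2.1 h
    · intro a ha
      simp only [mem_erase] at ha ⊢
      refine ⟨?_, ?_, hw a ha.2.2⟩
      · intro h; exact hws (by rw [← h]; simp)
      · intro h
        have hsa : s ⊆ a := by
          intro x hx
          have : x ∈ insert w a := by rw [h]; simp [hx]
          rcases mem_insert.1 this with rfl | h
          · exact absurd hx hws
          · exact h
        rcases hmax' a ha.2.2 hsa with h | h
        · exact ha.1 h
        · exact ha.2.1 h
  · push Not at hS
    have : L = {∅, {w}} := by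
      ext t
      simp only [mem_insert, mem_singleton]
      constructor
      · intro ht
        by_cases hwt : w ∈ t
        · right
          have := hS (t.erase w) (hL.2 _ ht _ (erase_subset _ _)) (notMem_erase _ _)
          rw [← insert_erase hwt, this]; rfl
        · left; exact hS t ht hwt
      · rintro (rfl | rfl)
        · exact hL.1
        · exact hw ∅ hL.1
    rw [this]; exact Expd.base

lemma Expd.simplex {w : V} {γ : Finset V} (hw : w ∈ γ) : Expd w γ.powerset := by
  refine Expd.of_cone _ rfl ⟨by simp, ?_⟩ ?_
  · intro s hs t hts; rw [mem_powerset] at *; exact hts.trans hs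
  · intro s hs; rw [mem_powerset] at *; exact insert_subset hw hs

lemma Expd.of_acyc [Infinite V] {v : V} : ∀ (n : ℕ) {L : Finset (Finset V)}, L.card = n → Cx L → Acyc L → {v} ∈ L →
    (vs L).card ≤ 7 → Expd v L := by
  intro n
  induction n using Nat.strong_induction_on with
  | _ n ih =>
  intro L hn hL hA hv h7
  obtain ⟨f, hf, hmax⟩ := Finset.exists_max_image L card ⟨_, hv⟩
  set k := f.card with hk
  have hk1 : 1 ≤ k := by simpa using hmax _ hv
  -- top cycles vanish
  have htop : ∀ z ∈ Ch (L : Set (Finset V)), z ∈ Ch (Dg k : Set (Finset V)) → bd z = 0 → z = 0 := by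
    intro z hz hd h0
    obtain ⟨b, hb, rfl⟩ := hA z hz h0
    ext s
    by_contra hne
    have hne : bd b s ≠ 0 := hne
    have hs : s.card = k := mem_Ch.1 hd s hne
    rw [bd_apply (sup_vs hb)] at hne
    obtain ⟨x, hx, hx2⟩ := exists_ne_zero_of_sum_ne_zero hne
    have := hmax _ (mem_Ch.1 hb _ hx2)
    rw [card_insert_of_notMem (mem_sdiff.1 hx).2] at this
    omega
  by_cases hk2 : k = 1
  · have : L = {∅, {v}} := by
      ext t
      simp only [mem_insert, mem_singleton]
      constructor
      · intro ht
        have h1 := hmax t ht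
        rcases Nat.eq_zero_or_pos t.card with h0 | h0
        · left; exact card_eq_zero.1 h0
        · right
          obtain ⟨u, rfl⟩ := card_eq_one.1 (show t.card = 1 by omega)
          by_contra hne
          have huv : u ≠ v := fun h => hne (by rw [h])
          have := htop (bs {u} + bs {v}) (Submodule.add_mem _ (bs_mem.2 (by exact_mod_cast ht)) (bs_mem.2 (by exact_mod_cast hv)))
            (by rw [hk2]; exact Submodule.add_mem _ (bs_mem.2 (by simp [Dg])) (bs_mem.2 (by simp [Dg])))
            (by rw [map_add, bd_bs, bd_bs]; simp [add_self2])
          have h2 := DFunLike.congr_fun this {u}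
          simp [bs, Finsupp.single_apply, Ne.symm huv] at h2
      · rintro (rfl | rfl)
        · exact hL.1
        · exact hv
    rw [this]; exact Expd.base
  · obtain ⟨τ, hτ, hτv, s, ⟨hsF, hτs⟩, huniq⟩ := free_ridge (F := L.filter (fun s => s.card = k)) (U := vs L) (v := v) (k := k)
      (fun s hs => ⟨(mem_filter.1 hs).2, fun x hx => mem_vs.2 ⟨s, (mem_filter.1 hs).1, hx⟩⟩) h7 (hL.mem_vs.2 hv)
      ⟨f, mem_filter.2 ⟨hf, rfl⟩⟩ (by omega) (fun z hz h0 => htop z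
        (Ch_mono (K := ((L.filter (fun s => s.card = k) : Finset (Finset V)) : Set (Finset V))) (fun s hs => by simp at hs; simpa using hs.1) hz)
        (Ch_mono (K := ((L.filter (fun s => s.card = k) : Finset (Finset V)) : Set (Finset V))) (fun s hs => by simp at hs; exact hs.2) hz) h0)
    rw [mem_filter] at hsF
    have hmax' : ∀ t ∈ L, τ ⊆ t → t = τ ∨ t = s := by
      intro t ht hst
      by_cases e : t = τ
      · exact Or.inl e
      right
      have h1 := card_lt_card (Finset.ssubset_iff_subset_ne.2 ⟨hst, Ne.symm e⟩)
      have h2 := hmax t ht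
      exact huniq t ⟨mem_filter.2 ⟨ht, by omega⟩, hst⟩
    have hτs' : τ ≠ s := by rintro rfl; omega
    have hτ0 : τ ≠ ∅ := by rintro rfl; simp at hτ; omega
    refine Expd.of_free hL hsF.1 hτs (by omega) hτ0 ?_
    refine ih _ ?_ rfl ?_ ?_ ?_ ?_
    · rw [← hn]
      exact card_lt_card ((erase_subset _ _).trans_ssubset (erase_ssubset hsF.1))
    · refine ⟨?_, ?_⟩
      · simp only [mem_erase]
        refine ⟨Ne.symm hτ0, ?_, hL.1⟩
        rintro rfl; simp at hsF; omega
      · intro a ha b hb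
        simp only [mem_erase] at ha ⊢
        refine ⟨?_, ?_, hL.2 _ ha.2.2 _ hb⟩
        · rintro rfl
          rcases hmax' a ha.2.2 hb with h | h
          · exact ha.1 h
          · exact ha.2.1 h
        · rintro rfl
          rcases hmax' a ha.2.2 (hτs.trans hb) with h | h
          · exact ha.1 h
          · exact ha.2.1 h
    · intro x hx h0
      have hsub : (((L.erase s).erase τ : Finset (Finset V)) : Set (Finset V)) ⊆ L := by
        intro a ha; exact mem_of_mem_erase (mem_of_mem_erase (mem_coe.1 ha))
      obtain ⟨b, hb, rfl⟩ := hA x (Ch_mono hsub hx) h0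
      have hbs : b s = 0 := by
        by_contra hne
        have h1 : bd b τ = 0 := by
          by_contra h
          have := mem_Ch.1 hx τ h
          simp at this
        rw [bd_apply (sup_vs hb)] at h1
        obtain ⟨x, hxs⟩ : ∃ x, s \ τ = {x} := by
          rw [← card_eq_one, card_sdiff_of_subset hτs]; omega
        have hx1 : x ∈ s \ τ := by rw [hxs]; simp
        have hxe : insert x τ = s := by rw [insert_eq, ← hxs, sdiff_union_of_subset hτs]
        rw [mem_sdiff] at hx1
        rw [sum_eq_single x] at h1
        · rw [hxe] at h1; exact hne h1
        · intro y hy hyx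
          by_contra hb'
          rw [mem_sdiff] at hy
          rcases hmax' _ (mem_Ch.1 hb _ hb') (subset_insert _ _) with h | h
          · exact hy.2 (by rw [← h]; simp)
          · have : y ∈ s \ τ := mem_sdiff.2 ⟨by rw [← h]; simp, hy.2⟩
            rw [hxs, mem_singleton] at this
            exact hyx this
        · intro h; exact absurd (mem_sdiff.2 ⟨mem_vs.2 ⟨s, hsF.1, hx1.1⟩, hx1.2⟩) h
      by_cases hbτ : b τ = 0
      · refine ⟨b, mem_Ch.2 fun t ht => ?_, rfl⟩
        have := mem_Ch.1 hb t ht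
        simp only [coe_erase, Set.mem_diff, Set.mem_singleton_iff]
        exact ⟨⟨this, fun h => ht (by rw [h]; exact hbs)⟩, fun h => ht (by rw [h]; exact hbτ)⟩
      · have hb1 : bd (bs s) ∈ Ch {t : Finset V | t ⊂ s} := by
          rw [bd_bs]
          exact Submodule.sum_mem _ fun v hv => bs_mem.2 (erase_ssubset hv)
        have hb2 : bd (bs s) τ = 1 := by
          rw [bd_sum (F := {s}) (k := k) (U := s) (by simp [hsF.2]) (bs_mem.2 (by simp)) hτ]
          rw [filter_singleton, if_pos hτs, sum_singleton]
          simp [bs]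
        refine ⟨b + bd (bs s), mem_Ch.2 fun t ht => ?_, by rw [map_add, bd_bd, add_zero]⟩
        simp only [coe_erase, Set.mem_diff, Set.mem_singleton_iff]
        rw [Finsupp.add_apply] at ht
        refine ⟨⟨?_, ?_⟩, ?_⟩
        · by_cases h1 : b t = 0
          · rw [h1, zero_add] at ht
            exact mem_coe.2 (hL.2 _ hsF.1 _ (mem_Ch.1 hb1 t ht : t ⊂ s).1)
          · exact mem_Ch.1 hb t h1
        · rintro rfl
          rw [hbs, zero_add] at ht
          exact absurd (mem_Ch.1 hb1 t ht : t ⊂ t) (by simp)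
        · rintro rfl
          apply ht
          rw [hb2]
          revert hbτ
          generalize b t = y
          revert y; decide
    · simp only [mem_erase]
      refine ⟨?_, ?_, hv⟩
      · by_cases h : k = 2
        · exact Ne.symm (hτv h)
        · rintro rfl; simp at hτ; omega
      · rintro rfl; simp at hsF; omega
    · refine (card_le_card ?_).trans h7
      intro x hx
      obtain ⟨t, ht, hxt⟩ := mem_vs.1 hx
      exact mem_vs.2 ⟨t, mem_of_mem_erase (mem_of_mem_erase ht), hxt⟩
end
end HS

namespace HS
open Finset
open scoped Classical
set_option linter.all false
section
variable {X Y : Type*} [DecidableEq X] [DecidableEq Y]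

noncomputable def nbr (R : X → X → Prop) (P : Finset X) (v : X) : Finset X := P.filter (R v)

lemma mem_nbr {R : X → X → Prop} {P : Finset X} {v w : X} : w ∈ nbr R P v ↔ w ∈ P ∧ R v w := by
  simp [nbr]

def Step (R : X → X → Prop) (T : Finset X → Finset X → Prop) (k : ℕ) (P A B : Finset X) : Prop :=
  A ⊆ P ∧ ∃ v ∈ P, v ∉ A ∧ B = insert v A ∧ T (nbr R P v) (A ∩ nbr R P v) ∧
    (k = 0 ∨ ((A ≠ ∅ → A ∩ nbr R P v ≠ ∅) ∧ (B ≠ P → ¬ nbr R P v ⊆ A)))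

def Tr (R : X → X → Prop) : ℕ → Finset X → Finset X → Prop
  | 0, P, W => P = ∅ ∧ W = ∅
  | k + 1, P, W => 2 ≤ P.card ∧ (k = 0 → P.card = 2) ∧
      Relation.ReflTransGen (Step R (Tr R k) k P) ∅ W ∧ Relation.ReflTransGen (Step R (Tr R k) k P) W P

variable {R : X → X → Prop} {T : Finset X → Finset X → Prop} {k : ℕ} {P A B W : Finset X}

lemma Step.le (h : Step R T k P A B) : A ⊆ B ∧ B ⊆ P := by
  obtain ⟨h1, v, hv, -, rfl, -⟩ := h
  exact ⟨subset_insert _ _, insert_subset hv h1⟩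

lemma rtg_le (h : Relation.ReflTransGen (Step R T k P) A B) : A ⊆ B := by
  induction h with
  | refl => exact Finset.Subset.refl _
  | tail _ h ih => exact ih.trans h.le.1

lemma rtg_le' (h : Relation.ReflTransGen (Step R T k P) A B) (hA : A ⊆ P) : B ⊆ P := by
  induction h with
  | refl => exact hA
  | tail _ h ih => exact h.le.2

lemma Tr.sub (h : Tr R k P W) : W ⊆ P := by
  cases k with
  | zero => rw [h.2]; simp
  | succ k => exact rtg_le h.2.2.2

lemma Tr.empty (h : Tr R k P W) : Tr R k P ∅ := by
  cases k with
  | zero => exact ⟨h.1, rfl⟩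
  | succ k => exact ⟨h.1, h.2.1, .refl, h.2.2.1.trans h.2.2.2⟩

lemma Tr.full (h : Tr R k P W) : Tr R k P P := by
  cases k with
  | zero => exact ⟨h.1, h.1⟩
  | succ k => exact ⟨h.1, h.2.1, h.2.2.1.trans h.2.2.2, .refl⟩

lemma Step.rev (hR : ∀ x, ¬ R x x) (hT : ∀ P W, T P W → T P (P \ W)) (h : Step R T k P A B) :
    Step R T k P (P \ B) (P \ A) := by
  obtain ⟨h1, v, hv, hvA, rfl, h2, h3⟩ := h
  refine ⟨sdiff_subset, v, hv, by simp, ?_, ?_, ?_⟩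
  · ext x; simp only [mem_sdiff, mem_insert]
    by_cases hx : x = v
    · subst hx; simp [hv, hvA]
    · simp [hx]
  · have := hT _ _ h2
    convert this using 1
    ext x; simp only [mem_sdiff, mem_inter, mem_insert, mem_nbr]
    by_cases hx : x = v
    · subst hx; simp [hR]
    · simp only [hx, false_or]; tauto
  · rcases h3 with h3 | h3
    · exact Or.inl h3
    · right
      constructor
      · intro hne
        have := h3.2 (fun h => hne (by rw [h]; simp))
        intro he
        apply this
        intro x hx
        by_contra hxA
        have hx' := mem_nbr.1 hx
        have : x ∈ (P \ insert v A) ∩ nbr R P v := by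
          refine mem_inter.2 ⟨mem_sdiff.2 ⟨hx'.1, ?_⟩, hx⟩
          rw [mem_insert]; rintro (rfl | h)
          · exact hR _ hx'.2
          · exact hxA h
        rw [he] at this; simp at this
      · intro hne hs
        have := h3.1 (fun h => hne (by rw [h]; simp))
        obtain ⟨x, hx⟩ := nonempty_iff_ne_empty.2 this
        rw [mem_inter] at hx
        have := hs hx.2
        simp [hx.1] at this

lemma rtg_rev (hR : ∀ x, ¬ R x x) (hT : ∀ P W, T P W → T P (P \ W))
    (h : Relation.ReflTransGen (Step R T k P) A B) : Relation.ReflTransGen (Step R T k P) (P \ B) (P \ A) := by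
  induction h with
  | refl => exact .refl
  | tail _ h ih => exact .head (h.rev hR hT) ih

lemma Tr.rev (hR : ∀ x, ¬ R x x) : ∀ (k : ℕ) (P W : Finset X), Tr R k P W → Tr R k P (P \ W) := by
  intro k
  induction k with
  | zero => intro P W h; exact ⟨h.1, by rw [h.1]; simp⟩
  | succ k ih =>
    intro P W h
    refine ⟨h.1, h.2.1, ?_, ?_⟩
    · have := rtg_rev hR ih h.2.2.2; simpa using this
    · have := rtg_rev hR ih h.2.2.1; simpa using this

lemma Tr.im {R' : Y → Y → Prop} : ∀ (k : ℕ) (P W : Finset X) (f : X → Y), Set.InjOn f P →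
    (∀ x ∈ P, ∀ y ∈ P, R' (f x) (f y) ↔ R x y) → Tr R k P W → Tr R' k (P.image f) (W.image f) := by
  intro k
  induction k with
  | zero => intro P W f _ _ h; rw [h.1, h.2]; exact ⟨by simp, by simp⟩
  | succ k ih =>
    intro P W f hf hR h
    have key : ∀ A B, Step R (Tr R k) k P A B → Step R' (Tr R' k) k (P.image f) (A.image f) (B.image f) := by
      rintro A B ⟨h1, v, hv, hvA, rfl, h2, h3⟩
      have e1 : nbr R' (P.image f) (f v) = (nbr R P v).image f := by
        ext y; simp only [mem_nbr, mem_image]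
        constructor
        · rintro ⟨⟨x, hx, rfl⟩, h⟩
          exact ⟨x, ⟨hx, (hR _ hv _ hx).1 h⟩, rfl⟩
        · rintro ⟨x, ⟨hx, h⟩, rfl⟩
          exact ⟨⟨x, hx, rfl⟩, (hR _ hv _ hx).2 h⟩
      have hnP : nbr R P v ⊆ P := filter_subset _ _
      have inj : ∀ {S : Finset X} {x : X}, S ⊆ P → x ∈ P → (f x ∈ S.image f ↔ x ∈ S) := by
        intro S x hS hx
        constructor
        · intro h
          obtain ⟨y, hy, hyx⟩ := mem_image.1 h
          rwa [← hf (hS hy) hx hyx]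
        · exact mem_image_of_mem f
      have e2 : A.image f ∩ (nbr R P v).image f = (A ∩ nbr R P v).image f := by
        ext y
        simp only [mem_inter, mem_image]
        constructor
        · rintro ⟨⟨x, hx, rfl⟩, h⟩
          exact ⟨x, ⟨hx, (inj hnP (h1 hx)).1 (mem_image.2 h)⟩, rfl⟩
        · rintro ⟨x, ⟨hx, h⟩, rfl⟩
          exact ⟨⟨x, hx, rfl⟩, ⟨x, h, rfl⟩⟩
      refine ⟨image_subset_image h1, f v, mem_image_of_mem _ hv, ?_, image_insert _ _ _, ?_, ?_⟩
      · rw [inj h1 hv]; exact hvA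
      · rw [e1, e2]
        exact ih _ _ _ (hf.mono (by exact_mod_cast hnP)) (fun x hx y hy => hR _ (hnP hx) _ (hnP hy)) h2
      · rcases h3 with h3 | h3
        · exact Or.inl h3
        right
        rw [e1, e2]
        refine ⟨fun h => ?_, fun h hs => ?_⟩
        · have := h3.1 (by rintro rfl; simp at h)
          rwa [ne_eq, image_eq_empty]
        · refine h3.2 (by intro h'; rw [h'] at h; exact h rfl) ?_
          intro x hx
          exact (inj h1 (hnP hx)).1 (hs (mem_image_of_mem f hx))
    have key2 : ∀ {A B}, Relation.ReflTransGen (Step R (Tr R k) k P) A B →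
        Relation.ReflTransGen (Step R' (Tr R' k) k (P.image f)) (A.image f) (B.image f) := by
      intro A B h
      exact h.lift _ key
    refine ⟨?_, ?_, ?_, key2 h.2.2.2⟩
    · rw [card_image_of_injOn hf]; exact h.1
    · rw [card_image_of_injOn hf]; exact h.2.1
    · have := key2 h.2.2.1; simpa using this

lemma Tr.first (h : Tr R (k+1) P W) : ∃ x ∈ P, Tr R (k+1) P {x} := by
  have h' := h.empty
  rcases Relation.ReflTransGen.cases_head h'.2.2.2 with h0 | ⟨S, h1, h2⟩
  · have := h.1; rw [← h0] at this; simp at this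
  · have h3 := h1
    obtain ⟨-, v, hv, -, rfl, -⟩ := h1
    refine ⟨v, hv, h.1, h.2.1, ?_, ?_⟩
    · simpa using Relation.ReflTransGen.single h3
    · simpa using h2

lemma aux_sets {W A T B N : Finset X} (h1 : W ⊆ A) (h2 : T ⊆ B) (h3 : N ⊆ B) (hd : ∀ x, x ∈ A → x ∈ B → False) :
    (W ∪ T) ∩ (A ∪ N) = W ∪ (T ∩ N) := by
  ext x; simp only [mem_inter, mem_union]
  have a1 := hd x; have a2 := @h1 x; have a3 := @h2 x; have a4 := @h3 x
  clear * - a1 a2 a3 a4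
  tauto

set_option maxHeartbeats 1000000 in
lemma Tr.join (hR : ∀ x, ¬ R x x) (hS : ∀ x y, R x y → R y x) : ∀ (n i j : ℕ), i + j = n → ∀ (A B W1 W2 : Finset X),
    (∀ a ∈ A, ∀ b ∈ B, R a b) → Tr R i A W1 → Tr R j B W2 →
    ((W1 ≠ ∅ ∧ W1 ≠ A) ∨ (W1 = ∅ ∧ W2 = ∅) ∨ (W1 = A ∧ W2 = B)) → Tr R n (A ∪ B) (W1 ∪ W2) := by
  intro n
  induction n with
  | zero =>
    intro i j hij A B W1 W2 hAB h1 h2 _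
    obtain rfl : i = 0 := by omega
    obtain rfl : j = 0 := by omega
    rw [h1.1, h1.2, h2.1, h2.2]; exact ⟨by simp, by simp⟩
  | succ n ih =>
    intro i j hij A B W1 W2 hAB h1 h2 hc
    rcases i with _ | i
    · obtain rfl : j = n + 1 := by omega
      rw [h1.1, h1.2, empty_union, empty_union]; exact h2
    rcases j with _ | j
    · obtain rfl : i = n := by omega
      rw [h2.1, h2.2, union_empty, union_empty]; exact h1
    have hn0 : n ≠ 0 := by omega
    have hdis : ∀ x, x ∈ A → x ∈ B → False := fun x ha hb => hR x (hAB x ha x hb)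
    have hAne : A ≠ ∅ := by have := h1.1; rintro rfl; simp at this
    have hBne : B ≠ ∅ := by have := h2.1; rintro rfl; simp at this
    have nA : ∀ v ∈ A, nbr R (A ∪ B) v = nbr R A v ∪ B := by
      intro v hv; ext x; simp only [mem_nbr, mem_union]
      constructor
      · tauto
      · rintro (h | h)
        · exact ⟨Or.inl h.1, h.2⟩
        · exact ⟨Or.inr h, hAB _ hv _ h⟩
    have nB : ∀ v ∈ B, nbr R (A ∪ B) v = A ∪ nbr R B v := by
      intro v hv; ext x; simp only [mem_nbr, mem_union]
      constructor
      · tauto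
      · rintro (h | h)
        · exact ⟨Or.inl h, hS _ _ (hAB _ h _ hv)⟩
        · exact ⟨Or.inr h.1, h.2⟩
    have hcard : 2 ≤ (A ∪ B).card := h1.1.trans (card_le_card subset_union_left)
    -- the nontrivial case
    have main : ∀ W1 W2, Tr R (i+1) A W1 → Tr R (j+1) B W2 → W1 ≠ ∅ → W1 ≠ A → Tr R (n+1) (A ∪ B) (W1 ∪ W2) := by
      intro W1 W2 h1 h2 hne hnA
      have hW1 : W1 ⊆ A := h1.sub
      have p1 : Relation.ReflTransGen (Step R (Tr R n) n (A ∪ B)) ∅ W1 := by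
        have : ∀ S, Relation.ReflTransGen (Step R (Tr R i) i A) S W1 →
            Relation.ReflTransGen (Step R (Tr R n) n (A ∪ B)) S W1 := by
          intro S hSW
          induction hSW using Relation.ReflTransGen.head_induction_on with
          | refl => exact .refl
          | head hst hr ihh =>
            rename_i S S'
            refine .head ?_ ihh
            have hle := rtg_le hr
            have hne' : S' ≠ A := by
              rintro rfl; exact hnA (Finset.Subset.antisymm hW1 hle)
            obtain ⟨q1, v, hv, hvS, rfl, q2, q3⟩ := hst
            have hBS : ∀ x, x ∈ S → x ∉ B := fun x h h' => hdis x (q1 h) h'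
            have hi0 : i = 0 → S = ∅ := by
              intro hi
              by_contra hSne
              have c1 := h1.2.1 hi
              have c2 : 0 < S.card := card_pos.2 (nonempty_iff_ne_empty.2 hSne)
              apply hne'
              apply eq_of_subset_of_card_le (insert_subset hv q1)
              rw [card_insert_of_notMem hvS]; omega
            refine ⟨q1.trans subset_union_left, v, mem_union_left _ hv, hvS, rfl, ?_, Or.inr ⟨?_, ?_⟩⟩
            · rw [nA v hv]
              have e : S ∩ (nbr R A v ∪ B) = (S ∩ nbr R A v) ∪ ∅ := by
                ext x; simp only [mem_inter, mem_union]
                have h5 := hBS x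
                clear * - h5
                simp; tauto
              rw [e]
              refine ih i (j+1) (by omega) _ _ _ _ (fun a ha b hb => hAB _ (mem_nbr.1 ha).1 _ hb) q2 h2.empty ?_
              by_cases hz : S ∩ nbr R A v = ∅
              · exact Or.inr (Or.inl ⟨hz, rfl⟩)
              · left
                refine ⟨hz, fun he => ?_⟩
                rcases q3 with q3 | q3
                · rw [hi0 q3] at hz; simp at hz
                · exact q3.2 hne' (inter_eq_right.1 he)
            · intro hSne
              rcases q3 with q3 | q3
              · exact absurd (hi0 q3) hSne
              · intro he
                apply q3.1 hSne
                rw [← subset_empty, ← he, nA v hv]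
                exact inter_subset_inter (Finset.Subset.refl _) subset_union_left
            · intro _ hs
              obtain ⟨b, hb⟩ := nonempty_iff_ne_empty.2 hBne
              have := hs (by rw [nA v hv]; exact mem_union_right _ hb)
              exact hBS b this hb
        exact this _ h1.2.2.1
      have p2 : ∀ {S S'}, Relation.ReflTransGen (Step R (Tr R j) j B) S S' →
          Relation.ReflTransGen (Step R (Tr R n) n (A ∪ B)) (W1 ∪ S) (W1 ∪ S') := by
        intro S S' h
        refine h.lift (fun S => W1 ∪ S) ?_
        rintro S S' ⟨q1, v, hv, hvS, rfl, q2, q3⟩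
        refine ⟨union_subset_union hW1 q1, v, mem_union_right _ hv, ?_, ?_, ?_, Or.inr ⟨?_, ?_⟩⟩
        · rw [mem_union]; rintro (h | h)
          · exact hdis v (hW1 h) hv
          · exact hvS h
        · exact union_insert _ _ _
        · rw [nB v hv]
          have e : (W1 ∪ S) ∩ (A ∪ nbr R B v) = W1 ∪ (S ∩ nbr R B v) := by
            exact aux_sets hW1 q1 (fun x h => (mem_nbr.1 h).1) hdis
          rw [e]
          exact ih (i+1) j (by omega) _ _ _ _ (fun a ha b hb => hAB _ ha _ (mem_nbr.1 hb).1) h1 q2 (Or.inl ⟨hne, hnA⟩)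
        · intro _ he
          apply hne
          rw [← subset_empty, ← he, nB v hv]
          intro x hx
          exact mem_inter.2 ⟨mem_union_left _ hx, mem_union_left _ (hW1 hx)⟩
        · intro _ hs
          apply hnA
          refine Finset.Subset.antisymm hW1 fun x hx => ?_
          have := hs (by rw [nB v hv]; exact mem_union_left _ hx)
          rcases mem_union.1 this with h | h
          · exact h
          · exact (hdis x hx (q1 h)).elim
      have p3 : ∀ S, Relation.ReflTransGen (Step R (Tr R i) i A) W1 S →
          Relation.ReflTransGen (Step R (Tr R n) n (A ∪ B)) (W1 ∪ B) (S ∪ B) := by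
        intro S h
        induction h with
        | refl => exact .refl
        | tail hr hst ihh =>
          rename_i S S'
          refine .tail ihh ?_
          have hle := rtg_le hr
          obtain ⟨q1, v, hv, hvS, rfl, q2, q3⟩ := hst
          have hSne : S ≠ ∅ := by rintro rfl; exact hne (subset_empty.1 hle)
          have hi0 : i = 0 → insert v S = A := by
            intro hi
            have c1 := h1.2.1 hi
            have c2 : 0 < S.card := card_pos.2 (nonempty_iff_ne_empty.2 hSne)
            apply eq_of_subset_of_card_le (insert_subset hv q1)
            rw [card_insert_of_notMem hvS]; omega
          refine ⟨union_subset_union q1 (Finset.Subset.refl _), v, mem_union_left _ hv, ?_, ?_, ?_, Or.inr ⟨?_, ?_⟩⟩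
          · rw [mem_union]; rintro (h | h)
            · exact hvS h
            · exact hdis v hv h
          · rw [insert_union]
          · rw [nA v hv]
            have e : (S ∪ B) ∩ (nbr R A v ∪ B) = (S ∩ nbr R A v) ∪ B := by
              rw [inter_union_distrib_right]
            rw [e]
            refine ih i (j+1) (by omega) _ _ _ _ (fun a ha b hb => hAB _ (mem_nbr.1 ha).1 _ hb) q2 h2.full ?_
            by_cases hz : S ∩ nbr R A v = nbr R A v
            · exact Or.inr (Or.inr ⟨hz, rfl⟩)
            · left
              refine ⟨fun he => ?_, hz⟩
              rcases q3 with q3 | q3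
              · subst q3
                exact hz (q2.2.trans q2.1.symm)
              · exact q3.1 hSne he
          · intro _ he
            apply hBne
            rw [← subset_empty, ← he, nA v hv]
            intro x hx
            exact mem_inter.2 ⟨mem_union_right _ hx, mem_union_right _ hx⟩
          · intro hne' hs
            have hne'' : insert v S ≠ A := by rintro h; rw [h] at hne'; exact hne' rfl
            rcases q3 with q3 | q3
            · exact hne'' (hi0 q3)
            · apply q3.2 hne''
              intro x hx
              have := hs (by rw [nA v hv]; exact mem_union_left _ hx)
              rcases mem_union.1 this with h | h
              · exact h
              · exact (hdis x (mem_nbr.1 hx).1 h).elim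
      refine ⟨hcard, fun h => absurd h hn0, ?_, ?_⟩
      · have := p2 h2.2.2.1
        rw [union_empty] at this
        exact p1.trans this
      · exact (p2 h2.2.2.2).trans (p3 _ h1.2.2.2)
    obtain ⟨x, hx, hx1⟩ := h1.first
    have hx2 := main {x} W2 hx1 h2 (by simp) (by rintro h; have := h1.1; rw [← h] at this; simp at this)
    rcases hc with hc | hc | hc
    · exact main W1 W2 h1 h2 hc.1 hc.2
    · rw [hc.1, hc.2, union_empty]; exact hx2.empty
    · rw [hc.1, hc.2]; exact hx2.full
end
end HS

namespace HS
open Finset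
open scoped Classical
set_option linter.all false
section
variable {V W U : Type*} [DecidableEq V] [DecidableEq W] [DecidableEq U]

def flk (K : Finset (Finset V)) (α : Finset V) : Finset (Finset V) := K.filter (fun t => Disjoint t α ∧ t ∪ α ∈ K)

lemma mem_flk {K : Finset (Finset V)} (hK : Cx K) {α t : Finset V} : t ∈ flk K α ↔ Disjoint t α ∧ t ∪ α ∈ K := by
  simp only [flk, mem_filter, and_iff_right_iff_imp]
  exact fun h => hK.2 _ h.2 _ subset_union_left

lemma flk_cx {K : Finset (Finset V)} (hK : Cx K) {α : Finset V} (hα : α ∈ K) : Cx (flk K α) := by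
  refine ⟨(mem_flk hK).2 ⟨by simp, by simpa using hα⟩, fun s hs t hts => ?_⟩
  rw [mem_flk hK] at hs ⊢
  exact ⟨hs.1.mono_left hts, hK.2 _ hs.2 _ (union_subset_union hts (Finset.Subset.refl _))⟩

lemma flk_empty {K : Finset (Finset V)} (hK : Cx K) : flk K ∅ = K := by
  ext t; rw [mem_flk hK]; simp

lemma flk_insert {K : Finset (Finset V)} (hK : Cx K) {v : V} {α : Finset V} (hα : insert v α ∈ K) (hv : v ∉ α) :
    flk K (insert v α) = lk (flk K α) v := by
  ext t
  rw [mem_flk hK, (flk_cx hK (hK.2 _ hα _ (subset_insert _ _))).mem_lk, mem_flk hK, disjoint_insert_right,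
    disjoint_insert_left, union_insert, insert_union]
  tauto

lemma HS.flk {α : Finset V} : ∀ {k j : ℕ} {K : Finset (Finset V)}, HS k K → α ∈ K → j + α.card = k → HS j (flk K α) := by
  induction α using Finset.induction_on with
  | empty => intro k j K h hα hj; simp at hj; subst hj; rwa [flk_empty h.cx]
  | insert v α hv ih =>
    intro k j K h hα hj
    rw [card_insert_of_notMem hv] at hj
    rw [flk_insert h.cx hα hv]
    refine (ih (j := j + 1) h (h.cx.2 _ hα _ (subset_insert _ _)) (by omega)).lk ?_
    rw [mem_flk h.cx]
    exact ⟨by simpa using hv, by rwa [← insert_eq]⟩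

lemma vs_flk {K : Finset (Finset V)} (hK : Cx K) {α : Finset V} (hα : α ∈ K) : (vs (flk K α)).card + α.card ≤ (vs K).card := by
  rw [← card_union_of_disjoint]
  · refine card_le_card ?_
    intro x hx
    rcases mem_union.1 hx with h | h
    · obtain ⟨t, ht, hxt⟩ := mem_vs.1 h
      exact mem_vs.2 ⟨_, ((mem_flk hK).1 ht).2, mem_union_left _ hxt⟩
    · exact mem_vs.2 ⟨_, hα, h⟩
  · rw [disjoint_left]
    intro x hx
    obtain ⟨t, ht, hxt⟩ := mem_vs.1 hx
    exact disjoint_left.1 ((mem_flk hK).1 ht).1 hxt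

def Adj (a b : Finset V) : Prop := a ⊂ b ∨ b ⊂ a

lemma adj_irr (a : Finset V) : ¬ Adj a a := by simp [Adj]
lemma adj_symm (a b : Finset V) (h : Adj a b) : Adj b a := h.symm

def Dn (α : Finset V) : Finset (Finset V) := α.ssubsets.erase ∅
def Up (K : Finset (Finset V)) (α : Finset V) : Finset (Finset V) := K.filter (fun β => α ⊂ β)

lemma mem_Dn {α t : Finset V} : t ∈ Dn α ↔ t ≠ ∅ ∧ t ⊂ α := by simp [Dn]
lemma mem_Up {K : Finset (Finset V)} {α t : Finset V} : t ∈ Up K α ↔ t ∈ K ∧ α ⊂ t := by simp [Up]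

lemma nbr_eq {K : Finset (Finset V)} (hK : Cx K) {α : Finset V} (hα : α ∈ K) :
    nbr Adj (K.erase ∅) α = Dn α ∪ Up K α := by
  ext t
  rw [mem_nbr, mem_union, mem_Dn, mem_Up, mem_erase, Adj]
  constructor
  · tauto
  · rintro (h | h)
    · exact ⟨⟨h.1, hK.2 _ hα _ h.2.1⟩, Or.inr h.2⟩
    · exact ⟨⟨by rintro rfl; simp at h, h.1⟩, Or.inl h.2⟩

lemma Dn_Up {K : Finset (Finset V)} {α : Finset V} : ∀ a ∈ Dn α, ∀ b ∈ Up K α, Adj a b := fun a ha b hb =>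
  Or.inl ((mem_Dn.1 ha).2.trans (mem_Up.1 hb).2)

lemma Up_im {K : Finset (Finset V)} (hK : Cx K) {α : Finset V} (hα : α ∈ K) : Up K α = ((flk K α).erase ∅).image (· ∪ α) := by
  ext t
  rw [mem_Up, mem_image]
  constructor
  · rintro ⟨h1, h2⟩
    refine ⟨t \ α, ?_, sdiff_union_of_subset h2.1⟩
    rw [mem_erase, mem_flk hK, sdiff_union_of_subset h2.1]
    refine ⟨?_, sdiff_disjoint, h1⟩
    intro h; exact h2.2 (sdiff_eq_empty_iff_subset.1 h)
  · rintro ⟨s, hs, rfl⟩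
    rw [mem_erase, mem_flk hK] at hs
    refine ⟨hs.2.2, subset_union_right, fun h => hs.1 ?_⟩
    have := hs.2.1
    rw [← disjoint_self_iff_empty]
    exact this.mono_right (subset_union_left.trans h)

lemma un_ss {α s t : Finset V} (hs : Disjoint s α) (ht : Disjoint t α) : s ∪ α ⊂ t ∪ α ↔ s ⊂ t := by
  have key : ∀ {s t : Finset V}, Disjoint s α → (s ∪ α ⊆ t ∪ α ↔ s ⊆ t) := by
    intro s t hs
    refine ⟨fun h x hx => ?_, fun h => union_subset_union h (Finset.Subset.refl _)⟩
    rcases mem_union.1 (h (mem_union_left _ hx)) with h' | h'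
    · exact h'
    · exact (disjoint_left.1 hs hx h').elim
  rw [Finset.ssubset_def, Finset.ssubset_def, key hs, key ht]

def SV (V : Type*) [DecidableEq V] (j : ℕ) : Prop := ∀ K : Finset (Finset V), HS j K → (vs K).card ≤ j + 7 → ∀ v, {v} ∈ K →
  Tr Adj j (K.erase ∅) {{v}}

def MM (V : Type*) [DecidableEq V] (j : ℕ) : Prop := ∀ K : Finset (Finset V), HS j K → (vs K).card ≤ j + 7 → ∀ σ ∈ K, σ ≠ ∅ →
  ∀ v, Expd v (del K σ) → Tr Adj j (K.erase ∅) {{v}} ∧ Tr Adj j (K.erase ∅) ((del K σ).erase ∅)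

lemma MM.sv [Infinite V] {j : ℕ} (h : MM V j) : SV V j := by
  intro K hK hc v hv
  obtain ⟨σ, hσ, hσk, hvσ⟩ := hK.avoid v
  have hj : 1 ≤ j := by simpa using hK.card_le _ hv
  have hne : σ ≠ ∅ := by rintro rfl; simp at hσk; omega
  refine (h K hK hc σ hσ hne v ?_).1
  refine Expd.of_acyc _ rfl (del_cx hK.cx _) (hK.acyc hσ (nonempty_iff_ne_empty.2 hne))
    (mem_del.2 ⟨hv, by simpa using hvσ⟩) ?_
  have : (vs (del K σ)).card + σ.card ≤ (vs K).card := by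
    rw [← card_union_of_disjoint]
    · refine card_le_card ?_
      intro x hx
      rcases mem_union.1 hx with h | h
      · obtain ⟨t, ht, hxt⟩ := mem_vs.1 h
        exact mem_vs.2 ⟨_, (mem_del.1 ht).1, hxt⟩
      · exact mem_vs.2 ⟨_, hσ, h⟩
    · rw [disjoint_left]
      intro x hx
      obtain ⟨t, ht, hxt⟩ := mem_vs.1 hx
      exact disjoint_left.1 (mem_del.1 ht).2 hxt
  omega

lemma SV.empty {j : ℕ} (h : SV V j) {K : Finset (Finset V)} (hK : HS j K) (hc : (vs K).card ≤ j + 7) :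
    Tr Adj j (K.erase ∅) ∅ := by
  rcases j with _ | j
  · have : K = {∅} := hK
    rw [this]; exact ⟨by simp, rfl⟩
  · obtain ⟨f, hf, hfk, -⟩ := hK.pure hK.cx.1
    obtain ⟨x, hx⟩ : f.Nonempty := by rw [← card_pos]; omega
    exact (h K hK hc x (hK.cx.vert hf hx)).empty

/-- upper neighbourhoods -/
lemma TU {j k : ℕ} (h : SV V j) {K : Finset (Finset V)} (hK : HS k K) (hc : (vs K).card ≤ k + 7) {α : Finset V} (hα : α ∈ K)
    (hj : j + α.card = k) : Tr Adj j (Up K α) ∅ ∧ ∀ σ ∈ K, α ⊆ σ → α.card + 1 = σ.card → Tr Adj j (Up K α) {σ} := by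
  have h1 := hK.flk hα hj
  have h2 := vs_flk hK.cx hα
  have hd : ∀ s ∈ (flk K α).erase ∅, Disjoint s α := fun s hs => ((mem_flk hK.cx).1 (mem_of_mem_erase hs)).1
  have hinj : Set.InjOn (· ∪ α) (((flk K α).erase ∅ : Finset (Finset V)) : Set (Finset V)) := by
    intro s hs t ht hst
    simp only at hst
    have h1 := hd s hs; have h2 := hd t ht
    have e : ∀ {s : Finset V}, Disjoint s α → (s ∪ α) \ α = s := fun h => by
      rw [union_sdiff_right, sdiff_eq_self_of_disjoint h]
    rw [← e h1, ← e h2, hst]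
  have key : ∀ W, Tr Adj j ((flk K α).erase ∅) W → Tr Adj j (Up K α) (W.image (· ∪ α)) := by
    intro W hW
    rw [Up_im hK.cx hα]
    refine Tr.im _ _ _ _ hinj ?_ hW
    intro x hx y hy
    rw [Adj, Adj, un_ss (hd x hx) (hd y hy), un_ss (hd y hy) (hd x hx)]
  refine ⟨?_, ?_⟩
  · simpa using key _ (h.empty h1 (by omega))
  · intro σ hσ h3 h4
    obtain ⟨x, hx⟩ : ∃ x, σ \ α = {x} := by
      rw [← card_eq_one, card_sdiff_of_subset h3]; omega
    have e : {x} ∪ α = σ := by rw [← hx, sdiff_union_of_subset h3]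
    have hxα : x ∉ α := by
      have : x ∈ σ \ α := by rw [hx]; simp
      exact (mem_sdiff.1 this).2
    have := key _ (h _ h1 (by omega) x ((mem_flk hK.cx).2 ⟨by simpa using hxα, by rwa [e]⟩))
    rwa [image_singleton, e] at this

lemma vs_ssub {α : Finset V} : vs α.ssubsets ⊆ α := by
  intro x hx
  obtain ⟨t, ht, hxt⟩ := mem_vs.1 hx
  exact (mem_ssubsets.1 ht).1 hxt

lemma hs_ssub {α : Finset V} {j : ℕ} (h : α.card = j + 1) : HS j α.ssubsets ∧ (vs α.ssubsets).card ≤ j + 7 :=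
  ⟨(PL.ssub h).hs, (card_le_card vs_ssub).trans (by omega)⟩

lemma TD {j : ℕ} (h : SV V j) {α : Finset V} (hα : α.card = j + 1) : Tr Adj j (Dn α) ∅ :=
  h.empty (hs_ssub hα).1 (hs_ssub hα).2

lemma TD1 {j : ℕ} (h : SV V j) {σ τ : Finset V} (hσ : σ.card = j + 1) (hτ : τ ⊆ σ) (hτ1 : τ.card + 1 = σ.card) (h0 : τ ≠ ∅) :
    Tr Adj j (Dn σ) (Dn σ \ {τ}) := by
  refine Tr.rev adj_irr _ _ _ ?_
  obtain ⟨x, hx⟩ : ∃ x, σ \ τ = {x} := by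
    rw [← card_eq_one, card_sdiff_of_subset hτ]; omega
  have hxσ : x ∈ σ := by
    have : x ∈ σ \ τ := by rw [hx]; simp
    exact (mem_sdiff.1 this).1
  have hτc : 0 < τ.card := card_pos.2 (nonempty_iff_ne_empty.2 h0)
  have h1 := h _ (hs_ssub hσ).1 (hs_ssub hσ).2 x (by
    rw [mem_ssubsets]
    refine Finset.ssubset_iff_subset_ne.2 ⟨by simpa using hxσ, ?_⟩
    intro h; rw [← h] at hτ1; simp at hτ1; exact h0 hτ1)
  have hss : ∀ x ∈ Dn σ, ∀ y ∈ Dn σ, (σ \ x ⊂ σ \ y ↔ y ⊂ x) := by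
    intro x hx y hy
    have key : ∀ x ∈ Dn σ, ∀ y ∈ Dn σ, (σ \ x ⊆ σ \ y ↔ y ⊆ x) := by
      intro x hx y hy
      constructor
      · intro h z hz
        by_contra hzx
        have := h (mem_sdiff.2 ⟨(mem_Dn.1 hy).2.1 hz, hzx⟩)
        exact (mem_sdiff.1 this).2 hz
      · exact fun h => sdiff_subset_sdiff (Finset.Subset.refl _) h
    rw [Finset.ssubset_def, Finset.ssubset_def, key x hx y hy, key y hy x hx]
  have h2 := Tr.im (R' := Adj) j (Dn σ) {{x}} (fun γ => σ \ γ) ?_ ?_ h1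
  · convert h2 using 1
    · ext t
      rw [mem_image]
      constructor
      · intro ht
        rw [mem_Dn] at ht
        refine ⟨σ \ t, mem_Dn.2 ⟨?_, ?_⟩, ?_⟩
        · intro h; exact ht.2.2 (sdiff_eq_empty_iff_subset.1 h)
        · exact sdiff_ssubset ht.2.1 (nonempty_iff_ne_empty.2 ht.1)
        · exact Finset.sdiff_sdiff_eq_self ht.2.1
      · rintro ⟨s, hs, rfl⟩
        rw [mem_Dn] at hs ⊢
        refine ⟨?_, sdiff_ssubset hs.2.1 (nonempty_iff_ne_empty.2 hs.1)⟩
        intro h; exact hs.2.2 (sdiff_eq_empty_iff_subset.1 h)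
    · rw [image_singleton, ← hx, Finset.sdiff_sdiff_eq_self hτ]
  · intro s hs t ht hst
    simp only at hst
    rw [← Finset.sdiff_sdiff_eq_self (mem_Dn.1 hs).2.1, hst, Finset.sdiff_sdiff_eq_self (mem_Dn.1 ht).2.1]
  · intro x hx y hy
    rw [Adj, Adj, hss x hx y hy, hss y hy x hx, or_comm]

lemma TD2 {j : ℕ} (h : MM V j) {α γ : Finset V} (hα : α.card = j + 1) (hγ : γ ⊂ α) (h0 : γ ≠ ∅) :
    Tr Adj j (Dn α) (γ.powerset.erase ∅) := by
  obtain ⟨w, hw⟩ := nonempty_iff_ne_empty.2 h0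
  have hd : del α.ssubsets (α \ γ) = γ.powerset := by
    ext t
    rw [mem_del, mem_ssubsets, mem_powerset]
    constructor
    · rintro ⟨h1, h2⟩ x hx
      by_contra hxγ
      exact disjoint_left.1 h2 hx (mem_sdiff.2 ⟨h1.1 hx, hxγ⟩)
    · intro h
      refine ⟨h.trans_ssubset hγ, ?_⟩
      exact disjoint_sdiff.mono_left h
  have := (h _ (hs_ssub hα).1 (hs_ssub hα).2 (α \ γ) (mem_ssubsets.2 (sdiff_ssubset hγ.1 ⟨w, hw⟩)) ?_ w ?_).2
  · rwa [hd] at this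
  · intro h; exact hγ.2 (sdiff_eq_empty_iff_subset.1 h)
  · rw [hd]; exact Expd.simplex hw
end
end HS

namespace HS
open Finset
open scoped Classical
set_option linter.all false
section
variable {V W U : Type*} [DecidableEq V] [DecidableEq W] [DecidableEq U]

lemma Tr.two {X : Type*} [DecidableEq X] {R : X → X → Prop} {k : ℕ} {P W : Finset X} (h : Tr R k P W) (hk : k ≠ 0) : 2 ≤ P.card := by
  cases k with
  | zero => exact absurd rfl hk
  | succ k => exact h.1

variable {k : ℕ} {K : Finset (Finset V)}

lemma step_v (ih : ∀ j < k + 1, SV V j) (hK : HS (k+1) K) (hc : (vs K).card ≤ k + 1 + 7) {v : V} (hv : {v} ∈ K) :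
    Step Adj (Tr Adj k) k (K.erase ∅) ∅ {{v}} := by
  have hT : Tr Adj k (nbr Adj (K.erase ∅) {v}) ∅ := by
    rw [nbr_eq hK.cx hv]
    have := Tr.join adj_irr adj_symm k 0 k (by omega) _ _ _ _ (Dn_Up (K := K)) (TD (ih 0 (by omega)) (α := {v}) (by simp))
      (TU (ih k (by omega)) hK hc hv (by simp)).1 (Or.inr (Or.inl ⟨rfl, rfl⟩))
    simpa using this
  refine ⟨by simp, {v}, by simp [hv], by simp, by simp, by simpa using hT, ?_⟩
  by_cases h0 : k = 0
  · exact Or.inl h0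
  · refine Or.inr ⟨fun h => absurd rfl h, fun _ h => ?_⟩
    have := hT.two h0
    rw [subset_empty.1 h] at this; simp at this

lemma step_σ (ih : ∀ j < k + 1, SV V j) (hK : HS (k+1) K) (hc : (vs K).card ≤ k + 1 + 7) {L : Finset (Finset V)} {σ τ : Finset V}
    (hL : Cx L) (hLK : L ⊆ K) (h1 : τ ⊆ σ) (h2 : τ.card + 1 = σ.card) (h3 : τ ≠ ∅) (h4 : σ ∉ L) (h5 : τ ∉ L)
    (h6 : ∀ t, t ⊂ σ → t ≠ τ → t ∈ L) (hσ : σ ∈ K) :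
    Step Adj (Tr Adj k) k (K.erase ∅) (L.erase ∅) (insert σ (L.erase ∅)) := by
  have hτc : 0 < τ.card := card_pos.2 (nonempty_iff_ne_empty.2 h3)
  have hσc := hK.card_le _ hσ
  have hne : σ ≠ ∅ := by rintro rfl; simp at h2
  have hτD : τ ∈ Dn σ := mem_Dn.2 ⟨h3, Finset.ssubset_iff_subset_ne.2 ⟨h1, by rintro rfl; omega⟩⟩
  have hD : Tr Adj (σ.card - 1) (Dn σ) (Dn σ \ {τ}) := TD1 (ih _ (by omega)) (by omega) h1 h2 h3
  have e : L.erase ∅ ∩ (Dn σ ∪ Up K σ) = (Dn σ \ {τ}) ∪ ∅ := by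
    ext t
    simp only [mem_inter, mem_erase, mem_union, mem_Dn, mem_Up, mem_sdiff, mem_singleton, notMem_empty, or_false]
    constructor
    · rintro ⟨⟨a, b⟩, c | c⟩
      · exact ⟨⟨a, c.2⟩, by rintro rfl; exact h5 b⟩
      · exact absurd (hL.2 _ b _ c.2.1) h4
    · rintro ⟨⟨a, b⟩, c⟩
      exact ⟨⟨a, h6 _ b c⟩, Or.inl ⟨a, b⟩⟩
  have hD0 : Dn σ \ {τ} ≠ ∅ := by
    have := hD.two (by omega)
    intro h
    have h' := card_le_card (sdiff_eq_empty_iff_subset.1 h)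
    simp at h'; omega
  refine ⟨erase_subset_erase _ hLK, σ, mem_erase.2 ⟨hne, hσ⟩, fun h => h4 (mem_of_mem_erase h), rfl, ?_, Or.inr ⟨?_, ?_⟩⟩
  · rw [nbr_eq hK.cx hσ, e]
    refine Tr.join adj_irr adj_symm k (σ.card - 1) (k + 1 - σ.card) (by omega) _ _ _ _ Dn_Up hD
      (TU (ih _ (by omega)) hK hc hσ (by omega)).1 (Or.inl ⟨hD0, ?_⟩)
    intro h
    have : τ ∈ Dn σ \ {τ} := by rw [h]; exact hτD
    simp at this
  · intro _
    rw [nbr_eq hK.cx hσ, e, union_empty]; exact hD0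
  · intro _ h
    have := h (show τ ∈ _ by rw [nbr_eq hK.cx hσ]; exact mem_union_left _ hτD)
    exact h5 (mem_of_mem_erase this)

lemma step_τ (ih : ∀ j < k + 1, SV V j) (hK : HS (k+1) K) (hc : (vs K).card ≤ k + 1 + 7) {L : Finset (Finset V)} {σ τ : Finset V}
    (hL : Cx L) (hLK : L ⊆ K) (h1 : τ ⊆ σ) (h2 : τ.card + 1 = σ.card) (h3 : τ ≠ ∅) (h4 : σ ∉ L) (h5 : τ ∉ L)
    (h6 : ∀ t, t ⊂ σ → t ≠ τ → t ∈ L) (hσ : σ ∈ K) :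
    Step Adj (Tr Adj k) k (K.erase ∅) (insert σ (L.erase ∅)) (insert τ (insert σ (L.erase ∅))) := by
  have hτc : 0 < τ.card := card_pos.2 (nonempty_iff_ne_empty.2 h3)
  have hσc := hK.card_le _ hσ
  have hne : σ ≠ ∅ := by rintro rfl; simp at h2
  have hτσ : τ ⊂ σ := Finset.ssubset_iff_subset_ne.2 ⟨h1, by rintro rfl; omega⟩
  have hτ : τ ∈ K := hK.cx.2 _ hσ _ h1
  have hU : Tr Adj (k + 1 - τ.card) (Up K τ) {σ} := (TU (ih _ (by omega)) hK hc hτ (by omega)).2 σ hσ h1 h2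
  have hσU : σ ∈ Up K τ := mem_Up.2 ⟨hσ, hτσ⟩
  have e : insert σ (L.erase ∅) ∩ (Dn τ ∪ Up K τ) = {σ} ∪ Dn τ := by
    ext t
    simp only [mem_inter, mem_erase, mem_union, mem_Dn, mem_Up, mem_insert, mem_singleton]
    constructor
    · rintro ⟨rfl | ⟨a, b⟩, c | c⟩
      · exact Or.inl rfl
      · exact Or.inl rfl
      · exact Or.inr c
      · exact absurd (hL.2 _ b _ c.2.1) h5
    · rintro (rfl | h)
      · exact ⟨Or.inl rfl, Or.inr ⟨hσ, hτσ⟩⟩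
      · exact ⟨Or.inr ⟨h.1, h6 _ (h.2.trans hτσ) h.2.ne⟩, Or.inl h⟩
  have hUne : ({σ} : Finset (Finset V)) ≠ Up K τ := by
    have := hU.two (by omega)
    intro h; rw [← h] at this; simp at this
  refine ⟨insert_subset (mem_erase.2 ⟨hne, hσ⟩) (erase_subset_erase _ hLK), τ, mem_erase.2 ⟨h3, hτ⟩, ?_, rfl, ?_, Or.inr ⟨?_, ?_⟩⟩
  · rw [mem_insert]; rintro (h | h)
    · exact hτσ.ne h
    · exact h5 (mem_of_mem_erase h)
  · rw [nbr_eq hK.cx hτ, e, union_comm (Dn τ)]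
    refine Tr.join adj_irr adj_symm k (k + 1 - τ.card) (τ.card - 1) (by omega) _ _ _ _
      (fun a ha b hb => adj_symm _ _ (Dn_Up b hb a ha)) hU
      (TD (ih _ (by omega)) (by omega)).full (Or.inl ⟨by simp, hUne⟩)
  · intro _
    rw [nbr_eq hK.cx hτ, e]; simp
  · intro _ h
    apply hUne
    refine Finset.Subset.antisymm (by simpa using hσU) ?_
    intro t ht
    have ht2 := h (show t ∈ _ by rw [nbr_eq hK.cx hτ]; exact mem_union_right _ ht)
    rw [mem_insert] at ht2
    rcases ht2 with h | h
    · simp [h]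
    · exact absurd (hL.2 _ (mem_of_mem_erase h) _ (mem_Up.1 ht).2.1) h5

lemma rtg_expd (ih : ∀ j < k + 1, SV V j) (hK : HS (k+1) K) (hc : (vs K).card ≤ k + 1 + 7) {L : Finset (Finset V)} {v : V}
    (h : Expd v L) : L ⊆ K → Relation.ReflTransGen (Step Adj (Tr Adj k) k (K.erase ∅)) {{v}} (L.erase ∅) := by
  induction h with
  | base =>
    intro _
    have : ({∅, {v}} : Finset (Finset V)).erase ∅ = {{v}} := by
      ext t; simp only [mem_erase, mem_insert, mem_singleton]
      constructor
      · tauto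
      · rintro rfl; simp
    rw [this]
  | step hL h1 h2 h3 h4 h5 h6 ihL =>
    rename_i L σ τ
    intro hs
    have hσ : σ ∈ K := hs (by simp)
    have hLK : L ⊆ K := fun t ht => hs (by simp [ht])
    have e : (insert σ (insert τ L)).erase ∅ = insert τ (insert σ (L.erase ∅)) := by
      have hne : σ ≠ ∅ := by rintro rfl; simp at h2
      rw [erase_insert_of_ne hne, erase_insert_of_ne h3, insert_comm]
    rw [e]
    exact ((ihL hLK).tail (step_σ ih hK hc hL.cx.1 hLK h1 h2 h3 h4 h5 h6 hσ)).tail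
      (step_τ ih hK hc hL.cx.1 hLK h1 h2 h3 h4 h5 h6 hσ)

lemma step_mixed (ih : ∀ j < k + 1, SV V j) (ihM : ∀ j < k + 1, MM V j) (hK : HS (k+1) K) (hc : (vs K).card ≤ k + 1 + 7)
    {σ : Finset V} {A : Finset (Finset V)} (hA1 : (del K σ).erase ∅ ⊆ A) (hA2 : A ⊆ K.erase ∅ \ σ.powerset)
    (hup : ∀ α ∈ A, ¬ Disjoint α σ → ∀ β ∈ K, α ⊆ β → β ∈ A) {α : Finset V} (hα : α ∈ K.erase ∅ \ σ.powerset) (hαA : α ∉ A)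
    (hmax : ∀ β ∈ K, α ⊂ β → β ∈ A) : Step Adj (Tr Adj k) k (K.erase ∅) A (insert α A) := by
  rw [mem_sdiff, mem_erase, mem_powerset] at hα
  obtain ⟨⟨hα0, hαK⟩, hασ⟩ := hα
  have hmeet : ¬ Disjoint α σ := fun h => hαA (hA1 (mem_erase.2 ⟨hα0, mem_del.2 ⟨hαK, h⟩⟩))
  have hγ0 : α \ σ ≠ ∅ := fun h => hασ (sdiff_eq_empty_iff_subset.1 h)
  have hγ : α \ σ ⊂ α := by
    refine Finset.ssubset_iff_subset_ne.2 ⟨sdiff_subset, fun h => hmeet ?_⟩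
    rw [← h]; exact sdiff_disjoint
  have hI0 : α ∩ σ ≠ ∅ := fun h => hmeet (disjoint_iff_inter_eq_empty.2 h)
  have hI : α ∩ σ ⊂ α := Finset.ssubset_iff_subset_ne.2 ⟨inter_subset_left, fun h => hασ (inter_eq_left.1 h)⟩
  have hIA : α ∩ σ ∉ A := fun h => by
    have := hA2 h
    rw [mem_sdiff, mem_powerset] at this
    exact this.2 inter_subset_right
  have hαc := hK.card_le _ hαK
  have hα1 : 0 < α.card := card_pos.2 (nonempty_iff_ne_empty.2 hα0)
  have hγA : ∀ t, t ≠ ∅ → t ⊆ α \ σ → t ∈ A := by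
    intro t h0 ht
    refine hA1 (mem_erase.2 ⟨h0, mem_del.2 ⟨hK.cx.2 _ hαK _ (ht.trans sdiff_subset), sdiff_disjoint.mono_left ht⟩⟩)
  have e : A ∩ (Dn α ∪ Up K α) = (α \ σ).powerset.erase ∅ ∪ Up K α := by
    ext t
    simp only [mem_inter, mem_erase, mem_union, mem_Dn, mem_Up, mem_powerset]
    constructor
    · rintro ⟨a, c | c⟩
      · left
        refine ⟨c.1, ?_⟩
        by_cases hd : Disjoint t σ
        · exact fun x hx => mem_sdiff.2 ⟨c.2.1 hx, disjoint_left.1 hd hx⟩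
        · exact absurd (hup t a hd α hαK c.2.1) hαA
      · exact Or.inr c
    · rintro (h | h)
      · exact ⟨hγA t h.1 h.2, Or.inl ⟨h.1, h.2.trans_ssubset hγ⟩⟩
      · exact ⟨hmax t h.1 h.2, Or.inr h⟩
  have hW0 : (α \ σ).powerset.erase ∅ ≠ ∅ := by
    apply nonempty_iff_ne_empty.1
    exact ⟨α \ σ, by simp only [mem_erase, mem_powerset]; exact ⟨hγ0, Finset.Subset.refl _⟩⟩
  refine ⟨fun t ht => (mem_sdiff.1 (hA2 ht)).1, α, mem_erase.2 ⟨hα0, hαK⟩, hαA, rfl, ?_, Or.inr ⟨?_, ?_⟩⟩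
  · rw [nbr_eq hK.cx hαK, e]
    refine Tr.join adj_irr adj_symm k (α.card - 1) (k + 1 - α.card) (by omega) _ _ _ _ Dn_Up (TD2 (ihM _ (by omega)) (by omega) hγ hγ0)
      (TU (ih _ (by omega)) hK hc hαK (by omega)).1.full (Or.inl ⟨hW0, ?_⟩)
    intro h
    have : α ∩ σ ∈ Dn α := mem_Dn.2 ⟨hI0, hI⟩
    rw [← h, mem_erase, mem_powerset] at this
    apply hI0
    rw [← disjoint_self_iff_empty]
    exact (sdiff_disjoint.mono_left this.2).mono_right inter_subset_right
  · intro _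
    rw [nbr_eq hK.cx hαK, e]
    obtain ⟨x, hx⟩ := nonempty_iff_ne_empty.2 hW0
    exact nonempty_iff_ne_empty.1 ⟨x, mem_union_left _ hx⟩
  · intro _ h
    exact hIA (h (by rw [nbr_eq hK.cx hαK]; exact mem_union_left _ (mem_Dn.2 ⟨hI0, hI⟩)))

lemma rtg_mixed (ih : ∀ j < k + 1, SV V j) (ihM : ∀ j < k + 1, MM V j) (hK : HS (k+1) K) (hc : (vs K).card ≤ k + 1 + 7)
    {σ : Finset V} : ∀ (n : ℕ) {A : Finset (Finset V)}, ((K.erase ∅ \ σ.powerset) \ A).card = n →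
    (del K σ).erase ∅ ⊆ A → A ⊆ K.erase ∅ \ σ.powerset →
    (∀ α ∈ A, ¬ Disjoint α σ → ∀ β ∈ K, α ⊆ β → β ∈ A) →
    Relation.ReflTransGen (Step Adj (Tr Adj k) k (K.erase ∅)) A (K.erase ∅ \ σ.powerset) := by
  intro n
  induction n with
  | zero =>
    intro A hn h1 h2 h3
    rw [card_eq_zero, sdiff_eq_empty_iff_subset] at hn
    rw [Finset.Subset.antisymm hn h2]
  | succ n ihn =>
    intro A hn h1 h2 h3
    obtain ⟨α, hα, hmax⟩ := Finset.exists_max_image ((K.erase ∅ \ σ.powerset) \ A) card (by rw [← card_pos]; omega)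
    rw [mem_sdiff] at hα
    have hQ := hα.1
    rw [mem_sdiff, mem_erase, mem_powerset] at hQ
    have hmax' : ∀ β ∈ K, α ⊂ β → β ∈ A := by
      intro β hβ hαβ
      by_contra hβA
      have := hmax β (by
        rw [mem_sdiff, mem_sdiff, mem_erase, mem_powerset]
        refine ⟨⟨⟨?_, hβ⟩, fun h => hQ.2 (hαβ.1.trans h)⟩, hβA⟩
        rintro rfl; simp at hαβ)
      have := card_lt_card hαβ
      omega
    refine .head (step_mixed ih ihM hK hc h1 h2 h3 hα.1 hα.2 hmax') (ihn ?_ (h1.trans (subset_insert _ _)) (insert_subset hα.1 h2) ?_)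
    · have : (K.erase ∅ \ σ.powerset) \ insert α A = ((K.erase ∅ \ σ.powerset) \ A).erase α := by
        ext t; simp only [mem_sdiff, mem_insert, mem_erase]; tauto
      rw [this, card_erase_of_mem (mem_sdiff.2 hα)]; omega
    · intro t ht hd β hβ htβ
      rw [mem_insert] at ht
      rcases ht with rfl | ht
      · by_cases h : t = β
        · rw [h]; simp
        · exact mem_insert_of_mem (hmax' β hβ (Finset.ssubset_iff_subset_ne.2 ⟨htβ, h⟩))
      · exact mem_insert_of_mem (h3 t ht hd β hβ htβ)

lemma HS.two (hK : HS (k+1) K) : 2 ≤ (K.erase ∅).card ∧ (k = 0 → (K.erase ∅).card = 2) := by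
  obtain ⟨f, hf, hfk, -⟩ := hK.pure hK.cx.1
  obtain ⟨r, hr, hrk⟩ := exists_subset_card_eq (show k ≤ f.card by omega)
  have hrK := hK.cx.2 _ hf _ hr
  have h2 := hK.closed r hrK hrk
  have hinj : Set.InjOn (fun x => insert x r) (nb K r : Set V) := by
    intro x hx y hy hxy
    have hx := mem_nb.1 hx
    have hy := mem_nb.1 hy
    have : x ∈ insert y r := by
      have h : insert x r = insert y r := hxy
      rw [← h]; simp
    simp only [mem_insert] at this
    exact this.resolve_right hx.1
  have hs : (nb K r).image (fun x => insert x r) ⊆ K.erase ∅ := by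
    intro t ht
    obtain ⟨x, hx, rfl⟩ := mem_image.1 ht
    exact mem_erase.2 ⟨by simp, (mem_nb.1 hx).2⟩
  have hc := card_image_of_injOn hinj
  refine ⟨by rw [← h2, ← hc]; exact card_le_card hs, ?_⟩
  rintro rfl
  obtain rfl : r = ∅ := card_eq_zero.1 hrk
  rw [← h2, ← hc]
  congr 1
  refine Finset.Subset.antisymm ?_ hs
  intro t ht
  rw [mem_erase] at ht
  have h1 := hK.card_le _ ht.2
  have h3 : 0 < t.card := card_pos.2 (nonempty_iff_ne_empty.2 ht.1)
  obtain ⟨x, rfl⟩ := card_eq_one.1 (show t.card = 1 by omega)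
  exact mem_image.2 ⟨x, mem_nb.2 ⟨by simp, by simpa using ht.2⟩, by simp⟩

theorem main_MM [Infinite V] (k : ℕ) : MM V k := by
  induction k using Nat.strong_induction_on with
  | _ k ihM =>
  rcases k with _ | k
  · intro K hK hc σ hσ hne
    have : K = {∅} := hK
    rw [this] at hσ
    exact absurd (by simpa using hσ) hne
  have ih : ∀ j < k + 1, SV V j := fun j hj => (ihM j hj).sv
  intro K hK hc σ hσ hne v hE
  have hv : {v} ∈ K := (mem_del.1 hE.cx.2).1
  have r1 : Relation.ReflTransGen (Step Adj (Tr Adj k) k (K.erase ∅)) ∅ {{v}} := .single (step_v ih hK hc hv)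
  have r2 := rtg_expd ih hK hc hE (fun t ht => (mem_del.1 ht).1)
  have r3 := rtg_mixed ih ihM hK hc (σ := σ) _ (A := (del K σ).erase ∅) rfl (Finset.Subset.refl _) ?_ ?_
  · obtain ⟨w, hw⟩ := nonempty_iff_ne_empty.2 hne
    have hwK := hK.cx.vert hσ hw
    have r4 := (Relation.ReflTransGen.single (step_v ih hK hc hwK)).trans (rtg_expd ih hK hc (Expd.simplex hw)
      (fun t ht => hK.cx.2 _ hσ _ (mem_powerset.1 ht)))
    have r5 := rtg_rev adj_irr (Tr.rev adj_irr k) r4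
    have e : K.erase ∅ \ σ.powerset.erase ∅ = K.erase ∅ \ σ.powerset := by
      ext t; simp only [mem_sdiff, mem_erase]; tauto
    rw [e, sdiff_empty] at r5
    exact ⟨⟨hK.two.1, hK.two.2, r1, r2.trans (r3.trans r5)⟩, ⟨hK.two.1, hK.two.2, r1.trans r2, r3.trans r5⟩⟩
  · intro t ht
    rw [mem_erase, mem_del] at ht
    rw [mem_sdiff, mem_erase, mem_powerset]
    refine ⟨⟨ht.1, ht.2.1⟩, fun h => ht.1 ?_⟩
    rw [← disjoint_self_iff_empty]
    exact ht.2.2.mono_right h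
  · intro t ht hd
    rw [mem_erase, mem_del] at ht
    exact absurd ht.2.2 hd

theorem main_Tr [Infinite V] {k : ℕ} {K : Finset (Finset V)} (hK : HS k K) (hc : (vs K).card ≤ k + 7) :
    Tr Adj k (K.erase ∅) ∅ := (main_MM k).sv.empty hK hc
end
end HS

namespace HS
open Finset
open scoped Classical
set_option linter.all false
section
variable {X : Type*} [DecidableEq X] {R : X → X → Prop} {k : ℕ} {P A B W : Finset X}

def Full (R : X → X → Prop) (k : ℕ) (P : Finset X) (l : List X) : Prop :=
  l.length = k ∧ (∀ x ∈ l, x ∈ P) ∧ l.Pairwise R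

lemma full_cons {v : X} {l : List X} : Full R (k+1) P (v :: l) ↔ v ∈ P ∧ Full R k (nbr R P v) l := by
  simp only [Full, List.length_cons, List.mem_cons, List.pairwise_cons, mem_nbr]
  constructor
  · rintro ⟨h1, h2, h3, h4⟩
    exact ⟨h2 v (Or.inl rfl), by omega, fun x hx => ⟨h2 x (Or.inr hx), h3 x hx⟩, h4⟩
  · rintro ⟨h1, h2, h3, h4⟩
    refine ⟨by omega, ?_, fun x hx => (h3 x hx).2, h4⟩
    rintro x (rfl | hx)
    · exact h1
    · exact (h3 x hx).1

lemma Full.perm (hS : ∀ x y, R x y → R y x) {l m : List X} (h : Full R k P l) (hm : l.Perm m) : Full R k P m :=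
  ⟨by rw [← hm.length_eq]; exact h.1, fun x hx => h.2.1 x (hm.mem_iff.2 hx),
    (hm.pairwise_iff (fun {x y} => hS x y)).1 h.2.2⟩

/-- The set of nonempty initial sets. -/
def Fac : List X → Finset (Finset X)
  | [] => ∅
  | v :: l => insert {v} ((Fac l).image (insert v))

lemma Fac_sub {l : List X} : ∀ {x : Finset X}, x ∈ Fac l → x.Nonempty ∧ ∀ y ∈ x, y ∈ l := by
  induction l with
  | nil => intro x hx; simp [Fac] at hx
  | cons v l ih =>
    intro x hx
    simp only [Fac, mem_insert, mem_image] at hx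
    rcases hx with rfl | ⟨y, hy, rfl⟩
    · simp
    · refine ⟨by simp, ?_⟩
      intro z hz
      rw [mem_insert] at hz
      rcases hz with rfl | hz
      · simp
      · exact List.mem_cons_of_mem _ ((ih hy).2 z hz)

lemma Fac_head {v : X} {l : List X} {x : Finset X} (hx : x ∈ Fac (v :: l)) : v ∈ x := by
  simp only [Fac, mem_insert, mem_image] at hx
  rcases hx with rfl | ⟨y, hy, rfl⟩ <;> simp

lemma Fac_move {u : X} {l : List X} : ∀ {x : Finset X}, x ∈ Fac l → u ∈ x → x ∈ Fac (u :: l.erase u) := by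
  induction l with
  | nil => intro x hx; simp [Fac] at hx
  | cons v l ih =>
    intro x hx hu
    by_cases hvu : v = u
    · subst hvu; rwa [List.erase_cons_head]
    · rw [List.erase_cons_tail (by simpa using hvu)]
      simp only [Fac, mem_insert, mem_image] at hx
      rcases hx with rfl | ⟨y, hy, rfl⟩
      · simp at hu; exact absurd hu.symm hvu
      · rw [mem_insert] at hu
        have := ih hy (hu.resolve_left (Ne.symm hvu))
        simp only [Fac, mem_insert, mem_image] at this ⊢
        right
        rcases this with rfl | ⟨z, hz, rfl⟩
        · exact ⟨{v}, Or.inl rfl, by ext a; simp; tauto⟩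
        · exact ⟨insert v z, Or.inr ⟨z, hz, rfl⟩, Finset.insert_comm _ _ _⟩

def Shel (E : List (List X)) : Prop := ∀ p l q, E = p ++ l :: q → ∀ g ∈ p, ∃ h ∈ p, ∃ x ∈ Fac l, x ∉ Fac g ∧ (Fac l).erase x ⊆ Fac h

def Hd (W : Finset X) (l : List X) : Prop := ∃ v ∈ W, ∃ l', l = v :: l'

lemma rtg_mem {T : Finset X → Finset X → Prop} (h : Relation.ReflTransGen (Step R T k P) A B) {w : X} (hw : w ∈ B) (hA : w ∉ A) :
    ∃ S, T (nbr R P w) S := by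
  induction h with
  | refl => exact absurd hw hA
  | tail hr hst ih =>
    obtain ⟨q1, v, hv, hvS, rfl, q2, q3⟩ := hst
    rw [mem_insert] at hw
    rcases hw with rfl | hw
    · exact ⟨_, q2⟩
    · exact ih hw

lemma Tr.nbr {w : X} (h : Tr R (k+1) P W) (hw : w ∈ P) : ∃ S, Tr R k (nbr R P w) S :=
  rtg_mem (h.2.2.1.trans h.2.2.2) hw (by simp)

lemma Tr.exists_full : ∀ {k : ℕ} {P W : Finset X}, Tr R k P W → ∃ l, Full R k P l := by
  intro k
  induction k with
  | zero => intro P W h; exact ⟨[], by simp [Full]⟩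
  | succ k ih =>
    intro P W h
    obtain ⟨w, hw⟩ : P.Nonempty := by rw [← card_pos]; have := h.1; omega
    obtain ⟨S, hS⟩ := h.nbr hw
    obtain ⟨l, hl⟩ := ih hS
    exact ⟨w :: l, full_cons.2 ⟨hw, hl⟩⟩

lemma Tr.exists_full' {w : X} (h : Tr R k P W) (hw : w ∈ P) : ∃ l, Full R k P (w :: l) := by
  cases k with
  | zero => rw [h.1] at hw; simp at hw
  | succ k =>
    obtain ⟨S, hS⟩ := h.nbr hw
    obtain ⟨l, hl⟩ := hS.exists_full
    exact ⟨l, full_cons.2 ⟨hw, hl⟩⟩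

lemma shel_step (hR : ∀ x, ¬ R x x) (hS : ∀ x y, R x y → R y x)
    (ih : ∀ P W, Tr R k P W → ∃ E1 E2, Shel (E1 ++ E2) ∧ (∀ l, l ∈ E1 ↔ Full R k P l ∧ Hd W l) ∧ ∀ l, l ∈ E1 ++ E2 ↔ Full R k P l)
    (h : Step R (Tr R k) k P A B) {E : List (List X)} (hE : Shel E) (hm : ∀ l, l ∈ E ↔ Full R (k+1) P l ∧ Hd A l) :
    ∃ E', Shel (E ++ E') ∧ ∀ l, l ∈ E ++ E' ↔ Full R (k+1) P l ∧ Hd B l := by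
  obtain ⟨q1, v, hv, hvA, rfl, q2, q3⟩ := h
  obtain ⟨E1, E2, hs, h1, h2⟩ := ih _ _ q2
  have hvn : ∀ m, Full R k (nbr R P v) m → v ∉ m := fun m hm hvm => hR v (mem_nbr.1 (hm.2.1 v hvm)).2
  refine ⟨(E1 ++ E2).map (v :: ·), ?_, ?_⟩
  swap
  · intro l
    rw [List.mem_append, hm, List.mem_map]
    constructor
    · rintro (⟨a, w, hw, l', rfl⟩ | ⟨m, hm, rfl⟩)
      · exact ⟨a, w, mem_insert_of_mem hw, l', rfl⟩
      · exact ⟨full_cons.2 ⟨hv, (h2 m).1 hm⟩, v, mem_insert_self _ _, m, rfl⟩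
    · rintro ⟨a, w, hw, l', rfl⟩
      rw [mem_insert] at hw
      rcases hw with rfl | hw
      · exact Or.inr ⟨l', (h2 _).2 (full_cons.1 a).2, rfl⟩
      · exact Or.inl ⟨a, w, hw, l', rfl⟩
  intro p l q hpq g hg
  rw [List.append_eq_append_iff] at hpq
  have main : ∀ p' : List (List X), p = E ++ p' → (E1 ++ E2).map (v :: ·) = p' ++ l :: q →
      ∃ h ∈ p, ∃ x ∈ Fac l, x ∉ Fac g ∧ (Fac l).erase x ⊆ Fac h := by
    rintro p' rfl he
    rw [List.map_eq_append_iff] at he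
    obtain ⟨p2, r2, he, rfl, hr⟩ := he
    rw [List.map_eq_cons_iff] at hr
    obtain ⟨m, q2', rfl, rfl, rfl⟩ := hr
    have hmF : Full R k (nbr R P v) m := (h2 m).1 (by rw [he]; simp)
    have hp2 : ∀ y ∈ p2, v ∉ y := fun y hy => hvn y ((h2 y).1 (by rw [he]; simp [hy]))
    have hvm := hvn m hmF
    -- lifting from the link
    have lift : ∀ g' ∈ p2, (∀ x' ∈ Fac m, x' ∉ Fac g' → insert v x' ∉ Fac g) →
        ∃ h ∈ E ++ p2.map (v :: ·), ∃ x ∈ Fac (v :: m), x ∉ Fac g ∧ (Fac (v :: m)).erase x ⊆ Fac h := by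
      intro g' hg' hx
      obtain ⟨h', hh', x', hx', hxg, hsub⟩ := hs p2 m q2' he g' hg'
      refine ⟨v :: h', List.mem_append_right _ (List.mem_map_of_mem hh'), insert v x', ?_, hx x' hx' hxg, ?_⟩
      · simp only [Fac, mem_insert, mem_image]; exact Or.inr ⟨x', hx', rfl⟩
      · intro y hy
        simp only [Fac, mem_erase, mem_insert, mem_image] at hy ⊢
        obtain ⟨hy1, rfl | ⟨z, hz, rfl⟩⟩ := hy
        · exact Or.inl rfl
        · refine Or.inr ⟨z, hsub (mem_erase.2 ⟨?_, hz⟩), rfl⟩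
          rintro rfl; exact hy1 rfl
    rw [List.mem_append] at hg
    rcases hg with hg | hg
    · -- g has head in A
      obtain ⟨hgF, u, huA, g', rfl⟩ := (hm g).1 hg
      have huv : u ≠ v := by rintro rfl; exact hvA huA
      have hvg : ({v} : Finset X) ∉ Fac (u :: g') := fun h => by
        have := Fac_head h; simp at this; exact huv this
      have hv1 : ({v} : Finset X) ∈ Fac (v :: m) := by simp [Fac]
      rcases m with _ | ⟨w, m⟩
      · refine ⟨u :: g', List.mem_append_left _ hg, {v}, hv1, hvg, ?_⟩
        intro y hy
        simp [Fac] at hy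
      by_cases hwA : w ∈ A
      · refine ⟨w :: v :: m, ?_, {v}, hv1, hvg, ?_⟩
        · refine List.mem_append_left _ ((hm _).2 ⟨?_, w, hwA, _, rfl⟩)
          exact (full_cons.2 ⟨hv, hmF⟩).perm hS (List.Perm.swap _ _ _)
        · intro y hy
          simp only [Fac, mem_erase, mem_insert, mem_image] at hy ⊢
          right
          obtain ⟨hy1, rfl | ⟨z, rfl | ⟨z', hz', rfl⟩, rfl⟩⟩ := hy
          · exact absurd rfl hy1
          · exact ⟨{v}, Or.inl rfl, Finset.pair_comm _ _⟩
          · exact ⟨insert v z', Or.inr ⟨z', hz', rfl⟩, Finset.insert_comm _ _ _⟩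
      · have hk0 : k ≠ 0 := by rintro rfl; simp [Full] at hmF
        have hE1 : ∀ y, Full R k (nbr R P v) y → Hd (A ∩ nbr R P v) y → y ∈ p2 := by
          intro y hy1 hy2
          have hy := (h1 y).2 ⟨hy1, hy2⟩
          rw [List.append_eq_append_iff] at he
          rcases he with ⟨a, rfl, -⟩ | ⟨a, rfl, ha⟩
          · exact List.mem_append_left _ hy
          · rcases a with _ | ⟨b, a⟩
            · simpa using hy
            · exfalso
              rw [List.cons_append, List.cons_eq_cons] at ha
              obtain ⟨-, w', hw', l', hl'⟩ := (h1 b).1 (by simp)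
              rw [← ha.1, List.cons_eq_cons] at hl'
              rw [← hl'.1] at hw'
              exact hwA (mem_inter.1 hw').1
        by_cases hum : u ∈ w :: m
        · have hun := hmF.2.1 u hum
          refine lift (u :: (w :: m).erase u) (hE1 _ (hmF.perm hS (List.perm_cons_erase hum)) ⟨u, mem_inter.2 ⟨huA, hun⟩, _, rfl⟩) ?_
          intro x' hx' hxn hin
          have := Fac_head hin
          rw [mem_insert] at this
          exact hxn (Fac_move hx' (this.resolve_left huv))
        · have hne : A ∩ nbr R P v ≠ ∅ := (q3.resolve_left hk0).1 (by rintro rfl; simp at huA)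
          obtain ⟨w', hw'⟩ := nonempty_iff_ne_empty.2 hne
          obtain ⟨l', hl'⟩ := Tr.exists_full' q2 (mem_inter.1 hw').2
          refine lift (w' :: l') (hE1 _ hl' ⟨w', hw', _, rfl⟩) ?_
          intro x' hx' hxn hin
          have := Fac_head hin
          rw [mem_insert] at this
          exact hum ((Fac_sub hx').2 _ (this.resolve_left huv))
    · obtain ⟨g', hg', rfl⟩ := List.mem_map.1 hg
      refine lift g' hg' ?_
      intro x' hx' hxn hin
      have hvx : v ∉ x' := fun h => hvm ((Fac_sub hx').2 _ h)
      simp only [Fac, mem_insert, mem_image] at hin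
      rcases hin with h | ⟨y, hy, hyx⟩
      · obtain ⟨z, hz⟩ := (Fac_sub hx').1
        have : z ∈ ({v} : Finset X) := by rw [← h]; exact mem_insert_of_mem hz
        rw [mem_singleton] at this
        subst this; exact hvx hz
      · have hvy : v ∉ y := fun h => hp2 g' hg' ((Fac_sub hy).2 _ h)
        apply hxn
        rw [← erase_insert hvx, ← hyx, erase_insert hvy]; exact hy
  rcases hpq with ⟨p', hp, he⟩ | ⟨a, ha, he⟩
  · exact main p' hp he
  · rcases a with _ | ⟨b, a⟩
    · rw [List.append_nil] at ha
      exact main [] (by rw [ha, List.append_nil]) (by simpa using he.symm)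
    · rw [List.cons_append, List.cons_eq_cons] at he
      exact hE p l a (by rw [ha, he.1]) g hg

lemma shel_rtg (hR : ∀ x, ¬ R x x) (hS : ∀ x y, R x y → R y x)
    (ih : ∀ P W, Tr R k P W → ∃ E1 E2, Shel (E1 ++ E2) ∧ (∀ l, l ∈ E1 ↔ Full R k P l ∧ Hd W l) ∧ ∀ l, l ∈ E1 ++ E2 ↔ Full R k P l)
    (h : Relation.ReflTransGen (Step R (Tr R k) k P) A B) {E : List (List X)} (hE : Shel E) (hm : ∀ l, l ∈ E ↔ Full R (k+1) P l ∧ Hd A l) :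
    ∃ E', Shel (E ++ E') ∧ ∀ l, l ∈ E ++ E' ↔ Full R (k+1) P l ∧ Hd B l := by
  induction h with
  | refl => exact ⟨[], by rwa [List.append_nil], by simpa using hm⟩
  | tail hr hst ihh =>
    obtain ⟨E', h1, h2⟩ := ihh
    obtain ⟨E'', h3, h4⟩ := shel_step hR hS ih hst h1 h2
    exact ⟨E' ++ E'', by rwa [← List.append_assoc], by simpa [List.append_assoc] using h4⟩

theorem Tr.shel (hR : ∀ x, ¬ R x x) (hS : ∀ x y, R x y → R y x) : ∀ (k : ℕ) (P W : Finset X), Tr R k P W →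
    ∃ E1 E2, Shel (E1 ++ E2) ∧ (∀ l, l ∈ E1 ↔ Full R k P l ∧ Hd W l) ∧ ∀ l, l ∈ E1 ++ E2 ↔ Full R k P l := by
  intro k
  induction k with
  | zero =>
    intro P W h
    refine ⟨[], [[]], ?_, ?_, ?_⟩
    · intro p l q h g hg
      rw [List.nil_append, List.singleton_eq_append_iff] at h
      rcases h with h | h
      · rw [h.1] at hg; simp at hg
      · simp at h
    · intro l; rw [h.2]; simp [Hd]
    · intro l
      simp only [Full, List.nil_append, List.mem_singleton, List.length_eq_zero_iff]
      constructor
      · rintro rfl; simp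
      · exact fun h => h.1
  | succ k ih =>
    intro P W h
    obtain ⟨E1, h1, h2⟩ := shel_rtg hR hS ih h.2.2.1 (E := []) (by intro p l q h; simp at h) (by intro l; simp [Hd])
    rw [List.nil_append] at h1 h2
    obtain ⟨E2, h3, h4⟩ := shel_rtg hR hS ih h.2.2.2 h1 h2
    refine ⟨E1, E2, h3, h2, fun l => (h4 l).trans ⟨fun h => h.1, fun hl => ⟨hl, ?_⟩⟩⟩
    rcases l with _ | ⟨v, l⟩
    · simp [Full] at hl
    · exact ⟨v, hl.2.1 v (by simp), l, rfl⟩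
end
end HS

namespace HS
open Finset
open scoped Classical
set_option linter.all false
section
variable {V : Type*} [DecidableEq V]

/-- a boundary ridge of a list of facets -/
def BR (k : ℕ) (p : List (Finset V)) (r : Finset V) : Prop :=
  r.card + 1 = k ∧ ∃ G ∈ p, r ⊆ G ∧ ∀ G' ∈ p, r ⊆ G' → G' = G

noncomputable def XX (k : ℕ) (c : V) (p : List (Finset V)) : Finset (Finset V) :=
  (insert c (p.toFinset.biUnion id)).powerset.filter
    (fun t => (∃ G ∈ p, t ⊆ G) ∨ (c ∈ t ∧ ∃ r, BR k p r ∧ t.erase c ⊆ r))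

variable {k : ℕ} {c : V} {p : List (Finset V)}

lemma mem_XX {t : Finset V} : t ∈ XX k c p ↔ (∃ G ∈ p, t ⊆ G) ∨ (c ∈ t ∧ ∃ r, BR k p r ∧ t.erase c ⊆ r) := by
  simp only [XX, mem_filter, and_iff_right_iff_imp, mem_powerset]
  have key : ∀ G ∈ p, G ⊆ p.toFinset.biUnion id := fun G hG => subset_biUnion_of_mem id (by simpa using hG)
  rintro (⟨G, hG, h⟩ | ⟨hc, r, ⟨-, G, hG, hr, -⟩, h⟩)
  · exact (h.trans (key G hG)).trans (subset_insert _ _)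
  · rw [← insert_erase hc]
    exact insert_subset_insert _ ((h.trans hr).trans (key G hG))

lemma XX_cx (hp : p ≠ []) : Cx (XX k c p) := by
  constructor
  · obtain ⟨G, hG⟩ := List.exists_mem_of_ne_nil p hp
    exact mem_XX.2 (Or.inl ⟨G, hG, by simp⟩)
  · intro s hs t hts
    rw [mem_XX] at hs ⊢
    rcases hs with ⟨G, hG, h⟩ | ⟨hc, r, hr, h⟩
    · exact Or.inl ⟨G, hG, hts.trans h⟩
    · by_cases hct : c ∈ t
      · exact Or.inr ⟨hct, r, hr, (erase_subset_erase _ hts).trans h⟩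
      · obtain ⟨-, G, hG, hrG, -⟩ := hr
        refine Or.inl ⟨G, hG, ?_⟩
        rw [← erase_eq_of_notMem hct]
        exact ((erase_subset_erase _ hts).trans h).trans hrG

lemma XX_one {F : Finset V} (hF : F.card = k) (hcF : c ∉ F) : XX k c [F] = (insert c F).ssubsets := by
  ext t
  rw [mem_XX, mem_ssubsets]
  constructor
  · rintro (⟨G, hG, h⟩ | ⟨hc, r, ⟨hrk, G, hG, hrG, -⟩, h⟩)
    · rw [List.mem_singleton] at hG; subst hG
      exact h.trans_ssubset (ssubset_insert hcF)
    · rw [List.mem_singleton] at hG; subst hG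
      have : r ⊂ G := Finset.ssubset_iff_subset_ne.2 ⟨hrG, by rintro rfl; omega⟩
      refine Finset.ssubset_iff_subset_ne.2 ⟨?_, ?_⟩
      · rw [← insert_erase hc]; exact insert_subset_insert _ (h.trans hrG)
      · rintro rfl
        rw [erase_insert hcF] at h
        exact this.2 h
  · intro h
    by_cases hc : c ∈ t
    · right
      have h1 : t.erase c ⊂ F := by
        refine Finset.ssubset_iff_subset_ne.2 ⟨?_, ?_⟩
        · intro x hx
          rw [mem_erase] at hx
          exact (mem_insert.1 (h.1 hx.2)).resolve_left hx.1
        · intro e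
          apply h.ne; rw [← e, insert_erase hc]
      obtain ⟨x, hx, hxt⟩ := exists_of_ssubset h1
      refine ⟨hc, F.erase x, ⟨?_, F, by simp, erase_subset _ _, by simp⟩, ?_⟩
      · rw [card_erase_of_mem hx, hF]
        have : 0 < F.card := card_pos.2 ⟨x, hx⟩
        omega
      · exact fun y hy => mem_erase.2 ⟨by rintro rfl; exact hxt hy, h1.1 hy⟩
    · left
      exact ⟨F, by simp, fun x hx => (mem_insert.1 (h.1 hx)).resolve_left (by rintro rfl; exact hc hx)⟩

lemma ridge_in {r F : Finset V} (hF : F.card = k) (hr : r.card + 1 = k) (h : r ⊆ F) : ∃ x ∈ F, r = F.erase x := by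
  obtain ⟨x, hx⟩ : ∃ x, F \ r = {x} := by
    rw [← card_eq_one, card_sdiff_of_subset h]; omega
  have hxm : x ∈ F \ r := by rw [hx]; simp
  rw [mem_sdiff] at hxm
  refine ⟨x, hxm.1, eq_of_subset_of_card_le (fun y hy => mem_erase.2 ⟨by rintro rfl; exact hxm.2 hy, h hy⟩) ?_⟩
  rw [card_erase_of_mem hxm.1]; omega

lemma XX_step [Infinite V] {F : Finset V} (hp : p ≠ []) (hc : ∀ G ∈ p, c ∉ G) (hcF : c ∉ F) (hF : F.card = k)
    (hsh : ∀ G ∈ p, ∃ H ∈ p, ∃ x ∈ F, x ∉ G ∧ F.erase x ⊆ H)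
    (hthree : ∀ x ∈ F, ∀ G ∈ p, ∀ G' ∈ p, F.erase x ⊆ G → F.erase x ⊆ G' → G = G')
    (h : PL k (XX k c p)) : PL k (XX k c (p ++ [F])) := by
  set β := F.filter (fun x => ∃ H ∈ p, F.erase x ⊆ H) with hβ
  have mβ : ∀ {x}, x ∈ β ↔ x ∈ F ∧ ∃ H ∈ p, F.erase x ⊆ H := by intro x; simp [hβ]
  have hβF : β ⊆ F := filter_subset _ _
  obtain ⟨G0, hG0⟩ := List.exists_mem_of_ne_nil p hp
  have hβ0 : β.Nonempty := by
    obtain ⟨H, hH, x, hx, -, h⟩ := hsh G0 hG0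
    exact ⟨x, mβ.2 ⟨hx, H, hH, h⟩⟩
  have hk : 0 < k := by rw [← hF]; exact card_pos.2 (hβ0.mono hβF)
  have hbr : ∀ x ∈ β, BR k p (F.erase x) := by
    intro x hx
    obtain ⟨hxF, H, hH, hs⟩ := mβ.1 hx
    refine ⟨by rw [card_erase_of_mem hxF]; omega, H, hH, hs, fun G' hG' h' => hthree x hxF _ hG' _ hH h' hs⟩
  set a := insert c (F \ β) with ha
  have hca : c ∈ a := mem_insert_self _ _
  have hcs : c ∉ F \ β := fun h => hcF (mem_sdiff.1 h).1
  have hd : Disjoint a β := by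
    rw [ha, disjoint_insert_left]
    exact ⟨fun h => hcF (hβF h), sdiff_disjoint⟩
  have haβ : a ∪ β = insert c F := by rw [ha, insert_union, sdiff_union_of_subset hβF]
  have haer : ∀ x ∈ β, insert c (F.erase x) ∈ XX k c p := by
    intro x hx
    exact mem_XX.2 (Or.inr ⟨by simp, _, hbr x hx, by rw [erase_insert (fun h => hcF (mem_of_mem_erase h))]⟩)
  have h1 : Cx (XX k c p) := XX_cx hp
  have haK : a ∈ XX k c p := by
    obtain ⟨x, hx⟩ := hβ0
    refine h1.2 _ (haer x hx) _ (insert_subset_insert _ ?_)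
    intro y hy
    rw [mem_sdiff] at hy
    exact mem_erase.2 ⟨by rintro rfl; exact hy.2 hx, hy.1⟩
  have hcβ : c ∉ β := fun h => hcF (hβF h)
  have hβK : β ∉ XX k c p := by
    rw [mem_XX]
    rintro (⟨G, hG, h⟩ | ⟨hc, -⟩)
    · obtain ⟨H, hH, x, hx, hxG, hs⟩ := hsh G hG
      exact hxG (h (mβ.2 ⟨hx, H, hH, hs⟩))
    · exact hcβ hc
  have hcard : a.card = 1 + k - β.card := by
    rw [ha, card_insert_of_notMem hcs, card_sdiff_of_subset hβF, hF]
    have := card_le_card hβF; omega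
  have hβc := card_le_card hβF
  have hβc1 : 0 < β.card := card_pos.2 hβ0
  have hsub : ∀ t, t ⊂ β → t ∪ a ∈ XX k c p := by
    intro t ht
    obtain ⟨x, hx, hxt⟩ := exists_of_ssubset ht
    refine h1.2 _ (haer x hx) _ ?_
    intro y hy
    rw [ha, mem_union, mem_insert, mem_sdiff] at hy
    rw [mem_insert, mem_erase]
    rcases hy with hy | rfl | hy
    · exact Or.inr ⟨by rintro rfl; exact hxt hy, hβF (ht.1 hy)⟩
    · exact Or.inl rfl
    · exact Or.inr ⟨by rintro rfl; exact hy.2 hx, hy.1⟩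
  have hlk : ∀ t, Disjoint t a → (t ∪ a ∈ XX k c p ↔ t ⊂ β) := by
    intro t ht
    refine ⟨fun htK => ?_, hsub t⟩
    have hH : HS (β.card - 1) (flk (XX k c p) a) := h.hs.flk haK (by omega)
    have hb1 : ∀ f, bd (bs β) f ≠ 0 → f ⊂ β := by
      have : bd (bs β) ∈ Ch {t : Finset V | t ⊂ β} := by
        rw [bd_bs]
        exact Submodule.sum_mem _ fun v hv => bs_mem.2 (erase_ssubset hv)
      exact fun f hf => mem_Ch.1 this f hf
    have htop : Top (β.card - 1) (flk (XX k c p) a) (bd (bs β)) := by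
      refine ⟨mem_Ch.2 fun f hf => ?_, ?_, bd_bd _⟩
      · have := hb1 f hf
        exact mem_coe.2 ((mem_flk h1).2 ⟨hd.symm.mono_left this.1, hsub f this⟩)
      · rw [bd_bs]
        refine Submodule.sum_mem _ fun v hv => bs_mem.2 ?_
        show (β.erase v).card = β.card - 1
        exact card_erase_of_mem hv
    have hne : bd (bs β) ≠ 0 := by
      obtain ⟨x, hx⟩ := hβ0
      intro h0
      have : bd (bs β) (β.erase x) = 1 := by
        rw [bd_sum (F := {β}) (k := β.card) (U := β) (by simp) (bs_mem.2 (by simp)) (by rw [card_erase_of_mem hx]; omega)]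
        rw [filter_singleton, if_pos (erase_subset _ _), sum_singleton]
        simp [bs]
      rw [h0] at this; simp at this
    obtain ⟨f, hf, htf⟩ := hH.full _ htop hne t ((mem_flk h1).2 ⟨ht, htK⟩)
    exact htf.trans_ssubset (hb1 f hf)
  have hp' : p ++ [F] ≠ [] := by simp
  -- faces of the old complex containing `a` are inside `insert c F`
  have hin : ∀ t ∈ XX k c p, a ⊆ t → t ⊆ insert c F := by
    intro t ht hat
    have := (hlk (t \ a) sdiff_disjoint).1 (by rwa [sdiff_union_of_subset hat])
    rw [← haβ, ← sdiff_union_of_subset hat, union_comm]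
    exact union_subset_union (Finset.Subset.refl _) this.1
  have hyF : ∀ s : Finset V, s ⊆ F → ¬ F \ β ⊆ s → ∃ r, BR k (p ++ [F]) r ∧ s ⊆ r := by
    intro s hs hns
    obtain ⟨y, hy, hys⟩ := not_subset.1 hns
    rw [mem_sdiff] at hy
    refine ⟨F.erase y, ⟨by rw [card_erase_of_mem hy.1]; omega, F, by simp, erase_subset _ _, ?_⟩, ?_⟩
    · intro G' hG' hr
      rw [List.mem_append, List.mem_singleton] at hG'
      rcases hG' with hG' | hG'
      · exact absurd (mβ.2 ⟨hy.1, G', hG', hr⟩) hy.2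
      · exact hG'
    · exact fun x hx => mem_erase.2 ⟨by rintro rfl; exact hys hx, hs hx⟩
  have hK2 : ∀ t, t ∈ XX k c (p ++ [F]) ↔ (t ∈ XX k c p ∧ ¬ a ⊆ t) ∨ (t ⊆ a ∪ β ∧ ¬ a ⊆ t) := by
    intro t
    rw [haβ]
    by_cases hct : c ∈ t
    · have hat : a ⊆ t ↔ F \ β ⊆ t.erase c := by
        rw [ha, insert_subset_iff]
        constructor
        · exact fun h x hx => mem_erase.2 ⟨by rintro rfl; exact hcs hx, h.2 hx⟩
        · exact fun h => ⟨hct, h.trans (erase_subset _ _)⟩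
      have htF : t ⊆ insert c F ↔ t.erase c ⊆ F := by
        rw [subset_insert_iff]
      constructor
      · intro ht
        rw [mem_XX] at ht
        rcases ht with ⟨G, hG, h⟩ | ⟨-, r, ⟨hrk, G, hG, hrG, hu⟩, hr⟩
        · exfalso
          rw [List.mem_append, List.mem_singleton] at hG
          rcases hG with hG | rfl
          · exact hc G hG (h hct)
          · exact hcF (h hct)
        by_cases hrF : r ⊆ F
        · obtain rfl : F = G := hu F (by simp) hrF
          obtain ⟨x, hx, rfl⟩ := ridge_in hF hrk hrF
          right
          refine ⟨htF.2 (hr.trans hrF), ?_⟩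
          rw [hat]
          intro h
          have hxβ : x ∉ β := fun hxβ => by
            obtain ⟨-, H, hH, hs⟩ := mβ.1 hxβ
            have e := hu H (by simp [hH]) hs
            subst e
            obtain ⟨H', hH', y, hy, hyn, -⟩ := hsh H hH
            exact hyn hy
          have := hr (h (mem_sdiff.2 ⟨hx, hxβ⟩))
          simp at this
        · have hGp : G ∈ p := by
            rw [List.mem_append, List.mem_singleton] at hG
            rcases hG with hG | rfl
            · exact hG
            · exact absurd hrG hrF
          have hrB : BR k p r := ⟨hrk, G, hGp, hrG, fun G' hG' h' => hu G' (by simp [hG']) h'⟩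
          left
          refine ⟨mem_XX.2 (Or.inr ⟨hct, r, hrB, hr⟩), ?_⟩
          intro h
          have hcr : c ∉ r := fun h => hc G hGp (hrG h)
          have : insert c r ∈ XX k c p := mem_XX.2 (Or.inr ⟨by simp, r, hrB, by rw [erase_insert hcr]⟩)
          have h3 := hin _ this (by
            rw [hat] at h
            exact insert_subset_insert _ (h.trans hr))
          exact hrF fun x hx => (mem_insert.1 (h3 (mem_insert_of_mem hx))).resolve_left (by rintro rfl; exact hcr hx)
      · rintro (⟨ht, hn⟩ | ⟨ht, hn⟩)
        · rw [hat] at hn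
          rw [mem_XX] at ht ⊢
          rcases ht with ⟨G, hG, h⟩ | ⟨-, r, ⟨hrk, G, hG, hrG, hu⟩, hr⟩
          · exact absurd (h hct) (hc G hG)
          right
          refine ⟨hct, ?_⟩
          by_cases hrF : r ⊆ F
          · exact hyF _ (hr.trans hrF) hn
          · refine ⟨r, ⟨hrk, G, by simp [hG], hrG, ?_⟩, hr⟩
            intro G' hG' h'
            rw [List.mem_append, List.mem_singleton] at hG'
            rcases hG' with hG' | rfl
            · exact hu G' hG' h'
            · exact absurd h' hrF
        · rw [hat] at hn
          exact mem_XX.2 (Or.inr ⟨hct, hyF _ (htF.1 ht) hn⟩)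
    · have hat : ¬ a ⊆ t := fun h => hct (h hca)
      rw [mem_XX, mem_XX]
      simp only [hct, false_and, or_false, hat, not_false_eq_true, and_true, List.mem_append, List.mem_singleton]
      constructor
      · rintro ⟨G, hG | rfl, h⟩
        · exact Or.inl ⟨G, hG, h⟩
        · exact Or.inr (h.trans (subset_insert _ _))
      · rintro (⟨G, hG, h⟩ | h)
        · exact ⟨G, Or.inl hG, h⟩
        · exact ⟨F, Or.inr rfl, fun x hx => (mem_insert.1 (h hx)).resolve_left (by rintro rfl; exact hct hx)⟩
  exact PL.of_combEq h (XX_cx hp') (flip_combEq h1 (XX_cx hp') ⟨c, hca⟩ hβ0 hd haK hβK hlk hK2).symm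

theorem PL.of_shelling [Infinite V] {N : Finset (Finset V)} {Fs : List (Finset V)} (hN : Cx N)
    (hpure : ∀ t ∈ N, ∃ F ∈ N, F.card = k + 1 ∧ t ⊆ F) (hcl : ∀ r ∈ N, r.card = k → (nb N r).card = 2)
    (hFs : ∀ F, F ∈ Fs ↔ F ∈ N ∧ F.card = k + 1)
    (hsh : ∀ p F q, Fs = p ++ F :: q → ∀ G ∈ p, ∃ H ∈ p, ∃ x ∈ F, x ∉ G ∧ F.erase x ⊆ H) : PL (k+1) N := by
  obtain ⟨c, hc⟩ := Infinite.exists_notMem_finset (vs N)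
  have hcN : ∀ t ∈ N, c ∉ t := fun t ht h => hc (mem_vs.2 ⟨t, ht, h⟩)
  have hnb : ∀ r, r.card = k → ∀ G ∈ Fs, r ⊆ G → ∃ x ∈ nb N r, G = insert x r := by
    intro r hr G hG hrG
    have hG' := (hFs G).1 hG
    obtain ⟨x, hx, e⟩ := ridge_in hG'.2 (by omega : r.card + 1 = k + 1) hrG
    refine ⟨x, mem_nb.2 ⟨by rw [e]; simp, ?_⟩, ?_⟩
    · rw [e, insert_erase hx]; exact hG'.1
    · rw [e, insert_erase hx]
  have main : ∀ p q, Fs = p ++ q → p ≠ [] → PL (k+1) (XX (k+1) c p) := by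
    intro p
    induction p using List.reverseRecOn with
    | nil => intro q _ h; exact absurd rfl h
    | append_singleton p F ih =>
      intro q hq _
      have hF := (hFs F).1 (by rw [hq]; simp)
      by_cases hp : p = []
      · subst hp
        rw [List.nil_append, XX_one hF.2 (hcN _ hF.1)]
        exact PL.ssub (by rw [card_insert_of_notMem (hcN _ hF.1), hF.2])
      have hpF : ∀ G ∈ p, G ∈ Fs := fun G hG => by rw [hq]; simp [hG]
      have hs := hsh p F q (by rw [hq]; simp)
      refine XX_step hp (fun G hG => hcN G ((hFs G).1 (hpF G hG)).1) (hcN _ hF.1) hF.2 hs ?_ (ih (F :: q) (by rw [hq]; simp) hp)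
      intro x hx G hG G' hG' h h'
      have hr : (F.erase x).card = k := by rw [card_erase_of_mem hx, hF.2]; omega
      have hrN : F.erase x ∈ N := hN.2 _ hF.1 _ (erase_subset _ _)
      obtain ⟨y1, hy1, e1⟩ := hnb _ hr G (hpF G hG) h
      obtain ⟨y2, hy2, e2⟩ := hnb _ hr G' (hpF G' hG') h'
      have hxn : x ∈ nb N (F.erase x) := mem_nb.2 ⟨by simp, by rw [insert_erase hx]; exact hF.1⟩
      have hFp : F ∉ p := fun h => by
        obtain ⟨H, hH, y, hy, hyn, -⟩ := hs F h
        exact hyn hy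
      have hne1 : y1 ≠ x := by rintro rfl; rw [insert_erase hx] at e1; subst e1; exact hFp hG
      have hne2 : y2 ≠ x := by rintro rfl; rw [insert_erase hx] at e2; subst e2; exact hFp hG'
      have h2 : ((nb N (F.erase x)).erase x).card = 1 := by rw [card_erase_of_mem hxn, hcl _ hrN hr]
      obtain ⟨z, hz⟩ := card_eq_one.1 h2
      have a1 : y1 ∈ (nb N (F.erase x)).erase x := mem_erase.2 ⟨hne1, hy1⟩
      have a2 : y2 ∈ (nb N (F.erase x)).erase x := mem_erase.2 ⟨hne2, hy2⟩
      rw [hz, mem_singleton] at a1 a2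
      rw [e1, e2, a1, a2]
  have hFne : Fs ≠ [] := by
    rintro rfl
    obtain ⟨F, hF, hFk, -⟩ := hpure ∅ hN.1
    have := (hFs F).2 ⟨hF, hFk⟩
    simp at this
  have h := main Fs [] (by simp) hFne
  have e : XX (k+1) c Fs = N := by
    ext t
    rw [mem_XX]
    constructor
    · rintro (⟨G, hG, h⟩ | ⟨hct, r, ⟨hrk, G, hG, hrG, hu⟩, hr⟩)
      · exact hN.2 _ ((hFs G).1 hG).1 _ h
      · exfalso
        have hrN : r ∈ N := hN.2 _ ((hFs G).1 hG).1 _ hrG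
        have h2 := hcl r hrN (by omega)
        obtain ⟨x, y, hxy, e⟩ := card_eq_two.1 h2
        have key : ∀ z ∈ nb N r, insert z r = G := fun z hz => by
          have hz' := mem_nb.1 hz
          exact hu _ ((hFs _).2 ⟨hz'.2, by rw [card_insert_of_notMem hz'.1]; omega⟩) (subset_insert _ _)
        have hx : x ∈ nb N r := by rw [e]; simp
        have hy : y ∈ nb N r := by rw [e]; simp
        have : x ∈ insert y r := by rw [key y hy, ← key x hx]; simp
        rw [mem_insert] at this
        exact this.elim hxy (mem_nb.1 hx).1
    · intro ht
      obtain ⟨F, hF, hFk, htF⟩ := hpure t ht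
      exact Or.inl ⟨F, (hFs F).2 ⟨hF, hFk⟩, htF⟩
  rwa [e] at h
end
end HS

namespace HS
open Finset
open scoped Classical
set_option linter.all false

section

variable {V W U : Type*} [DecidableEq V] [DecidableEq W] [DecidableEq U]

/-- pure closed pseudomanifold-like complexes of rank n -/
structure PC (n : ℕ) (K : Finset (Finset V)) : Prop where
  cx : Cx K
  le : ∀ t ∈ K, t.card ≤ n
  pure : ∀ t ∈ K, ∃ F ∈ K, F.card = n ∧ t ⊆ F
  cl : ∀ r ∈ K, r.card + 1 = n → (nb K r).card = 2

lemma sd_ss {K : Finset (Finset V)} {c : Finset (Finset V)} (hc : c ∈ sd K) {s t : Finset V} (hs : s ∈ insert ∅ c)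
    (ht : t ∈ insert ∅ c) (h : s.card ≤ t.card) : s ⊆ t := by
  rw [mem_insert] at hs ht
  rcases hs with rfl | hs
  · exact empty_subset _
  rcases ht with rfl | ht
  · rw [card_empty, Nat.le_zero, card_eq_zero] at h; rw [h]
  rcases (mem_sd.1 hc).2 s hs t ht with h' | h'
  · exact h'
  · rw [eq_of_subset_of_card_le h' h]

lemma sd_inj' {K : Finset (Finset V)} {c : Finset (Finset V)} (hc : c ∈ sd K) {s t : Finset V} (hs : s ∈ insert ∅ c)
    (ht : t ∈ insert ∅ c) (h : s.card = t.card) : s = t :=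
  Finset.Subset.antisymm (sd_ss hc hs ht h.le) (sd_ss hc ht hs h.ge)

lemma sd_card {K : Finset (Finset V)} {c : Finset (Finset V)} (hc : c ∈ sd K) : (c.image card).card = c.card :=
  card_image_of_injOn fun _ hs _ ht h => sd_inj' hc (mem_insert_of_mem (mem_coe.1 hs)) (mem_insert_of_mem (mem_coe.1 ht)) h

lemma sd_img {n : ℕ} {K : Finset (Finset V)} (hK : ∀ t ∈ K, t.card ≤ n) {c : Finset (Finset V)} (hc : c ∈ sd K) :
    c.image card ⊆ Icc 1 n := by
  intro i hi
  obtain ⟨s, hs, rfl⟩ := mem_image.1 hi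
  have := (mem_sd.1 hc).1 s hs
  exact mem_Icc.2 ⟨this.2.card_pos, hK _ this.1⟩

lemma sd_mem {K : Finset (Finset V)} (hK : Cx K) {c : Finset (Finset V)} (hc : c ∈ sd K) {s : Finset V} (hs : s ∈ insert ∅ c) : s ∈ K := by
  rw [mem_insert] at hs
  rcases hs with rfl | hs
  · exact hK.1
  · exact ((mem_sd.1 hc).1 s hs).1

lemma sd_insert {K : Finset (Finset V)} {c : Finset (Finset V)} (hc : c ∈ sd K) {s : Finset V} (hs : s ∈ K) (hne : s.Nonempty)
    (h : ∀ t ∈ c, s ⊆ t ∨ t ⊆ s) : insert s c ∈ sd K := by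
  have := mem_sd.1 hc
  refine mem_sd.2 ⟨?_, ?_⟩
  · intro t ht
    rcases mem_insert.1 ht with rfl | ht
    · exact ⟨hs, hne⟩
    · exact this.1 t ht
  · intro a ha b hb
    rcases mem_insert.1 ha with ea | ha' <;> rcases mem_insert.1 hb with eb | hb'
    · rw [ea, eb]; exact Or.inl (Finset.Subset.refl _)
    · rw [ea]; exact h _ hb'
    · rw [eb]; exact (h _ ha').symm
    · exact this.2 _ ha' _ hb'

lemma sd_pred {n : ℕ} {K : Finset (Finset V)} {c : Finset (Finset V)} {m : ℕ} (hm : 1 ≤ m) 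
    (hmin : ∀ i, 1 ≤ i → i < m → i ∈ c.image card) : ∃ A ∈ insert ∅ c, A.card + 1 = m := by
  by_cases h1 : m = 1
  · exact ⟨∅, by simp, by simp [h1]⟩
  · obtain ⟨A, hA, e⟩ := mem_image.1 (hmin (m - 1) (by omega) (by omega))
    exact ⟨A, mem_insert_of_mem hA, by omega⟩

lemma PC.sd {n : ℕ} {K : Finset (Finset V)} (h : PC n K) : PC n (sd K) := by
  have hle : ∀ t ∈ _root_.HS.sd K, t.card ≤ n := by
    intro c hc
    have := card_le_card (sd_img h.le hc)
    rw [sd_card hc, Nat.card_Icc] at this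
    omega
  refine ⟨sd_cx K, hle, ?_, ?_⟩
  · intro t ht
    obtain ⟨c, hc, hmax⟩ := exists_max_image ((_root_.HS.sd K).filter (t ⊆ ·)) card ⟨t, by simp [ht]⟩
    rw [mem_filter] at hc
    refine ⟨c, hc.1, ?_, hc.2⟩
    by_contra hne
    have hlt : c.card < n := lt_of_le_of_ne (hle c hc.1) hne
    have hex : ∃ m, 1 ≤ m ∧ m ≤ n ∧ m ∉ c.image card := by
      by_contra hcon
      push Not at hcon
      have : Icc 1 n ⊆ c.image card := fun i hi => hcon i (mem_Icc.1 hi).1 (mem_Icc.1 hi).2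
      have := card_le_card this
      rw [sd_card hc.1, Nat.card_Icc] at this
      omega
    set m := Nat.find hex with hmdef
    have hm := Nat.find_spec hex
    rw [← hmdef] at hm
    obtain ⟨A, hA, hAm⟩ := sd_pred (n := n) (K := K) hm.1 (fun i hi him => by
      have := Nat.find_min hex him
      by_contra hn; exact this ⟨hi, by omega, hn⟩)
    have hB : ∃ B ∈ K, A ⊆ B ∧ m ≤ B.card ∧ ∀ s ∈ c, m ≤ s.card → B ⊆ s := by
      by_cases hb : ∃ s ∈ c, m ≤ s.card
      · obtain ⟨B, hB, hBmin⟩ := exists_min_image (c.filter (m ≤ ·.card)) card (by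
          obtain ⟨s, hs, h⟩ := hb; exact ⟨s, mem_filter.2 ⟨hs, h⟩⟩)
        rw [mem_filter] at hB
        refine ⟨B, ((mem_sd.1 hc.1).1 B hB.1).1, sd_ss hc.1 hA (mem_insert_of_mem hB.1) (by omega), hB.2, fun s hs hsm => ?_⟩
        exact sd_ss hc.1 (mem_insert_of_mem hB.1) (mem_insert_of_mem hs) (hBmin s (mem_filter.2 ⟨hs, hsm⟩))
      · obtain ⟨F, hF, hFn, hAF⟩ := h.pure A (sd_mem h.cx hc.1 hA)
        exact ⟨F, hF, hAF, by omega, fun s hs hsm => absurd ⟨s, hs, hsm⟩ hb⟩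
    obtain ⟨B, hBK, hAB, hmB, hBs⟩ := hB
    obtain ⟨x, hxB, hxA⟩ : ∃ x ∈ B, x ∉ A := by
      by_contra hcon
      push Not at hcon
      have := card_le_card (show B ⊆ A from hcon)
      omega
    have hsm : (insert x A).card = m := by rw [card_insert_of_notMem hxA]; exact hAm
    have hnc : insert x A ∉ c := fun hh => hm.2.2 (mem_image.2 ⟨_, hh, hsm⟩)
    have hsB : insert x A ⊆ B := insert_subset hxB hAB
    have hin : insert (insert x A) c ∈ _root_.HS.sd K := by
      refine sd_insert hc.1 (h.cx.2 _ hBK _ hsB) (insert_nonempty _ _) fun t ht => ?_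
      by_cases htm : m ≤ t.card
      · exact Or.inl (hsB.trans (hBs t ht htm))
      · exact Or.inr ((sd_ss hc.1 (mem_insert_of_mem ht) hA (by omega)).trans (subset_insert _ _))
    have := hmax _ (mem_filter.2 ⟨hin, hc.2.trans (subset_insert _ _)⟩)
    rw [card_insert_of_notMem hnc] at this
    omega
  · intro r hr hrn
    have hJ := sd_img h.le hr
    have hJc : (Icc 1 n \ r.image card).card = 1 := by
      rw [card_sdiff_of_subset hJ, sd_card hr, Nat.card_Icc]; omega
    obtain ⟨m, hm⟩ := card_eq_one.1 hJc
    have hmm : ∀ i, (1 ≤ i ∧ i ≤ n) ∧ i ∉ r.image card ↔ i = m := by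
      intro i
      have : i ∈ Icc 1 n \ r.image card ↔ i = m := by rw [hm, mem_singleton]
      rwa [mem_sdiff, mem_Icc] at this
    have hm0 := (hmm m).2 rfl
    obtain ⟨A, hA, hAm⟩ := sd_pred (n := n) (K := K) hm0.1.1 (fun i hi him => by
      by_contra hn
      have := (hmm i).1 ⟨⟨hi, by omega⟩, hn⟩
      omega)
    have hAK := sd_mem h.cx hr hA
    have hcard : ∀ s ∈ nb (_root_.HS.sd K) r, s.card = m ∧ s ∈ K ∧ A ⊆ s ∧ ∀ t ∈ r, m ≤ t.card → s ⊆ t := by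
      intro s hs
      rw [mem_nb] at hs
      have hsK := (mem_sd.1 hs.2).1 s (mem_insert_self _ _)
      have e1 : s.card = m := by
        refine (hmm _).1 ⟨⟨hsK.2.card_pos, h.le _ hsK.1⟩, fun hh => ?_⟩
        obtain ⟨t, ht, e⟩ := mem_image.1 hh
        have := sd_inj' hs.2 (mem_insert_of_mem (mem_insert_self s r)) (mem_insert_of_mem (mem_insert_of_mem ht)) e.symm
        exact hs.1 (this ▸ ht)
      refine ⟨e1, hsK.1, ?_, ?_⟩
      · refine sd_ss hs.2 ?_ (mem_insert_of_mem (mem_insert_self s r)) (by omega)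
        rw [mem_insert] at hA ⊢
        exact hA.imp id (mem_insert_of_mem)
      · intro t ht htm
        exact sd_ss hs.2 (mem_insert_of_mem (mem_insert_self s r)) (mem_insert_of_mem (mem_insert_of_mem ht)) (by omega)
    have hconv : ∀ x, x ∉ A → insert x A ∈ K → (∀ t ∈ r, m ≤ t.card → insert x A ⊆ t) → insert x A ∈ nb (_root_.HS.sd K) r := by
      intro x hx hxK hxt
      have hsm : (insert x A).card = m := by rw [card_insert_of_notMem hx]; exact hAm
      refine mem_nb.2 ⟨fun hh => hm0.2 (mem_image.2 ⟨_, hh, hsm⟩), sd_insert hr hxK (insert_nonempty _ _) fun t ht => ?_⟩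
      by_cases htm : m ≤ t.card
      · exact Or.inl (hxt t ht htm)
      · exact Or.inr ((sd_ss hr (mem_insert_of_mem ht) hA (by omega)).trans (subset_insert _ _))
    have hS : ∃ S : Finset V, S.card = 2 ∧ (∀ x ∈ S, x ∉ A) ∧ ∀ x, x ∉ A → (x ∈ S ↔ insert x A ∈ K ∧ ∀ t ∈ r, m ≤ t.card → insert x A ⊆ t) := by
      by_cases hmn : m = n
      · refine ⟨nb K A, h.cl A hAK (by omega), fun x hx => (mem_nb.1 hx).1, fun x hx => ?_⟩
        rw [mem_nb]
        constructor
        · rintro ⟨-, h2⟩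
          refine ⟨h2, fun t ht htm => absurd ?_ hm0.2⟩
          have := h.le t ((mem_sd.1 hr).1 t ht).1
          exact mem_image.2 ⟨t, ht, by omega⟩
        · rintro ⟨h2, -⟩
          exact ⟨hx, h2⟩
      · obtain ⟨B, hB, hBm⟩ : ∃ B ∈ r, B.card = m + 1 := by
          by_contra hcon
          have := (hmm (m+1)).1 ⟨⟨by omega, by omega⟩, fun hh => hcon (mem_image.1 hh)⟩
          omega
        have hAB : A ⊆ B := sd_ss hr hA (mem_insert_of_mem hB) (by omega)
        refine ⟨B \ A, by rw [card_sdiff_of_subset hAB]; omega, fun x hx => (mem_sdiff.1 hx).2, fun x hx => ?_⟩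
        rw [mem_sdiff]
        constructor
        · rintro ⟨h2, -⟩
          have hxB : insert x A ⊆ B := insert_subset h2 hAB
          refine ⟨h.cx.2 _ ((mem_sd.1 hr).1 B hB).1 _ hxB, fun t ht htm => hxB.trans (sd_ss hr (mem_insert_of_mem hB) (mem_insert_of_mem ht) ?_)⟩
          have : t.card ≠ m := fun e => hm0.2 (mem_image.2 ⟨t, ht, e⟩)
          omega
        · rintro ⟨-, h2⟩
          exact ⟨h2 B hB (by omega) (mem_insert_self _ _), hx⟩
    obtain ⟨S, hS2, hSA, hS⟩ := hS
    have : nb (_root_.HS.sd K) r = S.image (fun x => insert x A) := by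
      ext s
      rw [mem_image]
      constructor
      · intro hs
        obtain ⟨h1, h2, h3, h4⟩ := hcard s hs
        have : (s \ A).card = 1 := by rw [card_sdiff_of_subset h3]; omega
        obtain ⟨x, hx⟩ := card_eq_one.1 this
        have hxs : x ∈ s \ A := by rw [hx]; simp
        have e : insert x A = s := by
          rw [insert_eq, ← hx, sdiff_union_of_subset h3]
        have hxA := (mem_sdiff.1 hxs).2
        exact ⟨x, (hS x hxA).2 (by rw [e]; exact ⟨h2, h4⟩), e⟩
      · rintro ⟨x, hx, rfl⟩
        have := (hS x (hSA x hx)).1 hx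
        exact hconv x (hSA x hx) this.1 this.2
    rw [this, card_image_of_injOn, hS2]
    intro x hx y hy e
    have : x ∈ insert y A := by
      have e' : insert x A = insert y A := e
      rw [← e']; simp
    rw [mem_insert] at this
    exact this.resolve_right (hSA x (mem_coe.1 hx))

lemma HS.pc {k : ℕ} {K : Finset (Finset V)} (h : HS (k + 1) K) : PC (k + 1) K :=
  ⟨h.cx, h.card_le, fun t ht => h.pure ht, fun r hr e => h.closed r hr (by omega)⟩

lemma Fac_snoc (l : List V) (x : V) : Fac (l ++ [x]) = insert (l ++ [x]).toFinset (Fac l) := by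
  induction l with
  | nil => simp [Fac]
  | cons v l ih =>
    rw [List.cons_append]
    simp only [Fac, ih, image_insert, List.toFinset_cons]
    rw [insert_comm]

lemma Fac_chain {l : List V} (hl : l.Nodup) : (Fac l).card = l.length ∧ (∀ s ∈ Fac l, ∀ t ∈ Fac l, s ⊆ t ∨ t ⊆ s) := by
  induction l using List.reverseRecOn with
  | nil => simp [Fac]
  | append_singleton l x ih =>
    have hl' := List.nodup_append.1 hl
    obtain ⟨h1, h2⟩ := ih hl'.1
    have hx : x ∉ l := fun h => hl'.2.2 x h x (by simp) rfl
    have hsub : ∀ s ∈ Fac l, s ⊆ (l ++ [x]).toFinset := fun s hs y hy => by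
      have := (Fac_sub hs).2 y hy
      simp [this]
    rw [Fac_snoc, card_insert_of_notMem, h1, List.length_append]
    · refine ⟨rfl, ?_⟩
      intro a ha b hb
      rcases mem_insert.1 ha with rfl | ha <;> rcases mem_insert.1 hb with rfl | hb
      · exact Or.inl (Finset.Subset.refl _)
      · exact Or.inr (hsub b hb)
      · exact Or.inl (hsub a ha)
      · exact h2 a ha b hb
    · intro h
      exact hx ((Fac_sub h).2 x (by simp))

lemma chain_Fac {n : ℕ} {K : Finset (Finset V)} : ∀ {F : Finset (Finset V)}, F ∈ sd K → F.card = n → (∀ s ∈ F, s.card ≤ n) →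
    ∃ l : List V, l.Nodup ∧ l.length = n ∧ Fac l = F ∧ l.toFinset ∈ insert ∅ F := by
  induction n with
  | zero =>
    intro F hF h0 _
    refine ⟨[], by simp, by simp, ?_, by simp⟩
    rw [card_eq_zero] at h0
    simp [Fac, h0]
  | succ n ih =>
    intro F hF hn hle
    have hJ : F.image card = Icc 1 (n+1) := by
      refine eq_of_subset_of_card_le ?_ (by rw [sd_card hF, Nat.card_Icc]; omega)
      intro i hi
      obtain ⟨s, hs, rfl⟩ := mem_image.1 hi
      exact mem_Icc.2 ⟨((mem_sd.1 hF).1 s hs).2.card_pos, hle s hs⟩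
    obtain ⟨B, hB, hBn⟩ := mem_image.1 (show n + 1 ∈ F.image card by rw [hJ]; simp)
    obtain ⟨l, hl, hln, hlF, hlt⟩ := ih ((sd_cx K).2 _ hF (F.erase B) (erase_subset _ _)) (by rw [card_erase_of_mem hB]; omega) (by
      intro s hs
      rw [mem_erase] at hs
      have h1 := hle s hs.2
      have : s.card ≠ n + 1 := fun e => hs.1 (sd_inj' hF (mem_insert_of_mem hs.2) (mem_insert_of_mem hB) (by omega))
      omega)
    have hlc : l.toFinset.card = n := by rw [List.toFinset_card_of_nodup hl, hln]
    have hlB : l.toFinset ⊆ B := by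
      refine sd_ss hF ?_ (mem_insert_of_mem hB) (by omega)
      rw [mem_insert] at hlt ⊢
      exact hlt.imp id mem_of_mem_erase
    have : (B \ l.toFinset).card = 1 := by rw [card_sdiff_of_subset hlB]; omega
    obtain ⟨x, hx⟩ := card_eq_one.1 this
    have hxs : x ∈ B \ l.toFinset := by rw [hx]; simp
    have hxl : x ∉ l := fun h => (mem_sdiff.1 hxs).2 (by simpa using h)
    have e : (l ++ [x]).toFinset = B := by
      rw [List.toFinset_append]
      have : [x].toFinset = B \ l.toFinset := by rw [hx]; simp
      rw [this, union_sdiff_of_subset hlB]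
    refine ⟨l ++ [x], ?_, by simp [hln], ?_, ?_⟩
    · rw [List.nodup_append]
      refine ⟨hl, by simp, fun a ha b hb => ?_⟩
      rw [List.mem_singleton] at hb
      rintro rfl
      exact hxl (hb ▸ ha)
    · rw [Fac_snoc, e, hlF, insert_erase hB]
    · rw [e]; exact mem_insert_of_mem hB

lemma full_iff {n : ℕ} {K : Finset (Finset V)} (l : List (Finset V)) :
    Full Adj n (K.erase ∅) l ↔ l.length = n ∧ l.Nodup ∧ l.toFinset ∈ sd K := by
  constructor
  · rintro ⟨h1, h2, h3⟩
    refine ⟨h1, h3.imp (fun {a b} h => by rintro rfl; exact adj_irr _ h), mem_sd.2 ⟨?_, ?_⟩⟩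
    · intro s hs
      have := h2 s (by simpa using hs)
      rw [mem_erase] at this
      exact ⟨this.2, nonempty_iff_ne_empty.2 this.1⟩
    · intro s hs t ht
      by_cases e : s = t
      · subst e; exact Or.inl (Finset.Subset.refl _)
      · haveI : Std.Symm (Adj (V := V)) := ⟨adj_symm⟩
        rcases h3.forall (by simpa using hs) (by simpa using ht) e with h | h
        · exact Or.inl h.1
        · exact Or.inr h.1
  · rintro ⟨h1, h2, h3⟩
    rw [mem_sd] at h3
    refine ⟨h1, fun x hx => ?_, ?_⟩
    · have := h3.1 x (by simpa using hx)
      exact mem_erase.2 ⟨this.2.ne_empty, this.1⟩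
    · refine List.Pairwise.imp_of_mem ?_ h2
      intro a b ha hb hab
      rcases h3.2 a (by simpa using ha) b (by simpa using hb) with h | h
      · exact Or.inl (Finset.ssubset_iff_subset_ne.2 ⟨h, hab⟩)
      · exact Or.inr (Finset.ssubset_iff_subset_ne.2 ⟨h, hab.symm⟩)

theorem HS.to_PL [Infinite V] {k : ℕ} {K : Finset (Finset V)} (hK : HS (k + 1) K) (hc : (vs K).card ≤ k + 8) : PL (k + 1) K := by
  have hP := hK.pc
  have hP2 := hP.sd.sd
  obtain ⟨E1, E2, hsh, -, hE⟩ := Tr.shel adj_irr adj_symm _ _ _ (main_Tr hK (by omega))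
  generalize E1 ++ E2 = E at hsh hE
  have h2 : PL (k + 1) (_root_.HS.sd (_root_.HS.sd K)) := by
    refine PL.of_shelling (Fs := E.map Fac) (sd_cx _) hP2.pure (fun r hr e => hP2.cl r hr (by omega)) ?_ ?_
    · intro F
      rw [List.mem_map]
      constructor
      · rintro ⟨l, hl, rfl⟩
        obtain ⟨h1, h2, h3⟩ := (full_iff l).1 ((hE l).1 hl)
        obtain ⟨h4, h5⟩ := Fac_chain h2
        refine ⟨mem_sd.2 ⟨fun s hs => ⟨(sd_cx K).2 _ h3 _ fun y hy => by simpa using (Fac_sub hs).2 y hy, (Fac_sub hs).1⟩, h5⟩, by omega⟩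
      · rintro ⟨hF, hFn⟩
        obtain ⟨l, h1, h2, h3, h4⟩ := chain_Fac hF hFn (fun s hs => hP.sd.le s ((mem_sd.1 hF).1 s hs).1)
        refine ⟨l, (hE l).2 ((full_iff l).2 ⟨h2, h1, sd_mem (sd_cx K) hF h4⟩), h3⟩
    · intro p F q e G hG
      obtain ⟨p', l', hE', rfl, e'⟩ := List.map_eq_append_iff.1 e
      obtain ⟨l, q', rfl, rfl, rfl⟩ := List.map_eq_cons_iff.1 e'
      obtain ⟨g, hg, rfl⟩ := List.mem_map.1 hG
      obtain ⟨h, hh, x, hx, hxg, hs⟩ := hsh _ _ _ hE' g hg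
      exact ⟨Fac h, List.mem_map.2 ⟨h, hh, rfl⟩, x, hx, hxg, hs⟩
  have e1 := CombEq.of_sub (sd_cx _) (sd_sub (sd_cx K))
  have e2 := CombEq.of_sub (sd_cx _) (sd_sub hK.cx)
  exact PL.of_combEq h2 hK.cx (e1.trans e2).symm

end

end HS

namespace HS
open Finset HomologySpheres
open scoped Classical
set_option linter.all false

section

variable {V W U : Type*} [DecidableEq V] [DecidableEq W] [DecidableEq U]

lemma lk_im {f : V → W} {K : Finset (Finset V)} (hK : Cx K) (hf : Set.InjOn f (vs K)) {v : V} (hv : {v} ∈ K) :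
    lk (im f K) (f v) = im f (lk K v) := by
  have hvs : ∀ t ∈ K, ∀ u ∈ t, u ∈ (vs K : Set V) := fun t ht u hu => mem_coe.2 (mem_vs.2 ⟨t, ht, hu⟩)
  have hv' : v ∈ (vs K : Set V) := hvs _ hv v (by simp)
  ext s
  rw [mem_lk, mem_im, mem_im, mem_im]
  constructor
  · rintro ⟨-, h1, t, ht, e⟩
    have hvt : v ∈ t := by
      have : f v ∈ t.image f := by rw [e]; simp
      obtain ⟨u, hu, e'⟩ := mem_image.1 this
      rwa [← hf (hvs t ht u hu) hv' e']
    refine ⟨t.erase v, mem_lk.2 ⟨hK.2 _ ht _ (erase_subset _ _), by simp, by rw [insert_erase hvt]; exact ht⟩, ?_⟩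
    have e2 : insert (f v) ((t.erase v).image f) = insert (f v) s := by
      rw [← e, ← image_insert, insert_erase hvt]
    have h2 : f v ∉ (t.erase v).image f := by
      intro hh
      obtain ⟨u, hu, e'⟩ := mem_image.1 hh
      rw [mem_erase] at hu
      exact hu.1 (hf (hvs t ht u hu.2) hv' e')
    rw [← erase_insert h2, e2, erase_insert h1]
  · rintro ⟨t, ht, rfl⟩
    rw [mem_lk] at ht
    refine ⟨⟨t, ht.1, rfl⟩, ?_, ⟨insert v t, ht.2.2, by rw [image_insert]⟩⟩
    intro hh
    obtain ⟨u, hu, e'⟩ := mem_image.1 hh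
    have := hf (hvs t ht.1 u hu) hv' e'
    exact ht.2.1 (this ▸ hu)

lemma HS.im {f : V → W} {k : ℕ} : ∀ {K : Finset (Finset V)}, HS k K → Set.InjOn f (vs K) → HS k (_root_.HS.im f K) := by
  induction k with
  | zero =>
    intro K h _
    have h' : K = {∅} := h
    show _root_.HS.im f K = {∅}
    subst h'
    simp [_root_.HS.im]
  | succ k ih =>
    intro K h hf
    haveI : Nonempty V := by
      obtain ⟨F, -, hF, -⟩ := h.pure h.cx.1
      obtain ⟨a, -⟩ : F.Nonempty := by rw [← card_pos]; omega
      exact ⟨a⟩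
    haveI : Nonempty W := this.map f
    refine ⟨im_cx h.cx, h.hsph.of_dom (dom_im h.cx hf).2 (dom_im h.cx hf).1, fun w hw => ?_⟩
    obtain ⟨t, ht, e⟩ := mem_im.1 hw
    have hwt : w ∈ t.image f := by rw [e]; simp
    obtain ⟨v, hv, rfl⟩ := mem_image.1 hwt
    have hvK := h.cx.vert ht hv
    rw [lk_im h.cx hf hvK]
    refine ih (h.lk hvK) (hf.mono ?_)
    intro u hu
    obtain ⟨s, hs, hus⟩ := mem_vs.1 (mem_coe.1 hu)
    exact mem_coe.2 (mem_vs.2 ⟨s, (mem_lk.1 hs).1, hus⟩)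

theorem HS.to_PL' {k : ℕ} {K : Finset (Finset V)} (hK : HS (k + 1) K) (hc : (vs K).card ≤ k + 8) : PL (k + 1) K := by
  obtain ⟨f, hf⟩ := exists_nat_inj (vs K)
  have h := (hK.im hf).to_PL (by rw [vs_im]; exact card_image_le.trans hc)
  exact PL.of_combEq h hK.cx (CombEq.im hK.cx hf)

lemma lk_link (M : Finset (Finset V)) {v : V} (hv : {v} ∈ insert ∅ M) : lk (insert ∅ M) v = insert ∅ (link M {v}) := by
  ext t
  rw [mem_lk, mem_insert, mem_insert, link, mem_insert, mem_filter]
  have e : t ∪ {v} = insert v t := by ext; simp [or_comm]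
  rw [e, disjoint_singleton_right]
  have h0 : insert v t ≠ ∅ := insert_ne_empty _ _
  constructor
  · rintro ⟨h1, h2, h3⟩
    exact h1.imp id fun h => ⟨h, h2, h3.resolve_left h0⟩
  · rintro (rfl | ⟨h1, h2, h3⟩)
    · exact ⟨Or.inl rfl, by simp, by simpa using hv⟩
    · exact ⟨Or.inr h1, h2, Or.inr h3⟩

lemma man_link {d : ℕ} {M : Finset (Finset V)} (hM : IsCombManifold d M) {v : V} (hv : {v} ∈ insert ∅ M) :
    HS (d - 1 + 1) (lk (insert ∅ M) v) := by
  have hK := cx_insert hM.1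
  have h1 := lk_cx hK hv
  have h2 := hM.2 v (by rw [verts_eq]; exact mem_vs.2 ⟨_, hv, by simp⟩)
  rw [lk_link M hv] at h1 ⊢
  exact (PL.of_combSphere h1 h2).hs

lemma z2fin {M : Finset (Finset V)} {n : ℕ} {c : Finset V → ZMod 2} (h : z2chainOK M n c) :
    ∃ x : Chn V, x ∈ Ch (insert ∅ M : Finset (Finset V)) ∧ x ∈ Ch (Dg n : Set (Finset V)) ∧ ⇑x = c := by
  refine ⟨Finsupp.onFinset (insert ∅ M) c (fun s hs => ?_), mem_Ch.2 fun t ht => ?_, mem_Ch.2 fun t ht => ?_, ?_⟩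
  · exact mem_insert.2 (h s hs).2.symm
  · exact mem_coe.2 (mem_insert.2 (h t ht).2.symm)
  · exact (h t ht).1
  · rfl

lemma z2bd {M : Finset (Finset V)} {x : Chn V} (h : x ∈ Ch (insert ∅ M : Finset (Finset V))) : z2bdry M x = bd x := by
  funext t
  rw [bd_apply (sup_vs h), z2bdry, verts_eq]

lemma z2ok {M : Finset (Finset V)} {n : ℕ} {x : Chn V} (h : x ∈ Ch (insert ∅ M : Finset (Finset V)))
    (h' : x ∈ Ch (Dg n : Set (Finset V))) : z2chainOK M n x := by
  intro s hs
  exact ⟨mem_Ch.1 h' s hs, (mem_insert.1 (mem_coe.1 (mem_Ch.1 h s hs))).symm⟩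

/-- homogeneous part -/
noncomputable def pt (n : ℕ) (x : Chn V) : Chn V := x.filter (fun t => t.card = n)

lemma pt_apply (n : ℕ) (x : Chn V) (t : Finset V) : pt n x t = if t.card = n then x t else 0 := by
  rw [pt, Finsupp.filter_apply]

lemma pt_mem {K : Set (Finset V)} (n : ℕ) {x : Chn V} (h : x ∈ Ch K) : pt n x ∈ Ch K := by
  rw [mem_Ch] at h ⊢
  intro t ht
  rw [pt_apply] at ht
  refine h t fun h0 => ht ?_
  rw [h0, ite_self]

lemma pt_deg (n : ℕ) (x : Chn V) : pt n x ∈ Ch (Dg n : Set (Finset V)) := by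
  rw [mem_Ch]
  intro t ht
  rw [pt_apply] at ht
  by_contra h0
  exact ht (if_neg h0)

lemma pt_id {n : ℕ} {x : Chn V} (h : x ∈ Ch (Dg n : Set (Finset V))) : pt n x = x := by
  ext t
  rw [pt_apply]
  split_ifs with h0
  · rfl
  · by_contra hh
    exact h0 (mem_Ch.1 h t (Ne.symm hh))

lemma bd_pt {K : Finset (Finset V)} {x : Chn V} (h : x ∈ Ch (K : Set (Finset V))) (n : ℕ) : bd (pt (n + 1) x) = pt n (bd x) := by
  ext t
  rw [pt_apply, bd_apply (sup_vs (pt_mem _ h)), bd_apply (sup_vs h)]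
  have : ∀ v ∈ vs K \ t, pt (n + 1) x (insert v t) = if t.card = n then x (insert v t) else 0 := by
    intro v hv
    rw [pt_apply, card_insert_of_notMem (mem_sdiff.1 hv).2]
    simp
  rw [sum_congr rfl this]
  split_ifs with h0
  · rfl
  · simp

lemma bd_pt0 (x : Chn V) : bd (pt 0 x) = 0 := by
  have h : pt 0 x ∈ Ch ({∅} : Set (Finset V)) := by
    refine Ch_mono ?_ (pt_deg 0 x)
    intro t ht
    have : t.card = 0 := ht
    simpa using this
  have := chn_ext_on (f := (bd : Chn V →ₗ[ZMod 2] Chn V)) (g := 0) (fun t ht => by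
    rw [Set.mem_singleton_iff] at ht
    rw [ht, bd_bs]; simp) h
  simpa using this

lemma sum_pt {x : Chn V} {N : ℕ} (h : ∀ t, x t ≠ 0 → t.card < N) : ∑ n ∈ range N, pt n x = x := by
  ext t
  rw [Finsupp.finsetSum_apply]
  simp only [pt_apply]
  rw [sum_ite_eq]
  split_ifs with h0
  · rfl
  · by_contra hh
    exact h0 (mem_range.2 (h t (Ne.symm hh)))

lemma z2_HSph {d : ℕ} {M : Finset (Finset V)} (h : Z2HomologySphere d M) : HSph (d + 1) (insert ∅ M) := by
  obtain ⟨h1, z, z1, z2, z3, z4⟩ := h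
  obtain ⟨Z, hZ, hZd, rfl⟩ := z2fin z1
  rw [z2bd hZ] at z2
  refine ⟨Z, hZ, hZd, DFunLike.coe_injective z2, ?_, ?_⟩
  · intro b hb e
    refine z3 _ (z2ok (pt_mem (d + 2) hb) (pt_deg _ _)) ?_
    rw [z2bd (pt_mem _ hb), bd_pt hb, e, pt_id hZd]
  · intro x hx hx0
    have hc : ∀ n, bd (pt n x) = 0 := by
      intro n
      cases n with
      | zero => exact bd_pt0 x
      | succ n => rw [bd_pt hx, hx0]; ext t; rw [pt_apply]; simp
    have hz : ∀ n, z2bdry M (pt n x) = 0 := fun n => by rw [z2bd (pt_mem _ hx), hc]; rfl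
    have hb : ∀ n, ∃ b ∈ Ch (insert ∅ M : Finset (Finset V)), n ≠ d + 1 → bd b = pt n x := by
      intro n
      by_cases hn : n = d + 1
      · exact ⟨0, Submodule.zero_mem _, fun h => absurd hn h⟩
      · obtain ⟨c, hc1, hc2⟩ := h1 n _ hn (z2ok (pt_mem n hx) (pt_deg n x)) (hz n)
        obtain ⟨b, hb, -, rfl⟩ := z2fin hc1
        rw [z2bd hb] at hc2
        exact ⟨b, hb, fun _ => DFunLike.coe_injective hc2⟩
    choose b hb hbn using hb
    have hb0 : ∃ b0 ∈ Ch (insert ∅ M : Finset (Finset V)), bd b0 = pt (d + 1) x ∨ bd b0 = Z + pt (d + 1) x := by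
      rcases z4 _ (z2ok (pt_mem (d + 1) hx) (pt_deg (d + 1) x)) (hz _) with ⟨c, hc1, hc2⟩ | ⟨c, hc1, hc2⟩
      · obtain ⟨b, hb, -, rfl⟩ := z2fin hc1
        rw [z2bd hb] at hc2
        exact ⟨b, hb, Or.inl (DFunLike.coe_injective hc2)⟩
      · obtain ⟨b, hb, -, rfl⟩ := z2fin hc1
        rw [z2bd hb] at hc2
        refine ⟨b, hb, Or.inr (DFunLike.coe_injective ?_)⟩
        rw [hc2]; rfl
    obtain ⟨b0, hb0, hb1⟩ := hb0
    set N := (vs (insert ∅ M)).card + d + 2 with hN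
    have hs : ∑ n ∈ range N, pt n x = x := sum_pt fun t ht => by
      have := card_le_card (sup_vs hx t ht)
      omega
    have hmem : d + 1 ∈ range N := mem_range.2 (by omega)
    rw [← add_sum_erase _ _ hmem] at hs
    have hsb : bd (∑ n ∈ (range N).erase (d + 1), b n) = ∑ n ∈ (range N).erase (d + 1), pt n x := by
      rw [map_sum]
      exact sum_congr rfl fun n hn => hbn n (mem_erase.1 hn).1
    refine ⟨b0 + ∑ n ∈ (range N).erase (d + 1), b n, Submodule.add_mem _ hb0 (Submodule.sum_mem _ fun n _ => hb n), ?_⟩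
    rw [map_add, hsb]
    rcases hb1 with e | e
    · left; rw [e, hs]
    · right; rw [e, add_assoc, hs]

lemma no_zero {M : Finset (Finset V)} (hM : IsCombManifold 0 M) (h : Z2HomologySphere 0 M) : False := by
  have hK := cx_insert hM.1
  have hl : ∀ v, {v} ∈ insert ∅ M → HS 1 (lk (insert ∅ M) v) := fun v hv => man_link hM hv
  have hvM : ∀ v, {v} ∈ insert ∅ M ↔ {v} ∈ M := fun v => by
    rw [mem_insert]
    exact ⟨fun h => h.resolve_left (singleton_ne_empty v), Or.inr⟩
  let Y : Finset V → ZMod 2 := fun t => if t ∈ M ∧ t.card = 2 then 1 else 0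
  have hY : z2chainOK M 2 Y := by
    intro s hs
    by_contra hh
    refine hs (if_neg fun h => hh ⟨h.2, Or.inl h.1⟩)
  have hYb : z2bdry M Y = 0 := by
    funext t
    show ∑ v ∈ verts M \ t, Y (insert v t) = 0
    by_cases ht : t.card = 1
    · obtain ⟨w, rfl⟩ := card_eq_one.1 ht
      by_cases hw : {w} ∈ insert ∅ M
      · have h2 := (hl w hw).closed ∅ (hl w hw).cx.1 rfl
        have e : (verts M \ {w}).filter (fun v => insert v {w} ∈ M ∧ (insert v ({w} : Finset V)).card = 2) = nb (lk (insert ∅ M) w) ∅ := by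
          ext v
          rw [mem_filter, mem_nb, mem_lk, mem_sdiff, mem_singleton, verts_eq]
          constructor
          · rintro ⟨⟨h1, h2⟩, h3, h4⟩
            have h5 : insert w (insert v (∅ : Finset V)) = insert v {w} := by ext; simp [or_comm]
            refine ⟨by simp, ?_, ?_, ?_⟩
            · exact hK.2 _ (mem_insert_of_mem h3) _ (by intro y; simp; tauto)
            · simp; exact fun h => h2 h.symm
            · rw [h5]; exact mem_insert_of_mem h3
          · rintro ⟨-, h1, h2, h3⟩
            have h5 : insert w (insert v (∅ : Finset V)) = insert v {w} := by ext; simp [or_comm]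
            have h6 : v ≠ w := by rintro rfl; exact h2 (by simp)
            rw [h5, mem_insert] at h3
            refine ⟨⟨mem_vs.2 ⟨_, h1, by simp⟩, h6⟩, h3.resolve_left (insert_ne_empty _ _), ?_⟩
            rw [card_insert_of_notMem (by simpa using h6)]; simp
        have : ∑ v ∈ verts M \ {w}, Y (insert v {w}) = ((nb (lk (insert ∅ M) w) ∅).card : ZMod 2) := by
          rw [← e]
          simp only [Y]
          rw [sum_boole]
        rw [this, h2]
        rfl
      · refine sum_eq_zero fun v hv => if_neg fun h => hw (hK.2 _ (mem_insert_of_mem h.1) _ (by simp))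
    · refine sum_eq_zero fun v hv => if_neg fun h => ht ?_
      have := h.2
      rw [card_insert_of_notMem (mem_sdiff.1 hv).2] at this
      omega
  obtain ⟨c, hc1, hc2⟩ := h.1 2 Y (by norm_num) hY hYb
  have hc0 : c = 0 := by
    funext s
    by_contra hs
    obtain ⟨h3, h4⟩ := hc1 s hs
    have hsK : s ∈ insert ∅ M := mem_insert.2 h4.symm
    obtain ⟨v, hv⟩ : s.Nonempty := by rw [← card_pos]; omega
    have := (hl v (hK.vert hsK hv)).card_le (s.erase v) (mem_lk.2 ⟨hK.2 _ hsK _ (erase_subset _ _), by simp, by rw [insert_erase hv]; exact hsK⟩)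
    rw [card_erase_of_mem hv] at this
    omega
  obtain ⟨s, hs⟩ := hM.1.1
  obtain ⟨v, hv⟩ : s.Nonempty := by
    rw [nonempty_iff_ne_empty]; rintro rfl; exact hM.1.2.1 hs
  have hvK := hK.vert (mem_insert_of_mem hs) hv
  obtain ⟨f, hf, hf1, -⟩ := (hl v hvK).pure (hl v hvK).cx.1
  rw [mem_lk] at hf
  have h1 : Y (insert v f) = 1 := if_pos ⟨(mem_insert.1 hf.2.2).resolve_left (insert_ne_empty _ _), by
    rw [card_insert_of_notMem hf.2.1, hf1]⟩
  rw [← hc2, hc0] at h1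
  simp [z2bdry] at h1

theorem final {d n : ℕ} {M : Finset (Finset V)} (hM : IsCombManifold d M) (hn : (verts M).card = n)
    (hsph : Z2HomologySphere d M) (hnd : n ≤ d + 8) : IsCombSphere d M := by
  cases d with
  | zero => exact (no_zero hM hsph).elim
  | succ e =>
    refine PL.toCombSphere hM.1 (HS.to_PL' ?_ (by rw [← verts_eq]; omega))
    exact ⟨cx_insert hM.1, z2_HSph hsph, fun v hv => man_link hM hv⟩

end

end HS

noncomputable section

attribute [local instance] Classical.propDecidable

namespace HomologySpheres

variable {V : Type*} [DecidableEq V] {W : Type*} [DecidableEq W]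

/-- Corollary 3: an `n`-vertex combinatorial `d`-manifold which is
a `ℤ/2`-homology sphere with `n ≤ d + 8` is a combinatorial `d`-sphere. -/
theorem combSphere_of_card_le {V : Type*} [DecidableEq V] (d n : ℕ)
    (M : Finset (Finset V))
    (hM : IsCombManifold d M) (hn : (verts M).card = n)
    (hsph : Z2HomologySphere d M) (hnd : n ≤ d + 8) :
    IsCombSphere d M := by
  exact HS.final hM hn hsph hnd

end HomologySpheres
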